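/- Let Ω ⊂ ℝ² be a bounded connected open set whose boundary is a compact C^∞ one-dimensional submanifold of ℝ² (a finite disjoint union of smooth Jordan curves). Suppose there exists an infinite sequence (u_n, μ_n), n ∈ ℕ, with the μ_n pairwise distinct real numbers, where each u_n is nonconstant, twice continuously differentiable on closure(Ω), and satisfies Δu_n + μ_n u_n = 0 in Ω and ∇u_n = 0 at every point of ∂Ω (so each u_n is a Neumann eigenfunction which is locally constant on the boundary). Then Ω is a disk or an annulus: there exist x₀ ∈ ℝ² and radii 0 ≤ r₁ < r₂ such that Ω = {x ∈ ℝ² : r₁ < |x − x₀| < r₂} if r₁ > 0, or Ω = {x ∈ ℝ² : |x − x₀| < r₂} if r₁ = 0. -/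

import Mathlib

open Real Set MeasureTheory

noncomputable section

abbrev Pt := EuclideanSpace ℝ (Fin 2)

/-- Partial derivative in the `i`-th coordinate direction. -/
def pd (i : Fin 2) (f : Pt → ℝ) (x : Pt) : ℝ := fderiv ℝ f x (EuclideanSpace.single i 1)

/-- The Laplacian of a function on the plane. -/
def lap (f : Pt → ℝ) (x : Pt) : ℝ := pd 0 (pd 0 f) x + pd 1 (pd 1 f) x

/-- A smooth Jordan curve in the plane: the image of a smooth, regular, `2π`-periodic
injective (modulo periods) parametrization. -/
def IsSmoothJordanCurve (Γ : Set Pt) : Prop :=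
  ∃ γ : ℝ → Pt, ContDiff ℝ (⊤ : ℕ∞) γ ∧ Function.Periodic γ (2*π) ∧
    (∀ s t, γ s = γ t → ∃ n : ℤ, s - t = n * (2*π)) ∧
    (∀ t, deriv γ t ≠ 0) ∧ Γ = Set.range γ

namespace Rig

open Filter Topology ComplexConjugate

/-- Bounded connected open set whose frontier is a disjoint union of smooth Jordan curves. -/
structure Dom (Ω : Set ℂ) (J : ℕ) (γ : Fin J → ℝ → ℂ) : Prop where
  op : IsOpen Ω
  conn : IsConnected Ω
  bdd : Bornology.IsBounded Ω
  smooth : ∀ j, ContDiff ℝ (⊤ : ℕ∞) (γ j)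
  per : ∀ j, Function.Periodic (γ j) (2 * π)
  inj : ∀ j s t, γ j s = γ j t → ∃ n : ℤ, s - t = n * (2 * π)
  reg : ∀ j t, deriv (γ j) t ≠ 0
  disj : ∀ i j s t, γ i s = γ j t → i = j
  fr : frontier Ω = ⋃ j, Set.range (γ j)

/-- `u` is twice continuously differentiable up to the boundary, with derivatives `D`, `H`. -/
structure C2B (Ω : Set ℂ) (u : ℂ → ℝ) (D : ℂ → ℂ →L[ℝ] ℝ) (H : ℂ → ℂ →L[ℝ] ℂ →L[ℝ] ℝ) : Prop where
  du : ∀ x ∈ closure Ω, HasFDerivWithinAt u (D x) (closure Ω) x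
  dD : ∀ x ∈ closure Ω, HasFDerivWithinAt D (H x) (closure Ω) x
  cH : ContinuousOn H (closure Ω)

/-- Eigenfunction with vanishing gradient on the boundary. -/
structure Eig (Ω : Set ℂ) (u : ℂ → ℝ) (D : ℂ → ℂ →L[ℝ] ℝ) (H : ℂ → ℂ →L[ℝ] ℂ →L[ℝ] ℝ)
    (μ : ℝ) : Prop extends C2B Ω u D H where
  zero : ∀ x ∈ frontier Ω, D x = 0
  pde : ∀ x ∈ Ω, H x 1 1 + H x Complex.I Complex.I = - (μ * u x)

lemma Dom.mem_fr {Ω : Set ℂ} {J : ℕ} {γ : Fin J → ℝ → ℂ} (hd : Dom Ω J γ) (j : Fin J) (s : ℝ) :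
    γ j s ∈ frontier Ω := by
  rw [hd.fr]; exact mem_iUnion.2 ⟨j, mem_range_self s⟩

lemma Dom.exists_fr {Ω : Set ℂ} {J : ℕ} {γ : Fin J → ℝ → ℂ} (hd : Dom Ω J γ) {q : ℂ}
    (hq : q ∈ frontier Ω) : ∃ j s, γ j s = q := by
  rw [hd.fr] at hq
  obtain ⟨j, s, hs⟩ := mem_iUnion.1 hq
  exact ⟨j, s, hs⟩

lemma unit_conj_mul {e : ℂ} (he : ‖e‖ = 1) : conj e * e = 1 := by
  rw [mul_comm, Complex.mul_conj, Complex.normSq_eq_norm_sq, he]; simp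

/-- a set that is preconnected and misses the frontier lies in Ω or misses the closure -/
lemma side_of_preconnected {Ω A : Set ℂ} (ho : IsOpen Ω) (hA : IsPreconnected A)
    (hf : Disjoint A (frontier Ω)) : A ⊆ Ω ∨ Disjoint A (closure Ω) := by
  have h1 : A ⊆ Ω ∪ (closure Ω)ᶜ := by
    intro x hx
    by_cases h : x ∈ closure Ω
    · left
      by_contra h2
      exact (Set.disjoint_left.1 hf hx) (by rw [ho.frontier_eq]; exact ⟨h, h2⟩)
    · right; exact h
  have h2 : Disjoint Ω (closure Ω)ᶜ :=
    Set.disjoint_left.2 fun x hx hx' => hx' (subset_closure hx)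
  rcases hA.subset_or_subset ho isClosed_closure.isOpen_compl h2 h1 with h | h
  · exact Or.inl h
  · exact Or.inr (Set.disjoint_left.2 fun x hx => h hx)

lemma Dom.far {Ω : Set ℂ} {J : ℕ} {γ : Fin J → ℝ → ℂ} (hd : Dom Ω J γ) (j : Fin J) (σ0 : ℝ)
    {ε : ℝ} (hε : 0 < ε) : ∃ r > 0, ∀ z ∈ frontier Ω, dist z (γ j σ0) < r →
      ∃ σ, |σ - σ0| < ε ∧ γ j σ = z := by
  wlog hεπ : ε ≤ π generalizing ε
  · obtain ⟨r, hr, h⟩ := this (ε := π) pi_pos le_rfl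
    refine ⟨r, hr, fun z hz hzr => ?_⟩
    obtain ⟨σ, h1, h2⟩ := h z hz hzr
    exact ⟨σ, by linarith, h2⟩
  set K : Set ℂ := (⋃ i ∈ {i | i ≠ j}, γ i '' Icc 0 (2*π)) ∪ γ j '' Icc (σ0 + ε) (σ0 + 2*π - ε)
    with hK
  have hpi : (0:ℝ) < 2 * π := by positivity
  have hKc : IsClosed K := by
    apply IsCompact.isClosed
    apply IsCompact.union
    · exact (Set.toFinite _).isCompact_biUnion
        fun i _ => isCompact_Icc.image (hd.smooth i).continuous
    · exact isCompact_Icc.image (hd.smooth j).continuous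
  have hq : γ j σ0 ∉ K := by
    rintro (h | ⟨t, ht, h⟩)
    · obtain ⟨i, hi, t, -, h⟩ := mem_iUnion₂.1 h
      exact hi (hd.disj _ _ _ _ h)
    · obtain ⟨n, hn⟩ := hd.inj _ _ _ h
      have h1 : (0:ℝ) < n := by
        by_contra hneg
        push Not at hneg
        nlinarith [ht.1]
      have h2 : (n:ℝ) < 1 := by
        by_contra hneg
        push Not at hneg
        nlinarith [ht.2]
      have h1' : 0 < n := by exact_mod_cast h1
      have h2' : n < 1 := by exact_mod_cast h2
      omega
  obtain ⟨r, hr, hrK⟩ := Metric.isOpen_iff.1 hKc.isOpen_compl _ hq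
  refine ⟨r, hr, fun z hz hzr => ?_⟩
  obtain ⟨i, s, hs⟩ := hd.exists_fr hz
  have hzK : z ∉ K := hrK hzr
  have hij : i = j := by
    by_contra hij
    obtain ⟨s', hs', he⟩ := (hd.per i).exists_mem_Ico₀ hpi s
    exact hzK (Or.inl (mem_iUnion₂.2 ⟨i, hij, s', ⟨hs'.1, hs'.2.le⟩, by rw [← he, hs]⟩))
  subst hij
  obtain ⟨s', hs', he⟩ := (hd.per i).exists_mem_Ico hpi s (σ0 - ε)
  refine ⟨s', ?_, by rw [← he, hs]⟩
  rw [abs_lt]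
  constructor
  · rcases eq_or_lt_of_le hs'.1 with h | h
    · exfalso
      apply hzK
      refine Or.inr ⟨s' + 2*π, ⟨by linarith, by linarith⟩, ?_⟩
      rw [hd.per i, ← he, hs]
    · linarith
  · by_contra hlt
    push Not at hlt
    apply hzK
    refine Or.inr ⟨s', ⟨by linarith, by linarith [hs'.2]⟩, by rw [← he, hs]⟩

end Rig

namespace Rig

open Filter Topology ComplexConjugate

lemma three_le_inf : (3 : WithTop ℕ∞) ≤ ((⊤ : ℕ∞) : WithTop ℕ∞) :=
  WithTop.coe_le_coe.2 (le_top : (3 : ℕ∞) ≤ ⊤)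

lemma frame_eq {e : ℂ} (he : ‖e‖ = 1) (z : ℂ) :
    z = e * (((conj e * z).re : ℂ) + ((conj e * z).im : ℂ) * Complex.I) := by
  rw [Complex.re_add_im, ← mul_assoc, mul_comm e, unit_conj_mul he, one_mul]

lemma local_inv {X : ℝ → ℝ} {a m : ℝ} (hX : ContDiffAt ℝ 3 X a) (hm : HasDerivAt X m a)
    (hm0 : m ≠ 0) : ∃ S : ℝ → ℝ, S (X a) = a ∧ ContDiffAt ℝ 3 S (X a) ∧
      (∀ᶠ x in 𝓝 (X a), X (S x) = x) ∧ (∀ᶠ s in 𝓝 a, S (X s) = s) := by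
  have h1 : HasFDerivAt X ((ContinuousLinearEquiv.unitsEquivAut ℝ (Units.mk0 m hm0) : ℝ ≃L[ℝ] ℝ) : ℝ →L[ℝ] ℝ) a := by
    have h0 : ((ContinuousLinearEquiv.unitsEquivAut ℝ (Units.mk0 m hm0) : ℝ ≃L[ℝ] ℝ) : ℝ →L[ℝ] ℝ)
        = ContinuousLinearMap.toSpanSingleton ℝ m := by ext; simp
    rw [h0]; exact hm.hasFDerivAt
  have h3 : (3 : WithTop ℕ∞) ≠ 0 := by norm_num
  have h2 := hX.hasStrictFDerivAt' h1 h3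
  refine ⟨hX.localInverse h1 h3, hX.localInverse_apply_image h1 h3, hX.to_localInverse h1 h3,
    h2.eventually_right_inverse, h2.eventually_left_inverse⟩

lemma Dom.chart {Ω : Set ℂ} {J : ℕ} {γ : Fin J → ℝ → ℂ} (hd : Dom Ω J γ) (j : Fin J) (σ0 : ℝ)
    {e : ℂ} (he : ‖e‖ = 1) (hn : (conj e * deriv (γ j) σ0).re ≠ 0) {ε : ℝ} (hε : 0 < ε) :
    ∃ δ h : ℝ, 0 < δ ∧ δ < ε ∧ 0 < h ∧ h < ε ∧ ∃ f S : ℝ → ℝ,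
      ContDiffOn ℝ 3 f (Ioo (-δ) δ) ∧ ContDiffOn ℝ 3 S (Ioo (-δ) δ) ∧ f 0 = 0 ∧ S 0 = σ0 ∧
      (∀ x ∈ Ioo (-δ) δ, |f x| < h ∧ γ j (S x) = γ j σ0 + e * (x + f x * Complex.I)) ∧
      (∀ x y : ℝ, |x| < δ → |y| < h → γ j σ0 + e * (x + y * Complex.I) ∈ frontier Ω → y = f x) := by
  set q := γ j σ0 with hq
  have hsm : ContDiff ℝ 3 (γ j) := (hd.smooth j).of_le three_le_inf
  set Z : ℝ → ℂ := fun σ => conj e * (γ j σ - q) with hZ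
  have hZs : ContDiff ℝ 3 Z := contDiff_const.mul (hsm.sub contDiff_const)
  set X : ℝ → ℝ := fun σ => (Z σ).re with hX
  set Y : ℝ → ℝ := fun σ => (Z σ).im with hY
  have hXs : ContDiff ℝ 3 X := Complex.reCLM.contDiff.comp hZs
  have hYs : ContDiff ℝ 3 Y := Complex.imCLM.contDiff.comp hZs
  have hX0 : X σ0 = 0 := by simp [hX, hZ, hq]
  have hY0 : Y σ0 = 0 := by simp [hY, hZ, hq]
  have hXd : HasDerivAt X (conj e * deriv (γ j) σ0).re σ0 := by
    have h1 : HasDerivAt (γ j) (deriv (γ j) σ0) σ0 :=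
      ((hsm.differentiable (by norm_num)) σ0).hasDerivAt
    have h2 : HasDerivAt Z (conj e * deriv (γ j) σ0) σ0 := (h1.sub_const q).const_mul _
    exact Complex.reCLM.hasFDerivAt.comp_hasDerivAt σ0 h2
  obtain ⟨S, hS0, hSs, hXS, hSX⟩ := local_inv hXs.contDiffAt hXd hn
  rw [hX0] at hS0 hSs hXS
  obtain ⟨ε1, hε1, hSX⟩ := Metric.eventually_nhds_iff.1 hSX
  obtain ⟨r, hr, hfar⟩ := hd.far j σ0 hε1
  set h := min (ε / 2) (r / 2) with hh
  have hh0 : 0 < h := by positivity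
  set f : ℝ → ℝ := fun x => Y (S x) with hf
  have hf0 : f 0 = 0 := by simp [hf, hS0, hY0]
  have hSc : ContinuousAt S 0 := hSs.continuousAt
  have hfc : ContinuousAt f 0 := (hYs.continuous.continuousAt).comp hSc
  have e1 : ∀ᶠ x in 𝓝 (0:ℝ), |f x| < h := by
    have := hfc.abs.eventually (gt_mem_nhds (show |f 0| < h by simpa [hf0] using hh0))
    exact this
  have e2 : ∀ᶠ x in 𝓝 (0:ℝ), ContDiffAt ℝ 3 S x := hSs.eventually (by simp)
  obtain ⟨δ1, hδ1, hev⟩ := Metric.eventually_nhds_iff.1 (hXS.and (e1.and e2))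
  set δ := min (δ1 / 2) (min (ε / 2) (r / 2)) with hδ
  have hδ0 : 0 < δ := by positivity
  have hin : ∀ x ∈ Ioo (-δ) δ, dist x 0 < δ1 := by
    intro x hx
    rw [Real.dist_eq, sub_zero, abs_lt]
    have : δ ≤ δ1 / 2 := min_le_left _ _
    constructor <;> linarith [hx.1, hx.2]
  have hgr : ∀ σ, γ j σ = q + e * (X σ + Y σ * Complex.I) := by
    intro σ
    have := frame_eq he (γ j σ - q)
    rw [← sub_eq_iff_eq_add']; exact this
  refine ⟨δ, h, hδ0, ?_, hh0, ?_, f, S, ?_, ?_, hf0, hS0, ?_, ?_⟩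
  · have : δ ≤ ε / 2 := (min_le_right _ _).trans (min_le_left _ _)
    linarith
  · have : h ≤ ε / 2 := min_le_left _ _
    linarith
  · intro x hx
    exact (hYs.contDiffAt.comp x (hev (hin x hx)).2.2).contDiffWithinAt
  · intro x hx
    exact (hev (hin x hx)).2.2.contDiffWithinAt
  · intro x hx
    refine ⟨(hev (hin x hx)).2.1, ?_⟩
    rw [hgr, (hev (hin x hx)).1]
  · intro x y hx hy hfr
    have hdist : dist (q + e * (x + y * Complex.I)) q < r := by
      rw [dist_eq_norm, add_sub_cancel_left, norm_mul, he, one_mul]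
      have h1 : ‖(x:ℂ) + y * Complex.I‖ ≤ |x| + |y| := by
        refine (norm_add_le _ _).trans ?_
        simp
      have h2 : δ ≤ r / 2 := (min_le_right _ _).trans (min_le_right _ _)
      have h3 : h ≤ r / 2 := min_le_right _ _
      linarith
    obtain ⟨σ, hσ, hσz⟩ := hfar _ hfr hdist
    have hZσ : Z σ = x + y * Complex.I := by
      simp only [hZ]
      rw [hσz, add_sub_cancel_left, ← mul_assoc, unit_conj_mul he, one_mul]
    have h1 : X σ = x := by simp [hX, hZσ]
    have h2 : Y σ = y := by simp [hY, hZσ]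
    have h3 : S x = σ := by rw [← h1]; exact hSX hσ
    simp only [hf, h3, h2]

end Rig

namespace Rig

open Filter Topology ComplexConjugate

/-- a graph chart of the frontier at `q`, over direction `e` -/
structure Ch (Ω : Set ℂ) (q e : ℂ) (δ h : ℝ) (f : ℝ → ℝ) : Prop where
  he : ‖e‖ = 1
  hδ : 0 < δ
  hh : 0 < h
  sm : ContDiffOn ℝ 3 f (Ioo (-δ) δ)
  f0 : f 0 = 0
  bd : ∀ x ∈ Ioo (-δ) δ, |f x| < h
  mem : ∀ x ∈ Ioo (-δ) δ, q + e * (x + f x * Complex.I) ∈ frontier Ω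
  uniq : ∀ x y : ℝ, |x| < δ → |y| < h → q + e * (x + y * Complex.I) ∈ frontier Ω → y = f x

/-- the region above the graph -/
def upper (q e : ℂ) (δ h : ℝ) (f : ℝ → ℝ) : Set ℂ :=
  {z | ∃ x y : ℝ, |x| < δ ∧ f x < y ∧ y < h ∧ z = q + e * (x + y * Complex.I)}

lemma Ch.flip {Ω : Set ℂ} {q e : ℂ} {δ h : ℝ} {f : ℝ → ℝ} (c : Ch Ω q e δ h f) :
    Ch Ω q (-e) δ h (fun x => - f (-x)) where
  he := by rw [norm_neg, c.he]
  hδ := c.hδ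
  hh := c.hh
  sm := by
    apply ContDiffOn.neg
    apply c.sm.comp contDiff_neg.contDiffOn
    intro x hx
    exact ⟨by linarith [hx.2], by linarith [hx.1]⟩
  f0 := by simp [c.f0]
  bd := by
    intro x hx
    rw [abs_neg]
    exact c.bd _ ⟨by linarith [hx.2], by linarith [hx.1]⟩
  mem := by
    intro x hx
    have := c.mem (-x) ⟨by linarith [hx.2], by linarith [hx.1]⟩
    convert this using 1
    push_cast; ring
  uniq := by
    intro x y hx hy hm
    have := c.uniq (-x) (-y) (by rwa [abs_neg]) (by rwa [abs_neg]) (by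
      convert hm using 1
      push_cast; ring)
    linarith

lemma upper_conn {Ω : Set ℂ} {q e : ℂ} {δ h : ℝ} {f : ℝ → ℝ} (c : Ch Ω q e δ h f) :
    IsPreconnected (upper q e δ h f) := by
  have hs : IsPreconnected ((Ioo (-δ) δ) ×ˢ (Ioo (0:ℝ) 1)) :=
    isPreconnected_Ioo.prod isPreconnected_Ioo
  have hc : ContinuousOn (fun p : ℝ × ℝ => q + e * (p.1 + ((f p.1 + p.2 * (h - f p.1) : ℝ) : ℂ) * Complex.I))
      ((Ioo (-δ) δ) ×ˢ (Ioo (0:ℝ) 1)) := by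
    have h1 : ContinuousOn (fun p : ℝ × ℝ => f p.1) ((Ioo (-δ) δ) ×ˢ (Ioo (0:ℝ) 1)) :=
      c.sm.continuousOn.comp continuousOn_fst (fun p hp => hp.1)
    have h2 : ContinuousOn (fun p : ℝ × ℝ => ((f p.1 + p.2 * (h - f p.1) : ℝ) : ℂ))
        ((Ioo (-δ) δ) ×ˢ (Ioo (0:ℝ) 1)) :=
      Complex.continuous_ofReal.comp_continuousOn
        (h1.add (continuousOn_snd.mul (continuousOn_const.sub h1)))
    have h3 : ContinuousOn (fun p : ℝ × ℝ => (p.1 : ℂ)) ((Ioo (-δ) δ) ×ˢ (Ioo (0:ℝ) 1)) :=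
      Complex.continuous_ofReal.comp_continuousOn continuousOn_fst
    exact continuousOn_const.add (continuousOn_const.mul (h3.add (h2.mul continuousOn_const)))
  convert hs.image _ hc using 1
  ext z
  constructor
  · rintro ⟨x, y, hx, hy, hy2, rfl⟩
    have hpos : 0 < h - f x := by linarith
    refine ⟨(x, (y - f x) / (h - f x)), ⟨abs_lt.1 hx, ?_, ?_⟩, ?_⟩
    · exact div_pos (by linarith) hpos
    · rw [div_lt_one hpos]; linarith
    · simp only
      rw [div_mul_cancel₀ _ hpos.ne']
      congr 4; simp
  · rintro ⟨⟨x, t⟩, ⟨hx, ht⟩, rfl⟩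
    have hb := (abs_lt.1 (c.bd x hx)).2
    simp only at hx ht
    refine ⟨x, f x + t * (h - f x), abs_lt.2 hx, ?_, ?_, rfl⟩
    · nlinarith [ht.1]
    · nlinarith [ht.2]

lemma Ch.side {Ω : Set ℂ} {q e : ℂ} {δ h : ℝ} {f : ℝ → ℝ} (c : Ch Ω q e δ h f) (ho : IsOpen Ω) :
    upper q e δ h f ⊆ Ω ∨ Disjoint (upper q e δ h f) (closure Ω) := by
  apply side_of_preconnected ho (upper_conn c)
  rw [Set.disjoint_left]
  rintro z ⟨x, y, hx, hy, hy2, rfl⟩ hf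
  have hb := (abs_lt.1 (c.bd x (abs_lt.1 hx)))
  have := c.uniq x y hx (abs_lt.2 ⟨by linarith, hy2⟩) hf
  linarith

/-- points near `q` in the frame -/
lemma Ch.near {Ω : Set ℂ} {q e : ℂ} {δ h : ℝ} {f : ℝ → ℝ} (c : Ch Ω q e δ h f) {z : ℂ}
    (hz : dist z q < min δ h) : ∃ x y : ℝ, |x| < δ ∧ |y| < h ∧ z = q + e * (x + y * Complex.I) := by
  have hn : ‖conj e * (z - q)‖ < min δ h := by
    rw [norm_mul, RCLike.norm_conj, c.he, one_mul, ← dist_eq_norm]; exact hz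
  refine ⟨(conj e * (z - q)).re, (conj e * (z - q)).im, ?_, ?_, ?_⟩
  · exact (Complex.abs_re_le_norm _).trans_lt (hn.trans_le (min_le_left _ _))
  · exact (Complex.abs_im_le_norm _).trans_lt (hn.trans_le (min_le_right _ _))
  · rw [← frame_eq c.he]; ring

lemma Ch.cases {q e : ℂ} {δ h : ℝ} {f : ℝ → ℝ} {x y : ℝ} (hx : |x| < δ) (hy : |y| < h) :
    y = f x ∨ q + e * (x + y * Complex.I) ∈ upper q e δ h f ∨
     q + e * (x + y * Complex.I) ∈ upper q (-e) δ h (fun x => - f (-x)) := by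
  rcases lt_trichotomy y (f x) with h1 | h1 | h1
  · right; right
    refine ⟨-x, -y, by rwa [abs_neg], by simpa using h1, by linarith [(abs_lt.1 hy).1], ?_⟩
    push_cast; ring
  · exact Or.inl h1
  · right; left
    exact ⟨x, y, hx, h1, (abs_lt.1 hy).2, rfl⟩

lemma Ch.q_mem {Ω : Set ℂ} {q e : ℂ} {δ h : ℝ} {f : ℝ → ℝ} (c : Ch Ω q e δ h f) :
    q ∈ frontier Ω := by
  have := c.mem 0 ⟨by linarith [c.hδ], c.hδ⟩
  simpa [c.f0] using this

lemma Ch.one_side {Ω : Set ℂ} {q e : ℂ} {δ h : ℝ} {f : ℝ → ℝ} (c : Ch Ω q e δ h f) (ho : IsOpen Ω) :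
    upper q e δ h f ⊆ Ω ∨ upper q (-e) δ h (fun x => - f (-x)) ⊆ Ω := by
  have hq : q ∈ closure Ω := frontier_subset_closure c.q_mem
  obtain ⟨z, hz, hzq⟩ := Metric.mem_closure_iff.1 hq _ (lt_min c.hδ c.hh)
  rw [dist_comm] at hzq
  obtain ⟨x, y, hx, hy, rfl⟩ := c.near hzq
  rcases Ch.cases (q := q) (e := e) (f := f) hx hy with h1 | h1 | h1
  · exfalso
    have := c.mem x (abs_lt.1 hx)
    rw [← h1] at this
    rw [ho.frontier_eq] at this
    exact this.2 hz
  · left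
    rcases c.side ho with h2 | h2
    · exact h2
    · exact absurd (subset_closure hz) (Set.disjoint_left.1 h2 h1)
  · right
    rcases c.flip.side ho with h2 | h2
    · exact h2
    · exact absurd (subset_closure hz) (Set.disjoint_left.1 h2 h1)

lemma Dom.ch {Ω : Set ℂ} {J : ℕ} {γ : Fin J → ℝ → ℂ} (hd : Dom Ω J γ) (j : Fin J) (σ0 : ℝ)
    {e : ℂ} (he : ‖e‖ = 1) (hn : (conj e * deriv (γ j) σ0).re ≠ 0) {ε : ℝ} (hε : 0 < ε) :
    ∃ δ h : ℝ, δ < ε ∧ h < ε ∧ ∃ f S : ℝ → ℝ, Ch Ω (γ j σ0) e δ h f ∧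
      ContDiffOn ℝ 3 S (Ioo (-δ) δ) ∧ S 0 = σ0 ∧
      (∀ x ∈ Ioo (-δ) δ, γ j (S x) = γ j σ0 + e * (x + f x * Complex.I)) := by
  obtain ⟨δ, h, h1, h2, h3, h4, f, S, hf, hS, hf0, hS0, hm, hu⟩ := hd.chart j σ0 he hn hε
  refine ⟨δ, h, h2, h4, f, S, ⟨he, h1, h3, hf, hf0, fun x hx => (hm x hx).1, fun x hx => ?_, hu⟩,
    hS, hS0, fun x hx => (hm x hx).2⟩
  rw [← (hm x hx).2]
  exact hd.mem_fr _ _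

/-- unit tangent -/
lemma unit_tangent {g : ℂ} (hg : g ≠ 0) : ‖g / ‖g‖‖ = 1 ∧ conj (g / ‖g‖) * g = ‖g‖ := by
  have h0 : (‖g‖ : ℂ) ≠ 0 := by exact_mod_cast norm_ne_zero_iff.2 hg
  constructor
  · rw [norm_div]; simp [norm_ne_zero_iff.2 hg]
  · rw [map_div₀, Complex.conj_ofReal, div_mul_eq_mul_div, mul_comm, Complex.mul_conj,
      Complex.normSq_eq_norm_sq]
    field_simp
    push_cast; ring

lemma Dom.ch_up {Ω : Set ℂ} {J : ℕ} {γ : Fin J → ℝ → ℂ} (hd : Dom Ω J γ) {q : ℂ}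
    (hq : q ∈ frontier Ω) : ∃ e δ h f, Ch Ω q e δ h f ∧ upper q e δ h f ⊆ Ω := by
  obtain ⟨j, σ0, rfl⟩ := hd.exists_fr hq
  obtain ⟨h1, h2⟩ := unit_tangent (hd.reg j σ0)
  obtain ⟨δ, h, -, -, f, S, c, -⟩ := hd.ch j σ0 h1 (by
    rw [h2, Complex.ofReal_re]; exact norm_ne_zero_iff.2 (hd.reg j σ0)) one_pos
  rcases c.one_side hd.op with h3 | h3
  · exact ⟨_, _, _, _, c, h3⟩
  · exact ⟨_, _, _, _, c.flip, h3⟩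

lemma Ch.uniqueDiff {Ω : Set ℂ} {q e : ℂ} {δ h : ℝ} {f : ℝ → ℝ} (c : Ch Ω q e δ h f)
    (hu : upper q e δ h f ⊆ Ω) : UniqueDiffWithinAt ℝ (closure Ω) q := by
  have hfd : DifferentiableAt ℝ f 0 :=
    ((c.sm.contDiffAt (Ioo_mem_nhds (by linarith [c.hδ]) c.hδ)).differentiableAt (by norm_num))
  obtain ⟨M, hM⟩ := (hfd.isBigO_sub).bound
  obtain ⟨r, hr, hM⟩ := Metric.eventually_nhds_iff.1 hM
  have hM' : ∀ x : ℝ, |x| < r → |f x| ≤ M * |x| := by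
    intro x hx
    have := hM (y := x) (by simpa [Real.dist_eq] using hx)
    simpa [c.f0] using this
  set N := |M| + 1
  set A : ℂ → ℝ := fun z => (conj e * (z - q)).re
  set B : ℂ → ℝ := fun z => (conj e * (z - q)).im
  set a := min r (min δ h)
  have ha : 0 < a := lt_min hr (lt_min c.hδ c.hh)
  have hA : Continuous A := by fun_prop
  have hB : Continuous B := by fun_prop
  set C : Set ℂ := {z | N * |A z| < B z ∧ B z < a}
  have hCo : IsOpen C := by
    apply IsOpen.inter
    · exact isOpen_lt (continuous_const.mul hA.abs) hB
    · exact isOpen_lt hB continuous_const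
  have hN1 : 1 ≤ N := by simp [N]
  have hCs : C ⊆ Ω := by
    rintro z ⟨h1, h2⟩
    apply hu
    have h3 : |A z| < a := by nlinarith [abs_nonneg (A z)]
    have h4 : |A z| < r := h3.trans_le (min_le_left _ _)
    refine ⟨A z, B z, h3.trans_le ((min_le_right _ _).trans (min_le_left _ _)), ?_,
      h2.trans_le ((min_le_right _ _).trans (min_le_right _ _)), ?_⟩
    · have h5 := hM' _ h4
      have h6 : M ≤ N := by simp only [N]; linarith [le_abs_self M]
      have h7 : M * |A z| ≤ N * |A z| := mul_le_mul_of_nonneg_right h6 (abs_nonneg _)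
      linarith [le_abs_self (f (A z))]
    · simp only [A, B]; rw [← frame_eq c.he]; ring
  have hCc : Convex ℝ C := by
    intro z hz w hw s t hs ht hst
    have eA : A (s • z + t • w) = s * A z + t * A w := by
      have : conj e * (s • z + t • w - q) = s • (conj e * (z - q)) + t • (conj e * (w - q)) := by
        have hq : q = s • q + t • q := by rw [← add_smul, hst, one_smul]
        conv_lhs => rw [hq]
        simp only [Complex.real_smul]; ring
      simp only [A, this, Complex.add_re, Complex.smul_re, smul_eq_mul]
    have eB : B (s • z + t • w) = s * B z + t * B w := by
      have : conj e * (s • z + t • w - q) = s • (conj e * (z - q)) + t • (conj e * (w - q)) := by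
        have hq : q = s • q + t • q := by rw [← add_smul, hst, one_smul]
        conv_lhs => rw [hq]
        simp only [Complex.real_smul]; ring
      simp only [B, this, Complex.add_im, Complex.smul_im, smul_eq_mul]
    have hkey : ∀ a b c d : ℝ, a < b → c < d → s * a + t * c < s * b + t * d := by
      intro a b c d h1 h2
      rcases hs.eq_or_lt with h | h
      · have : t = 1 := by linarith
        rw [← h, this]; linarith
      · have := mul_lt_mul_of_pos_left h1 h
        have := mul_le_mul_of_nonneg_left h2.le ht
        linarith
    constructor
    · rw [eA, eB]
      have h1 : |s * A z + t * A w| ≤ s * |A z| + t * |A w| := by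
        refine (abs_add_le _ _).trans ?_
        rw [abs_mul, abs_mul, abs_of_nonneg hs, abs_of_nonneg ht]
      have := hkey _ _ _ _ hz.1 hw.1
      nlinarith
    · rw [eB]
      have := hkey _ _ _ _ hz.2 hw.2
      nlinarith
  have hline : ∀ y : ℝ, A (q + e * (y * Complex.I)) = 0 ∧ B (q + e * (y * Complex.I)) = y := by
    intro y
    simp only [A, B, add_sub_cancel_left, ← mul_assoc, unit_conj_mul c.he]
    simp
  have hin : ∀ y : ℝ, 0 < y → y < a → q + e * (y * Complex.I) ∈ C := by
    intro y h1 h2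
    refine ⟨?_, ?_⟩
    · rw [(hline y).1, (hline y).2]; simpa using h1
    · rw [(hline y).2]; exact h2
  have hqc : q ∈ closure C := by
    have ht : Tendsto (fun y : ℝ => q + e * (y * Complex.I)) (𝓝[>] 0) (𝓝 q) := by
      have : Continuous (fun y : ℝ => q + e * (y * Complex.I)) := by fun_prop
      have h2 := this.tendsto 0
      simp only [Complex.ofReal_zero, zero_mul, mul_zero, add_zero] at h2
      exact h2.mono_left nhdsWithin_le_nhds
    apply mem_closure_of_tendsto ht
    filter_upwards [Ioo_mem_nhdsGT ha] with y hy
    exact hin y hy.1 hy.2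
  have hne : (interior C).Nonempty := by
    rw [hCo.interior_eq]
    exact ⟨_, hin (a/2) (by linarith) (by linarith)⟩
  exact (uniqueDiffWithinAt_convex hCc hne hqc).mono (hCs.trans subset_closure)

lemma Dom.uniqueDiff {Ω : Set ℂ} {J : ℕ} {γ : Fin J → ℝ → ℂ} (hd : Dom Ω J γ) :
    UniqueDiffOn ℝ (closure Ω) := by
  intro z hz
  by_cases h : z ∈ Ω
  · exact (hd.op.uniqueDiffWithinAt h).mono subset_closure
  · obtain ⟨e, δ, hh, f, c, hu⟩ := hd.ch_up (q := z) (by rw [hd.op.frontier_eq]; exact ⟨hz, h⟩)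
    exact c.uniqueDiff hu

end Rig

namespace Rig

open Filter Topology ComplexConjugate

lemma curve_null {g : ℝ → ℂ} (hg : ContDiff ℝ 1 g) : volume (range g) = 0 := by
  have h : range g = (fun z : ℂ => g z.re) '' univ := by
    ext w; constructor
    · rintro ⟨t, rfl⟩; exact ⟨(t:ℂ), trivial, by simp⟩
    · rintro ⟨z, -, rfl⟩; exact ⟨z.re, rfl⟩
  rw [h]
  apply addHaar_image_eq_zero_of_det_fderivWithin_eq_zero volume
    (f' := fun z => (ContinuousLinearMap.toSpanSingleton ℝ (deriv g z.re)).comp Complex.reCLM)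
  · intro z _
    apply HasFDerivAt.hasFDerivWithinAt
    have h1 : HasFDerivAt g (ContinuousLinearMap.toSpanSingleton ℝ (deriv g z.re)) (Complex.reCLM z) :=
      ((hg.differentiable (by norm_num)) z.re).hasDerivAt.hasFDerivAt
    exact h1.comp z Complex.reCLM.hasFDerivAt
  · intro z _
    by_contra hne
    have hu : IsUnit (LinearMap.det (((ContinuousLinearMap.toSpanSingleton ℝ (deriv g z.re)).comp Complex.reCLM : ℂ →L[ℝ] ℂ) : ℂ →ₗ[ℝ] ℂ)) := isUnit_iff_ne_zero.2 hne
    have := (LinearMap.equivOfDetNeZero _ hne).injective (a₁ := Complex.I) (a₂ := 0) (by simp)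
    exact Complex.I_ne_zero this

lemma Dom.null {Ω : Set ℂ} {J : ℕ} {γ : Fin J → ℝ → ℂ} (hd : Dom Ω J γ) :
    volume (frontier Ω) = 0 := by
  rw [hd.fr]
  exact measure_iUnion_null fun j => curve_null ((hd.smooth j).of_le
    (le_trans (by norm_num) three_le_inf))

lemma bd_dist {Ω : Set ℂ} (ho : IsOpen Ω) {g : ℂ → ℝ} {G : ℂ → ℂ →L[ℝ] ℝ} {M : ℝ}
    (hc : ContinuousOn g (closure Ω)) (h0 : ∀ x ∈ frontier Ω, g x = 0)
    (hG : ∀ x ∈ Ω, HasFDerivAt g (G x) x) (hM : ∀ x ∈ Ω, ‖G x‖ ≤ M) {x y : ℂ} (hx : x ∈ Ω)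
    (hy : y ∉ Ω) : |g x| ≤ M * dist x y := by
  have hM0 : 0 ≤ M := (norm_nonneg _).trans (hM x hx)
  have hne : (Ωᶜ).Nonempty := ⟨y, hy⟩
  obtain ⟨z, hz, hzd⟩ := ho.isClosed_compl.exists_infDist_eq_dist hne x
  have hzy : dist x z ≤ dist x y := by rw [← hzd]; exact Metric.infDist_le_dist_of_mem hy
  have hball : Metric.ball x (dist x z) ⊆ Ω := by
    intro w hw
    by_contra hw2
    have h1 : Metric.infDist x Ωᶜ ≤ dist x w := Metric.infDist_le_dist_of_mem hw2
    rw [hzd] at h1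
    rw [Metric.mem_ball, dist_comm] at hw
    linarith
  have hxz : x ≠ z := fun h => hz (h ▸ hx)
  have hd0 : dist x z ≠ 0 := dist_ne_zero.2 hxz
  have hzc : z ∈ closure Ω := by
    apply closure_mono hball
    rw [closure_ball x hd0, Metric.mem_closedBall, dist_comm]
  have hzf : z ∈ frontier Ω := by rw [ho.frontier_eq]; exact ⟨hzc, hz⟩
  have hcb : ContinuousOn g (Metric.closedBall x (dist x z)) := by
    rw [← closure_ball x hd0]; exact hc.mono (closure_mono hball)
  have hmv : ∀ w ∈ Metric.ball x (dist x z), |g w - g x| ≤ M * dist x z := by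
    intro w hw
    have := (convex_ball x (dist x z)).norm_image_sub_le_of_norm_hasFDerivWithin_le
      (f := g) (f' := G) (C := M) (fun w hw => (hG w (hball hw)).hasFDerivWithinAt)
      (fun w hw => hM w (hball hw)) (Metric.mem_ball_self (lt_of_le_of_ne dist_nonneg hd0.symm)) hw
    refine this.trans ?_
    apply mul_le_mul_of_nonneg_left _ hM0
    rw [← dist_eq_norm]; exact hw.le
  have hcl : ∀ w ∈ closure (Metric.ball x (dist x z)), |g w - g x| ≤ M * dist x z := by
    apply le_on_closure hmv
    · rw [closure_ball x hd0]; exact (hcb.sub continuousOn_const).abs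
    · exact continuousOn_const
  have := hcl z (by rw [closure_ball x hd0, Metric.mem_closedBall, dist_comm])
  rw [h0 z hzf, zero_sub, abs_neg] at this
  exact this.trans (mul_le_mul_of_nonneg_left hzy hM0)

lemma ext_lip {Ω : Set ℂ} (ho : IsOpen Ω) {g : ℂ → ℝ} {G : ℂ → ℂ →L[ℝ] ℝ} {M : ℝ}
    (hM0 : 0 ≤ M)
    (hc : ContinuousOn g (closure Ω)) (h0 : ∀ x ∈ frontier Ω, g x = 0)
    (hG : ∀ x ∈ Ω, HasFDerivAt g (G x) x) (hM : ∀ x ∈ Ω, ‖G x‖ ≤ M) :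
    LipschitzWith (3 * M).toNNReal (indicator Ω g) := by
  apply LipschitzWith.of_dist_le_mul
  intro x y
  rw [Real.coe_toNNReal _ (by positivity), Real.dist_eq]
  have key := fun x y hx hy => bd_dist ho hc h0 hG hM (x := x) (y := y) hx hy
  by_cases hx : x ∈ Ω <;> by_cases hy : y ∈ Ω
  · rw [indicator_of_mem hx, indicator_of_mem hy]
    have hp := mul_nonneg hM0 (dist_nonneg (x := x) (y := y))
    by_cases hs : segment ℝ x y ⊆ Ω
    · have := (convex_segment x y).norm_image_sub_le_of_norm_hasFDerivWithin_le
        (f := g) (f' := G) (C := M) (fun w hw => (hG w (hs hw)).hasFDerivWithinAt)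
        (fun w hw => hM w (hs hw)) (right_mem_segment ℝ x y) (left_mem_segment ℝ x y)
      rw [← dist_eq_norm, ← dist_eq_norm, Real.dist_eq] at this
      linarith
    · obtain ⟨z, hz, hzn⟩ := not_subset.1 hs
      have hz' := dist_add_dist_of_mem_segment hz
      have h1 := key x z hx hzn
      have h2 := key y z hy hzn
      rw [dist_comm y z] at h2
      have h5 : |g x - g y| ≤ |g x| + |g y| := abs_sub _ _
      have h6 : M * dist x z + M * dist z y = M * dist x y := by rw [← hz']; ring
      linarith
  · rw [indicator_of_mem hx, indicator_of_notMem hy, sub_zero]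
    have := key x y hx hy
    nlinarith [mul_nonneg hM0 (dist_nonneg (x := x) (y := y))]
  · rw [indicator_of_notMem hx, indicator_of_mem hy, zero_sub, abs_neg]
    have := key y x hy hx
    rw [dist_comm] at this
    nlinarith [mul_nonneg hM0 (dist_nonneg (x := x) (y := y))]
  · rw [indicator_of_notMem hx, indicator_of_notMem hy]
    simp; positivity

/-- Integral of a derivative of a function vanishing on the boundary. -/
lemma Dom.GL {Ω : Set ℂ} {J : ℕ} {γ : Fin J → ℝ → ℂ} (hd : Dom Ω J γ) {g : ℂ → ℝ}
    {G : ℂ → ℂ →L[ℝ] ℝ} {M : ℝ}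
    (hc : ContinuousOn g (closure Ω)) (h0 : ∀ x ∈ frontier Ω, g x = 0)
    (hG : ∀ x ∈ Ω, HasFDerivAt g (G x) x) (hM : ∀ x ∈ Ω, ‖G x‖ ≤ M) (v : ℂ) :
    ∫ x in Ω, G x v = 0 := by
  have hM0 : 0 ≤ M := by
    obtain ⟨x, hx⟩ := hd.conn.nonempty
    exact (norm_nonneg _).trans (hM x hx)
  have hl := ext_lip hd.op hM0 hc h0 hG hM
  have hcs : HasCompactSupport (indicator Ω g) := by
    apply HasCompactSupport.intro (hd.bdd.isCompact_closure)
    intro x hx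
    exact indicator_of_notMem (fun h => hx (subset_closure h)) _
  have h1 := LipschitzWith.integral_lineDeriv_mul_eq (μ := (volume : Measure ℂ))
    (f := fun _ : ℂ => (1:ℝ)) (LipschitzWith.const (1:ℝ)) hl hcs (-v)
  simp only [neg_neg, mul_one] at h1
  have h2 : ∀ x : ℂ, lineDeriv ℝ (fun _ : ℂ => (1:ℝ)) x (-v) = 0 := by
    intro x; simp [lineDeriv]
  simp only [h2, zero_mul, integral_zero] at h1
  rw [h1, ← integral_indicator hd.op.measurableSet]
  apply integral_congr_ae
  have hn : ∀ᵐ x ∂(volume : Measure ℂ), x ∉ frontier Ω := by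
    rw [ae_iff]; simpa using hd.null
  filter_upwards [hn] with x hx
  by_cases hxΩ : x ∈ Ω
  · rw [indicator_of_mem hxΩ]
    have : HasFDerivAt (indicator Ω g) (G x) x := by
      apply (hG x hxΩ).congr_of_eventuallyEq
      filter_upwards [hd.op.mem_nhds hxΩ] with y hy
      exact indicator_of_mem hy _
    exact (this.hasLineDerivAt v).lineDeriv.symm
  · rw [indicator_of_notMem hxΩ]
    have hxc : x ∉ closure Ω := fun h => hx (by rw [hd.op.frontier_eq]; exact ⟨h, hxΩ⟩)
    have : HasFDerivAt (indicator Ω g) (0 : ℂ →L[ℝ] ℝ) x := by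
      apply (hasFDerivAt_const (0:ℝ) x).congr_of_eventuallyEq
      filter_upwards [isClosed_closure.isOpen_compl.mem_nhds hxc] with y hy
      exact indicator_of_notMem (fun h => hy (subset_closure h)) _
    rw [(this.hasLineDerivAt v).lineDeriv]; simp

end Rig

namespace Rig

open Filter Topology ComplexConjugate

/-- continuously differentiable up to the boundary -/
structure C1B (Ω : Set ℂ) (g : ℂ → ℝ) (P : ℂ → ℂ →L[ℝ] ℝ) : Prop where
  d : ∀ x ∈ closure Ω, HasFDerivWithinAt g (P x) (closure Ω) x
  c : ContinuousOn P (closure Ω)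

lemma C1B.cont {Ω : Set ℂ} {g : ℂ → ℝ} {P : ℂ → ℂ →L[ℝ] ℝ} (h : C1B Ω g P) :
    ContinuousOn g (closure Ω) := fun x hx => (h.d x hx).continuousWithinAt

lemma C1B.mul {Ω : Set ℂ} {g k : ℂ → ℝ} {P Q : ℂ → ℂ →L[ℝ] ℝ} (h : C1B Ω g P) (h' : C1B Ω k Q) :
    C1B Ω (fun x => g x * k x) (fun x => g x • Q x + k x • P x) where
  d := fun x hx => (h.d x hx).mul (h'.d x hx)
  c := (h.cont.smul h'.c).add (h'.cont.smul h.c)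

lemma C1B.add {Ω : Set ℂ} {g k : ℂ → ℝ} {P Q : ℂ → ℂ →L[ℝ] ℝ} (h : C1B Ω g P) (h' : C1B Ω k Q) :
    C1B Ω (fun x => g x + k x) (fun x => P x + Q x) where
  d := fun x hx => (h.d x hx).add (h'.d x hx)
  c := h.c.add h'.c

lemma C1B.sub {Ω : Set ℂ} {g k : ℂ → ℝ} {P Q : ℂ → ℂ →L[ℝ] ℝ} (h : C1B Ω g P) (h' : C1B Ω k Q) :
    C1B Ω (fun x => g x - k x) (fun x => P x - Q x) where
  d := fun x hx => (h.d x hx).sub (h'.d x hx)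
  c := h.c.sub h'.c

lemma C1B.of_smooth {Ω : Set ℂ} {g : ℂ → ℝ} (h : ContDiff ℝ 1 g) : C1B Ω g (fderiv ℝ g) where
  d := fun x _ => ((h.differentiable (by norm_num)) x).hasFDerivAt.hasFDerivWithinAt
  c := (h.continuous_fderiv (by norm_num)).continuousOn

lemma C1B.of_clm {Ω : Set ℂ} (L : ℂ →L[ℝ] ℝ) : C1B Ω L (fun _ => L) where
  d := fun x _ => L.hasFDerivAt.hasFDerivWithinAt
  c := continuousOn_const

lemma C2B.c1 {Ω : Set ℂ} {u : ℂ → ℝ} {D : ℂ → ℂ →L[ℝ] ℝ} {H : ℂ → ℂ →L[ℝ] ℂ →L[ℝ] ℝ}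
    (h : C2B Ω u D H) : C1B Ω u D where
  d := h.du
  c := fun x hx => (h.dD x hx).continuousWithinAt

lemma C2B.d1 {Ω : Set ℂ} {u : ℂ → ℝ} {D : ℂ → ℂ →L[ℝ] ℝ} {H : ℂ → ℂ →L[ℝ] ℂ →L[ℝ] ℝ}
    (h : C2B Ω u D H) (v : ℂ) : C1B Ω (fun x => D x v) (fun x => (H x).flip v) where
  d := fun x hx => by
    have := (h.dD x hx).clm_apply (hasFDerivWithinAt_const v x (closure Ω))
    refine this.congr_fderiv ?_
    ext; simp
  c := by
    have : ContinuousOn (fun x => (ContinuousLinearMap.flipₗᵢ ℝ ℂ ℂ ℝ) (H x)) (closure Ω) :=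
      (ContinuousLinearMap.flipₗᵢ ℝ ℂ ℂ ℝ).continuous.comp_continuousOn h.cH
    exact this.clm_apply continuousOn_const

lemma closure_nhds {Ω : Set ℂ} (ho : IsOpen Ω) {x : ℂ} (hx : x ∈ Ω) : closure Ω ∈ 𝓝 x :=
  mem_of_superset (ho.mem_nhds hx) subset_closure

lemma C2B.symm {Ω : Set ℂ} {u : ℂ → ℝ} {D : ℂ → ℂ →L[ℝ] ℝ} {H : ℂ → ℂ →L[ℝ] ℂ →L[ℝ] ℝ}
    (h : C2B Ω u D H) (ho : IsOpen Ω) {x : ℂ} (hx : x ∈ Ω) (v w : ℂ) : H x v w = H x w v := by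
  apply second_derivative_symmetric_of_eventually (𝕜 := ℝ) (f := u) (f' := D) (x := x)
  · filter_upwards [ho.mem_nhds hx] with y hy
    exact (h.du y (subset_closure hy)).hasFDerivAt (closure_nhds ho hy)
  · exact (h.dD x (subset_closure hx)).hasFDerivAt (closure_nhds ho hx)

lemma Dom.int {Ω : Set ℂ} {J : ℕ} {γ : Fin J → ℝ → ℂ} (hd : Dom Ω J γ) {g : ℂ → ℝ}
    (hg : ContinuousOn g (closure Ω)) : IntegrableOn g Ω :=
  (hg.integrableOn_compact hd.bdd.isCompact_closure).mono_set subset_closure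

lemma Dom.GL1 {Ω : Set ℂ} {J : ℕ} {γ : Fin J → ℝ → ℂ} (hd : Dom Ω J γ) {g : ℂ → ℝ}
    {P : ℂ → ℂ →L[ℝ] ℝ} (h : C1B Ω g P) (h0 : ∀ x ∈ frontier Ω, g x = 0) (v : ℂ) :
    ∫ x in Ω, P x v = 0 := by
  obtain ⟨M, hM⟩ := hd.bdd.isCompact_closure.exists_bound_of_continuousOn h.c
  exact hd.GL h.cont h0 (fun x hx => (h.d x (subset_closure hx)).hasFDerivAt (closure_nhds hd.op hx))
    (fun x hx => hM x (subset_closure hx)) v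

/-- Green's first identity -/
lemma Dom.green {Ω : Set ℂ} {J : ℕ} {γ : Fin J → ℝ → ℂ} (hd : Dom Ω J γ) {u g : ℂ → ℝ}
    {D P : ℂ → ℂ →L[ℝ] ℝ} {H : ℂ → ℂ →L[ℝ] ℂ →L[ℝ] ℝ} (h : C2B Ω u D H)
    (h0 : ∀ x ∈ frontier Ω, D x = 0) (hg : C1B Ω g P) :
    ∫ x in Ω, (g x * (H x 1 1 + H x Complex.I Complex.I) +
      (P x 1 * D x 1 + P x Complex.I * D x Complex.I)) = 0 := by
  have k1 := hd.GL1 (hg.mul (h.d1 1)) (fun x hx => by simp [h0 x hx]) 1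
  have k2 := hd.GL1 (hg.mul (h.d1 Complex.I)) (fun x hx => by simp [h0 x hx]) Complex.I
  have i1 := hd.int ((hg.mul (h.d1 1)).c.clm_apply (continuousOn_const (c := (1:ℂ))))
  have i2 := hd.int ((hg.mul (h.d1 Complex.I)).c.clm_apply (continuousOn_const (c := Complex.I)))
  have := integral_add i1 i2
  rw [k1, k2, add_zero] at this
  rw [← this]
  congr 1; ext x
  simp
  ring

/-- `∫ div (g x) = 0` for `g` vanishing on the boundary -/
lemma Dom.radial {Ω : Set ℂ} {J : ℕ} {γ : Fin J → ℝ → ℂ} (hd : Dom Ω J γ) {g : ℂ → ℝ}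
    {P : ℂ → ℂ →L[ℝ] ℝ} (hg : C1B Ω g P) (h0 : ∀ x ∈ frontier Ω, g x = 0) :
    ∫ x in Ω, (2 * g x + P x x) = 0 := by
  have k1 := hd.GL1 (hg.mul (C1B.of_clm Complex.reCLM)) (fun x hx => by simp [h0 x hx]) 1
  have k2 := hd.GL1 (hg.mul (C1B.of_clm Complex.imCLM)) (fun x hx => by simp [h0 x hx]) Complex.I
  have i1 := hd.int ((hg.mul (C1B.of_clm Complex.reCLM)).c.clm_apply (continuousOn_const (c := (1:ℂ))))
  have i2 := hd.int ((hg.mul (C1B.of_clm Complex.imCLM)).c.clm_apply (continuousOn_const (c := Complex.I)))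
  have := integral_add i1 i2
  rw [k1, k2, add_zero] at this
  rw [← this]
  congr 1; ext x
  have hx : P x x = x.re * P x 1 + x.im * P x Complex.I := by
    conv_lhs => rw [show x = x.re • (1:ℂ) + x.im • Complex.I by
      simp [Complex.re_add_im]]
    rw [map_add, map_smul, map_smul]
    simp
  rw [hx]
  simp
  ring

lemma clm_decomp (L : ℂ →L[ℝ] ℝ) (x : ℂ) : L x = x.re * L 1 + x.im * L Complex.I := by
  conv_lhs => rw [show x = x.re • (1:ℂ) + x.im • Complex.I by
      simp [Complex.re_add_im]]
  rw [map_add, map_smul, map_smul]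
  simp

lemma C2B.radial {Ω : Set ℂ} {u : ℂ → ℝ} {D : ℂ → ℂ →L[ℝ] ℝ} {H : ℂ → ℂ →L[ℝ] ℂ →L[ℝ] ℝ}
    (h : C2B Ω u D H) : C1B Ω (fun x => D x x) (fun x => D x + (H x).flip x) where
  d := fun x hx => by
    have := (h.dD x hx).clm_apply (hasFDerivWithinAt_id x (closure Ω))
    refine this.congr_fderiv ?_
    ext; simp
  c := by
    have : ContinuousOn (fun x => (ContinuousLinearMap.flipₗᵢ ℝ ℂ ℂ ℝ) (H x)) (closure Ω) :=
      (ContinuousLinearMap.flipₗᵢ ℝ ℂ ℂ ℝ).continuous.comp_continuousOn h.cH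
    exact h.c1.c.add (this.clm_apply continuousOn_id)

/-- Pohozaev -/
lemma Dom.pohozaev {Ω : Set ℂ} {J : ℕ} {γ : Fin J → ℝ → ℂ} (hd : Dom Ω J γ) {u : ℂ → ℝ}
    {D : ℂ → ℂ →L[ℝ] ℝ} {H : ℂ → ℂ →L[ℝ] ℂ →L[ℝ] ℝ} (h : C2B Ω u D H)
    (h0 : ∀ x ∈ frontier Ω, D x = 0) :
    ∫ x in Ω, D x x * (H x 1 1 + H x Complex.I Complex.I) = 0 := by
  have k1 := hd.green h h0 h.radial
  have hq := ((h.d1 1).mul (h.d1 1)).add ((h.d1 Complex.I).mul (h.d1 Complex.I))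
  have k2 := hd.radial hq (fun x hx => by simp [h0 x hx])
  have cH : ∀ v w : ℂ, ContinuousOn (fun x => H x v w) (closure Ω) := fun v w =>
    (h.cH.clm_apply continuousOn_const).clm_apply continuousOn_const
  have cD : ∀ v : ℂ, ContinuousOn (fun x => D x v) (closure Ω) := fun v =>
    h.c1.c.clm_apply continuousOn_const
  have cDx : ContinuousOn (fun x => D x x) (closure Ω) := h.c1.c.clm_apply continuousOn_id
  have i1 : IntegrableOn (fun x => (D x x * (H x 1 1 + H x Complex.I Complex.I) +
      ((D x + (H x).flip x) 1 * D x 1 + (D x + (H x).flip x) Complex.I * D x Complex.I))) Ω := by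
    apply hd.int
    have := h.radial.c
    exact (cDx.mul ((cH _ _).add (cH _ _))).add
      (((this.clm_apply continuousOn_const).mul (cD _)).add ((this.clm_apply continuousOn_const).mul (cD _)))
  have i2 := hd.int ((hq.cont.const_mul 2).add (hq.c.clm_apply continuousOn_id))
  have := integral_sub i1 (i2.const_mul (1/2))
  rw [integral_const_mul] at this
  simp only [Pi.add_apply, id] at this
  rw [k1, k2] at this
  simp only [mul_zero, sub_zero] at this
  rw [← this]
  apply setIntegral_congr_fun hd.op.measurableSet
  intro x hx
  simp only [add_apply, ContinuousLinearMap.flip_apply, smul_apply, smul_eq_mul]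
  rw [h.symm hd.op hx x 1, h.symm hd.op hx x Complex.I]
  ring

instance instCA : ContinuousAdd (ℂ →L[ℝ] ℂ →L[ℝ] ℝ) :=
  (SeminormedAddCommGroup.toIsTopologicalAddGroup (E := ℂ →L[ℝ] ℂ →L[ℝ] ℝ)).toContinuousAdd

lemma C2B.add {Ω : Set ℂ} {u u' : ℂ → ℝ} {D D' : ℂ → ℂ →L[ℝ] ℝ} {H H' : ℂ → ℂ →L[ℝ] ℂ →L[ℝ] ℝ}
    (h : C2B Ω u D H) (h' : C2B Ω u' D' H') :
    C2B Ω (fun x => u x + u' x) (fun x => D x + D' x) (fun x => H x + H' x) where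
  du := fun x hx => (h.du x hx).add (h'.du x hx)
  dD := fun x hx => (h.dD x hx).add (h'.dD x hx)
  cH := h.cH.add h'.cH

lemma C2B.smul {Ω : Set ℂ} {u : ℂ → ℝ} {D : ℂ → ℂ →L[ℝ] ℝ} {H : ℂ → ℂ →L[ℝ] ℂ →L[ℝ] ℝ}
    (h : C2B Ω u D H) (a : ℝ) :
    C2B Ω (fun x => a * u x) (fun x => a • D x) (fun x => a • H x) where
  du := fun x hx => (h.du x hx).const_mul a
  dD := fun x hx => (h.dD x hx).const_smul a
  cH := h.cH.const_smul a

lemma C2B.sum {Ω : Set ℂ} {ι : Type*} (s : Finset ι) {u : ι → ℂ → ℝ} {D : ι → ℂ → ℂ →L[ℝ] ℝ}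
    {H : ι → ℂ → ℂ →L[ℝ] ℂ →L[ℝ] ℝ} (h : ∀ i ∈ s, C2B Ω (u i) (D i) (H i)) :
    C2B Ω (fun x => ∑ i ∈ s, u i x) (fun x => ∑ i ∈ s, D i x) (fun x => ∑ i ∈ s, H i x) where
  du := fun x hx => HasFDerivWithinAt.fun_sum fun i hi => (h i hi).du x hx
  dD := fun x hx => HasFDerivWithinAt.fun_sum fun i hi => (h i hi).dD x hx
  cH := continuousOn_finsetSum _ fun i hi => (h i hi).cH

/-- `u` is constant on each boundary curve -/
lemma Eig.const {Ω : Set ℂ} {J : ℕ} {γ : Fin J → ℝ → ℂ} (hd : Dom Ω J γ) {u : ℂ → ℝ} {μ : ℝ}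
    {D : ℂ → ℂ →L[ℝ] ℝ} {H : ℂ → ℂ →L[ℝ] ℂ →L[ℝ] ℝ} (h : Eig Ω u D H μ) (j : Fin J) (s t : ℝ) :
    u (γ j s) = u (γ j t) := by
  have hder : ∀ s, HasDerivAt (fun s => u (γ j s)) 0 s := by
    intro s
    have h1 : HasDerivAt (γ j) (deriv (γ j) s) s :=
      (((hd.smooth j).differentiable (by simp)) s).hasDerivAt
    have h2 := h.du (γ j s) (frontier_subset_closure (hd.mem_fr j s))
    have := h2.comp_hasDerivAt s h1 (Eventually.of_forall fun s => frontier_subset_closure (hd.mem_fr j s))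
    rw [h.zero _ (hd.mem_fr j s)] at this
    exact this
  exact is_const_of_deriv_eq_zero (fun s => (hder s).differentiableAt) (fun s => (hder s).deriv) s t

end Rig

namespace Rig

open Filter Topology ComplexConjugate

section
variable {Ω : Set ℂ} {J : ℕ} {γ : Fin J → ℝ → ℂ}
  {u u' : ℂ → ℝ} {D D' : ℂ → ℂ →L[ℝ] ℝ} {H H' : ℂ → ℂ →L[ℝ] ℂ →L[ℝ] ℝ} {μ μ' : ℝ}

lemma C2B.cD (h : C2B Ω u D H) (v : ℂ) : ContinuousOn (fun x => D x v) (closure Ω) :=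
  h.c1.c.clm_apply continuousOn_const

lemma C2B.cu (h : C2B Ω u D H) : ContinuousOn u (closure Ω) := h.c1.cont

lemma Eig.energy (hd : Dom Ω J γ) (h : Eig Ω u D H μ) (h' : Eig Ω u' D' H' μ') :
    ∫ x in Ω, (D' x 1 * D x 1 + D' x Complex.I * D x Complex.I) = μ * ∫ x in Ω, u x * u' x := by
  have k := hd.green h.toC2B h.zero h'.toC2B.c1
  have i1 : IntegrableOn (fun x => D' x 1 * D x 1 + D' x Complex.I * D x Complex.I) Ω :=
    hd.int (((h'.toC2B.cD _).mul (h.toC2B.cD _)).add ((h'.toC2B.cD _).mul (h.toC2B.cD _)))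
  have i2 : IntegrableOn (fun x => u x * u' x) Ω := hd.int (h.toC2B.cu.mul h'.toC2B.cu)
  have e : ∫ x in Ω, (u' x * (H x 1 1 + H x Complex.I Complex.I) +
      (D' x 1 * D x 1 + D' x Complex.I * D x Complex.I)) =
      ∫ x in Ω, ((D' x 1 * D x 1 + D' x Complex.I * D x Complex.I) - μ * (u x * u' x)) := by
    apply setIntegral_congr_fun hd.op.measurableSet
    intro x hx
    simp only [h.pde x hx]; ring
  rw [e, integral_sub i1 (i2.const_mul μ), integral_const_mul] at k
  linarith

lemma Eig.orth (hd : Dom Ω J γ) (h : Eig Ω u D H μ) (h' : Eig Ω u' D' H' μ') (hne : μ ≠ μ') :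
    ∫ x in Ω, u x * u' x = 0 := by
  have k1 := h.energy hd h'
  have k2 := h'.energy hd h
  have e1 : ∫ x in Ω, (D' x 1 * D x 1 + D' x Complex.I * D x Complex.I) =
      ∫ x in Ω, (D x 1 * D' x 1 + D x Complex.I * D' x Complex.I) := by
    congr 1; ext x; ring
  have e2 : ∫ x in Ω, u' x * u x = ∫ x in Ω, u x * u' x := by
    congr 1; ext x; ring
  rw [e1, k2, e2] at k1
  have : (μ' - μ) * ∫ x in Ω, u x * u' x = 0 := by linarith
  rcases mul_eq_zero.1 this with h1 | h1
  · exact absurd (by linarith) hne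
  · exact h1

lemma zero_of_int (hd : Dom Ω J γ) {g : ℂ → ℝ} (hg : ContinuousOn g (closure Ω)) (h0 : ∀ x ∈ Ω, 0 ≤ g x)
    (hi : ∫ x in Ω, g x = 0) : ∀ x ∈ Ω, g x = 0 := by
  have h1 : g =ᵐ[volume.restrict Ω] 0 := by
    rw [← setIntegral_eq_zero_iff_of_nonneg_ae _ (hd.int hg)]
    · exact hi
    · exact (ae_restrict_iff' hd.op.measurableSet).2 (Eventually.of_forall h0)
  have := MeasureTheory.Measure.eqOn_open_of_ae_eq h1 hd.op (hg.mono subset_closure) continuousOn_const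
  exact this

lemma Eig.pos (hd : Dom Ω J γ) (h : Eig Ω u D H μ) (hnc : ∃ x ∈ closure Ω, ∃ y ∈ closure Ω, u x ≠ u y) :
    0 < μ ∧ 0 < ∫ x in Ω, u x * u x := by
  have k := h.energy hd h
  have hn : 0 ≤ ∫ x in Ω, u x * u x := setIntegral_nonneg hd.op.measurableSet
    fun x _ => mul_self_nonneg _
  have hD : 0 ≤ ∫ x in Ω, (D x 1 * D x 1 + D x Complex.I * D x Complex.I) :=
    setIntegral_nonneg hd.op.measurableSet
      fun x _ => add_nonneg (mul_self_nonneg _) (mul_self_nonneg _)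
  have hpos : 0 < ∫ x in Ω, (D x 1 * D x 1 + D x Complex.I * D x Complex.I) := by
    rcases hD.eq_or_lt with h1 | h1
    · exfalso
      have hz := zero_of_int hd (((h.toC2B.cD 1).mul (h.toC2B.cD 1)).add
        ((h.toC2B.cD Complex.I).mul (h.toC2B.cD Complex.I)))
        (fun x _ => add_nonneg (mul_self_nonneg _) (mul_self_nonneg _)) h1.symm
      have hD0 : ∀ x ∈ Ω, D x = 0 := by
        intro x hx
        have this : D x 1 * D x 1 + D x Complex.I * D x Complex.I = 0 := hz x hx
        have a1 : D x 1 = 0 := by nlinarith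
        have a2 : D x Complex.I = 0 := by nlinarith
        ext y
        rw [clm_decomp, a1, a2]; simp
      obtain ⟨a, ha⟩ := hd.op.exists_is_const_of_fderiv_eq_zero hd.conn.isPreconnected
        (f := u) (𝕜 := ℝ)
        (fun x hx => ((h.du x (subset_closure hx)).hasFDerivAt (closure_nhds hd.op hx)).differentiableAt.differentiableWithinAt)
        (fun x hx => by
          rw [((h.du x (subset_closure hx)).hasFDerivAt (closure_nhds hd.op hx)).fderiv]
          exact hD0 x hx)
      have hcl : EqOn u (fun _ => a) (closure Ω) :=
        EqOn.of_subset_closure ha h.toC2B.cu continuousOn_const subset_closure subset_rfl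
      obtain ⟨x, hx, y, hy, hxy⟩ := hnc
      exact hxy ((hcl hx).trans (hcl hy).symm)
    · exact h1
  rw [k] at hpos
  constructor
  · by_contra hh; push Not at hh; nlinarith
  · rcases hn.eq_or_lt with h1 | h1
    · rw [← h1, mul_zero] at hpos; exact absurd hpos (lt_irrefl _)
    · exact h1

lemma Dom.bumps (hd : Dom Ω J γ) : ∃ η : Fin J → ℂ → ℝ, (∀ j, ContDiff ℝ 1 (η j)) ∧
    ∀ i j s, η i (γ j s) = if i = j then 1 else 0 := by
  have hcl : ∀ j, IsClosed (range (γ j)) := by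
    intro j
    have : range (γ j) = γ j '' Icc 0 (0 + 2*π) := ((hd.per j).image_Icc (by positivity) 0).symm
    rw [this]
    exact (isCompact_Icc.image (hd.smooth j).continuous).isClosed
  have : ∀ i, ∃ f : ℂ → ℝ, ContDiff ℝ 1 f ∧ ∀ j s, f (γ j s) = if i = j then 1 else 0 := by
    intro i
    obtain ⟨f, h1, h2, -⟩ := exists_contMDiffMap_zero_one_of_isClosed (n := (1 : ℕ)) (modelWithCornersSelf ℝ ℂ)
      (s := ⋃ j ∈ {j | j ≠ i}, range (γ j)) (t := range (γ i))
      ((Set.toFinite _).isClosed_biUnion fun j _ => hcl j) (hcl i) (by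
        rw [Set.disjoint_left]
        rintro z hz ⟨s, hs⟩
        obtain ⟨j, hj, t, ht⟩ := mem_iUnion₂.1 hz
        exact hj (hd.disj _ _ _ _ (ht.trans hs.symm)))
    refine ⟨f, ?_, fun j s => ?_⟩
    · exact f.contMDiff.contDiff
    · split_ifs with hij
      · subst hij; exact h2 (mem_range_self s)
      · exact h1 (mem_iUnion₂.2 ⟨j, fun h => hij h.symm, mem_range_self s⟩)
  choose η h1 h2 using this
  exact ⟨η, h1, h2⟩

lemma Dom.mass (hd : Dom Ω J γ) : ∃ C > 0, ∀ (u : ℂ → ℝ) D H μ, μ ≠ 0 → Eig Ω u D H μ → ∀ m : ℝ,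
    (∀ j, |u (γ j 0)| ≤ m) → ∫ x in Ω, u x * u x ≤ C * m ^ 2 := by
  obtain ⟨η, hη, hηv⟩ := hd.bumps
  set a : Fin J → ℝ := fun j => ∫ x in Ω, (2 * η j x + fderiv ℝ (η j) x x)
  refine ⟨∑ j, |a j| + 1, by positivity, fun u D H μ hμ h m hm => ?_⟩
  set b : Fin J → ℝ := fun j => u (γ j 0) ^ 2
  have hψ : C1B Ω (fun x => ∑ j, b j * η j x) (fun x => ∑ j, b j • fderiv ℝ (η j) x) := by
    constructor
    · intro x _
      exact HasFDerivWithinAt.fun_sum fun j _ =>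
        ((((hη j).differentiable (by norm_num)) x).hasFDerivAt.hasFDerivWithinAt).const_mul (b j)
    · exact continuousOn_finsetSum _ fun j _ =>
        (((hη j).continuous_fderiv (by norm_num)).continuousOn).const_smul (b j)
  have hu2 := h.toC2B.c1.mul h.toC2B.c1
  have k := hd.radial (hu2.sub hψ) (by
    intro x hx
    obtain ⟨j, s, rfl⟩ := hd.exists_fr hx
    simp only [hηv, mul_ite, mul_one, mul_zero, Finset.sum_ite_eq', Finset.mem_univ, if_true, b]
    rw [h.const hd j s 0]; ring)
  have p := hd.pohozaev h.toC2B h.zero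
  have p' : ∫ x in Ω, u x * D x x = 0 := by
    have : ∫ x in Ω, D x x * (H x 1 1 + H x Complex.I Complex.I) = ∫ x in Ω, (-μ) * (u x * D x x) := by
      apply setIntegral_congr_fun hd.op.measurableSet
      intro x hx
      simp only [h.pde x hx]; ring
    rw [this, integral_const_mul] at p
    rcases mul_eq_zero.1 p with h1 | h1
    · exact absurd (neg_eq_zero.1 h1) hμ
    · exact h1
  have ia : ∀ j, IntegrableOn (fun x => 2 * η j x + fderiv ℝ (η j) x x) Ω := by
    intro j
    apply hd.int
    exact ((hη j).continuous.continuousOn.const_mul 2).add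
      (((hη j).continuous_fderiv (by norm_num)).continuousOn.clm_apply continuousOn_id)
  have cDx : ContinuousOn (fun x => D x x) (closure Ω) := h.toC2B.c1.c.clm_apply continuousOn_id
  have i1 : IntegrableOn (fun x => u x * u x) Ω := hd.int (h.toC2B.cu.mul h.toC2B.cu)
  have i2 : IntegrableOn (fun x => u x * D x x) Ω := hd.int (h.toC2B.cu.mul cDx)
  have e : ∫ x in Ω, (2 * (u x * u x - ∑ j, b j * η j x) +
      ((u x • D x + u x • D x) - ∑ j, b j • fderiv ℝ (η j) x) x) =
      2 * (∫ x in Ω, u x * u x) + 2 * (∫ x in Ω, u x * D x x) - ∑ j, b j * a j := by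
    have : ∀ x, (2 * (u x * u x - ∑ j, b j * η j x) +
      ((u x • D x + u x • D x) - ∑ j, b j • fderiv ℝ (η j) x) x) =
      (2 * (u x * u x) + 2 * (u x * D x x)) - ∑ j, b j * (2 * η j x + fderiv ℝ (η j) x x) := by
      intro x
      simp only [mul_add, Finset.sum_add_distrib, sub_apply, add_apply, smul_apply, sum_apply, smul_eq_mul, mul_sub, Finset.mul_sum]
      have : ∑ i, b i * (2 * η i x) = ∑ i, 2 * (b i * η i x) := by
        congr 1; ext; ring
      rw [this]; ring
    simp only [this]
    have s1 : IntegrableOn (fun x => 2 * (u x * u x) + 2 * (u x * D x x)) Ω := (i1.const_mul 2).add (i2.const_mul 2)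
    rw [integral_sub s1
      (integrable_finsetSum _ fun j _ => (ia j).const_mul (b j)),
      integral_finsetSum _ fun j _ => (ia j).const_mul (b j)]
    rw [integral_add (i1.const_mul 2) (i2.const_mul 2)]
    simp only [integral_const_mul, a]
  rw [e, p'] at k
  have hb : ∀ j, b j * a j ≤ m ^ 2 * |a j| := by
    intro j
    have h1 : b j ≤ m ^ 2 := by
      simp only [b]; rw [← sq_abs]
      exact pow_le_pow_left₀ (abs_nonneg _) (hm j) 2
    have h2 : 0 ≤ b j := sq_nonneg _
    calc b j * a j ≤ b j * |a j| := mul_le_mul_of_nonneg_left (le_abs_self _) h2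
      _ ≤ _ := mul_le_mul_of_nonneg_right h1 (abs_nonneg _)
  have hs : ∑ j, b j * a j ≤ m ^ 2 * ∑ j, |a j| := by
    rw [Finset.mul_sum]; exact Finset.sum_le_sum fun j _ => hb j
  have hm2 := sq_nonneg m
  have hs0 : 0 ≤ m ^ 2 * ∑ j, |a j| := mul_nonneg hm2 (Finset.sum_nonneg fun j _ => abs_nonneg _)
  nlinarith

end

end Rig

namespace Rig

open Filter Topology ComplexConjugate

lemma bilin {Ω : Set ℂ} {ι : Type*} [Fintype ι] [DecidableEq ι] {u : ι → ℂ → ℝ} {q : ι → ℝ}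
    (hi : ∀ i k, IntegrableOn (fun x => u i x * u k x) Ω)
    (ho : ∀ i k, ∫ x in Ω, u i x * u k x = if i = k then q i else 0) (a b : ι → ℝ) :
    ∫ x in Ω, (∑ i, a i * u i x) * (∑ k, b k * u k x) = ∑ i, a i * b i * q i := by
  have : ∀ x, (∑ i, a i * u i x) * (∑ k, b k * u k x) = ∑ i, ∑ k, (a i * b k) * (u i x * u k x) := by
    intro x
    rw [Finset.sum_mul_sum]
    refine Finset.sum_congr rfl fun i _ => Finset.sum_congr rfl fun k _ => by ring
  simp only [this]
  rw [integral_finsetSum _ fun i _ => integrable_finsetSum _ fun k _ => (hi i k).const_mul _]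
  refine Finset.sum_congr rfl fun i _ => ?_
  rw [integral_finsetSum _ fun k _ => (hi i k).const_mul _]
  simp only [integral_const_mul, ho, mul_ite, mul_zero, Finset.sum_ite_eq, Finset.mem_univ, if_true]

section
variable {Ω : Set ℂ} {J : ℕ} {γ : Fin J → ℝ → ℂ}
  {u : ℕ → ℂ → ℝ} {D : ℕ → ℂ → ℂ →L[ℝ] ℝ} {H : ℕ → ℂ → ℂ →L[ℝ] ℂ →L[ℝ] ℝ} {μ : ℕ → ℝ}

lemma dxx_bound {R : ℝ} {x : ℂ} (hx : ‖x‖ ≤ R) (L : ℂ →L[ℝ] ℝ) :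
    (L x) ^ 2 ≤ R ^ 2 * (L 1 * L 1 + L Complex.I * L Complex.I) := by
  rw [clm_decomp L x]
  have h1 : x.re ^ 2 + x.im ^ 2 ≤ R ^ 2 := by
    have : ‖x‖ ^ 2 ≤ R ^ 2 := pow_le_pow_left₀ (norm_nonneg _) hx 2
    rw [← Complex.normSq_eq_norm_sq, Complex.normSq_apply] at this
    nlinarith
  have h2 : (x.re * L 1 + x.im * L Complex.I) ^ 2 ≤
      (x.re ^ 2 + x.im ^ 2) * (L 1 * L 1 + L Complex.I * L Complex.I) := by
    nlinarith [sq_nonneg (x.re * L Complex.I - x.im * L 1)]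
  refine h2.trans (mul_le_mul_of_nonneg_right h1 ?_)
  nlinarith [sq_nonneg (L 1), sq_nonneg (L Complex.I)]

lemma no_cluster (hd : Dom Ω J γ) (hE : ∀ n, Eig Ω (u n) (D n) (H n) (μ n)) (hμ : Function.Injective μ)
    (hnc : ∀ n, ∃ x ∈ closure Ω, ∃ y ∈ closure Ω, u n x ≠ u n y) (l : ℝ) (hl : 0 ≤ l) :
    ∃ δ > 0, ∀ φ : Fin (J + 1) → ℕ, Function.Injective φ → (∀ i, |μ (φ i) - l| < δ) → False := by
  obtain ⟨R0, hR0⟩ := hd.bdd.isCompact_closure.isBounded.exists_norm_le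
  set R := |R0| + 1
  have hRpos : 0 < R := by positivity
  have hR : ∀ x ∈ closure Ω, ‖x‖ ≤ R := fun x hx =>
    (hR0 x hx).trans (by simp only [R]; linarith [le_abs_self R0])
  -- the combination
  have main : ∀ δ > 0, ∀ φ : Fin (J + 1) → ℕ, Function.Injective φ → (∀ i, |μ (φ i) - l| < δ) →
      ∃ N F E : ℝ, 0 < N ∧ 0 ≤ F ∧ F ≤ δ ^ 2 * N ∧ E ≤ (l + δ) * N ∧ 0 ≤ E ∧
        (∀ A > 0, l * N ≤ (A * F + R ^ 2 * E / A) / 2) ∧ N ≤ (N + R ^ 2 * E) / 2 := by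
    intro δ hδ φ hφ hφδ
    have hpos := fun n => (hE n).pos hd (hnc n)
    -- coefficients
    have hli : ¬ LinearIndependent ℝ (fun i : Fin (J+1) => (fun j : Fin J => u (φ i) (γ j 0))) := by
      intro h
      have := h.fintype_card_le_finrank
      simp at this
    obtain ⟨a, ha, i0, hi0⟩ := Fintype.not_linearIndependent_iff.1 hli
    have haj : ∀ j, ∑ i, a i * u (φ i) (γ j 0) = 0 := by
      intro j
      have := congrFun ha j
      simpa using this
    set q : Fin (J+1) → ℝ := fun i => ∫ x in Ω, u (φ i) x * u (φ i) x
    have hq : ∀ i, 0 < q i := fun i => (hpos (φ i)).2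
    have hi : ∀ i k, IntegrableOn (fun x => u (φ i) x * u (φ k) x) Ω := fun i k =>
      hd.int ((hE _).toC2B.cu.mul (hE _).toC2B.cu)
    have ho : ∀ i k, ∫ x in Ω, u (φ i) x * u (φ k) x = if i = k then q i else 0 := by
      intro i k
      split_ifs with h
      · subst h; rfl
      · exact (hE _).orth hd (hE _) (fun h' => h (hφ (hμ h')))
    have hb := bilin (u := fun i => u (φ i)) hi ho
    have hW : C2B Ω (fun x => ∑ i, a i * u (φ i) x) (fun x => ∑ i, a i • D (φ i) x)
        (fun x => ∑ i, a i • H (φ i) x) :=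
      C2B.sum _ fun i _ => (hE (φ i)).toC2B.smul (a i)
    set W : ℂ → ℝ := fun x => ∑ i, a i * u (φ i) x with hWd
    set DW : ℂ → ℂ →L[ℝ] ℝ := fun x => ∑ i, a i • D (φ i) x with hDWd
    set HW : ℂ → ℂ →L[ℝ] ℂ →L[ℝ] ℝ := fun x => ∑ i, a i • H (φ i) x with hHWd
    have hD0 : ∀ x ∈ frontier Ω, DW x = 0 := by
      intro x hx
      exact Finset.sum_eq_zero fun i _ => by rw [(hE _).zero x hx, smul_zero]
    have hW0 : ∀ x ∈ frontier Ω, W x = 0 := by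
      intro x hx
      obtain ⟨j, s, rfl⟩ := hd.exists_fr hx
      rw [← haj j]
      exact Finset.sum_congr rfl fun i _ => by rw [(hE _).const hd j s 0]
    have hlap : ∀ x ∈ Ω, HW x 1 1 + HW x Complex.I Complex.I = - ∑ i, (a i * μ (φ i)) * u (φ i) x := by
      intro x hx
      simp only [hHWd, sum_apply, smul_apply, smul_eq_mul]
      rw [← Finset.sum_add_distrib, ← Finset.sum_neg_distrib]
      refine Finset.sum_congr rfl fun i _ => ?_
      rw [← mul_add, (hE _).pde x hx]; ring
    have cW : ContinuousOn W (closure Ω) := hW.cu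
    have cDx : ContinuousOn (fun x => DW x x) (closure Ω) := hW.c1.c.clm_apply continuousOn_id
    set f : ℂ → ℝ := fun x => ∑ i, (a i * (l - μ (φ i))) * u (φ i) x with hf
    have cf : ContinuousOn f (closure Ω) := continuousOn_finsetSum _ fun i _ =>
      (hE _).toC2B.cu.const_mul _
    set G : ℂ → ℝ := fun x => DW x 1 * DW x 1 + DW x Complex.I * DW x Complex.I with hG
    have cG : ContinuousOn G (closure Ω) :=
      ((hW.cD 1).mul (hW.cD 1)).add ((hW.cD Complex.I).mul (hW.cD Complex.I))
    have hG0 : ∀ x, 0 ≤ G x := fun x => add_nonneg (mul_self_nonneg _) (mul_self_nonneg _)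
    have hN : ∫ x in Ω, W x * W x = ∑ i, a i * a i * q i := hb a a
    have hF : ∫ x in Ω, f x * f x = ∑ i, (a i * (l - μ (φ i))) * (a i * (l - μ (φ i))) * q i := hb _ _
    have iW : IntegrableOn (fun x => W x * W x) Ω := hd.int (cW.mul cW)
    have iG := hd.int cG
    have iF : IntegrableOn (fun x => f x * f x) Ω := hd.int (cf.mul cf)
    have iWD : IntegrableOn (fun x => W x * DW x x) Ω := hd.int (cW.mul cDx)
    have ifD : IntegrableOn (fun x => f x * DW x x) Ω := hd.int (cf.mul cDx)
    have hEn : ∫ x in Ω, G x = ∑ i, a i * (a i * μ (φ i)) * q i := by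
      have k := hd.green hW hD0 hW.c1
      rw [← hb a (fun i => a i * μ (φ i))]
      have e : ∫ x in Ω, (W x * (HW x 1 1 + HW x Complex.I Complex.I) +
          (DW x 1 * DW x 1 + DW x Complex.I * DW x Complex.I)) =
          ∫ x in Ω, (G x - (∑ i, a i * u (φ i) x) * (∑ i, (a i * μ (φ i)) * u (φ i) x)) := by
        apply setIntegral_congr_fun hd.op.measurableSet
        intro x hx
        simp only [hlap x hx, hWd, hG]; ring
      have cc : ContinuousOn (fun x => (∑ i, a i * u (φ i) x) * (∑ i, (a i * μ (φ i)) * u (φ i) x)) (closure Ω) :=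
        cW.mul (continuousOn_finsetSum _ fun i _ => (hE _).toC2B.cu.const_mul _)
      rw [e, integral_sub iG (hd.int cc)] at k
      linarith
    have hrad : ∫ x in Ω, W x * DW x x = - ∫ x in Ω, W x * W x := by
      have k := hd.radial (hW.c1.mul hW.c1) (fun x hx => by rw [hW0 x hx, mul_zero])
      have e : ∫ x in Ω, (2 * (W x * W x) + (W x • DW x + W x • DW x) x) =
          ∫ x in Ω, (2 * (W x * W x) + 2 * (W x * DW x x)) := by
        congr 1; ext x; simp only [add_apply, smul_apply, smul_eq_mul]; ring
      rw [e, integral_add (iW.const_mul 2) (iWD.const_mul 2), integral_const_mul, integral_const_mul] at k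
      linarith
    have hpoh : ∫ x in Ω, f x * DW x x = - (l * ∫ x in Ω, W x * W x) := by
      have k := hd.pohozaev hW hD0
      have e : ∫ x in Ω, DW x x * (HW x 1 1 + HW x Complex.I Complex.I) =
          ∫ x in Ω, (f x * DW x x - l * (W x * DW x x)) := by
        apply setIntegral_congr_fun hd.op.measurableSet
        intro x hx
        have : f x = l * W x - ∑ i, (a i * μ (φ i)) * u (φ i) x := by
          simp only [hf, hWd, Finset.mul_sum, ← Finset.sum_sub_distrib]
          exact Finset.sum_congr rfl fun i _ => by ring
        simp only [hlap x hx, this]; ring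
      rw [e, integral_sub ifD (iWD.const_mul l), integral_const_mul, hrad] at k
      linarith
    refine ⟨∫ x in Ω, W x * W x, ∫ x in Ω, f x * f x, ∫ x in Ω, G x, ?_, ?_, ?_, ?_, ?_, ?_, ?_⟩
    · rw [hN]
      refine Finset.sum_pos' (fun i _ => mul_nonneg (mul_self_nonneg _) (hq i).le)
        ⟨i0, Finset.mem_univ _, mul_pos (mul_self_pos.2 hi0) (hq i0)⟩
    · exact setIntegral_nonneg hd.op.measurableSet fun x _ => mul_self_nonneg _
    · rw [hF, hN, Finset.mul_sum]
      refine Finset.sum_le_sum fun i _ => ?_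
      have h1 : (l - μ (φ i)) ^ 2 ≤ δ ^ 2 := by
        rw [← sq_abs, abs_sub_comm]
        exact pow_le_pow_left₀ (abs_nonneg _) (hφδ i).le 2
      have h2 : 0 ≤ a i * a i * q i := mul_nonneg (mul_self_nonneg _) (hq i).le
      calc _ = (l - μ (φ i)) ^ 2 * (a i * a i * q i) := by ring
        _ ≤ _ := mul_le_mul_of_nonneg_right h1 h2
    · rw [hEn, hN, Finset.mul_sum]
      refine Finset.sum_le_sum fun i _ => ?_
      have h1 : μ (φ i) ≤ l + δ := by linarith [(abs_lt.1 (hφδ i)).2]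
      have h2 : 0 ≤ a i * a i * q i := mul_nonneg (mul_self_nonneg _) (hq i).le
      calc _ = μ (φ i) * (a i * a i * q i) := by ring
        _ ≤ _ := mul_le_mul_of_nonneg_right h1 h2
    · exact setIntegral_nonneg hd.op.measurableSet fun x _ => hG0 x
    · intro A hA
      have h1 : ∫ x in Ω, -(f x * DW x x) ≤ ∫ x in Ω, ((A/2) * (f x * f x) + (R^2/A/2) * G x) := by
        apply setIntegral_mono_on ifD.neg ((iF.const_mul _).add (iG.const_mul _)) hd.op.measurableSet
        intro x hx
        have h2 := dxx_bound (hR x (subset_closure hx)) (DW x)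
        have h3 : R^2/A/2 * G x ≥ (DW x x)^2 / A / 2 := by
          rw [show R^2/A/2 * G x = (R^2 * G x)/A/2 by ring]
          gcongr
        have h4 : 0 ≤ (A * f x + DW x x)^2 / A / 2 := by positivity
        have h5 : (A * f x + DW x x)^2 / A / 2 = A/2 * (f x * f x) + f x * DW x x + (DW x x)^2/A/2 := by
          field_simp; ring
        simp only [Pi.neg_apply, Pi.add_apply]
        linarith
      rw [integral_neg, hpoh, integral_add (iF.const_mul _) (iG.const_mul _), integral_const_mul,
        integral_const_mul] at h1
      calc _ ≤ _ := by simpa using h1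
        _ = _ := by ring
    · have h1 : ∫ x in Ω, -(W x * DW x x) ≤ ∫ x in Ω, ((1/2) * (W x * W x) + (R^2/2) * G x) := by
        apply setIntegral_mono_on iWD.neg ((iW.const_mul _).add (iG.const_mul _)) hd.op.measurableSet
        intro x hx
        have h2 := dxx_bound (hR x (subset_closure hx)) (DW x)
        have h4 := sq_nonneg (W x + DW x x)
        simp only [Pi.neg_apply, Pi.add_apply]
        have h5 : R^2/2 * G x ≥ (DW x x)^2 / 2 := by
          rw [show R^2/2 * G x = (R^2 * G x)/2 by ring]
          gcongr
        nlinarith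
      rw [integral_neg, hrad, integral_add (iW.const_mul _) (iG.const_mul _), integral_const_mul,
        integral_const_mul] at h1
      calc _ ≤ _ := by simpa using h1
        _ = _ := by ring
  rcases hl.eq_or_lt with h0 | h0
  · refine ⟨1 / (2 * R ^ 2), by positivity, fun φ hφ hφδ => ?_⟩
    obtain ⟨N, F, E, hN, -, -, hE1, -, -, h⟩ := main _ (by positivity) φ hφ hφδ
    rw [← h0, zero_add] at hE1
    have : R ^ 2 * E ≤ R ^ 2 * (1 / (2 * R ^ 2) * N) := mul_le_mul_of_nonneg_left hE1 (by positivity)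
    have e : R ^ 2 * (1 / (2 * R ^ 2) * N) = N / 2 := by field_simp
    linarith
  · set A := 2 * R ^ 2 * (l + 1) / l with hA
    have hApos : 0 < A := by positivity
    set δ := min 1 (√ (l / (2 * A))) with hδ
    have hδpos : 0 < δ := lt_min one_pos (Real.sqrt_pos.2 (by positivity))
    refine ⟨δ, hδpos, fun φ hφ hφδ => ?_⟩
    obtain ⟨N, F, E, hN, hF0, hF1, hE1, hE0, h, -⟩ := main _ hδpos φ hφ hφδ
    have h1 := h A hApos
    have h2 : δ ^ 2 ≤ l / (2 * A) := by
      rw [← Real.sq_sqrt (show 0 ≤ l / (2 * A) by positivity)]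
      exact pow_le_pow_left₀ hδpos.le (min_le_right _ _) 2
    have h3 : A * F ≤ l / 2 * N := by
      calc A * F ≤ A * (l / (2 * A) * N) := by
            apply mul_le_mul_of_nonneg_left _ hApos.le
            exact hF1.trans (mul_le_mul_of_nonneg_right h2 hN.le)
        _ = _ := by field_simp
    have h4 : R ^ 2 * E / A ≤ l / 2 * N := by
      rw [div_le_iff₀ hApos]
      have : E ≤ (l + 1) * N := hE1.trans (mul_le_mul_of_nonneg_right (by linarith [min_le_left 1 (√ (l / (2 * A)))]) hN.le)
      calc R ^ 2 * E ≤ R ^ 2 * ((l + 1) * N) := mul_le_mul_of_nonneg_left this (by positivity)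
        _ = _ := by rw [hA]; field_simp
    nlinarith

lemma finite_below (hd : Dom Ω J γ) (hE : ∀ n, Eig Ω (u n) (D n) (H n) (μ n)) (hμ : Function.Injective μ)
    (hnc : ∀ n, ∃ x ∈ closure Ω, ∃ y ∈ closure Ω, u n x ≠ u n y) (K : ℝ) :
    {n | μ n ≤ K}.Finite := by
  by_contra hinf
  have hinf : {n | μ n ≤ K}.Infinite := hinf
  have h1 : (μ '' {n | μ n ≤ K}).Infinite := hinf.image hμ.injOn
  have h2 : μ '' {n | μ n ≤ K} ⊆ Icc 0 K := by
    rintro _ ⟨n, hn, rfl⟩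
    exact ⟨((hE n).pos hd (hnc n)).1.le, hn⟩
  obtain ⟨l, hl, hacc⟩ := h1.exists_accPt_of_subset_isCompact isCompact_Icc h2
  obtain ⟨δ, hδ, hc⟩ := no_cluster hd hE hμ hnc l hl.1
  have h3 : (Metric.ball l δ ∩ μ '' {n | μ n ≤ K}).Infinite := by
    intro hfin
    rw [accPt_iff_nhds] at hacc
    -- remove the finitely many points
    set T := (Metric.ball l δ ∩ μ '' {n | μ n ≤ K}) \ {l}
    have hT : T.Finite := hfin.subset diff_subset
    have hU : Metric.ball l δ ∩ Tᶜ ∈ 𝓝 l :=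
      inter_mem (Metric.ball_mem_nhds l hδ) (hT.isClosed.isOpen_compl.mem_nhds (fun h => h.2 rfl))
    obtain ⟨y, hy, hne⟩ := hacc _ hU
    exact hy.1.2 ⟨⟨hy.1.1, hy.2⟩, hne⟩
  have h4 : (μ ⁻¹' Metric.ball l δ).Infinite := by
    intro hfin
    apply h3
    apply (hfin.image μ).subset
    rintro _ ⟨hb, n, hn, rfl⟩
    exact ⟨n, hb, rfl⟩
  let e := h4.natEmbedding
  refine hc (fun i => (e i : ℕ)) ?_ ?_
  · intro i k hik
    have := e.injective (Subtype.ext hik)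
    exact Fin.ext this
  · intro i
    have := (e i).2
    rw [mem_preimage, Metric.mem_ball, Real.dist_eq] at this
    exact this
end

end Rig

namespace Rig

open Filter Topology ComplexConjugate

/-- The real-linear map with given values at `1` and `I`. -/
def LL (a b : ℂ) : ℂ →L[ℝ] ℂ :=
  a • (Complex.ofRealCLM.comp Complex.reCLM) + b • (Complex.ofRealCLM.comp Complex.imCLM)

@[simp] lemma LL_apply (a b z : ℂ) : LL a b z = a * z.re + b * z.im := by
  simp [LL]

lemma LL_ext (L : ℂ →L[ℝ] ℂ) : L = LL (L 1) (L Complex.I) := by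
  ext z
  rw [LL_apply]
  conv_lhs => rw [show z = z.re • (1:ℂ) + z.im • Complex.I by
      simp [Complex.re_add_im]]
  rw [map_add, map_smul, map_smul]
  simp only [Complex.real_smul]; ring

/-- `F` has partial derivatives `a`, `b` at `z` in the Frechet sense. -/
def HP (F : ℂ → ℂ) (a b z : ℂ) : Prop := HasFDerivAt F (LL a b) z

namespace HP
variable {F G : ℂ → ℂ} {a b c d z : ℂ}

lemma of (L : ℂ →L[ℝ] ℂ) (h : HasFDerivAt F L z) (h1 : L 1 = a) (h2 : L Complex.I = b) : HP F a b z := by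
  rw [HP, ← h1, ← h2, ← LL_ext]; exact h

lemma congr (h : HP F a b z) (h1 : a = c) (h2 : b = d) : HP F c d z := h1 ▸ h2 ▸ h

lemma const (c : ℂ) : HP (fun _ => c) 0 0 z := of 0 (hasFDerivAt_const c z) (by simp) (by simp)

lemma re : HP (fun z => (z.re : ℂ)) 1 0 z :=
  of (Complex.ofRealCLM.comp Complex.reCLM) (Complex.ofRealCLM.comp Complex.reCLM).hasFDerivAt (by simp) (by simp)

lemma im : HP (fun z => (z.im : ℂ)) 0 1 z :=
  of (Complex.ofRealCLM.comp Complex.imCLM) (Complex.ofRealCLM.comp Complex.imCLM).hasFDerivAt (by simp) (by simp)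

lemma add (h : HP F a b z) (h' : HP G c d z) : HP (fun z => F z + G z) (a + c) (b + d) z :=
  of _ (HasFDerivAt.add h h') (by simp) (by simp)

lemma sub (h : HP F a b z) (h' : HP G c d z) : HP (fun z => F z - G z) (a - c) (b - d) z :=
  of _ (HasFDerivAt.sub h h') (by simp) (by simp)

lemma mul (h : HP F a b z) (h' : HP G c d z) :
    HP (fun z => F z * G z) (a * G z + F z * c) (b * G z + F z * d) z :=
  of _ (HasFDerivAt.mul h h') (by simp; ring) (by simp; ring)

lemma comp {φ : ℂ → ℂ} {φ' : ℂ} (hφ : HasDerivAt φ φ' (F z)) (h : HP F a b z) :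
    HP (fun z => φ (F z)) (φ' * a) (φ' * b) z :=
  of _ ((hφ.hasFDerivAt.restrictScalars ℝ).comp z h) (by simp [mul_comm]) (by simp [mul_comm])

lemma inv (h : HP F a b z) (h0 : F z ≠ 0) :
    HP (fun z => (F z)⁻¹) (-a / F z ^ 2) (-b / F z ^ 2) z :=
  (comp (hasDerivAt_inv h0) h).congr (by ring) (by ring)

end HP

/-- The beam parameter. -/
def bw (ρ : ℝ) (z : ℂ) : ℂ := ρ + z.im * Complex.I

/-- The Gaussian beam. -/
def bv (ρ k : ℝ) (z : ℂ) : ℂ :=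
  Complex.exp (Complex.I * k * z.im - Complex.log (bw ρ z) / 2 - k * z.re ^ 2 / (2 * bw ρ z))

lemma bw_re (ρ : ℝ) (z : ℂ) : (bw ρ z).re = ρ := by simp [bw]
lemma bw_im (ρ : ℝ) (z : ℂ) : (bw ρ z).im = z.im := by simp [bw]
lemma bw_ne {ρ : ℝ} (h : 0 < ρ) (z : ℂ) : bw ρ z ≠ 0 := fun h' => by
  have := bw_re ρ z; rw [h'] at this; simp at this; linarith

lemma bw_hp (ρ : ℝ) (z : ℂ) : HP (bw ρ) 0 Complex.I z :=
  ((HP.const (ρ : ℂ)).add (HP.im.mul (HP.const Complex.I))).congr (by simp) (by simp)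

lemma bv_hp {ρ : ℝ} (hρ : 0 < ρ) (k : ℝ) (z : ℂ) :
    HP (bv ρ k) (-(k * z.re / bw ρ z) * bv ρ k z)
      ((Complex.I * k - Complex.I / (2 * bw ρ z) + Complex.I * k * z.re ^ 2 / (2 * bw ρ z ^ 2)) * bv ρ k z) z := by
  have hw := bw_ne hρ z
  have hs : bw ρ z ∈ Complex.slitPlane := Or.inl (by rw [bw_re]; exact hρ)
  have h1 : HP (fun z => Complex.I * k * z.im - Complex.log (bw ρ z) / 2 - k * z.re ^ 2 / (2 * bw ρ z))
      (-(k * z.re / bw ρ z))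
      (Complex.I * k - Complex.I / (2 * bw ρ z) + Complex.I * k * z.re ^ 2 / (2 * bw ρ z ^ 2)) z := by
    have a1 := (HP.const (z := z) (Complex.I * k)).mul (HP.im)
    have a2 := (HP.comp (Complex.hasDerivAt_log hs) (bw_hp ρ z)).mul (HP.const (1/2))
    have a3 := ((HP.const (z := z) (k/2 : ℂ)).mul (HP.re.mul HP.re)).mul ((bw_hp ρ z).inv hw)
    have a4 := (a1.sub a2).sub a3
    have e : (fun z : ℂ => Complex.I * k * z.im - Complex.log (bw ρ z) / 2 - k * z.re ^ 2 / (2 * bw ρ z))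
      = fun z : ℂ => (Complex.I * k * z.im - Complex.log (bw ρ z) * (1/2) - (k/2) * (z.re * z.re) * (bw ρ z)⁻¹) := by
      ext z
      have := bw_ne hρ z
      field_simp
    rw [e]
    refine a4.congr ?_ ?_
    · field_simp; ring
    · field_simp; ring
  exact (HP.comp (Complex.hasDerivAt_exp _) h1).congr (by rw [bv]; ring) (by rw [bv]; ring)

/-- Cut-off. -/
def bz (δ : ℝ) (z : ℂ) : ℂ := (δ ^ 2 - z.re ^ 2) ^ 2

lemma bz_hp (δ : ℝ) (z : ℂ) : HP (bz δ) (-4 * z.re * (δ ^ 2 - z.re ^ 2)) 0 z := by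
  have a := (HP.const (z := z) ((δ:ℂ) ^ 2)).sub (HP.re.mul HP.re)
  have e : bz δ = fun z : ℂ => ((δ:ℂ) ^ 2 - z.re * z.re) * ((δ:ℂ) ^ 2 - z.re * z.re) := by
    ext z; simp [bz]; ring
  rw [e]
  exact (a.mul a).congr (by ring) (by ring)

def bV (ρ k δ : ℝ) (z : ℂ) : ℂ := bz δ z * bv ρ k z

def bVx (ρ k δ : ℝ) (z : ℂ) : ℂ :=
  (-4 * z.re * (δ ^ 2 - z.re ^ 2) - bz δ z * (k * z.re / bw ρ z)) * bv ρ k z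

def bVy (ρ k δ : ℝ) (z : ℂ) : ℂ :=
  bz δ z * (Complex.I * k - Complex.I / (2 * bw ρ z) + Complex.I * k * z.re ^ 2 / (2 * bw ρ z ^ 2)) * bv ρ k z

lemma bV_hp {ρ : ℝ} (hρ : 0 < ρ) (k δ : ℝ) (z : ℂ) : HP (bV ρ k δ) (bVx ρ k δ z) (bVy ρ k δ z) z :=
  ((bz_hp δ z).mul (bv_hp hρ k z)).congr (by simp only [bVx]; ring) (by simp only [bVy]; ring)

/-- Error factor. -/
def bR (ρ k δ : ℝ) (z : ℂ) : ℂ :=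
  bz δ z * (-3 / (4 * bw ρ z ^ 2) + 3 / 2 * (k * z.re ^ 2) / bw ρ z ^ 3 - (k * z.re ^ 2) ^ 2 / (4 * bw ρ z ^ 4))
   + 8 * (δ ^ 2 - z.re ^ 2) * (k * z.re ^ 2) / bw ρ z + (-4 * (δ ^ 2 - z.re ^ 2) + 8 * z.re ^ 2)

lemma bV_helm {ρ : ℝ} (hρ : 0 < ρ) (k δ : ℝ) (z : ℂ) : ∃ a b c d : ℂ,
    HP (bVx ρ k δ) a b z ∧ HP (bVy ρ k δ) c d z ∧ a + d + k ^ 2 * bV ρ k δ z = bR ρ k δ z * bv ρ k z := by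
  have hw := bw_ne hρ z
  have hv := bv_hp hρ k z
  have hc := fun c => HP.const (z := z) c
  have hx2 := (hc ((δ:ℂ) ^ 2)).sub (HP.re.mul HP.re)
  have hi := (bw_hp ρ z).inv hw
  have f1 := ((((hc (-4)).mul HP.re).mul hx2).sub ((bz_hp δ z).mul (((hc (k:ℂ)).mul HP.re).mul hi))).mul hv
  have f2 := ((bz_hp δ z).mul (((hc (Complex.I * k)).sub ((hc (Complex.I / 2)).mul hi)).add
    (((hc (Complex.I * k / 2)).mul (HP.re.mul HP.re)).mul (hi.mul hi)))).mul hv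
  have e1 : bVx ρ k δ = fun z : ℂ => (-4 * (z.re:ℂ) * ((δ:ℂ) ^ 2 - z.re * z.re) - bz δ z * (k * z.re * (bw ρ z)⁻¹)) * bv ρ k z := by
    ext z; simp only [bVx]; ring
  have e2 : bVy ρ k δ = fun z : ℂ => bz δ z * (Complex.I * k - Complex.I / 2 * (bw ρ z)⁻¹ + Complex.I * k / 2 * ((z.re:ℂ) * z.re) * ((bw ρ z)⁻¹ * (bw ρ z)⁻¹)) * bv ρ k z := by
    ext z; simp only [bVy]
    have := bw_ne hρ z
    field_simp
  refine ⟨_, _, _, _, e1 ▸ f1, e2 ▸ f2, ?_⟩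
  simp only [bR, bV, bz]
  field_simp
  ring_nf
  simp only [Complex.I_sq]
  ring

end Rig

namespace Rig

open Filter Topology ComplexConjugate

/-- Closed region between two graphs. -/
def strip (δ : ℝ) (f1 f2 : ℝ → ℝ) : Set ℂ :=
  {z | z.re ∈ Icc (-δ) δ ∧ f1 z.re ≤ z.im ∧ z.im ≤ f2 z.re}

/-- Open region between two graphs. -/
def ostrip (δ : ℝ) (f1 f2 : ℝ → ℝ) : Set ℂ :=
  {z | z.re ∈ Ioo (-δ) δ ∧ f1 z.re < z.im ∧ z.im < f2 z.re}

def gpt (f : ℝ → ℝ) (x : ℝ) : ℂ := x + f x * Complex.I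

@[simp] lemma gpt_re (f : ℝ → ℝ) (x : ℝ) : (gpt f x).re = x := by simp [gpt]
@[simp] lemma gpt_im (f : ℝ → ℝ) (x : ℝ) : (gpt f x).im = f x := by simp [gpt]

/-- Parametrization of the strip. -/
def sph (f1 f2 : ℝ → ℝ) (p : ℝ × ℝ) : ℂ :=
  p.1 + (f1 p.1 + p.2 * (f2 p.1 - f1 p.1) : ℝ) * Complex.I

lemma sph_mem {δ : ℝ} {f1 f2 : ℝ → ℝ} (hlt : ∀ x ∈ Icc (-δ) δ, f1 x < f2 x) {p : ℝ × ℝ}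
    (h1 : p.1 ∈ Icc (-δ) δ) (h2 : p.2 ∈ Icc (0:ℝ) 1) : sph f1 f2 p ∈ strip δ f1 f2 := by
  have := hlt _ h1
  have h3 := h2.1; have h4 := h2.2
  refine ⟨by simpa [sph] using h1, ?_, ?_⟩ <;> simp [sph] <;> nlinarith

lemma sph_omem {δ : ℝ} {f1 f2 : ℝ → ℝ} (hlt : ∀ x ∈ Icc (-δ) δ, f1 x < f2 x) {p : ℝ × ℝ}
    (h1 : p.1 ∈ Ioo (-δ) δ) (h2 : p.2 ∈ Ioo (0:ℝ) 1) : sph f1 f2 p ∈ ostrip δ f1 f2 := by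
  have := hlt _ (Ioo_subset_Icc_self h1)
  have h3 := h2.1; have h4 := h2.2
  refine ⟨by simpa [sph] using h1, ?_, ?_⟩ <;> simp [sph] <;> nlinarith

lemma strip_div {δ : ℝ} (hδ : 0 < δ) {f1 f2 : ℝ → ℝ}
    (h1 : ∀ x ∈ Icc (-δ) δ, ContDiffAt ℝ 2 f1 x) (h2 : ∀ x ∈ Icc (-δ) δ, ContDiffAt ℝ 2 f2 x)
    (hlt : ∀ x ∈ Icc (-δ) δ, f1 x < f2 x) {X1 X2 : ℂ → ℂ} {X1' X2' : ℂ → ℂ →L[ℝ] ℂ} {d : ℂ → ℂ}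
    (c1 : ContinuousOn X1 (strip δ f1 f2)) (c2 : ContinuousOn X2 (strip δ f1 f2))
    (cd : ContinuousOn d (strip δ f1 f2))
    (hX1 : ∀ z ∈ ostrip δ f1 f2, HasFDerivAt X1 (X1' z) z)
    (hX2 : ∀ z ∈ ostrip δ f1 f2, HasFDerivAt X2 (X2' z) z)
    (hdiv : ∀ z ∈ strip δ f1 f2, X1' z 1 + X2' z Complex.I = d z)
    (lat : ∀ z, |z.re| = δ → X1 z = 0) :
    ∫ x in (-δ)..δ, ∫ τ in (0:ℝ)..1, ((f2 x - f1 x : ℝ) : ℂ) * d (sph f1 f2 (x, τ)) =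
      (∫ x in (-δ)..δ, (X2 (gpt f2 x) - deriv f2 x * X1 (gpt f2 x))) -
      ∫ x in (-δ)..δ, (X2 (gpt f1 x) - deriv f1 x * X1 (gpt f1 x)) := by
  have hle : -δ ≤ δ := by linarith
  have d1 : ∀ x ∈ Icc (-δ) δ, HasDerivAt f1 (deriv f1 x) x := fun x hx =>
    ((h1 x hx).differentiableAt (by norm_num)).hasDerivAt
  have d2 : ∀ x ∈ Icc (-δ) δ, HasDerivAt f2 (deriv f2 x) x := fun x hx =>
    ((h2 x hx).differentiableAt (by norm_num)).hasDerivAt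
  have dd : ∀ f : ℝ → ℝ, ∀ x, ContDiffAt ℝ 2 f x → HasDerivAt (deriv f) (deriv (deriv f) x) x := by
    intro f x h
    have : ContDiffAt ℝ 1 (fderiv ℝ f) x := h.fderiv_right (m := 1) (by norm_num)
    have h3 : DifferentiableAt ℝ (deriv f) x := by
      have := (this.differentiableAt (by norm_num)).clm_apply (differentiableAt_const (1:ℝ))
      exact this
    exact h3.hasDerivAt
  have e1 : ∀ x ∈ Icc (-δ) δ, HasDerivAt (deriv f1) (deriv (deriv f1) x) x := fun x hx => dd _ _ (h1 x hx)
  have e2 : ∀ x ∈ Icc (-δ) δ, HasDerivAt (deriv f2) (deriv (deriv f2) x) x := fun x hx => dd _ _ (h2 x hx)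
  set h : ℝ → ℝ := fun x => f2 x - f1 x with hh
  set B : Set (ℝ × ℝ) := Icc (-δ) δ ×ˢ Icc (0:ℝ) 1 with hB
  have hfst : ∀ p : ℝ × ℝ, HasFDerivAt (fun p : ℝ × ℝ => p.1) (ContinuousLinearMap.fst ℝ ℝ ℝ) p := fun p => hasFDerivAt_fst
  have hsnd : ∀ p : ℝ × ℝ, HasFDerivAt (fun p : ℝ × ℝ => p.2) (ContinuousLinearMap.snd ℝ ℝ ℝ) p := fun p => hasFDerivAt_snd
  -- lift a one variable function
  have lift : ∀ (f : ℝ → ℝ) (f' : ℝ) (p : ℝ × ℝ), HasDerivAt f f' p.1 →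
      HasFDerivAt (fun p : ℝ × ℝ => f p.1) (f' • ContinuousLinearMap.fst ℝ ℝ ℝ) p := by
    intro f f' p hf
    exact hf.comp_hasFDerivAt p (hfst p)
  have ofR : ∀ (f : ℝ × ℝ → ℝ) (f' : ℝ × ℝ →L[ℝ] ℝ) p, HasFDerivAt f f' p →
      HasFDerivAt (fun p => (f p : ℂ)) (Complex.ofRealCLM.comp f') p := by
    intro f f' p hf
    exact Complex.ofRealCLM.hasFDerivAt.comp p hf
  -- g and gx
  set g : ℝ × ℝ → ℝ := fun p => f1 p.1 + p.2 * h p.1 with hg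
  set gx : ℝ × ℝ → ℝ := fun p => deriv f1 p.1 + p.2 * (deriv f2 p.1 - deriv f1 p.1) with hgx
  have Dh : ∀ p : ℝ × ℝ, p.1 ∈ Icc (-δ) δ → HasFDerivAt (fun p : ℝ × ℝ => h p.1)
      ((deriv f2 p.1 - deriv f1 p.1) • ContinuousLinearMap.fst ℝ ℝ ℝ) p := fun p hp =>
    lift h _ p ((d2 _ hp).sub (d1 _ hp))
  have Dg : ∀ p : ℝ × ℝ, p.1 ∈ Icc (-δ) δ → HasFDerivAt g
      (deriv f1 p.1 • ContinuousLinearMap.fst ℝ ℝ ℝ + (p.2 • ((deriv f2 p.1 - deriv f1 p.1) • ContinuousLinearMap.fst ℝ ℝ ℝ) + h p.1 • ContinuousLinearMap.snd ℝ ℝ ℝ)) p := fun p hp =>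
    (lift f1 _ p (d1 _ hp)).add ((hsnd p).mul (Dh p hp))
  have Dgx : ∀ p : ℝ × ℝ, p.1 ∈ Icc (-δ) δ → HasFDerivAt gx
      (deriv (deriv f1) p.1 • ContinuousLinearMap.fst ℝ ℝ ℝ + (p.2 • ((deriv (deriv f2) p.1 - deriv (deriv f1) p.1) • ContinuousLinearMap.fst ℝ ℝ ℝ) + (deriv f2 p.1 - deriv f1 p.1) • ContinuousLinearMap.snd ℝ ℝ ℝ)) p := fun p hp =>
    (lift (deriv f1) _ p (e1 _ hp)).add ((hsnd p).mul
      (lift (fun x => deriv f2 x - deriv f1 x) _ p ((e2 _ hp).sub (e1 _ hp))))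
  have DΦ : ∀ p : ℝ × ℝ, p.1 ∈ Icc (-δ) δ → ∃ L : ℝ × ℝ →L[ℝ] ℂ, HasFDerivAt (sph f1 f2) L p ∧
      L (1, 0) = 1 + gx p * Complex.I ∧ L (0, 1) = h p.1 * Complex.I := by
    intro p hp
    refine ⟨_, (ofR _ _ p (hfst p)).add ((ofR _ _ p (Dg p hp)).mul_const Complex.I), ?_, ?_⟩
    · simp [hgx]; ring
    · simp [hgx]; ring
  choose! L hL hL1 hL2 using DΦ
  have hΦ : ContinuousOn (sph f1 f2) B := fun p hp => (hL p hp.1).continuousAt.continuousWithinAt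
  have mΦ : MapsTo (sph f1 f2) B (strip δ f1 f2) := fun p hp => sph_mem hlt hp.1 hp.2
  have ch : ContinuousOn (fun p : ℝ × ℝ => (h p.1 : ℂ)) B := fun p hp =>
    (ofR _ _ p (Dh p hp.1)).continuousAt.continuousWithinAt
  have cgx : ContinuousOn (fun p : ℝ × ℝ => (gx p : ℂ)) B := fun p hp =>
    (ofR _ _ p (Dgx p hp.1)).continuousAt.continuousWithinAt
  have key : ∀ p : ℝ × ℝ, ∃ f' g' : ℝ × ℝ →L[ℝ] ℂ, p ∈ B →
      ((p.1 ∈ Ioo (-δ) δ → p.2 ∈ Ioo (0:ℝ) 1 →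
        HasFDerivAt (fun p => (h p.1 : ℂ) * X1 (sph f1 f2 p)) f' p ∧
        HasFDerivAt (fun p => X2 (sph f1 f2 p) - (gx p : ℂ) * X1 (sph f1 f2 p)) g' p) ∧
        f' (1, 0) + g' (0, 1) = h p.1 * d (sph f1 f2 p)) := by
    intro p
    by_cases hp : p ∈ B
    · refine ⟨(h p.1 : ℂ) • ((X1' (sph f1 f2 p)).comp (L p)) + X1 (sph f1 f2 p) •
          (Complex.ofRealCLM.comp ((deriv f2 p.1 - deriv f1 p.1) • ContinuousLinearMap.fst ℝ ℝ ℝ)),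
        (X2' (sph f1 f2 p)).comp (L p) - ((gx p : ℂ) • ((X1' (sph f1 f2 p)).comp (L p)) +
          X1 (sph f1 f2 p) • (Complex.ofRealCLM.comp (deriv (deriv f1) p.1 • ContinuousLinearMap.fst ℝ ℝ ℝ + (p.2 • ((deriv (deriv f2) p.1 - deriv (deriv f1) p.1) • ContinuousLinearMap.fst ℝ ℝ ℝ) + (deriv f2 p.1 - deriv f1 p.1) • ContinuousLinearMap.snd ℝ ℝ ℝ)))),
        fun _ => ⟨fun i1 i2 => ⟨?_, ?_⟩, ?_⟩⟩
      · have := sph_omem hlt i1 i2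
        exact (ofR _ _ p (Dh p hp.1)).mul ((hX1 _ this).comp p (hL p hp.1))
      · have := sph_omem hlt i1 i2
        exact ((hX2 _ this).comp p (hL p hp.1)).sub
          ((ofR _ _ p (Dgx p hp.1)).mul ((hX1 _ this).comp p (hL p hp.1)))
      · have k := hdiv _ (mΦ hp)
        rw [← k]
        have l1 : X1' (sph f1 f2 p) (1 + gx p * Complex.I) = X1' (sph f1 f2 p) 1 + gx p * X1' (sph f1 f2 p) Complex.I := by
          rw [map_add, ← Complex.real_smul, map_smul, Complex.real_smul]
        have l2 : ∀ T : ℂ →L[ℝ] ℂ, T (h p.1 * Complex.I) = h p.1 * T Complex.I := by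
          intro T
          rw [← Complex.real_smul, map_smul, Complex.real_smul]
        simp [hL1 p hp.1, hL2 p hp.1, l1, l2]
        ring
    · exact ⟨0, 0, fun h => absurd h hp⟩
  choose f' g' key using key
  have cdΦ : ContinuousOn (fun p : ℝ × ℝ => (h p.1 : ℂ) * d (sph f1 f2 p)) B := ch.mul (cd.comp hΦ mΦ)
  have u1 : uIcc (-δ) δ = Icc (-δ) δ := uIcc_of_le hle
  have u2 : uIcc (0:ℝ) 1 = Icc (0:ℝ) 1 := uIcc_of_le zero_le_one
  have main := integral2_divergence_prod_of_hasFDerivAt_off_countable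
    (fun p => (h p.1 : ℂ) * X1 (sph f1 f2 p)) (fun p => X2 (sph f1 f2 p) - (gx p : ℂ) * X1 (sph f1 f2 p))
    f' g' (-δ) 0 δ 1 ∅ countable_empty
    (by rw [u1, u2]; exact ch.mul (c1.comp hΦ mΦ))
    (by rw [u1, u2]; exact (c2.comp hΦ mΦ).sub (cgx.mul (c1.comp hΦ mΦ)))
    (by
      intro p hp
      rw [min_eq_left hle, max_eq_right hle, min_eq_left zero_le_one, max_eq_right zero_le_one] at hp
      exact ((key p ⟨Ioo_subset_Icc_self hp.1.1, Ioo_subset_Icc_self hp.1.2⟩).1 hp.1.1 hp.1.2).1)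
    (by
      intro p hp
      rw [min_eq_left hle, max_eq_right hle, min_eq_left zero_le_one, max_eq_right zero_le_one] at hp
      exact ((key p ⟨Ioo_subset_Icc_self hp.1.1, Ioo_subset_Icc_self hp.1.2⟩).1 hp.1.1 hp.1.2).2)
    (by
      rw [u1, u2]
      refine (cdΦ.integrableOn_compact (isCompact_Icc.prod isCompact_Icc)).congr_fun ?_
        (measurableSet_Icc.prod measurableSet_Icc)
      intro p hp
      exact (key p hp).2.symm)
  have lhs : ∫ x in (-δ)..δ, ∫ y in (0:ℝ)..1, (f' (x, y)) (1, 0) + (g' (x, y)) (0, 1) =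
      ∫ x in (-δ)..δ, ∫ τ in (0:ℝ)..1, ((f2 x - f1 x : ℝ) : ℂ) * d (sph f1 f2 (x, τ)) := by
    apply intervalIntegral.integral_congr
    intro x hx
    apply intervalIntegral.integral_congr
    intro y hy
    rw [u1] at hx; rw [u2] at hy
    exact (key (x, y) ⟨hx, hy⟩).2
  rw [← lhs, main]
  have z1 : ∀ y, X1 (sph f1 f2 (δ, y)) = 0 := fun y => lat _ (by simp [sph, abs_of_pos hδ])
  have z2 : ∀ y, X1 (sph f1 f2 (-δ, y)) = 0 := fun y => lat _ (by simp [sph, abs_of_pos hδ])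
  simp only [z1, z2, mul_zero, intervalIntegral.integral_zero, add_zero, sub_zero]
  congr 1
  · congr 1; ext x; simp [sph, gpt, hgx, hh]
  · congr 1; ext x; simp [sph, gpt, hgx]

end Rig

namespace Rig

open Filter Topology ComplexConjugate

lemma bv_norm_le {ρ R : ℝ} (hρ : 0 < ρ) : ∃ N > 0, ∃ c > 0, ∀ k ≥ 0, ∀ z : ℂ, |z.im| ≤ R →
    ‖bv ρ k z‖ ≤ N * Real.exp (-(c * (k * z.re ^ 2))) := by
  refine ⟨Real.exp (-(Real.log ρ / 2)), Real.exp_pos _, ρ / (2 * (ρ ^ 2 + R ^ 2)), by positivity, ?_⟩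
  intro k hk z hz
  have hw := bw_ne hρ z
  have hn : Complex.normSq (bw ρ z) = ρ ^ 2 + z.im ^ 2 := by
    rw [Complex.normSq_apply, bw_re, bw_im]; ring
  have hlog : Real.log ρ ≤ Real.log ‖bw ρ z‖ := by
    apply Real.log_le_log hρ
    have := (le_abs_self _).trans (Complex.abs_re_le_norm (bw ρ z))
    rwa [bw_re] at this
  have hre : (Complex.I * k * z.im - Complex.log (bw ρ z) / 2 - k * z.re ^ 2 / (2 * bw ρ z)).re
      = - (Real.log ‖bw ρ z‖ / 2) - k * z.re ^ 2 * ρ / (2 * (ρ ^ 2 + z.im ^ 2)) := by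
    have e : (k * z.re ^ 2 / (2 * bw ρ z) : ℂ) = ((k * z.re ^ 2 / 2 : ℝ) : ℂ) * (bw ρ z)⁻¹ := by
      push_cast; field_simp
    have e2 : Complex.log (bw ρ z) / 2 = ((1/2 : ℝ) : ℂ) * Complex.log (bw ρ z) := by
      push_cast; ring
    have e3 : Complex.I * k * z.im = ((k * z.im : ℝ) : ℂ) * Complex.I := by push_cast; ring
    rw [e, e2, e3]
    simp only [Complex.sub_re, Complex.re_ofReal_mul, Complex.log_re, Complex.inv_re, hn, bw_re, Complex.I_re]
    field_simp
    ring
  rw [bv, Complex.norm_exp, hre, ← Real.exp_add]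
  apply Real.exp_le_exp.2
  have h2 : z.im ^ 2 ≤ R ^ 2 := by
    rw [← sq_abs]; exact pow_le_pow_left₀ (abs_nonneg _) hz 2
  have h3 : ρ / (2 * (ρ ^ 2 + R ^ 2)) * (k * z.re ^ 2) ≤ k * z.re ^ 2 * ρ / (2 * (ρ ^ 2 + z.im ^ 2)) := by
    rw [show ρ / (2 * (ρ ^ 2 + R ^ 2)) * (k * z.re ^ 2) = k * z.re ^ 2 * ρ / (2 * (ρ ^ 2 + R ^ 2)) by ring]
    apply div_le_div_of_nonneg_left (by positivity) (by positivity)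
    linarith
  linarith

lemma bw_norm {ρ : ℝ} (hρ : 0 < ρ) (z : ℂ) : ‖(bw ρ z)⁻¹‖ ≤ 1 / ρ := by
  rw [norm_inv, one_div]
  apply inv_anti₀ hρ
  have := (le_abs_self _).trans (Complex.abs_re_le_norm (bw ρ z))
  rwa [bw_re] at this

set_option maxHeartbeats 1000000 in
lemma bR_bound {ρ R δ : ℝ} (hρ : 0 < ρ) (hδ : 0 < δ) : ∃ M > 0, ∀ k ≥ 0, ∀ z : ℂ, |z.im| ≤ R → |z.re| ≤ δ →
    ‖bR ρ k δ z * bv ρ k z‖ ≤ M := by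
  obtain ⟨N, hN, c, hc, hb⟩ := bv_norm_le (R := R) hρ
  set i := 1 / ρ with hi
  have hip : 0 < i := by positivity
  set A := δ ^ 4 * (i ^ 2 + 2 * i ^ 3 + i ^ 4) + 8 * δ ^ 2 * i + 12 * δ ^ 2 with hA
  set B := 1 + 1 / c + 2 / c ^ 2 with hB
  refine ⟨A * B * N, by positivity, ?_⟩
  intro k hk z h1 h2
  set ξ := k * z.re ^ 2 with hξ
  have hξ0 : 0 ≤ ξ := by positivity
  set W := (bw ρ z)⁻¹ with hW
  have hWn : ‖W‖ ≤ i := bw_norm hρ z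
  have hx : z.re ^ 2 ≤ δ ^ 2 := by
    rw [← sq_abs]; exact pow_le_pow_left₀ (abs_nonneg _) h2 2
  have hcut : ‖((δ:ℂ) ^ 2 - z.re ^ 2)‖ ≤ δ ^ 2 := by
    rw [show ((δ:ℂ) ^ 2 - z.re ^ 2) = ((δ ^ 2 - z.re ^ 2 : ℝ) : ℂ) by push_cast; ring, Complex.norm_real,
      Real.norm_eq_abs, abs_of_nonneg (by linarith)]
    nlinarith [sq_nonneg z.re]
  have hz : ‖bz δ z‖ ≤ δ ^ 4 := by
    rw [bz, norm_pow]
    calc _ ≤ (δ ^ 2) ^ 2 := pow_le_pow_left₀ (norm_nonneg _) hcut 2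
      _ = _ := by ring
  have e : bR ρ k δ z = bz δ z * (-(3/4) * W ^ 2 + 3 / 2 * ξ * W ^ 3 - (ξ:ℂ) ^ 2 * (W ^ 4 / 4))
      + 8 * ((δ:ℂ) ^ 2 - z.re ^ 2) * ξ * W + (-4 * ((δ:ℂ) ^ 2 - z.re ^ 2) + 8 * z.re ^ 2) := by
    have hw := bw_ne hρ z
    simp only [bR, hW, hξ]; push_cast; field_simp
  have nξ : ‖(ξ:ℂ)‖ = ξ := by rw [Complex.norm_real, Real.norm_eq_abs, abs_of_nonneg hξ0]
  have nx : ‖((z.re:ℂ)) ^ 2‖ ≤ δ ^ 2 := by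
    rw [norm_pow, Complex.norm_real, Real.norm_eq_abs, sq_abs]; exact hx
  have hW2 : ‖W‖ ^ 2 ≤ i ^ 2 := pow_le_pow_left₀ (norm_nonneg _) hWn 2
  have hW3 : ‖W‖ ^ 3 ≤ i ^ 3 := pow_le_pow_left₀ (norm_nonneg _) hWn 3
  have hW4 : ‖W‖ ^ 4 ≤ i ^ 4 := pow_le_pow_left₀ (norm_nonneg _) hWn 4
  have p1 : ‖-(3/4) * W ^ 2 + 3 / 2 * ξ * W ^ 3 - (ξ:ℂ) ^ 2 * (W ^ 4 / 4)‖ ≤ (i ^ 2 + 2 * i ^ 3 + i ^ 4) * (1 + ξ + ξ ^ 2) := by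
    have q1 : ‖-(3/4) * W ^ 2‖ ≤ i ^ 2 := by
      rw [norm_mul, norm_pow]; norm_num; nlinarith [sq_nonneg ‖W‖]
    have q2 : ‖3 / 2 * (ξ:ℂ) * W ^ 3‖ ≤ 2 * i ^ 3 * ξ := by
      rw [norm_mul, norm_mul, norm_pow, nξ]; norm_num
      have := mul_le_mul_of_nonneg_left hW3 hξ0
      have : 0 ≤ ξ * i ^ 3 := by positivity
      nlinarith
    have q3 : ‖(ξ:ℂ) ^ 2 * (W ^ 4 / 4)‖ ≤ i ^ 4 * ξ ^ 2 := by
      rw [norm_mul, norm_div, norm_pow, norm_pow, nξ]; norm_num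
      have := mul_le_mul_of_nonneg_left hW4 (sq_nonneg ξ)
      have : 0 ≤ ξ ^ 2 * ‖W‖ ^ 4 := by positivity
      nlinarith
    have t1 := norm_sub_le (-(3/4) * W ^ 2 + 3 / 2 * ξ * W ^ 3) ((ξ:ℂ) ^ 2 * (W ^ 4 / 4))
    have t2 := norm_add_le (-(3/4) * W ^ 2) (3 / 2 * ξ * W ^ 3)
    have : 0 ≤ i ^ 2 * ξ + i ^ 2 * ξ ^ 2 + 2 * i ^ 3 + 2 * i ^ 3 * ξ ^ 2 + i ^ 4 + i ^ 4 * ξ := by positivity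
    have e' : (i ^ 2 + 2 * i ^ 3 + i ^ 4) * (1 + ξ + ξ ^ 2) = i ^ 2 + 2 * i ^ 3 * ξ + i ^ 4 * ξ ^ 2 +
      (i ^ 2 * ξ + i ^ 2 * ξ ^ 2 + 2 * i ^ 3 + 2 * i ^ 3 * ξ ^ 2 + i ^ 4 + i ^ 4 * ξ) := by ring
    rw [e']
    linarith
  have p2 : ‖8 * ((δ:ℂ) ^ 2 - z.re ^ 2) * ξ * W‖ ≤ 8 * δ ^ 2 * i * ξ := by
    rw [norm_mul, norm_mul, norm_mul, nξ]; norm_num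
    calc 8 * ‖(δ:ℂ) ^ 2 - z.re ^ 2‖ * ξ * ‖W‖ ≤ 8 * δ ^ 2 * ξ * i := by gcongr
      _ = _ := by ring
  have p3 : ‖(-4 * ((δ:ℂ) ^ 2 - z.re ^ 2) + 8 * (z.re:ℂ) ^ 2)‖ ≤ 12 * δ ^ 2 := by
    refine (norm_add_le _ _).trans ?_
    rw [norm_mul, norm_mul]; norm_num
    have nx' : |z.re| ^ 2 ≤ δ ^ 2 := by rw [sq_abs]; exact hx
    linarith
  have hRn : ‖bR ρ k δ z‖ ≤ A * (1 + ξ + ξ ^ 2) := by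
    rw [e]
    refine (norm_add_le _ _).trans ?_
    have t2 := norm_add_le (bz δ z * (-(3/4) * W ^ 2 + 3 / 2 * ξ * W ^ 3 - (ξ:ℂ) ^ 2 * (W ^ 4 / 4))) (8 * ((δ:ℂ) ^ 2 - z.re ^ 2) * ξ * W)
    have t3 : ‖bz δ z * (-(3/4) * W ^ 2 + 3 / 2 * ξ * W ^ 3 - (ξ:ℂ) ^ 2 * (W ^ 4 / 4))‖ ≤
        δ ^ 4 * ((i ^ 2 + 2 * i ^ 3 + i ^ 4) * (1 + ξ + ξ ^ 2)) := by
      rw [norm_mul]; gcongr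
    have : 0 ≤ 8 * δ ^ 2 * i + 8 * δ ^ 2 * i * ξ ^ 2 + 12 * δ ^ 2 * ξ + 12 * δ ^ 2 * ξ ^ 2 := by positivity
    have e' : A * (1 + ξ + ξ ^ 2) = δ ^ 4 * ((i ^ 2 + 2 * i ^ 3 + i ^ 4) * (1 + ξ + ξ ^ 2)) + 8 * δ ^ 2 * i * ξ + 12 * δ ^ 2
        + (8 * δ ^ 2 * i + 8 * δ ^ 2 * i * ξ ^ 2 + 12 * δ ^ 2 * ξ + 12 * δ ^ 2 * ξ ^ 2) := by rw [hA]; ring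
    rw [e']
    linarith
  have hexp : 1 + ξ + ξ ^ 2 ≤ B * Real.exp (c * ξ) := by
    have := Real.quadratic_le_exp_of_nonneg (x := c * ξ) (by positivity)
    have h1 : 1 + ξ + ξ ^ 2 ≤ B * (1 + c * ξ + (c * ξ) ^ 2 / 2) := by
      have e : B * (1 + c * ξ + (c * ξ) ^ 2 / 2) = 1 + ξ + ξ ^ 2 + (c * ξ + (c*ξ)^2/2 + (1/c) + (c * ξ^2/2) + 2/c^2 + 2 * ξ / c) := by
        rw [hB]; field_simp; ring
      rw [e]
      have : 0 ≤ (c * ξ + (c*ξ)^2/2 + (1/c) + (c * ξ^2/2) + 2/c^2 + 2 * ξ / c) := by positivity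
      linarith
    exact h1.trans (mul_le_mul_of_nonneg_left this (by positivity))
  rw [norm_mul]
  calc ‖bR ρ k δ z‖ * ‖bv ρ k z‖ ≤ (A * (B * Real.exp (c * ξ))) * (N * Real.exp (-(c * ξ))) := by
        apply mul_le_mul (hRn.trans (mul_le_mul_of_nonneg_left hexp (by positivity))) (hb k hk z h1)
          (norm_nonneg _) (by positivity)
    _ = A * B * N * (Real.exp (c * ξ) * Real.exp (-(c * ξ))) := by ring
    _ = _ := by rw [← Real.exp_add, add_neg_cancel, Real.exp_zero, mul_one]

/-- Boundary functional of the beam along a graph. -/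
def bB (ρ k δ : ℝ) (f : ℝ → ℝ) : ℂ :=
  ∫ x in (-δ)..δ, (bVy ρ k δ (gpt f x) - deriv f x * bVx ρ k δ (gpt f x))

lemma bV_lat {ρ k δ : ℝ} {z : ℂ} (h : |z.re| = δ) : bV ρ k δ z = 0 ∧ bVx ρ k δ z = 0 := by
  have : ((δ:ℂ) ^ 2 - z.re ^ 2) = 0 := by
    rw [← h]; norm_cast; rw [sq_abs]; simp
  simp [bV, bVx, bz, this]

lemma HP.cont {F : ℂ → ℂ} {a b z : ℂ} (h : HP F a b z) : ContinuousAt F z := HasFDerivAt.continuousAt h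

lemma beam_green {ρ k δ : ℝ} (hρ : 0 < ρ) (hδ : 0 < δ) {f1 f2 : ℝ → ℝ}
    (h1 : ∀ x ∈ Icc (-δ) δ, ContDiffAt ℝ 2 f1 x) (h2 : ∀ x ∈ Icc (-δ) δ, ContDiffAt ℝ 2 f2 x)
    (hlt : ∀ x ∈ Icc (-δ) δ, f1 x < f2 x) {U : ℂ → ℝ} {D : ℂ → ℂ →L[ℝ] ℝ} {H : ℂ → ℂ →L[ℝ] ℂ →L[ℝ] ℝ}
    (cU : ContinuousOn U (strip δ f1 f2)) (cD : ContinuousOn D (strip δ f1 f2))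
    (dU : ∀ z ∈ ostrip δ f1 f2, HasFDerivAt U (D z) z)
    (dD : ∀ z ∈ ostrip δ f1 f2, HasFDerivAt D (H z) z)
    (pde : ∀ z ∈ strip δ f1 f2, H z 1 1 + H z Complex.I Complex.I = -(k ^ 2 * U z))
    {c1 c2 : ℝ} (u1 : ∀ x ∈ Icc (-δ) δ, U (gpt f1 x) = c1) (u2 : ∀ x ∈ Icc (-δ) δ, U (gpt f2 x) = c2)
    (D1 : ∀ x ∈ Icc (-δ) δ, D (gpt f1 x) = 0) (D2 : ∀ x ∈ Icc (-δ) δ, D (gpt f2 x) = 0) :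
    c1 * bB ρ k δ f1 - c2 * bB ρ k δ f2 =
    ∫ x in (-δ)..δ, ∫ τ in (0:ℝ)..1, ((f2 x - f1 x : ℝ) : ℂ) *
      (-(U (sph f1 f2 (x, τ)) * (bR ρ k δ (sph f1 f2 (x, τ)) * bv ρ k (sph f1 f2 (x, τ))))) := by
  choose a b c d hx hy hh using fun z => bV_helm hρ k δ z
  have hV := fun z => bV_hp hρ k δ z
  have hle : -δ ≤ δ := by linarith
  have cV : Continuous (bV ρ k δ) := continuous_iff_continuousAt.2 fun z => (hV z).cont
  have cVx : Continuous (bVx ρ k δ) := continuous_iff_continuousAt.2 fun z => (hx z).cont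
  have cVy : Continuous (bVy ρ k δ) := continuous_iff_continuousAt.2 fun z => (hy z).cont
  have cv : Continuous (bv ρ k) := continuous_iff_continuousAt.2 fun z => (bv_hp hρ k z).cont
  have cw : Continuous (bw ρ) := continuous_iff_continuousAt.2 fun z => (bw_hp ρ z).cont
  have cz : Continuous (bz δ) := continuous_iff_continuousAt.2 fun z => (bz_hp δ z).cont
  have cre : Continuous (fun z : ℂ => (z.re : ℂ)) := Complex.continuous_ofReal.comp Complex.continuous_re
  have cR : Continuous (bR ρ k δ) := by
    have n := fun z => bw_ne hρ z
    have n2 : ∀ z, 4 * bw ρ z ^ 2 ≠ 0 := fun z => mul_ne_zero (by norm_num) (pow_ne_zero _ (n z))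
    have n3 : ∀ z, bw ρ z ^ 3 ≠ 0 := fun z => pow_ne_zero _ (n z)
    have n4 : ∀ z, 4 * bw ρ z ^ 4 ≠ 0 := fun z => mul_ne_zero (by norm_num) (pow_ne_zero _ (n z))
    unfold bR
    refine ((cz.mul (((continuous_const.div (continuous_const.mul (cw.pow 2)) n2).add
      ((continuous_const.mul (continuous_const.mul (cre.pow 2))).div (cw.pow 3) n3)).sub
      (((continuous_const.mul (cre.pow 2)).pow 2).div (continuous_const.mul (cw.pow 4)) n4))).add
      (((continuous_const.mul (continuous_const.sub (cre.pow 2))).mul (continuous_const.mul (cre.pow 2))).div cw n)).add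
      ((continuous_const.mul (continuous_const.sub (cre.pow 2))).add (continuous_const.mul (cre.pow 2)))
  have cUc : ContinuousOn (fun z => (U z : ℂ)) (strip δ f1 f2) := Complex.continuous_ofReal.comp_continuousOn cU
  have cDc : ∀ v : ℂ, ContinuousOn (fun z => (D z v : ℂ)) (strip δ f1 f2) := fun v =>
    Complex.continuous_ofReal.comp_continuousOn (cD.clm_apply continuousOn_const)
  have hUc : ∀ z ∈ ostrip δ f1 f2, HP (fun z => (U z : ℂ)) (D z 1) (D z Complex.I) z := fun z hz =>
    HP.of (Complex.ofRealCLM.comp (D z)) (Complex.ofRealCLM.hasFDerivAt.comp z (dU z hz)) (by simp) (by simp)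
  have hDc : ∀ z ∈ ostrip δ f1 f2, ∀ v, HP (fun z => (D z v : ℂ)) (H z 1 v) (H z Complex.I v) z := fun z hz v =>
    HP.of (Complex.ofRealCLM.comp ((H z).flip v)) (Complex.ofRealCLM.hasFDerivAt.comp z
      (((dD z hz).clm_apply (hasFDerivAt_const v z)).congr_fderiv (by ext; simp))) (by simp) (by simp)
  have main := strip_div hδ h1 h2 hlt
    (X1 := fun z => bV ρ k δ z * D z 1 - U z * bVx ρ k δ z)
    (X2 := fun z => bV ρ k δ z * D z Complex.I - U z * bVy ρ k δ z)
    (X1' := fun z => LL ((bVx ρ k δ z * D z 1 + bV ρ k δ z * H z 1 1) - (D z 1 * bVx ρ k δ z + U z * a z))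
      ((bVy ρ k δ z * D z 1 + bV ρ k δ z * H z Complex.I 1) - (D z Complex.I * bVx ρ k δ z + U z * b z)))
    (X2' := fun z => LL ((bVx ρ k δ z * D z Complex.I + bV ρ k δ z * H z 1 Complex.I) - (D z 1 * bVy ρ k δ z + U z * c z))
      ((bVy ρ k δ z * D z Complex.I + bV ρ k δ z * H z Complex.I Complex.I) - (D z Complex.I * bVy ρ k δ z + U z * d z)))
    (d := fun z => -(U z * (bR ρ k δ z * bv ρ k z)))
    ((cV.continuousOn.mul (cDc 1)).sub (cUc.mul cVx.continuousOn))
    ((cV.continuousOn.mul (cDc Complex.I)).sub (cUc.mul cVy.continuousOn))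
    (cUc.mul (cR.mul cv).continuousOn).neg
    (fun z hz => ((hV z).mul (hDc z hz 1)).sub ((hUc z hz).mul (hx z)))
    (fun z hz => ((hV z).mul (hDc z hz Complex.I)).sub ((hUc z hz).mul (hy z)))
    (by
      intro z hz
      have p : ((H z 1 1 : ℝ) : ℂ) + (H z Complex.I Complex.I : ℝ) = -(k ^ 2 * U z) := by
        exact_mod_cast congrArg (fun r : ℝ => (r : ℂ)) (pde z hz)
      have q := hh z
      simp only [LL_apply, Complex.one_re, Complex.one_im, Complex.I_re, Complex.I_im]
      push_cast
      linear_combination bV ρ k δ z * p - U z * q)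
    (by
      intro z hz
      simp [bV_lat (ρ := ρ) (k := k) hz])
  rw [main]
  have s : ∀ (f : ℝ → ℝ) (c : ℝ), (∀ x ∈ Icc (-δ) δ, U (gpt f x) = c) → (∀ x ∈ Icc (-δ) δ, D (gpt f x) = 0) →
      ∫ x in (-δ)..δ, (bV ρ k δ (gpt f x) * (D (gpt f x) Complex.I : ℝ) - U (gpt f x) * bVy ρ k δ (gpt f x) -
        deriv f x * (bV ρ k δ (gpt f x) * (D (gpt f x) 1 : ℝ) - U (gpt f x) * bVx ρ k δ (gpt f x)))
      = - (c * bB ρ k δ f) := by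
    intro f c hu hD
    rw [bB, ← intervalIntegral.integral_const_mul, ← intervalIntegral.integral_neg]
    apply intervalIntegral.integral_congr
    intro x hx
    rw [uIcc_of_le hle] at hx
    simp only [hu x hx, hD x hx]
    simp
    ring
  rw [s f2 c2 u2 D2, s f1 c1 u1 D1]
  ring

end Rig

namespace Rig

open Filter Topology ComplexConjugate

lemma deriv_hasDerivAt {f : ℝ → ℝ} {x : ℝ} (h : ContDiffAt ℝ 2 f x) :
    HasDerivAt (deriv f) (deriv (deriv f) x) x := by
  have : ContDiffAt ℝ 1 (fderiv ℝ f) x := h.fderiv_right (m := 1) (by norm_num)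
  have h3 : DifferentiableAt ℝ (deriv f) x := by
    have := (this.differentiableAt (by norm_num)).clm_apply (differentiableAt_const (1:ℝ))
    exact this
  exact h3.hasDerivAt

lemma taylor2 {f : ℝ → ℝ} {δ : ℝ} (hδ : 0 < δ) (h : ∀ x ∈ Icc (-δ) δ, ContDiffAt ℝ 2 f x) (ε : ℝ) (hε : 0 < ε) :
    ∃ η > 0, ∀ x, |x| < η → |f x - f 0 - deriv f 0 * x - deriv (deriv f) 0 / 2 * x ^ 2| ≤ ε * x ^ 2 := by
  have h0 : (0:ℝ) ∈ Icc (-δ) δ := ⟨by linarith, hδ.le⟩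
  have hd := deriv_hasDerivAt (h 0 h0)
  rw [hasDerivAt_iff_isLittleO_nhds_zero] at hd
  have := (hd.def hε)
  obtain ⟨η, hη, hb⟩ := Metric.eventually_nhds_iff.1 this
  refine ⟨min η δ, lt_min hη hδ, fun x hx => ?_⟩
  have key := (convex_Icc (-|x|) |x|).norm_image_sub_le_of_norm_hasDerivWithin_le
    (f := fun x => f x - f 0 - deriv f 0 * x - deriv (deriv f) 0 / 2 * x ^ 2)
    (f' := fun x => deriv f x - deriv f 0 - deriv (deriv f) 0 * x) (C := ε * |x|) (x := 0) (y := x) ?_ ?_ ?_ ?_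
  · simp only [sub_self, mul_zero, Real.norm_eq_abs] at key
    simp at key
    calc _ ≤ _ := key
      _ = ε * |x| ^ 2 := by ring
      _ = _ := by rw [sq_abs]
  · intro y hy
    have hy' : |y| ≤ |x| := abs_le.2 hy
    have hyd : y ∈ Icc (-δ) δ := abs_le.1 (hy'.trans (hx.le.trans (min_le_right _ _)))
    have d1 := ((h y hyd).differentiableAt (by norm_num)).hasDerivAt
    have d2 := ((d1.sub_const (f 0)).sub ((hasDerivAt_id y).const_mul (deriv f 0))).sub
      (((hasDerivAt_pow 2 y).const_mul (deriv (deriv f) 0 / 2)))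
    refine (d2.congr_deriv ?_).hasDerivWithinAt
    simp; ring
  · intro y hy
    have hy' : |y| ≤ |x| := abs_le.2 hy
    have := hb (y := y) (by rw [dist_zero_right, Real.norm_eq_abs]; exact lt_of_le_of_lt hy' (hx.trans_le (min_le_left _ _)))
    simp only [zero_add, smul_eq_mul, Real.norm_eq_abs] at this
    rw [Real.norm_eq_abs, mul_comm (deriv (deriv f) 0)]
    exact this.trans (mul_le_mul_of_nonneg_left hy' hε.le)
  · exact ⟨by simp, abs_nonneg _⟩
  · exact ⟨neg_abs_le _, le_abs_self _⟩

/-- Exponent of the limiting Gaussian. -/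
def gb (w : ℂ) (κ : ℝ) : ℂ := (w⁻¹ - Complex.I * κ) / 2

/-- The limiting Gaussian. -/
def gG (δ : ℝ) (w : ℂ) (κ : ℝ) (z : ℝ) : ℂ :=
  δ ^ 4 * Complex.I * Complex.exp (-(Complex.log w / 2)) * Complex.exp (-(gb w κ) * z ^ 2)

lemma gb_re {w : ℂ} (hw : 0 < w.re) (κ : ℝ) : 0 < (gb w κ).re := by
  have hw0 : w ≠ 0 := fun h => by rw [h] at hw; simp at hw
  rw [gb, show (w⁻¹ - Complex.I * κ) / 2 = ((1/2 : ℝ) : ℂ) * (w⁻¹ - Complex.I * κ) by push_cast; ring,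
    Complex.re_ofReal_mul]
  simp only [Complex.sub_re, Complex.inv_re, Complex.mul_re, Complex.I_re, Complex.ofReal_re, Complex.I_im, Complex.ofReal_im]
  have := Complex.normSq_pos.2 hw0
  have : 0 < w.re / Complex.normSq w := by positivity
  linarith

lemma gG_int {w : ℂ} (hw : 0 < w.re) (δ κ : ℝ) : Integrable (gG δ w κ) := by
  unfold gG
  have := integrable_cexp_neg_mul_sq (gb_re hw κ)
  exact this.const_mul _

lemma gG_norm {w : ℂ} (hw : 0 < w.re) (δ κ : ℝ) :
    ‖∫ z, gG δ w κ z‖ ^ 2 = δ ^ 8 * (2 * π) / ‖1 - Complex.I * κ * w‖ := by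
  have hw0 : w ≠ 0 := fun h => by rw [h] at hw; simp at hw
  have hb := gb_re hw κ
  have hb0 : gb w κ ≠ 0 := fun h => by rw [h] at hb; simp at hb
  unfold gG
  rw [integral_const_mul, integral_gaussian_complex hb, norm_mul, mul_pow]
  have e1 : ‖((π:ℂ) / gb w κ) ^ (1/2 : ℂ)‖ ^ 2 = π / ‖gb w κ‖ := by
    have h2 := Complex.cpow_nat_inv_pow ((π:ℂ) / gb w κ) (n := 2) (by norm_num)
    rw [← norm_pow, show (1/2 : ℂ) = ((2:ℕ) : ℂ)⁻¹ by norm_num, h2, norm_div, Complex.norm_real, Real.norm_eq_abs,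
      abs_of_pos pi_pos]
  have e2 : ‖(δ:ℂ) ^ 4 * Complex.I * Complex.exp (-(Complex.log w / 2))‖ ^ 2 = δ ^ 8 / ‖w‖ := by
    rw [norm_mul, norm_mul, mul_pow, mul_pow, ← norm_pow (Complex.exp _), ← Complex.exp_nat_mul]
    rw [show ((2:ℕ):ℂ) * (-(Complex.log w / 2)) = -Complex.log w by push_cast; ring, Complex.exp_neg,
      Complex.exp_log hw0]
    simp
    rw [← pow_mul, show |δ| ^ (4*2) = (|δ|^2)^4 by ring, sq_abs]; ring
  rw [e1, e2]
  have e3 : 1 - Complex.I * κ * w = 2 * (w * gb w κ) := by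
    rw [gb]; field_simp
  rw [e3, norm_mul, norm_mul]
  have : 0 < ‖w‖ := norm_pos_iff.2 hw0
  have : 0 < ‖gb w κ‖ := norm_pos_iff.2 hb0
  norm_num
  field_simp

/-- Amplitude in the boundary functional. -/
def bA (ρ δ k x y q : ℝ) : ℂ :=
  ((δ ^ 2 - x ^ 2) ^ 2 : ℝ) * (Complex.I - Complex.I / (2 * k * (ρ + y * Complex.I)) + Complex.I * x ^ 2 / (2 * (ρ + y * Complex.I) ^ 2))
   - q * (-4 * x * (δ ^ 2 - x ^ 2) / k - ((δ ^ 2 - x ^ 2) ^ 2 : ℝ) * x / (ρ + y * Complex.I))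

lemma wne {ρ : ℝ} (hρ : 0 < ρ) (y : ℝ) : (ρ + y * Complex.I : ℂ) ≠ 0 := by
  have := bw_ne hρ (y * Complex.I); simpa [bw] using this

lemma bA_eq {ρ : ℝ} (hρ : 0 < ρ) {k : ℝ} (hk : 0 < k) (δ : ℝ) (f : ℝ → ℝ) (x : ℝ) :
    (bVy ρ k δ (gpt f x) - deriv f x * bVx ρ k δ (gpt f x)) = k * (bA ρ δ k x (f x) (deriv f x) * bv ρ k (gpt f x)) := by
  have h := wne hρ (f x)
  have hk' : (k:ℂ) ≠ 0 := by exact_mod_cast hk.ne'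
  simp only [bVy, bVx, bA, bz, gpt_re, bw, gpt_im]
  push_cast
  field_simp

lemma bA_bound {ρ δ Q : ℝ} (hρ : 0 < ρ) (hδ : 0 < δ) : ∃ C > 0, ∀ k ≥ 1, ∀ x y q : ℝ, |x| ≤ δ → |q| ≤ Q →
    ‖bA ρ δ k x y q‖ ≤ C := by
  set i := 1 / ρ
  have hi : 0 < i := by positivity
  refine ⟨δ ^ 4 * (1 + i + δ ^ 2 * i ^ 2) + |Q| * (4 * δ * δ ^ 2 + δ ^ 4 * δ * i), by positivity, ?_⟩
  intro k hk x y q hx hq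
  set W := (ρ + y * Complex.I : ℂ)⁻¹ with hW
  have hWn : ‖W‖ ≤ i := by
    have := bw_norm hρ (y * Complex.I)
    have e : bw ρ (y * Complex.I) = ρ + y * Complex.I := by simp [bw]
    rwa [e] at this
  have h := wne hρ y
  have hk' : (k:ℂ) ≠ 0 := by norm_cast; linarith
  have hki : ‖(k:ℂ)⁻¹‖ ≤ 1 := by
    rw [norm_inv, Complex.norm_real, Real.norm_eq_abs, abs_of_pos (by linarith)]
    exact inv_le_one_of_one_le₀ hk
  have e : bA ρ δ k x y q = (((δ ^ 2 - x ^ 2) ^ 2 : ℝ) : ℂ) * (Complex.I - Complex.I * (k:ℂ)⁻¹ * W / 2 + Complex.I * (x:ℂ) ^ 2 * W ^ 2 / 2)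
      - q * (-4 * x * ((δ ^ 2 - x ^ 2 : ℝ) : ℂ) * (k:ℂ)⁻¹ - ((δ ^ 2 - x ^ 2) ^ 2 : ℝ) * x * W) := by
    simp only [bA, hW]; push_cast; field_simp
  have hx2 : x ^ 2 ≤ δ ^ 2 := by rw [← sq_abs]; exact pow_le_pow_left₀ (abs_nonneg _) hx 2
  have c1 : |δ ^ 2 - x ^ 2| ≤ δ ^ 2 := by rw [abs_of_nonneg (by linarith)]; nlinarith [sq_nonneg x]
  have c2 : |(δ ^ 2 - x ^ 2) ^ 2| ≤ δ ^ 4 := by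
    rw [abs_pow]
    calc _ ≤ (δ ^ 2) ^ 2 := pow_le_pow_left₀ (abs_nonneg _) c1 2
      _ = _ := by ring
  have hW2 : ‖W‖ ^ 2 ≤ i ^ 2 := pow_le_pow_left₀ (norm_nonneg _) hWn 2
  rw [e]
  refine (norm_sub_le _ _).trans (add_le_add ?_ ?_)
  · rw [norm_mul, Complex.norm_real, Real.norm_eq_abs]
    refine mul_le_mul c2 ?_ (norm_nonneg _) (by positivity)
    refine (norm_add_le _ _).trans (add_le_add ((norm_sub_le _ _).trans (add_le_add ?_ ?_)) ?_)
    · simp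
    · rw [norm_div, norm_mul, norm_mul]; simp only [Complex.norm_I, one_mul, Complex.norm_ofNat]
      have : ‖(k:ℂ)⁻¹‖ * ‖W‖ ≤ 1 * i := mul_le_mul hki hWn (norm_nonneg _) zero_le_one
      linarith
    · rw [norm_div, norm_mul, norm_mul, norm_pow, norm_pow]
      simp only [Complex.norm_I, one_mul, Complex.norm_ofNat, Complex.norm_real, Real.norm_eq_abs, sq_abs]
      have : x ^ 2 * ‖W‖ ^ 2 ≤ δ ^ 2 * i ^ 2 := mul_le_mul hx2 hW2 (by positivity) (by positivity)
      have : 0 ≤ δ ^ 2 * i ^ 2 := by positivity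
      linarith
  · rw [norm_mul, Complex.norm_real, Real.norm_eq_abs]
    refine mul_le_mul (hq.trans (le_abs_self _)) ?_ (norm_nonneg _) (abs_nonneg _)
    refine (norm_sub_le _ _).trans (add_le_add ?_ ?_)
    · rw [norm_mul, norm_mul, norm_mul, Complex.norm_real, Complex.norm_real, Real.norm_eq_abs, Real.norm_eq_abs]
      have : ‖(-4:ℂ)‖ = 4 := by norm_num
      rw [this]
      calc 4 * |x| * |δ ^ 2 - x ^ 2| * ‖(k:ℂ)⁻¹‖ ≤ 4 * δ * δ ^ 2 * 1 := by gcongr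
        _ = _ := by ring
    · rw [norm_mul, norm_mul, Complex.norm_real, Complex.norm_real, Real.norm_eq_abs, Real.norm_eq_abs]
      gcongr

end Rig

namespace Rig

open Filter Topology ComplexConjugate

/-- The rescaled integrand. -/
def bG (ρ δ k : ℝ) (f : ℝ → ℝ) (z : ℝ) : ℂ :=
  (Icc (-(δ * √k)) (δ * √k)).indicator (fun z => bA ρ δ k (z / √k) (f (z / √k)) (deriv f (z / √k)) *
    (Complex.exp (-(Complex.I * k * (f 0 + deriv f 0 * (z / √k)))) * bv ρ k (gpt f (z / √k)))) z

lemma bA_tendsto {ρ δ : ℝ} (hρ : 0 < ρ) {k x y q : ℕ → ℝ} (hk : Tendsto k atTop atTop) {y0 q0 : ℝ}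
    (hx : Tendsto x atTop (𝓝 0)) (hy : Tendsto y atTop (𝓝 y0)) (hq : Tendsto q atTop (𝓝 q0)) :
    Tendsto (fun n => bA ρ δ (k n) (x n) (y n) (q n)) atTop (𝓝 (δ ^ 4 * Complex.I)) := by
  let P : ℂ × ℂ × ℂ × ℂ → ℂ := fun a => ((δ ^ 2 - a.2.1 ^ 2) ^ 2) * (Complex.I - Complex.I * a.1 * a.2.2.1 / 2 + Complex.I * a.2.1 ^ 2 * a.2.2.1 ^ 2 / 2)
      - a.2.2.2 * (-4 * a.2.1 * (δ ^ 2 - a.2.1 ^ 2) * a.1 - (δ ^ 2 - a.2.1 ^ 2) ^ 2 * a.2.1 * a.2.2.1)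
  have hP : Continuous P := by fun_prop
  have h1 : Tendsto (fun n => ((k n : ℂ))⁻¹) atTop (𝓝 0) := by
    have := (Complex.continuous_ofReal.tendsto 0).comp (tendsto_inv_atTop_zero.comp hk)
    refine Tendsto.congr (fun n => ?_) (by simpa using this)
    simp
  have h2 : Tendsto (fun n => (x n : ℂ)) atTop (𝓝 0) := by
    have := (Complex.continuous_ofReal.tendsto 0).comp hx
    rw [Complex.ofReal_zero] at this; exact this
  have h3 : Tendsto (fun n => (ρ + y n * Complex.I : ℂ)⁻¹) atTop (𝓝 ((ρ + y0 * Complex.I : ℂ)⁻¹)) := by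
    refine Tendsto.inv₀ ?_ (wne hρ y0)
    exact tendsto_const_nhds.add (((Complex.continuous_ofReal.tendsto y0).comp hy).mul_const _)
  have h4 : Tendsto (fun n => (q n : ℂ)) atTop (𝓝 q0) := (Complex.continuous_ofReal.tendsto q0).comp hq
  have := (hP.tendsto _).comp (h1.prodMk_nhds (h2.prodMk_nhds (h3.prodMk_nhds h4)))
  have e : P (0, 0, ((ρ + y0 * Complex.I : ℂ)⁻¹), (q0:ℂ)) = δ ^ 4 * Complex.I := by
    simp only [P]; ring
  rw [e] at this
  refine this.congr' ?_
  filter_upwards [hk.eventually_gt_atTop 0] with n hn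
  have h := wne hρ (y n)
  have hk' : (k n:ℂ) ≠ 0 := by exact_mod_cast hn.ne'
  simp only [P, Function.comp, bA]; push_cast; field_simp

lemma bG_tendsto {ρ δ : ℝ} (hρ : 0 < ρ) (hδ : 0 < δ) {f : ℝ → ℝ} (hf : ∀ x ∈ Icc (-δ) δ, ContDiffAt ℝ 2 f x)
    {k : ℕ → ℝ} (hk : Tendsto k atTop atTop) (z : ℝ) :
    Tendsto (fun n => bG ρ δ (k n) f z) atTop (𝓝 (gG δ (ρ + f 0 * Complex.I) (deriv (deriv f) 0) z)) := by
  have h0 : (0:ℝ) ∈ Icc (-δ) δ := ⟨by linarith, hδ.le⟩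
  have hsq : Tendsto (fun n => √(k n)) atTop atTop := tendsto_sqrt_atTop.comp hk
  have hx : Tendsto (fun n => z / √(k n)) atTop (𝓝 0) := tendsto_const_nhds.div_atTop hsq
  have hy : Tendsto (fun n => f (z / √(k n))) atTop (𝓝 (f 0)) := ((hf 0 h0).continuousAt.tendsto).comp hx
  have hq : Tendsto (fun n => deriv f (z / √(k n))) atTop (𝓝 (deriv f 0)) :=
    ((deriv_hasDerivAt (hf 0 h0)).continuousAt.tendsto).comp hx
  have hA := bA_tendsto (δ := δ) hρ hk hx hy hq
  have hT : Tendsto (fun n => k n * (f (z / √(k n)) - f 0 - deriv f 0 * (z / √(k n)))) atTop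
      (𝓝 (deriv (deriv f) 0 / 2 * z ^ 2)) := by
    rw [Metric.tendsto_nhds]
    intro ε hε
    obtain ⟨η, hη, hb⟩ := taylor2 hδ hf (ε / (z ^ 2 + 1)) (by positivity)
    filter_upwards [hk.eventually_gt_atTop 0, (Metric.tendsto_nhds.1 hx) η hη] with n hn hxn
    rw [dist_zero_right, Real.norm_eq_abs] at hxn
    have := hb _ hxn
    have hs : (z / √(k n)) ^ 2 = z ^ 2 / k n := by rw [div_pow, Real.sq_sqrt hn.le]
    rw [hs] at this
    rw [Real.dist_eq]
    have e : k n * (f (z / √(k n)) - f 0 - deriv f 0 * (z / √(k n))) - deriv (deriv f) 0 / 2 * z ^ 2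
        = k n * (f (z / √(k n)) - f 0 - deriv f 0 * (z / √(k n)) - deriv (deriv f) 0 / 2 * (z ^ 2 / k n)) := by
      field_simp
    rw [e, abs_mul, abs_of_pos hn]
    calc _ ≤ k n * (ε / (z ^ 2 + 1) * (z ^ 2 / k n)) := mul_le_mul_of_nonneg_left this hn.le
      _ = ε * (z ^ 2 / (z ^ 2 + 1)) := by field_simp
      _ < ε * 1 := by
        apply mul_lt_mul_of_pos_left _ hε
        rw [div_lt_one (by positivity)]; linarith
      _ = ε := mul_one _
  have hw0 : (ρ + f 0 * Complex.I : ℂ) ∈ Complex.slitPlane := by left; simpa using hρ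
  have hw : Tendsto (fun n => (ρ + f (z / √(k n)) * Complex.I : ℂ)) atTop (𝓝 (ρ + f 0 * Complex.I)) :=
    tendsto_const_nhds.add (((Complex.continuous_ofReal.tendsto _).comp hy).mul_const _)
  have hE : Tendsto (fun n => Complex.exp (Complex.I * ((k n * (f (z / √(k n)) - f 0 - deriv f 0 * (z / √(k n))) : ℝ) : ℂ)
      - Complex.log (ρ + f (z / √(k n)) * Complex.I) / 2 - z ^ 2 / (2 * (ρ + f (z / √(k n)) * Complex.I)))) atTop
      (𝓝 (Complex.exp (Complex.I * ((deriv (deriv f) 0 / 2 * z ^ 2 : ℝ) : ℂ)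
      - Complex.log (ρ + f 0 * Complex.I) / 2 - z ^ 2 / (2 * (ρ + f 0 * Complex.I))))) := by
    refine (Complex.continuous_exp.tendsto _).comp ?_
    refine Tendsto.sub (Tendsto.sub ?_ ?_) ?_
    · exact ((Complex.continuous_ofReal.tendsto _).comp hT).const_mul _
    · exact ((continuousAt_clog hw0).tendsto.comp hw).div_const _
    · exact tendsto_const_nhds.div (hw.const_mul _) (mul_ne_zero (by norm_num) (wne hρ _))
  have hfin := hA.mul hE
  have e : gG δ (ρ + f 0 * Complex.I) (deriv (deriv f) 0) z = δ ^ 4 * Complex.I *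
     Complex.exp (Complex.I * ((deriv (deriv f) 0 / 2 * z ^ 2 : ℝ) : ℂ)
      - Complex.log (ρ + f 0 * Complex.I) / 2 - z ^ 2 / (2 * (ρ + f 0 * Complex.I))) := by
    rw [gG, mul_assoc _ (Complex.exp _), ← Complex.exp_add, gb]
    congr 2
    have := wne hρ (f 0)
    push_cast; field_simp; ring
  rw [e]
  refine hfin.congr' ?_
  filter_upwards [hk.eventually_gt_atTop 0, (Metric.tendsto_nhds.1 hx) δ hδ] with n hn hxn
  rw [dist_zero_right, Real.norm_eq_abs] at hxn
  have hs0 : 0 < √(k n) := Real.sqrt_pos.2 hn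
  have hz : z ∈ Icc (-(δ * √(k n))) (δ * √(k n)) := by
    rw [abs_div, abs_of_pos hs0, div_lt_iff₀ hs0] at hxn
    exact abs_le.1 hxn.le
  rw [bG, indicator_of_mem hz]
  congr 1
  rw [bv, ← Complex.exp_add]
  have hs : ((z / √(k n) : ℝ) : ℂ) ^ 2 = z ^ 2 / k n := by
    rw [← Complex.ofReal_pow, div_pow, Real.sq_sqrt hn.le]; push_cast; rfl
  simp only [gpt_re, gpt_im, bw, hs]
  have hk' : (k n:ℂ) ≠ 0 := by exact_mod_cast hn.ne'
  congr 1
  have := wne hρ (f (z / √(k n)))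
  push_cast; field_simp; ring

lemma bG_meas {ρ δ : ℝ} (hρ : 0 < ρ) {f : ℝ → ℝ} (hf : ∀ x ∈ Icc (-δ) δ, ContDiffAt ℝ 2 f x)
    {k : ℝ} (hk : 0 < k) : AEStronglyMeasurable (bG ρ δ k f) volume := by
  unfold bG
  refine (aestronglyMeasurable_indicator_iff measurableSet_Icc).2 ?_
  refine ContinuousOn.aestronglyMeasurable ?_ measurableSet_Icc
  have hs0 : 0 < √k := Real.sqrt_pos.2 hk
  have hm : ∀ z ∈ Icc (-(δ * √k)) (δ * √k), z / √k ∈ Icc (-δ) δ := fun z hz =>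
    ⟨by rw [le_div_iff₀ hs0]; linarith [hz.1], by rw [div_le_iff₀ hs0]; exact hz.2⟩
  intro z hz
  refine ContinuousAt.continuousWithinAt ?_
  have c0 : ContinuousAt (fun z : ℝ => z / √k) z := by fun_prop
  have c1 : ContinuousAt (fun z => f (z / √k)) z :=
    ContinuousAt.comp (f := fun z : ℝ => z / √k) (hf _ (hm z hz)).continuousAt c0
  have c2 : ContinuousAt (fun z => deriv f (z / √k)) z :=
    ContinuousAt.comp (f := fun z : ℝ => z / √k) (deriv_hasDerivAt (hf _ (hm z hz))).continuousAt c0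
  have c1' : ContinuousAt (fun z => (f (z / √k) : ℂ)) z := Complex.continuous_ofReal.continuousAt.comp c1
  have c2' : ContinuousAt (fun z => ((deriv f (z / √k) : ℝ) : ℂ)) z := Complex.continuous_ofReal.continuousAt.comp c2
  have c0' : ContinuousAt (fun z => ((z / √k : ℝ) : ℂ)) z := Complex.continuous_ofReal.continuousAt.comp c0
  have cw : ContinuousAt (fun z => (ρ + f (z / √k) * Complex.I : ℂ)) z := continuousAt_const.add (c1'.mul continuousAt_const)
  have hw := wne hρ (f (z / √k))
  have hk' : (k:ℂ) ≠ 0 := by exact_mod_cast hk.ne'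
  have hsl : (ρ + f (z / √k) * Complex.I : ℂ) ∈ Complex.slitPlane := by left; simpa using hρ
  have cA : ContinuousAt (fun z => bA ρ δ k (z / √k) (f (z / √k)) (deriv f (z / √k))) z := by
    unfold bA
    refine ContinuousAt.sub (ContinuousAt.mul (by fun_prop) (ContinuousAt.add (ContinuousAt.sub continuousAt_const ?_) ?_)) (ContinuousAt.mul c2' (ContinuousAt.sub (by fun_prop) ?_))
    · exact continuousAt_const.div (continuousAt_const.mul cw) (mul_ne_zero (mul_ne_zero (by norm_num) hk') hw)
    · exact (continuousAt_const.mul (c0'.pow 2)).div (continuousAt_const.mul (cw.pow 2)) (mul_ne_zero (by norm_num) (pow_ne_zero _ hw))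
    · exact ContinuousAt.div (by fun_prop) cw hw
  refine cA.mul (ContinuousAt.mul (by fun_prop) ?_)
  unfold bv
  simp only [gpt_re, gpt_im, bw]
  refine Complex.continuous_exp.continuousAt.comp ?_
  refine ContinuousAt.sub (ContinuousAt.sub (continuousAt_const.mul c1') ((ContinuousAt.clog cw hsl).div_const _)) ?_
  exact (continuousAt_const.mul (c0'.pow 2)).div (continuousAt_const.mul cw) (mul_ne_zero (by norm_num) hw)

lemma bG_dom {ρ δ : ℝ} (hρ : 0 < ρ) (hδ : 0 < δ) {f : ℝ → ℝ} (hf : ∀ x ∈ Icc (-δ) δ, ContDiffAt ℝ 2 f x) :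
    ∃ N c : ℝ, 0 < c ∧ ∀ k ≥ 1, ∀ z, ‖bG ρ δ k f z‖ ≤ N * Real.exp (-c * z ^ 2) := by
  have cf : ContinuousOn f (Icc (-δ) δ) := fun x hx => (hf x hx).continuousAt.continuousWithinAt
  have cd : ContinuousOn (deriv f) (Icc (-δ) δ) := fun x hx => (deriv_hasDerivAt (hf x hx)).continuousAt.continuousWithinAt
  obtain ⟨R, hR⟩ := isCompact_Icc.exists_bound_of_continuousOn cf
  obtain ⟨Q, hQ⟩ := isCompact_Icc.exists_bound_of_continuousOn cd
  obtain ⟨C, hC, hA⟩ := bA_bound (Q := Q) hρ hδ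
  obtain ⟨N, hN, c, hc, hv⟩ := bv_norm_le (R := R) hρ
  refine ⟨C * N, c, hc, fun k hk z => ?_⟩
  have hk0 : 0 < k := by linarith
  have hs0 : 0 < √k := Real.sqrt_pos.2 hk0
  rw [bG]
  by_cases hz : z ∈ Icc (-(δ * √k)) (δ * √k)
  · rw [indicator_of_mem hz]
    have hm : z / √k ∈ Icc (-δ) δ :=
      ⟨by rw [le_div_iff₀ hs0]; linarith [hz.1], by rw [div_le_iff₀ hs0]; exact hz.2⟩
    rw [norm_mul, norm_mul, mul_assoc C N]
    have h1 := hA k hk (z / √k) (f (z / √k)) (deriv f (z / √k)) (abs_le.2 hm) (hQ _ hm)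
    have h2 := hv k hk0.le (gpt f (z / √k)) (by rw [gpt_im]; exact hR _ hm)
    have h3 : ‖Complex.exp (-(Complex.I * k * (f 0 + deriv f 0 * (z / √k))))‖ = 1 := by
      rw [show (-(Complex.I * k * (f 0 + deriv f 0 * (z / √k))) : ℂ) = ((-(k * (f 0 + deriv f 0 * (z / √k))) : ℝ) : ℂ) * Complex.I by push_cast; ring]
      exact Complex.norm_exp_ofReal_mul_I _
    rw [h3, one_mul]
    rw [gpt_re, div_pow, Real.sq_sqrt hk0.le] at h2
    rw [show -c * z ^ 2 = -(c * (k * (z ^ 2 / k))) by field_simp]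
    exact mul_le_mul h1 h2 (norm_nonneg _) hC.le
  · rw [indicator_of_notMem hz, norm_zero]; positivity

lemma bB_eq {ρ δ : ℝ} (hρ : 0 < ρ) (hδ : 0 < δ) {f : ℝ → ℝ} {k : ℝ} (hk : 0 < k) :
    bB ρ k δ f = √k * Complex.exp (Complex.I * k * f 0) * ∫ z : ℝ, Complex.exp (Complex.I * (√k * deriv f 0 * z)) * bG ρ δ k f z := by
  have hs0 : 0 < √k := Real.sqrt_pos.2 hk
  set F : ℝ → ℂ := fun x => bA ρ δ k x (f x) (deriv f x) * bv ρ k (gpt f x) with hF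
  have e1 : bB ρ k δ f = k * ∫ x in -δ..δ, F x := by
    rw [bB, ← intervalIntegral.integral_const_mul]
    exact intervalIntegral.integral_congr fun x _ => bA_eq hρ hk δ f x
  have e2 : ∫ z in (-(δ * √k))..(δ * √k), F (z / √k) = √k • ∫ x in -δ..δ, F x := by
    rw [intervalIntegral.integral_comp_div _ hs0.ne']
    congr 2
    · field_simp
    · field_simp
  have hle : -(δ * √k) ≤ δ * √k := by have : 0 < δ * √k := by positivity
                                      linarith
  have e3 : ∫ z : ℝ, Complex.exp (Complex.I * (√k * deriv f 0 * z)) * bG ρ δ k f z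
      = Complex.exp (-(Complex.I * k * f 0)) * ∫ z in (-(δ * √k))..(δ * √k), F (z / √k) := by
    rw [intervalIntegral.integral_of_le hle, ← integral_Icc_eq_integral_Ioc, ← integral_indicator measurableSet_Icc, ← integral_const_mul]
    congr 1; ext z
    rw [bG]
    by_cases hz : z ∈ Icc (-(δ * √k)) (δ * √k)
    · rw [indicator_of_mem hz, indicator_of_mem hz]
      rw [mul_left_comm, ← mul_assoc (Complex.exp _) (Complex.exp _), ← Complex.exp_add, hF, mul_left_comm (Complex.exp (-(Complex.I * k * f 0)))]
      congr 3
      have : (k:ℂ) = (√k:ℂ) * √k := by rw [← Complex.ofReal_mul, Real.mul_self_sqrt hk.le]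
      have hs' : (√k:ℂ) ≠ 0 := by exact_mod_cast hs0.ne'
      rw [this]; field_simp; ring
    · rw [indicator_of_notMem hz, indicator_of_notMem hz]; simp
  rw [e3, e2, e1]
  rw [Complex.real_smul]
  have h4 : Complex.exp (Complex.I * k * f 0) * Complex.exp (-(Complex.I * k * f 0)) = 1 := by
    rw [← Complex.exp_add]; simp
  have h5 : (k:ℂ) = (√k:ℂ) * √k := by rw [← Complex.ofReal_mul, Real.mul_self_sqrt hk.le]
  calc _ = ((√k:ℂ) * √k) * ∫ x in -δ..δ, F x := by rw [← h5]
    _ = (√k:ℂ) * (Complex.exp (Complex.I * k * f 0) * Complex.exp (-(Complex.I * k * f 0))) * (√k * ∫ x in -δ..δ, F x) := by rw [h4]; ring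
    _ = _ := by ring

lemma norm_exp_I (a : ℝ) : ‖Complex.exp (Complex.I * a)‖ = 1 := by
  rw [mul_comm]; exact Complex.norm_exp_ofReal_mul_I a

lemma bB_norm {ρ δ : ℝ} (hρ : 0 < ρ) (hδ : 0 < δ) {f : ℝ → ℝ} {k : ℝ} (hk : 0 < k) :
    ‖bB ρ k δ f‖ / √k = ‖∫ z : ℝ, Complex.exp (Complex.I * (√k * deriv f 0 * z)) * bG ρ δ k f z‖ := by
  have hs0 : 0 < √k := Real.sqrt_pos.2 hk
  rw [bB_eq hρ hδ hk, norm_mul, norm_mul, Complex.norm_real, Real.norm_eq_abs, abs_of_pos hs0,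
    show (Complex.I * k * f 0 : ℂ) = Complex.I * ((k * f 0 : ℝ) : ℂ) by push_cast; ring, norm_exp_I]
  field_simp

/-- Leading asymptotics at a normal hit. -/
lemma bB_lim {ρ δ : ℝ} (hρ : 0 < ρ) (hδ : 0 < δ) {f : ℝ → ℝ} (hf : ∀ x ∈ Icc (-δ) δ, ContDiffAt ℝ 2 f x)
    {k : ℕ → ℝ} (hk : Tendsto k atTop atTop) (h0 : deriv f 0 = 0) :
    Tendsto (fun n => ‖bB ρ (k n) δ f‖ / √(k n)) atTop
      (𝓝 ‖∫ z, gG δ (ρ + f 0 * Complex.I) (deriv (deriv f) 0) z‖) := by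
  obtain ⟨N, c, hc, hdom⟩ := bG_dom hρ hδ hf
  have hm : Tendsto (fun n => ∫ z, bG ρ δ (k n) f z) atTop (𝓝 (∫ z, gG δ (ρ + f 0 * Complex.I) (deriv (deriv f) 0) z)) := by
    refine tendsto_integral_filter_of_dominated_convergence (fun z => N * Real.exp (-c * z ^ 2)) ?_ ?_ ?_ ?_
    · filter_upwards [hk.eventually_gt_atTop 0] with n hn using bG_meas hρ hf hn
    · filter_upwards [hk.eventually_ge_atTop 1] with n hn using Eventually.of_forall (hdom _ hn)
    · exact (integrable_exp_neg_mul_sq hc).const_mul N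
    · exact Eventually.of_forall fun z => bG_tendsto hρ hδ hf hk z
  refine hm.norm.congr' ?_
  filter_upwards [hk.eventually_gt_atTop 0] with n hn
  rw [bB_norm hρ hδ hn, h0]; simp

/-- No contribution at a non-normal hit. -/
lemma bB_lim0 {ρ δ : ℝ} (hρ : 0 < ρ) (hδ : 0 < δ) {f : ℝ → ℝ} (hf : ∀ x ∈ Icc (-δ) δ, ContDiffAt ℝ 2 f x)
    {k : ℕ → ℝ} (hk : Tendsto k atTop atTop) (h0 : deriv f 0 ≠ 0) :
    Tendsto (fun n => ‖bB ρ (k n) δ f‖ / √(k n)) atTop (𝓝 0) := by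
  obtain ⟨N, c, hc, hdom⟩ := bG_dom hρ hδ hf
  set g := gG δ (ρ + f 0 * Complex.I) (deriv (deriv f) 0) with hg
  have hwre : 0 < (ρ + f 0 * Complex.I : ℂ).re := by simpa using hρ
  have gi : Integrable g := gG_int hwre _ _
  have di := (integrable_exp_neg_mul_sq hc).const_mul N
  have hI : ∀ n, 1 ≤ k n → Integrable (bG ρ δ (k n) f) := fun n hn =>
    di.mono' (bG_meas hρ hf (by linarith)) (Eventually.of_forall (hdom _ hn))
  have hm : Tendsto (fun n => ∫ z, ‖bG ρ δ (k n) f z - g z‖) atTop (𝓝 (∫ z : ℝ, (0:ℝ))) := by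
    refine tendsto_integral_filter_of_dominated_convergence (fun z => N * Real.exp (-c * z ^ 2) + ‖g z‖) ?_ ?_ ?_ ?_
    · filter_upwards [hk.eventually_gt_atTop 0] with n hn using ((bG_meas hρ hf hn).sub gi.1).norm
    · filter_upwards [hk.eventually_ge_atTop 1] with n hn
      refine Eventually.of_forall fun z => ?_
      rw [norm_norm]; exact (norm_sub_le _ _).trans (add_le_add (hdom _ hn z) le_rfl)
    · exact di.add gi.norm
    · refine Eventually.of_forall fun z => ?_
      have := (bG_tendsto hρ hδ hf hk z).sub_const (g z)
      rw [hg, sub_self] at this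
      simpa using this.norm
  rw [integral_zero] at hm
  have hRL : Tendsto (fun n => ∫ z : ℝ, Complex.exp (Complex.I * (√(k n) * deriv f 0 * z)) * g z) atTop (𝓝 0) := by
    have h1 := Real.tendsto_integral_exp_smul_cocompact g
    have hsq : Tendsto (fun n => √(k n)) atTop atTop := tendsto_sqrt_atTop.comp hk
    have h2 : Tendsto (fun n => √(k n) * (-(deriv f 0 / (2 * π)))) atTop (cocompact ℝ) := by
      rw [← Metric.cobounded_eq_cocompact, ← comap_norm_atTop, tendsto_comap_iff]
      have : (norm ∘ fun n => √(k n) * (-(deriv f 0 / (2 * π)))) = fun n => √(k n) * |deriv f 0 / (2 * π)| := by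
        ext n; simp only [Function.comp, Real.norm_eq_abs, abs_mul, abs_neg, abs_of_nonneg (Real.sqrt_nonneg (k n))]
      rw [this]
      refine hsq.atTop_mul_const ?_
      have := pi_pos
      positivity
    refine (h1.comp h2).congr fun n => ?_
    simp only [Function.comp]
    congr 1; ext z
    rw [Circle.smul_def, smul_eq_mul, Real.fourierChar_apply]
    congr 2
    have := pi_ne_zero
    push_cast; field_simp
  have hlim : Tendsto (fun n => (∫ z, ‖bG ρ δ (k n) f z - g z‖) + ‖∫ z : ℝ, Complex.exp (Complex.I * (√(k n) * deriv f 0 * z)) * g z‖) atTop (𝓝 0) := by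
    simpa using hm.add hRL.norm
  refine squeeze_zero' (Eventually.of_forall fun n => by positivity) ?_ hlim
  filter_upwards [hk.eventually_ge_atTop 1] with n hn
  rw [bB_norm hρ hδ (by linarith)]
  have me : AEStronglyMeasurable (fun z : ℝ => Complex.exp (Complex.I * (√(k n) * deriv f 0 * z))) volume :=
    Continuous.aestronglyMeasurable (by fun_prop)
  have ne : ∀ z : ℝ, ‖Complex.exp (Complex.I * (√(k n) * deriv f 0 * z))‖ = 1 := fun z => by
    have := norm_exp_I (√(k n) * deriv f 0 * z)
    push_cast at this; exact this
  have i1 : Integrable (fun z : ℝ => Complex.exp (Complex.I * (√(k n) * deriv f 0 * z)) * bG ρ δ (k n) f z) :=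
    (hI n hn).bdd_mul me (Eventually.of_forall fun z => (ne z).le)
  have i2 : Integrable (fun z : ℝ => Complex.exp (Complex.I * (√(k n) * deriv f 0 * z)) * g z) :=
    gi.bdd_mul me (Eventually.of_forall fun z => (ne z).le)
  have e : ∫ z : ℝ, Complex.exp (Complex.I * (√(k n) * deriv f 0 * z)) * bG ρ δ (k n) f z
     = (∫ z : ℝ, Complex.exp (Complex.I * (√(k n) * deriv f 0 * z)) * (bG ρ δ (k n) f z - g z)) + ∫ z : ℝ, Complex.exp (Complex.I * (√(k n) * deriv f 0 * z)) * g z := by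
    simp_rw [mul_sub]
    rw [integral_sub i1 i2]; ring
  rw [e]
  refine (norm_add_le _ _).trans (add_le_add ?_ le_rfl)
  refine (norm_integral_le_integral_norm _).trans (le_of_eq ?_)
  congr 1; ext z
  rw [norm_mul, ne, one_mul]

end Rig

namespace Rig

open Filter Topology ComplexConjugate

lemma strip_compact {δ : ℝ} {f1 f2 : ℝ → ℝ}
    (h1 : ContinuousOn f1 (Icc (-δ) δ)) (h2 : ContinuousOn f2 (Icc (-δ) δ))
    (hlt : ∀ x ∈ Icc (-δ) δ, f1 x < f2 x) : IsCompact (strip δ f1 f2) := by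
  have e : strip δ f1 f2 = sph f1 f2 '' (Icc (-δ) δ ×ˢ Icc (0:ℝ) 1) := by
    ext z; constructor
    · rintro ⟨a, b, c⟩
      have hl := hlt _ a
      refine ⟨(z.re, (z.im - f1 z.re) / (f2 z.re - f1 z.re)), ⟨a, ?_, ?_⟩, ?_⟩
      · exact div_nonneg (by linarith) (by linarith)
      · change _ / _ ≤ _
        rw [div_le_one (by linarith)]; linarith
      · have : f2 z.re - f1 z.re ≠ 0 := by linarith
        apply Complex.ext
        · rw [sph, Complex.add_re, Complex.re_ofReal_mul]; simp
        · simp only [sph]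
          rw [div_mul_cancel₀ _ this]; simp
    · rintro ⟨p, ⟨a, b⟩, rfl⟩
      exact sph_mem hlt a b
  rw [e]
  refine (isCompact_Icc.prod isCompact_Icc).image_of_continuousOn ?_
  have c1 : ContinuousOn (fun p : ℝ × ℝ => f1 p.1) (Icc (-δ) δ ×ˢ Icc (0:ℝ) 1) :=
    h1.comp continuousOn_fst fun p hp => hp.1
  have c2 : ContinuousOn (fun p : ℝ × ℝ => f2 p.1) (Icc (-δ) δ ×ˢ Icc (0:ℝ) 1) :=
    h2.comp continuousOn_fst fun p hp => hp.1
  unfold sph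
  refine ContinuousOn.add (by fun_prop) (ContinuousOn.mul ?_ continuousOn_const)
  exact Complex.continuous_ofReal.comp_continuousOn (c1.add (continuousOn_snd.mul (c2.sub c1)))

lemma strip_fubini {δ : ℝ} (hδ : 0 < δ) {f1 f2 : ℝ → ℝ}
    (h1 : ContinuousOn f1 (Icc (-δ) δ)) (h2 : ContinuousOn f2 (Icc (-δ) δ))
    (hlt : ∀ x ∈ Icc (-δ) δ, f1 x < f2 x) {F : ℂ → ℝ} (cF : ContinuousOn F (strip δ f1 f2)) :
    IntervalIntegrable (fun x => ∫ y in (f1 x)..(f2 x), F (x + y * Complex.I)) volume (-δ) δ ∧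
    ∫ z in strip δ f1 f2, F z = ∫ x in (-δ)..δ, ∫ y in (f1 x)..(f2 x), F (x + y * Complex.I) := by
  have hle : -δ ≤ δ := by linarith
  have hc := strip_compact h1 h2 hlt
  set G : ℂ → ℝ := (strip δ f1 f2).indicator F with hG
  have gi : Integrable G := (cF.integrableOn_compact hc).integrable_indicator hc.measurableSet
  have mp := Complex.volume_preserving_equiv_real_prod.symm
  have gi2 : Integrable (fun p : ℝ × ℝ => G (Complex.measurableEquivRealProd.symm p)) (volume.prod volume) :=
    mp.integrable_comp_of_integrable gi
  have inner : ∀ x, ∫ y, G (Complex.measurableEquivRealProd.symm (x, y)) =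
      (Icc (-δ) δ).indicator (fun x => ∫ y in (f1 x)..(f2 x), F (x + y * Complex.I)) x := by
    intro x
    by_cases hx : x ∈ Icc (-δ) δ
    · rw [indicator_of_mem hx, intervalIntegral.integral_of_le (hlt x hx).le, ← integral_Icc_eq_integral_Ioc,
        ← integral_indicator measurableSet_Icc]
      congr 1; ext y
      have e : Complex.measurableEquivRealProd.symm (x, y) = x + y * Complex.I := by
        apply Complex.ext <;> simp [Complex.measurableEquivRealProd_symm_apply]
      rw [e]
      by_cases hy : y ∈ Icc (f1 x) (f2 x)
      · rw [indicator_of_mem hy, hG, indicator_of_mem]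
        refine ⟨by simpa using hx, ?_, ?_⟩
        · simpa using hy.1
        · simpa using hy.2
      · rw [indicator_of_notMem hy, hG, indicator_of_notMem]
        rintro ⟨-, a, b⟩
        exact hy ⟨by simpa using a, by simpa using b⟩
    · rw [indicator_of_notMem hx]
      have : ∀ y, G (Complex.measurableEquivRealProd.symm (x, y)) = 0 := fun y => by
        rw [hG, indicator_of_notMem]
        rintro ⟨a, -⟩
        exact hx (by simpa [Complex.measurableEquivRealProd_symm_apply] using a)
      simp_rw [this]; simp
  have i1 := gi2.integral_prod_left
  have i2 := integral_prod _ gi2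
  simp_rw [inner] at i1 i2
  rw [integrable_indicator_iff measurableSet_Icc] at i1
  rw [integral_indicator measurableSet_Icc] at i2
  refine ⟨(intervalIntegrable_iff_integrableOn_Icc_of_le hle).2 i1, ?_⟩
  rw [intervalIntegral.integral_of_le hle, ← integral_Icc_eq_integral_Ioc, ← i2, ← integral_indicator hc.measurableSet]
  have := mp.integral_comp Complex.measurableEquivRealProd.symm.measurableEmbedding G
  rw [← this]; rfl

lemma beam_bound {ρ δ : ℝ} (hρ : 0 < ρ) (hδ : 0 < δ) {f1 f2 : ℝ → ℝ}
    (h1 : ∀ x ∈ Icc (-δ) δ, ContDiffAt ℝ 2 f1 x) (h2 : ∀ x ∈ Icc (-δ) δ, ContDiffAt ℝ 2 f2 x)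
    (hlt : ∀ x ∈ Icc (-δ) δ, f1 x < f2 x) : ∃ M > 0, ∀ k ≥ 0, ∀ (U : ℂ → ℝ) (D : ℂ → ℂ →L[ℝ] ℝ) (H : ℂ → ℂ →L[ℝ] ℂ →L[ℝ] ℝ)
    (_ : ContinuousOn U (strip δ f1 f2)) (_ : ContinuousOn D (strip δ f1 f2))
    (_ : ∀ z ∈ ostrip δ f1 f2, HasFDerivAt U (D z) z)
    (_ : ∀ z ∈ ostrip δ f1 f2, HasFDerivAt D (H z) z)
    (_ : ∀ z ∈ strip δ f1 f2, H z 1 1 + H z Complex.I Complex.I = -(k ^ 2 * U z))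
    (c1 c2 : ℝ) (_ : ∀ x ∈ Icc (-δ) δ, U (gpt f1 x) = c1) (_ : ∀ x ∈ Icc (-δ) δ, U (gpt f2 x) = c2)
    (_ : ∀ x ∈ Icc (-δ) δ, D (gpt f1 x) = 0) (_ : ∀ x ∈ Icc (-δ) δ, D (gpt f2 x) = 0),
    ‖c1 * bB ρ k δ f1 - c2 * bB ρ k δ f2‖ ≤ M * ∫ z in strip δ f1 f2, (1 + U z * U z) := by
  have c1' : ContinuousOn f1 (Icc (-δ) δ) := fun x hx => (h1 x hx).continuousAt.continuousWithinAt
  have c2' : ContinuousOn f2 (Icc (-δ) δ) := fun x hx => (h2 x hx).continuousAt.continuousWithinAt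
  have hc := strip_compact c1' c2' hlt
  obtain ⟨R, hR⟩ := hc.exists_bound_of_continuousOn (f := Complex.im) Complex.continuous_im.continuousOn
  obtain ⟨M, hM, hb⟩ := bR_bound (R := R) hρ hδ
  have hle : -δ ≤ δ := by linarith
  refine ⟨M, hM, ?_⟩
  intro k hk U D H cU cD dU dD pde c1 c2 u1 u2 D1 D2
  rw [beam_green hρ hδ h1 h2 hlt cU cD dU dD pde u1 u2 D1 D2]
  have cF : ContinuousOn (fun z => 1 + U z * U z) (strip δ f1 f2) := continuousOn_const.add (cU.mul cU)
  obtain ⟨ii, ie⟩ := strip_fubini hδ c1' c2' hlt cF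
  rw [ie, ← intervalIntegral.integral_const_mul]
  refine intervalIntegral.norm_integral_le_of_norm_le hle (Eventually.of_forall fun x hx' => ?_) (ii.const_mul M)
  have hx := Ioc_subset_Icc_self hx'
  have hl := hlt x hx
  set h := f2 x - f1 x with hh
  have hh0 : 0 < h := by rw [hh]; linarith
  have e0 : ∀ τ, sph f1 f2 (x, τ) = x + ((f1 x + h * τ : ℝ) : ℂ) * Complex.I := fun τ => by
    simp only [sph, hh]; push_cast; ring
  have sm : ∀ τ ∈ Icc (0:ℝ) 1, sph f1 f2 (x, τ) ∈ strip δ f1 f2 := fun τ hτ => sph_mem hlt hx hτ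
  have e1 : ∫ y in (f1 x)..(f2 x), (1 + U (x + y * Complex.I) * U (x + y * Complex.I)) =
      ∫ τ in (0:ℝ)..1, h * (1 + U (sph f1 f2 (x, τ)) * U (sph f1 f2 (x, τ))) := by
    rw [intervalIntegral.integral_const_mul]
    simp_rw [e0]
    rw [intervalIntegral.mul_integral_comp_add_mul (f := fun y : ℝ => 1 + U (x + (y:ℂ) * Complex.I) * U (x + (y:ℂ) * Complex.I))]
    congr 1 <;> rw [hh] <;> ring
  rw [e1, ← intervalIntegral.integral_const_mul]
  refine intervalIntegral.norm_integral_le_of_norm_le zero_le_one (Eventually.of_forall fun τ hτ' => ?_) ?_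
  · have hτ := Ioc_subset_Icc_self hτ'
    have s := sm τ hτ
    have b := hb k hk _ (hR _ s) (abs_le.2 s.1)
    rw [norm_mul, norm_neg, norm_mul, Complex.norm_real, Complex.norm_real, Real.norm_eq_abs, abs_of_pos hh0, Real.norm_eq_abs]
    have : |U (sph f1 f2 (x, τ))| ≤ 1 + U (sph f1 f2 (x, τ)) * U (sph f1 f2 (x, τ)) := by
      rw [← abs_mul_abs_self (U _)]; nlinarith [sq_nonneg (|U (sph f1 f2 (x, τ))| - 1), abs_nonneg (U (sph f1 f2 (x, τ)))]
    calc _ ≤ h * ((1 + U (sph f1 f2 (x, τ)) * U (sph f1 f2 (x, τ))) * M) := by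
          apply mul_le_mul_of_nonneg_left _ hh0.le
          exact mul_le_mul this b (norm_nonneg _) ((abs_nonneg _).trans this)
      _ = _ := by ring
  · apply ContinuousOn.intervalIntegrable
    rw [uIcc_of_le zero_le_one]
    have cs : Continuous (fun τ : ℝ => sph f1 f2 (x, τ)) := by
      simp_rw [e0]; fun_prop
    have : ContinuousOn (fun τ : ℝ => U (sph f1 f2 (x, τ))) (Icc 0 1) := cU.comp cs.continuousOn sm
    exact continuousOn_const.mul (continuousOn_const.mul (continuousOn_const.add (this.mul this)))

end Rig

namespace Rig

open Filter Topology ComplexConjugate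

lemma Eig.pde' {Ω : Set ℂ} {u : ℂ → ℝ} {μ : ℝ}
    {D : ℂ → ℂ →L[ℝ] ℝ} {H : ℂ → ℂ →L[ℝ] ℂ →L[ℝ] ℝ} (h : Eig Ω u D H μ) {x : ℂ} (hx : x ∈ closure Ω) :
    H x 1 1 + H x Complex.I Complex.I = - (μ * u x) := by
  have e : EqOn (fun x => H x 1 1 + H x Complex.I Complex.I) (fun x => - (μ * u x)) Ω := h.pde
  have c : ∀ v : ℂ, ContinuousOn (fun x => H x v v) (closure Ω) := fun v =>
    (h.cH.clm_apply continuousOn_const).clm_apply continuousOn_const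
  exact EqOn.of_subset_closure e ((c 1).add (c _)) (continuousOn_const.mul h.toC2B.cu).neg subset_closure subset_rfl hx

lemma trace_rot (B : ℂ →L[ℝ] ℂ →L[ℝ] ℝ) {e : ℂ} (he : ‖e‖ = 1) :
    B e e + B (e * Complex.I) (e * Complex.I) = B 1 1 + B Complex.I Complex.I := by
  have e1 : e = e.re • (1:ℂ) + e.im • Complex.I := by apply Complex.ext <;> simp
  have e2 : e * Complex.I = (-e.im) • (1:ℂ) + e.re • Complex.I := by apply Complex.ext <;> simp
  have e3 : e.re ^ 2 + e.im ^ 2 = 1 := by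
    have := Complex.normSq_eq_norm_sq e
    rw [he, Complex.normSq_apply] at this; linarith
  have r : ∀ a b : ℝ, B (a • (1:ℂ) + b • Complex.I) (a • (1:ℂ) + b • Complex.I) =
     a * (a * B 1 1 + b * B 1 Complex.I) + b * (a * B Complex.I 1 + b * B Complex.I Complex.I) := by
    intro a b; simp only [map_add, map_smul, add_apply, smul_apply, smul_eq_mul]; ring
  have r1 := r e.re e.im
  rw [← e1] at r1
  rw [e2, r, r1]
  linear_combination (B 1 1 + B Complex.I Complex.I) * e3

/-- rigid motion preserves integrals -/
lemma motion_mp {q e : ℂ} (he : ‖e‖ = 1) : MeasurePreserving (fun z : ℂ => q + e * z) volume volume := by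
  have hc : e ∈ Submonoid.unitSphere ℂ := by simpa [Submonoid.unitSphere] using he
  have h1 := (rotation (⟨e, hc⟩ : Circle)).measurePreserving
  have h2 := (measurePreserving_add_left (volume : Measure ℂ) q).comp h1
  exact h2

lemma motion_emb {q e : ℂ} (he : ‖e‖ = 1) : MeasurableEmbedding (fun z : ℂ => q + e * z) := by
  have e0 : e ≠ 0 := fun h => by rw [h] at he; simp at he
  have := ((Homeomorph.mulLeft₀ e e0).trans (Homeomorph.addLeft q)).measurableEmbedding
  exact this

/-- A tube: region between two boundary arcs, in the frame `(q,e)`. -/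
structure Tube (Ω : Set ℂ) {J : ℕ} (γ : Fin J → ℝ → ℂ) (j1 j2 : Fin J) (q e : ℂ) (δ : ℝ) (f1 f2 : ℝ → ℝ) : Prop where
  he : ‖e‖ = 1
  hδ : 0 < δ
  s1 : ∀ x ∈ Icc (-δ) δ, ContDiffAt ℝ 2 f1 x
  s2 : ∀ x ∈ Icc (-δ) δ, ContDiffAt ℝ 2 f2 x
  lt : ∀ x ∈ Icc (-δ) δ, f1 x < f2 x
  os : ∀ z ∈ ostrip δ f1 f2, q + e * z ∈ Ω
  cs : ∀ z ∈ strip δ f1 f2, q + e * z ∈ closure Ω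
  g1 : ∀ x ∈ Icc (-δ) δ, ∃ s, q + e * gpt f1 x = γ j1 s
  g2 : ∀ x ∈ Icc (-δ) δ, ∃ s, q + e * gpt f2 x = γ j2 s

/-- Normalised sequence of eigenfunctions. -/
structure Sq (Ω : Set ℂ) {J : ℕ} (γ : Fin J → ℝ → ℂ) (j0 : Fin J) (u : ℕ → ℂ → ℝ) (D : ℕ → ℂ → ℂ →L[ℝ] ℝ)
    (H : ℕ → ℂ → ℂ →L[ℝ] ℂ →L[ℝ] ℝ) (μ : ℕ → ℝ) : Prop where
  eig : ∀ n, Eig Ω (u n) (D n) (H n) (μ n)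
  pos : ∀ n, 0 < μ n
  lim : Tendsto μ atTop atTop
  c0 : ∀ n, |u n (γ j0 0)| = 1
  cle : ∀ n j, |u n (γ j 0)| ≤ 1
  bd : ∃ C, ∀ n, ∫ x in Ω, u n x * u n x ≤ C

section
variable {Ω : Set ℂ} {J : ℕ} {γ : Fin J → ℝ → ℂ} {j1 j2 : Fin J} {q e : ℂ} {δ : ℝ} {f1 f2 : ℝ → ℝ}

lemma Tube.bound (hd : Dom Ω J γ) (t : Tube Ω γ j1 j2 q e δ f1 f2) {ρ : ℝ} (hρ : 0 < ρ) :
    ∃ M, 0 ≤ M ∧ ∀ u D H μ, 0 < μ → Eig Ω u D H μ →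
    ‖(u (γ j1 0) : ℂ) * bB ρ (√μ) δ f1 - u (γ j2 0) * bB ρ (√μ) δ f2‖ ≤ M * (1 + ∫ x in Ω, u x * u x) := by
  obtain ⟨M, hM, hb⟩ := beam_bound hρ t.hδ t.s1 t.s2 t.lt
  have hc : IsCompact (strip δ f1 f2) := strip_compact (fun x hx => (t.s1 x hx).continuousAt.continuousWithinAt)
    (fun x hx => (t.s2 x hx).continuousAt.continuousWithinAt) t.lt
  set V := (volume (strip δ f1 f2)).toReal with hV
  have hV0 : 0 ≤ V := ENNReal.toReal_nonneg
  refine ⟨M * (V + 1), by positivity, ?_⟩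
  intro u D H μ hμ E
  set φ : ℂ → ℂ := fun z => q + e * z with hφ
  have cφ : Continuous φ := by fun_prop
  set A : ℂ →L[ℝ] ℂ := (ContinuousLinearMap.mul ℝ ℂ e) with hA
  have dφ : ∀ z, HasFDerivAt φ A z := fun z => by
    have := (A.hasFDerivAt (x := z)).const_add q
    exact this
  let Φ : (ℂ →L[ℝ] ℝ) →L[ℝ] (ℂ →L[ℝ] ℝ) := (ContinuousLinearMap.compL ℝ ℂ ℂ ℝ).flip A
  have mcs : MapsTo φ (strip δ f1 f2) (closure Ω) := t.cs
  have nn : ∀ z ∈ ostrip δ f1 f2, closure Ω ∈ 𝓝 (φ z) := fun z hz => closure_nhds hd.op (t.os z hz)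
  have main := hb (√μ) (Real.sqrt_nonneg _) (fun z => u (φ z)) (fun z => Φ (D (φ z)))
    (fun z => Φ.comp ((H (φ z)).comp A)) (E.toC2B.cu.comp cφ.continuousOn mcs)
    (Φ.continuous.comp_continuousOn (E.toC2B.c1.c.comp cφ.continuousOn mcs))
    (fun z hz => ((E.du _ (subset_closure (t.os z hz))).hasFDerivAt (nn z hz)).comp z (dφ z))
    (fun z hz => Φ.hasFDerivAt.comp z (((E.dD _ (subset_closure (t.os z hz))).hasFDerivAt (nn z hz)).comp z (dφ z)))
    (fun z hz => by
      have h1 := E.pde' (mcs hz)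
      rw [← trace_rot _ t.he] at h1
      rw [Real.sq_sqrt hμ.le, ← h1]
      simp [Φ, hA])
    (u (γ j1 0)) (u (γ j2 0))
    (fun x hx => by
      obtain ⟨s, hs⟩ := t.g1 x hx
      change u (q + e * gpt f1 x) = _
      rw [hs]; exact E.const hd _ _ _)
    (fun x hx => by
      obtain ⟨s, hs⟩ := t.g2 x hx
      change u (q + e * gpt f2 x) = _
      rw [hs]; exact E.const hd _ _ _)
    (fun x hx => by
      obtain ⟨s, hs⟩ := t.g1 x hx
      change Φ (D (q + e * gpt f1 x)) = _
      rw [hs, E.zero _ (hd.mem_fr _ _), map_zero])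
    (fun x hx => by
      obtain ⟨s, hs⟩ := t.g2 x hx
      change Φ (D (q + e * gpt f2 x)) = _
      rw [hs, E.zero _ (hd.mem_fr _ _), map_zero])
  refine main.trans ?_
  have cu := E.toC2B.cu
  have icl : IntegrableOn (fun z => u z * u z) (closure Ω) := (cu.mul cu).integrableOn_compact hd.bdd.isCompact_closure
  have i2 : IntegrableOn (fun z => u (φ z) * u (φ z)) (strip δ f1 f2) :=
    ((cu.comp cφ.continuousOn mcs).mul (cu.comp cφ.continuousOn mcs)).integrableOn_compact hc
  have i1 : IntegrableOn (fun _ : ℂ => (1:ℝ)) (strip δ f1 f2) := continuousOn_const.integrableOn_compact hc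
  have e1 : ∫ z in strip δ f1 f2, (1 + u (φ z) * u (φ z)) = V + ∫ z in strip δ f1 f2, u (φ z) * u (φ z) := by
    rw [integral_add i1 i2]; simp [hV, Measure.real]
  have e2 : ∫ z in strip δ f1 f2, u (φ z) * u (φ z) ≤ ∫ x in Ω, u x * u x := by
    have h1 := (motion_mp (q := q) t.he).setIntegral_preimage_emb (motion_emb t.he) (fun z => u z * u z) (φ '' strip δ f1 f2)
    have inj : Function.Injective φ := (motion_emb t.he).injective
    rw [show (fun z : ℂ => q + e * z) = φ from rfl, preimage_image_eq _ inj] at h1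
    rw [h1]
    have h2 : ∫ x in Ω, u x * u x = ∫ x in closure Ω, u x * u x := by
      apply setIntegral_congr_set
      refine (ae_eq_set.2 ⟨by rw [sdiff_eq_empty.2 subset_closure]; simp, ?_⟩)
      refine measure_mono_null ?_ hd.null
      rw [hd.op.frontier_eq]
    rw [h2]
    refine setIntegral_mono_set icl (Eventually.of_forall fun x => mul_self_nonneg _) ?_
    exact (Eventually.of_forall (image_subset_iff.2 mcs))
  rw [e1]
  have hI : 0 ≤ ∫ x in Ω, u x * u x := setIntegral_nonneg hd.op.measurableSet fun x _ => mul_self_nonneg _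
  calc _ ≤ M * (V + ∫ x in Ω, u x * u x) := mul_le_mul_of_nonneg_left (by linarith) hM.le
    _ ≤ M * ((V + 1) * (1 + ∫ x in Ω, u x * u x)) := mul_le_mul_of_nonneg_left (by nlinarith) hM.le
    _ = _ := by ring

lemma Tube.lim {u : ℕ → ℂ → ℝ} {D : ℕ → ℂ → ℂ →L[ℝ] ℝ}
    {H : ℕ → ℂ → ℂ →L[ℝ] ℂ →L[ℝ] ℝ} {μ : ℕ → ℝ} (hd : Dom Ω J γ) (t : Tube Ω γ j1 j2 q e δ f1 f2)
    (s : Sq Ω γ j1 u D H μ) (h10 : f1 0 = 0) (h1d : deriv f1 0 = 0) :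
    deriv f2 0 = 0 ∧ ∃ C, Tendsto (fun n => |u n (γ j2 0)| ^ 4) atTop (𝓝 C) ∧
      (1 + deriv (deriv f2) 0 * f2 0) ^ 2 = C ∧ (deriv (deriv f2) 0) ^ 2 = C * (deriv (deriv f1) 0) ^ 2 := by
  set κ1 := deriv (deriv f1) 0 with hκ1
  set κ2 := deriv (deriv f2) 0 with hκ2
  set k : ℕ → ℝ := fun n => √(μ n) with hk
  have hkl : Tendsto k atTop atTop := tendsto_sqrt_atTop.comp s.lim
  have hk0 : ∀ n, 0 < k n := fun n => Real.sqrt_pos.2 (s.pos n)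
  have diff : ∀ ρ > 0, Tendsto (fun n => |u n (γ j2 0)| * (‖bB ρ (k n) δ f2‖ / √(k n))) atTop
      (𝓝 ‖∫ z, gG δ (ρ + f1 0 * Complex.I) κ1 z‖) := by
    intro ρ hρ
    obtain ⟨M, hM, hb⟩ := t.bound hd hρ
    obtain ⟨C, hC⟩ := s.bd
    have l1 := bB_lim hρ t.hδ t.s1 hkl h1d
    have hz : Tendsto (fun n => (M * (1 + C)) / √(k n)) atTop (𝓝 0) :=
      tendsto_const_nhds.div_atTop (tendsto_sqrt_atTop.comp hkl)
    have l2 : Tendsto (fun n => |u n (γ j2 0)| * (‖bB ρ (k n) δ f2‖ / √(k n)) - ‖bB ρ (k n) δ f1‖ / √(k n)) atTop (𝓝 0) := by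
      refine squeeze_zero_norm (fun n => ?_) hz
      have hs : 0 < √(k n) := Real.sqrt_pos.2 (hk0 n)
      have b := hb (u n) (D n) (H n) (μ n) (s.pos n) (s.eig n)
      have b2 := abs_norm_sub_norm_le ((u n (γ j1 0) : ℂ) * bB ρ (k n) δ f1) (u n (γ j2 0) * bB ρ (k n) δ f2)
      rw [norm_mul, norm_mul, Complex.norm_real, Complex.norm_real, Real.norm_eq_abs, Real.norm_eq_abs, s.c0, one_mul] at b2
      have b3 : M * (1 + ∫ x in Ω, u n x * u n x) ≤ M * (1 + C) := mul_le_mul_of_nonneg_left (by linarith [hC n]) hM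
      rw [Real.norm_eq_abs, ← mul_div_assoc, ← sub_div, abs_div, abs_of_pos hs, abs_sub_comm]
      exact div_le_div_of_nonneg_right (b2.trans (b.trans b3)) hs.le
    have := l2.add l1
    rw [zero_add] at this
    refine this.congr fun n => by ring
  have wre : ∀ ρ : ℝ, ρ > 0 → ∀ y : ℝ, 0 < (ρ + y * Complex.I : ℂ).re := fun ρ hρ y => by simpa using hρ
  have nz : ∀ ρ : ℝ, ρ > 0 → ∀ κ y : ℝ, 0 < ‖1 - Complex.I * κ * (ρ + y * Complex.I)‖ := by
    intro ρ hρ κ y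
    have := gb_re (wre ρ hρ y) κ
    have hw := wne hρ y
    rw [norm_pos_iff]
    intro h0
    have : gb (ρ + y * Complex.I) κ = 0 := by
      rw [gb]; field_simp; linear_combination h0
    simp_all
  have gpos : ∀ ρ : ℝ, ρ > 0 → ∀ κ y : ℝ, 0 < ‖∫ z, gG δ (ρ + y * Complex.I) κ z‖ := by
    intro ρ hρ κ y
    have h1 := gG_norm (wre ρ hρ y) δ κ
    have h2 : 0 < δ ^ 8 * (2 * π) / ‖1 - Complex.I * κ * (ρ + y * Complex.I)‖ := by
      have := nz ρ hρ κ y; have := t.hδ; have := pi_pos; positivity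
    rw [← h1] at h2
    refine lt_of_le_of_ne (norm_nonneg _) fun h => ?_
    rw [← h] at h2; norm_num at h2
  have h2d : deriv f2 0 = 0 := by
    by_contra hne
    have l := bB_lim0 (ρ := 1) one_pos t.hδ t.s2 hkl hne
    have l' : Tendsto (fun n => |u n (γ j2 0)| * (‖bB 1 (k n) δ f2‖ / √(k n))) atTop (𝓝 0) := by
      refine squeeze_zero (fun n => by positivity) (fun n => ?_) l
      exact mul_le_of_le_one_left (by positivity) (s.cle n j2)
    have := tendsto_nhds_unique l' (diff 1 one_pos)
    have := gpos 1 one_pos κ1 (f1 0)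
    linarith
  refine ⟨h2d, ?_⟩
  have l4 : ∀ ρ > 0, Tendsto (fun n => |u n (γ j2 0)| ^ 4) atTop
      (𝓝 (((1 + κ2 * f2 0) ^ 2 + κ2 ^ 2 * ρ ^ 2) / (1 + κ1 ^ 2 * ρ ^ 2))) := by
    intro ρ hρ
    have l2 := bB_lim hρ t.hδ t.s2 hkl h2d
    have g2 := gpos ρ hρ κ2 (f2 0)
    have l3 := ((diff ρ hρ).div l2 g2.ne').pow 4
    have e1 : ∀ κ y : ℝ, ‖1 - Complex.I * κ * (ρ + y * Complex.I)‖ ^ 2 = (1 + κ * y) ^ 2 + κ ^ 2 * ρ ^ 2 := by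
      intro κ y
      rw [← Complex.normSq_eq_norm_sq, Complex.normSq_apply]
      simp; ring
    have e2 : (‖∫ z, gG δ (ρ + f1 0 * Complex.I) κ1 z‖ / ‖∫ z, gG δ (ρ + f2 0 * Complex.I) κ2 z‖) ^ 4 =
      ((1 + κ2 * f2 0) ^ 2 + κ2 ^ 2 * ρ ^ 2) / (1 + κ1 ^ 2 * ρ ^ 2) := by
      have a1 := e1 κ1 (f1 0)
      rw [h10, mul_zero, add_zero] at a1
      rw [show (4:ℕ) = 2 * 2 by norm_num, pow_mul, div_pow, gG_norm (wre ρ hρ _), gG_norm (wre ρ hρ _), ← e1 κ2 (f2 0)]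
      have b1 := nz ρ hρ κ1 (f1 0)
      have b2 := nz ρ hρ κ2 (f2 0)
      have e3 : 1 + κ1 ^ 2 * ρ ^ 2 = ‖1 - Complex.I * κ1 * (ρ + f1 0 * Complex.I)‖ ^ 2 := by rw [h10, a1]; ring
      rw [e3]
      have := t.hδ; have := pi_pos
      field_simp
    rw [← e2]
    refine l3.congr' ?_
    filter_upwards [l2.eventually (lt_mem_nhds g2)] with n hn
    simp only [Pi.div_apply]
    rw [mul_div_cancel_right₀ _ hn.ne']
  refine ⟨_, l4 1 one_pos, ?_⟩
  have u1 := tendsto_nhds_unique (l4 1 one_pos) (l4 2 two_pos)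
  have p1 : 0 < 1 + κ1 ^ 2 * 1 ^ 2 := by positivity
  have p2 : 0 < 1 + κ1 ^ 2 * 2 ^ 2 := by positivity
  set C := ((1 + κ2 * f2 0) ^ 2 + κ2 ^ 2 * 1 ^ 2) / (1 + κ1 ^ 2 * 1 ^ 2) with hC
  rw [eq_div_iff p1.ne'] at hC
  rw [eq_div_iff p2.ne'] at u1
  constructor <;> linarith

end
end Rig

namespace Rig
open Filter Topology ComplexConjugate

lemma Eig.scale {Ω : Set ℂ} {u : ℂ → ℝ} {D : ℂ → ℂ →L[ℝ] ℝ} {H : ℂ → ℂ →L[ℝ] ℂ →L[ℝ] ℝ} {μ : ℝ}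
    (h : Eig Ω u D H μ) (a : ℝ) :
    Eig Ω (fun x => a * u x) (fun x => a • D x) (fun x => a • H x) μ where
  toC2B := h.toC2B.smul a
  zero := fun x hx => by simp [h.zero x hx]
  pde := fun x hx => by
    have := h.pde x hx
    simp only [smul_apply, smul_eq_mul]
    linear_combination a * this

lemma Dom.normalise {Ω : Set ℂ} {J : ℕ} {γ : Fin J → ℝ → ℂ} (hd : Dom Ω J γ)
    {u : ℕ → ℂ → ℝ} {D : ℕ → ℂ → ℂ →L[ℝ] ℝ}
    {H : ℕ → ℂ → ℂ →L[ℝ] ℂ →L[ℝ] ℝ} {μ : ℕ → ℝ} (hE : ∀ n, Eig Ω (u n) (D n) (H n) (μ n))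
    (hμ : Function.Injective μ)
    (hnc : ∀ n, ∃ x ∈ closure Ω, ∃ y ∈ closure Ω, u n x ≠ u n y) :
    ∃ (j0 : Fin J) (u' : ℕ → ℂ → ℝ) (D' : ℕ → ℂ → ℂ →L[ℝ] ℝ)
      (H' : ℕ → ℂ → ℂ →L[ℝ] ℂ →L[ℝ] ℝ) (μ' : ℕ → ℝ), Sq Ω γ j0 u' D' H' μ' := by
  have hpos := fun n => (hE n).pos hd (hnc n)
  obtain ⟨C, hC, hm⟩ := hd.mass
  have hlim : Tendsto μ atTop atTop := by
    rw [tendsto_atTop]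
    intro b
    rw [← Nat.cofinite_eq_atTop]
    refine (finite_below hd hE hμ hnc b).subset ?_
    intro n hn
    simp only [mem_compl_iff, mem_setOf_eq] at hn ⊢
    exact (not_le.1 hn).le
  have hJ : Nonempty (Fin J) := by
    by_contra hJ
    have := hm (u 0) (D 0) (H 0) (μ 0) (hpos 0).1.ne' (hE 0) 0 (fun j => (hJ ⟨j⟩).elim)
    have := (hpos 0).2
    norm_num at *
    linarith
  have hmax : ∀ n, ∃ j, ∀ i, |u n (γ i 0)| ≤ |u n (γ j 0)| := fun n =>
    Finite.exists_max (fun i => |u n (γ i 0)|)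
  choose j hj using hmax
  have hu0 : ∀ n, 0 < |u n (γ (j n) 0)| := by
    intro n
    rcases (abs_nonneg (u n (γ (j n) 0))).lt_or_eq with h | h
    · exact h
    · exfalso
      have h1 := hm (u n) (D n) (H n) (μ n) (hpos n).1.ne' (hE n) 0 (fun i => (hj n i).trans h.symm.le)
      have := (hpos n).2
      norm_num at h1
      linarith
  obtain ⟨j0, hj0⟩ : ∃ j0, {n | j n = j0}.Infinite := by
    by_contra hcon
    push Not at hcon
    have : (⋃ j0, {n | j n = j0}).Finite := Set.finite_iUnion hcon
    have h2 : (⋃ j0, {n | j n = j0}) = univ := by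
      ext n; simp
    rw [h2] at this
    exact Set.infinite_univ this
  obtain ⟨φ, hφ, hφj⟩ := Filter.extraction_of_frequently_atTop (Nat.frequently_atTop_iff_infinite.2 hj0)
  set a : ℕ → ℝ := fun n => |u (φ n) (γ j0 0)|⁻¹ with ha
  have hφj : ∀ n, j (φ n) = j0 := hφj
  have ha0 : ∀ n, 0 < |u (φ n) (γ j0 0)| := fun n => by have := hu0 (φ n); rwa [hφj] at this
  have hcle : ∀ n i, |a n * u (φ n) (γ i 0)| ≤ 1 := by
    intro n i
    have := hj (φ n) i
    rw [hφj] at this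
    rw [abs_mul, abs_of_pos (inv_pos.2 (ha0 n)), inv_mul_le_iff₀ (ha0 n), mul_one]
    exact this
  refine ⟨j0, fun n x => a n * u (φ n) x, fun n x => a n • D (φ n) x, fun n x => a n • H (φ n) x,
    fun n => μ (φ n), fun n => (hE (φ n)).scale (a n), fun n => (hpos _).1,
    hlim.comp hφ.tendsto_atTop, ?_, hcle, C, ?_⟩
  · intro n
    rw [abs_mul, abs_of_pos (inv_pos.2 (ha0 n))]
    exact inv_mul_cancel₀ (ha0 n).ne'
  · intro n
    have := hm _ _ _ _ (hpos (φ n)).1.ne' ((hE (φ n)).scale (a n)) 1 (hcle n)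
    simpa using this
end Rig

namespace Rig
open Filter Topology ComplexConjugate

/-- A segment in `Ω` leaving `Γ_{j1}` orthogonally and hitting `Γ_{j2}` transversally. -/
structure Chord (Ω : Set ℂ) {J : ℕ} (γ : Fin J → ℝ → ℂ) (j1 j2 : Fin J) (s σ L : ℝ) (ν : ℂ) : Prop where
  hL : 0 < L
  hν : ‖ν‖ = 1
  hit : γ j2 σ = γ j1 s + L * ν
  orth : (conj ν * deriv (γ j1) s).re = 0
  ins : ∀ t ∈ Ioo 0 L, γ j1 s + t * ν ∈ Ω
  trans : (conj ν * deriv (γ j2) σ).im ≠ 0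

lemma hasDerivAt_re {f : ℝ → ℂ} {f' : ℂ} {x : ℝ} (h : HasDerivAt f f' x) :
    HasDerivAt (fun t => (f t).re) f'.re x :=
  Complex.reCLM.hasFDerivAt.comp_hasDerivAt x h

lemma hasDerivAt_im {f : ℝ → ℂ} {f' : ℂ} {x : ℝ} (h : HasDerivAt f f' x) :
    HasDerivAt (fun t => (f t).im) f'.im x :=
  Complex.imCLM.hasFDerivAt.comp_hasDerivAt x h

lemma hasDerivAt_conj {f : ℝ → ℂ} {f' : ℂ} {x : ℝ} (h : HasDerivAt f f' x) :
    HasDerivAt (fun t => conj (f t)) (conj f') x :=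
  (Complex.conjCLE : ℂ →L[ℝ] ℂ).hasFDerivAt.comp_hasDerivAt x h

lemma smooth_d1 {g : ℝ → ℂ} (hg : ContDiff ℝ (⊤ : ℕ∞) g) (t : ℝ) : HasDerivAt g (deriv g t) t :=
  (hg.differentiable (by simp) t).hasDerivAt

lemma smooth_deriv {g : ℝ → ℂ} (hg : ContDiff ℝ (⊤ : ℕ∞) g) : ContDiff ℝ (⊤ : ℕ∞) (deriv g) :=
  (contDiff_infty_iff_deriv.1 hg).2

lemma chart_deriv {g : ℝ → ℂ} (hg : ContDiff ℝ (⊤ : ℕ∞) g) {q e : ℂ} (he : ‖e‖ = 1) {δ σ0 : ℝ} (hδ : 0 < δ)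
    {f S : ℝ → ℝ} (hf : ContDiffOn ℝ 3 f (Ioo (-δ) δ)) (hS : ContDiffOn ℝ 3 S (Ioo (-δ) δ)) (hS0 : S 0 = σ0)
    (hfS : ∀ x ∈ Ioo (-δ) δ, g (S x) = q + e * (x + f x * Complex.I)) :
    deriv S 0 * (conj e * deriv g σ0).re = 1 ∧ deriv f 0 = deriv S 0 * (conj e * deriv g σ0).im ∧
    ((conj e * deriv g σ0).im = 0 → 
      deriv (deriv f) 0 = (deriv S 0) ^ 2 * (conj e * deriv (deriv g) σ0).im) := by
  have hn : ∀ x ∈ Ioo (-δ) δ, Ioo (-δ) δ ∈ 𝓝 x := fun x hx => isOpen_Ioo.mem_nhds hx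
  have hS1 : ∀ x ∈ Ioo (-δ) δ, HasDerivAt S (deriv S x) x := fun x hx =>
    ((hS.contDiffAt (hn x hx)).differentiableAt (by norm_num)).hasDerivAt
  have hf1 : ∀ x ∈ Ioo (-δ) δ, HasDerivAt f (deriv f x) x := fun x hx =>
    ((hf.contDiffAt (hn x hx)).differentiableAt (by norm_num)).hasDerivAt
  have key : ∀ x ∈ Ioo (-δ) δ, ((deriv S x : ℝ) : ℂ) * (conj e * deriv g (S x)) = 1 + ((deriv f x : ℝ) : ℂ) * Complex.I := by
    intro x hx
    have h1 : HasDerivAt (fun x => conj e * g (S x)) (conj e * (deriv S x • deriv g (S x))) x :=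
      ((smooth_d1 hg (S x)).scomp x (hS1 x hx)).const_mul _
    have h2 : HasDerivAt (fun x : ℝ => conj e * (q + e * ((x : ℂ) + (f x : ℂ) * Complex.I)))
       (conj e * (e * (1 + ((deriv f x : ℝ) : ℂ) * Complex.I))) x := by
      refine HasDerivAt.const_mul _ (HasDerivAt.const_add _ (HasDerivAt.const_mul _ ?_))
      exact (hasDerivAt_id x).ofReal_comp.add ((hf1 x hx).ofReal_comp.mul_const _)
    have h3 : (fun x => conj e * g (S x)) =ᶠ[𝓝 x] 
        (fun x : ℝ => conj e * (q + e * ((x : ℂ) + (f x : ℂ) * Complex.I))) := by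
      filter_upwards [hn x hx] with y hy
      rw [hfS y hy]
    have h4 := (h1.congr_of_eventuallyEq h3.symm).unique h2
    rw [Complex.real_smul] at h4
    linear_combination h4 + (1 + ((deriv f x : ℝ) : ℂ) * Complex.I) * unit_conj_mul he
  have h0 : (0:ℝ) ∈ Ioo (-δ) δ := ⟨by linarith, hδ⟩
  have hre : ∀ x ∈ Ioo (-δ) δ, deriv S x * (conj e * deriv g (S x)).re = 1 := by
    intro x hx
    have := congrArg Complex.re (key x hx)
    rw [Complex.re_ofReal_mul] at this
    simpa using this
  have him : ∀ x ∈ Ioo (-δ) δ, deriv f x = deriv S x * (conj e * deriv g (S x)).im := by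
    intro x hx
    have := congrArg Complex.im (key x hx)
    rw [Complex.im_ofReal_mul] at this
    simpa using this.symm
  refine ⟨by simpa [hS0] using hre 0 h0, by simpa [hS0] using him 0 h0, fun hM => ?_⟩
  have e1 : deriv f =ᶠ[𝓝 0] fun x => deriv S x * (conj e * deriv g (S x)).im := by
    filter_upwards [hn 0 h0] with x hx using him x hx
  have d1 : HasDerivAt (deriv S) (deriv (deriv S) 0) 0 :=
    deriv_hasDerivAt ((hS.contDiffAt (hn 0 h0)).of_le (by norm_num))
  have d2 : HasDerivAt (fun x => (conj e * deriv g (S x)).im) (conj e * (deriv S 0 • deriv (deriv g) (S 0))).im 0 :=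
    hasDerivAt_im (((smooth_d1 (smooth_deriv hg) (S 0)).scomp 0 (hS1 0 h0)).const_mul _)
  have d3 := (d1.mul d2).deriv
  simp only [Pi.mul_def] at d3
  rw [e1.deriv_eq, d3, hS0, hM, Complex.real_smul, mul_left_comm, Complex.im_ofReal_mul]
  ring

section
variable {Ω : Set ℂ} {J : ℕ} {γ : Fin J → ℝ → ℂ} {j1 j2 : Fin J} {s σ L : ℝ} {ν : ℂ}

/-- curvature of `g` at `s` with respect to the normal `ν` -/
def kap (g : ℝ → ℂ) (ν : ℂ) (s : ℝ) : ℝ := (conj ν * deriv (deriv g) s).re / ‖deriv g s‖ ^ 2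

lemma frame_re {ν g : ℂ} : (conj (-Complex.I * ν) * g).re = - (conj ν * g).im := by
  simp; ring
lemma frame_im {ν g : ℂ} : (conj (-Complex.I * ν) * g).im = (conj ν * g).re := by
  simp; ring

lemma chart_kap {g : ℝ → ℂ} (hg : ContDiff ℝ (⊤ : ℕ∞) g) {q ν : ℂ} (hν : ‖ν‖ = 1) {δ σ0 : ℝ} (hδ : 0 < δ)
    {f S : ℝ → ℝ} (hf : ContDiffOn ℝ 3 f (Ioo (-δ) δ)) (hS : ContDiffOn ℝ 3 S (Ioo (-δ) δ)) (hS0 : S 0 = σ0)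
    (hfS : ∀ x ∈ Ioo (-δ) δ, g (S x) = q + (-Complex.I * ν) * (x + f x * Complex.I)) :
    (deriv f 0 = 0 ↔ (conj ν * deriv g σ0).re = 0) ∧
    ((conj ν * deriv g σ0).re = 0 → deriv (deriv f) 0 = kap g ν σ0) := by
  obtain ⟨h1, h2, h3⟩ := chart_deriv hg (by simp [hν]) hδ hf hS hS0 hfS
  have hs : deriv S 0 ≠ 0 := by rintro h; rw [h] at h1; simp at h1
  refine ⟨by rw [h2, frame_im]; simp [hs], fun h0 => ?_⟩
  rw [h3 (by rw [frame_im, h0]), frame_im, kap]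
  have hn : ‖deriv g σ0‖ ^ 2 = (conj ν * deriv g σ0).im ^ 2 := by
    have : ‖conj ν * deriv g σ0‖ = ‖deriv g σ0‖ := by rw [norm_mul, RCLike.norm_conj, hν, one_mul]
    rw [← this, ← Complex.normSq_eq_norm_sq, Complex.normSq_apply, h0]; ring
  rw [hn]
  rw [frame_re] at h1
  have him : (conj ν * deriv g σ0).im ≠ 0 := by intro h; rw [h] at h1; simp at h1
  have : deriv S 0 = - ((conj ν * deriv g σ0).im)⁻¹ := by
    field_simp; linarith
  rw [this]; field_simp

lemma Chord.tube (hd : Dom Ω J γ) (c : Chord Ω γ j1 j2 s σ L ν) : ∃ δ f1 f2,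
    Tube Ω γ j1 j2 (γ j1 s) (-Complex.I * ν) δ f1 f2 ∧ f1 0 = 0 ∧ deriv f1 0 = 0 ∧ f2 0 = L ∧
    deriv (deriv f1) 0 = kap (γ j1) ν s ∧ (deriv f2 0 = 0 ↔ (conj ν * deriv (γ j2) σ).re = 0) ∧
    ((conj ν * deriv (γ j2) σ).re = 0 → deriv (deriv f2) 0 = kap (γ j2) ν σ) := by
  have hL := c.hL
  set e := -Complex.I * ν with he
  have heI : e * Complex.I = ν := by
    rw [he]; linear_combination (-ν) * Complex.I_mul_I
  have hen : ‖e‖ = 1 := by simp [he, c.hν]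
  have hn1 : (conj e * deriv (γ j1) s).re ≠ 0 := by
    rw [frame_re]
    intro h
    have h1 : conj ν * deriv (γ j1) s = 0 := Complex.ext c.orth (neg_eq_zero.1 h)
    rcases mul_eq_zero.1 h1 with h2 | h2
    · have h3 := c.hν
      rw [(map_eq_zero _).1 h2] at h3
      simp at h3
    · exact hd.reg j1 s h2
  have hn2 : (conj e * deriv (γ j2) σ).re ≠ 0 := by
    rw [frame_re]; exact neg_ne_zero.2 c.trans
  obtain ⟨δ1, h1, hδ1, hh1, f1, S1, c1, sS1, S10, hS1⟩ := hd.ch j1 s hen hn1 (ε := L/4) (by positivity)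
  obtain ⟨δ2, h2, hδ2, hh2, g2, S2, c2, sS2, S20, hS2⟩ := hd.ch j2 σ hen hn2 (ε := L/4) (by positivity)
  have hp1 := c1.hδ
  have hp2 := c2.hδ
  have hq1 := c1.hh
  have hq2 := c2.hh
  have u1 : upper (γ j1 s) e δ1 h1 f1 ⊆ Ω := by
    rcases c1.side hd.op with h | h
    · exact h
    · exfalso
      refine Set.disjoint_left.1 h (show γ j1 s + ((h1/2 : ℝ) : ℂ) * ν ∈ _ from ⟨0, h1/2, by simpa using c1.hδ, by rw [c1.f0]; linarith, by linarith, ?_⟩)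
        (subset_closure (c.ins _ ⟨by linarith, by linarith⟩))
      push_cast
      linear_combination (-(h1/2 : ℂ)) * heI
  have u2 : upper (γ j2 σ) (-e) δ2 h2 (fun x => - g2 (-x)) ⊆ Ω := by
    rcases c2.flip.side hd.op with h | h
    · exact h
    · exfalso
      refine Set.disjoint_left.1 h (show γ j1 s + ((L - h2/2 : ℝ) : ℂ) * ν ∈ _ from ⟨0, h2/2, by simpa using c2.hδ, by simp [c2.f0]; linarith, by linarith, ?_⟩)
        (subset_closure (c.ins _ ⟨by linarith, by linarith⟩))
      rw [c.hit]
      push_cast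
      linear_combination ((h2/2 : ℂ)) * heI
  set K : Set ℂ := (fun t : ℝ => γ j1 s + t * ν) '' Icc (h1/2) (L - h2/2) with hK
  have hKc : IsCompact K := isCompact_Icc.image (by fun_prop)
  have hKΩ : K ⊆ Ω := by
    rintro _ ⟨t, ht, rfl⟩
    exact c.ins t ⟨by linarith [ht.1], by linarith [ht.2]⟩
  obtain ⟨r, hr, hrΩ⟩ := hKc.exists_thickening_subset_open hd.op hKΩ
  obtain ⟨δ, hδ0, hδa, hδb, hδc⟩ : ∃ δ > 0, δ < δ1 ∧ δ < δ2 ∧ δ < r :=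
    ⟨min (min δ1 δ2) r / 2, by positivity, by
      have := min_le_left (min δ1 δ2) r; have := min_le_left δ1 δ2
      have : 0 < min (min δ1 δ2) r := by positivity
      linarith, by
      have := min_le_left (min δ1 δ2) r; have := min_le_right δ1 δ2
      have : 0 < min (min δ1 δ2) r := by positivity
      linarith, by
      have := min_le_right (min δ1 δ2) r
      have : 0 < min (min δ1 δ2) r := by positivity
      linarith⟩
  have in1 : ∀ x ∈ Icc (-δ) δ, x ∈ Ioo (-δ1) δ1 := fun x hx => ⟨by linarith [hx.1], by linarith [hx.2]⟩
  have in2 : ∀ x ∈ Icc (-δ) δ, x ∈ Ioo (-δ2) δ2 := fun x hx => ⟨by linarith [hx.1], by linarith [hx.2]⟩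
  have b1 : ∀ x ∈ Icc (-δ) δ, f1 x < h1 := fun x hx => (abs_lt.1 (c1.bd x (in1 x hx))).2
  have b2 : ∀ x ∈ Icc (-δ) δ, -h2 < g2 x := fun x hx => (abs_lt.1 (c2.bd x (in2 x hx))).1
  have hos : ∀ z : ℂ, z.re ∈ Icc (-δ) δ → f1 z.re < z.im → z.im < L + g2 z.re → γ j1 s + e * z ∈ Ω := by
    intro z hz hz1 hz2
    have hzz : z = z.re + z.im * Complex.I := (Complex.re_add_im z).symm
    by_cases a1 : z.im < h1
    · exact u1 ⟨z.re, z.im, abs_lt.2 (in1 _ hz), hz1, a1, by rw [← hzz]⟩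
    by_cases a2 : L - h2 < z.im
    · refine u2 ⟨-z.re, L - z.im, by rw [abs_neg]; exact abs_lt.2 (in2 _ hz), by simp; linarith, by linarith, ?_⟩
      rw [c.hit]
      conv_lhs => rw [hzz]
      push_cast
      linear_combination ((L : ℂ)) * heI
    · refine hrΩ (Metric.mem_thickening_iff.2 ⟨_, ⟨z.im, ⟨by linarith, by linarith⟩, rfl⟩, ?_⟩)
      rw [dist_eq_norm]
      have : γ j1 s + e * z - (γ j1 s + z.im * ν) = e * z.re := by
        linear_combination (z.im : ℂ) * heI + e * hzz
      simp only []
      rw [this, norm_mul, hen, one_mul, Complex.norm_real, Real.norm_eq_abs]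
      exact (abs_le.2 hz).trans_lt hδc
  have hg1 : ∀ x ∈ Icc (-δ) δ, γ j1 s + e * gpt f1 x = γ j1 (S1 x) := fun x hx =>
    (hS1 x (in1 x hx)).symm
  have hg2 : ∀ x ∈ Icc (-δ) δ, γ j1 s + e * gpt (fun x => L + g2 x) x = γ j2 (S2 x) := fun x hx => by
    rw [hS2 x (in2 x hx), c.hit, gpt]
    push_cast
    linear_combination ((L : ℂ)) * heI
  have sm1 : ∀ x ∈ Icc (-δ) δ, ContDiffAt ℝ 2 f1 x := fun x hx =>
    (c1.sm.contDiffAt (isOpen_Ioo.mem_nhds (in1 x hx))).of_le (by norm_num)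
  have sm2 : ∀ x ∈ Icc (-δ) δ, ContDiffAt ℝ 2 g2 x := fun x hx =>
    (c2.sm.contDiffAt (isOpen_Ioo.mem_nhds (in2 x hx))).of_le (by norm_num)
  obtain ⟨k1, k2⟩ := chart_kap (hd.smooth j1) c.hν c1.hδ c1.sm sS1 S10 hS1
  obtain ⟨k3, k4⟩ := chart_kap (hd.smooth j2) c.hν c2.hδ c2.sm sS2 S20 hS2
  have hdd : deriv (fun x => L + g2 x) = deriv g2 := by
    funext x; simp
  refine ⟨δ, f1, fun x => L + g2 x, ⟨hen, hδ0, sm1, fun x hx => contDiffAt_const.add (sm2 x hx), 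
    fun x hx => by linarith [b1 x hx, b2 x hx], ?_, ?_, fun x hx => ⟨_, hg1 x hx⟩, fun x hx => ⟨_, hg2 x hx⟩⟩,
    c1.f0, k1.2 c.orth, by simp [c2.f0], k2 c.orth, by rw [hdd]; exact k3, by rw [hdd]; exact k4⟩
  · rintro z ⟨hz, hz1, hz2⟩
    exact hos z ⟨hz.1.le, hz.2.le⟩ hz1 hz2
  · rintro z ⟨hz, hz1, hz2⟩
    rcases hz1.lt_or_eq with a1 | a1
    · rcases hz2.lt_or_eq with a2 | a2
      · exact subset_closure (hos z hz a1 a2)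
      · have : z = gpt (fun x => L + g2 x) z.re := by
          apply Complex.ext <;> simp [a2]
        rw [this, hg2 _ hz]
        exact frontier_subset_closure (hd.mem_fr _ _)
    · have : z = gpt f1 z.re := by
        apply Complex.ext <;> simp [a1]
      rw [this, hg1 _ hz]
      exact frontier_subset_closure (hd.mem_fr _ _)

lemma Chord.lim {u : ℕ → ℂ → ℝ} {D : ℕ → ℂ → ℂ →L[ℝ] ℝ}
    {H : ℕ → ℂ → ℂ →L[ℝ] ℂ →L[ℝ] ℝ} {μ : ℕ → ℝ} (hd : Dom Ω J γ) (c : Chord Ω γ j1 j2 s σ L ν)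
    (sq : Sq Ω γ j1 u D H μ) : (conj ν * deriv (γ j2) σ).re = 0 ∧
    ∃ C, Tendsto (fun n => |u n (γ j2 0)| ^ 4) atTop (𝓝 C) ∧ (1 + kap (γ j2) ν σ * L) ^ 2 = C ∧
      (kap (γ j2) ν σ) ^ 2 = C * (kap (γ j1) ν s) ^ 2 := by
  obtain ⟨δ, f1, f2, t, a1, a2, a3, a4, a5, a6⟩ := c.tube hd
  obtain ⟨b1, C, b2, b3, b4⟩ := t.lim hd sq a1 a2
  have := a5.1 b1
  rw [a6 this, a3] at b3
  rw [a6 this, a4] at b4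
  exact ⟨this, C, b2, b3, b4⟩
end
end Rig

namespace Rig
open Filter Topology ComplexConjugate

lemma ift {F : ℝ × ℝ → ℝ} {p : ℝ × ℝ} (hF : ContDiffAt ℝ 2 F p) (hF0 : F p = 0) {b : ℝ} (hb0 : b ≠ 0)
    (hb : HasDerivAt (fun τ => F (p.1, τ)) b p.2) :
    ∃ φ : ℝ → ℝ, φ p.1 = p.2 ∧ ContDiffAt ℝ 2 φ p.1 ∧ (∀ᶠ s in 𝓝 p.1, F (s, φ s) = 0) ∧
      ∀ᶠ v in 𝓝 p, F v = 0 → v.2 = φ v.1 := by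
  have h2 : (2 : WithTop ℕ∞) ≠ 0 := by norm_num
  set A := fderiv ℝ F p ∘SL ContinuousLinearMap.inr ℝ ℝ ℝ with hA
  have hA1 : A 1 = b := by
    have h1 : HasDerivAt (fun τ : ℝ => ((p.1, τ) : ℝ × ℝ)) ((0 : ℝ), (1 : ℝ)) p.2 :=
      (hasDerivAt_const _ _).prodMk (hasDerivAt_id _)
    have h3 := ((hF.differentiableAt (by norm_num)).hasFDerivAt).comp_hasDerivAt (f := fun τ : ℝ => ((p.1, τ) : ℝ × ℝ)) p.2 h1
    have := h3.unique hb
    rw [hA]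
    simpa using this
  have hinv : A.IsInvertible := by
    refine ⟨ContinuousLinearEquiv.unitsEquivAut ℝ (Units.mk0 b hb0), ?_⟩
    ext
    simp [hA1]
  refine ⟨hF.implicitFunction h2 hinv, hF.implicitFunction_apply_self h2 hinv,
    hF.contDiffAt_implicitFunction h2 hinv, ?_, ?_⟩
  · filter_upwards [hF.eventually_apply_implicitFunction h2 hinv] with s hs
    rw [hs, hF0]
  · filter_upwards [hF.eventually_apply_eq_iff_implicitFunction h2 hinv] with v hv h
    exact (hv.1 (h.trans hF0.symm)).symm

/-- unit normal field along the curve -/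
def nrm (g : ℝ → ℂ) (η : ℝ) (s : ℝ) : ℂ := η * Complex.I * deriv g s / ‖deriv g s‖

section
variable {g : ℝ → ℂ} {η : ℝ}

lemma nrm_norm (hr : ∀ t, deriv g t ≠ 0) (hη : η ^ 2 = 1) (s : ℝ) : ‖nrm g η s‖ = 1 := by
  have h1 : |η| = 1 := by
    have := sq_abs η
    have h0 := abs_nonneg η
    nlinarith
  have h2 := norm_ne_zero_iff.2 (hr s)
  simp [nrm, h1, h2]

lemma nrm_tan (hr : ∀ t, deriv g t ≠ 0) (hη : η ^ 2 = 1) (s : ℝ) :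
    deriv g s = -Complex.I * nrm g η s * (η * ‖deriv g s‖ : ℝ) := by
  have h2 : (‖deriv g s‖ : ℂ) ≠ 0 := by exact_mod_cast norm_ne_zero_iff.2 (hr s)
  have h3 : (η : ℂ) ^ 2 = 1 := by exact_mod_cast hη
  rw [nrm]; push_cast
  field_simp
  linear_combination (- deriv g s) * h3 + (deriv g s * η ^ 2) * Complex.I_sq

lemma nrm_orth (s : ℝ) : (conj (nrm g η s) * deriv g s).re = 0 := by
  have : conj (nrm g η s) * deriv g s = ((- η * Complex.normSq (deriv g s) / ‖deriv g s‖ : ℝ) : ℂ) * Complex.I := by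
    rw [nrm]; simp only [map_div₀, map_mul, Complex.conj_ofReal, Complex.conj_I]
    push_cast
    rw [Complex.normSq_eq_conj_mul_self]; ring
  rw [this]; simp

lemma nrm_im_ne (hr : ∀ t, deriv g t ≠ 0) (hη : η ^ 2 = 1) (s : ℝ) :
    (conj (nrm g η s) * deriv g s).im ≠ 0 := by
  intro h
  have h1 : conj (nrm g η s) * deriv g s = 0 := Complex.ext (nrm_orth s) h
  rcases mul_eq_zero.1 h1 with h2 | h2
  · have h3 := nrm_norm hr hη s
    rw [(map_eq_zero _).1 h2] at h3
    simp at h3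
  · exact hr s h2

lemma nrm_smooth (hg : ContDiff ℝ (⊤ : ℕ∞) g) (hr : ∀ t, deriv g t ≠ 0) : ContDiff ℝ (⊤ : ℕ∞) (nrm g η) := by
  have h1 := smooth_deriv hg
  have h2 : ContDiff ℝ (⊤ : ℕ∞) (fun s => ‖deriv g s‖) := h1.norm ℝ hr
  have h3 : ContDiff ℝ (⊤ : ℕ∞) (fun s => (‖deriv g s‖ : ℂ)) := Complex.ofRealCLM.contDiff.comp h2
  unfold nrm
  simp only [div_eq_mul_inv]
  exact (contDiff_const.mul h1).mul (h3.inv (fun s => by exact_mod_cast norm_ne_zero_iff.2 (hr s)))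

/-- curvature with respect to the normal field -/
def crv (g : ℝ → ℂ) (η : ℝ) (s : ℝ) : ℝ := kap g (nrm g η s) s

lemma crv_smooth (hg : ContDiff ℝ (⊤ : ℕ∞) g) (hr : ∀ t, deriv g t ≠ 0) : ContDiff ℝ (⊤ : ℕ∞) (crv g η) := by
  have h1 := smooth_deriv hg
  have h2 := smooth_deriv h1
  have h3 : ContDiff ℝ (⊤ : ℕ∞) (fun s => ‖deriv g s‖) := h1.norm ℝ hr
  unfold crv kap
  refine ContDiff.div ?_ (h3.pow 2) (fun s => pow_ne_zero 2 (norm_ne_zero_iff.2 (hr s)))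
  refine Complex.reCLM.contDiff.comp (ContDiff.mul ?_ h2)
  exact (Complex.conjCLE : ℂ →L[ℝ] ℂ).contDiff.comp (nrm_smooth hg hr)

lemma nrm_deriv (hg : ContDiff ℝ (⊤ : ℕ∞) g) (hr : ∀ t, deriv g t ≠ 0) (hη : η ^ 2 = 1) (s : ℝ) :
    HasDerivAt (nrm g η) (-(crv g η s : ℂ) * deriv g s) s := by
  have h1 := smooth_d1 (nrm_smooth (η := η) hg hr) s
  have h2 := smooth_d1 (smooth_deriv hg) s
  set N' := deriv (nrm g η) s with hN'
  set N := nrm g η s with hN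
  have a1 : (conj N' * deriv g s + conj N * deriv (deriv g) s).re = 0 := by
    have := hasDerivAt_re ((hasDerivAt_conj h1).mul h2)
    have hz : HasDerivAt (fun t : ℝ => (conj (nrm g η t) * deriv g t).re) 0 s := by
      simp only [nrm_orth]; exact hasDerivAt_const _ _
    exact this.unique hz
  have a2 : (conj N' * N + conj N * N').re = 0 := by
    have := hasDerivAt_re ((hasDerivAt_conj h1).mul h1)
    have hz : HasDerivAt (fun t : ℝ => (conj (nrm g η t) * nrm g η t).re) 0 s := by
      simp only [unit_conj_mul (nrm_norm hr hη _)]; exact hasDerivAt_const _ _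
    exact this.unique hz
  have hn := unit_conj_mul (nrm_norm hr hη s)
  rw [← hN] at hn
  have ht := nrm_tan hr hη s
  rw [← hN] at ht
  set c : ℝ := η * ‖deriv g s‖ with hc
  have hcn : c ^ 2 = ‖deriv g s‖ ^ 2 := by rw [hc, mul_pow, hη, one_mul]
  have hc0 : c ≠ 0 := by
    intro h
    rw [h] at ht; simp at ht
    exact hr s ht
  have hk : crv g η s = (conj N * deriv (deriv g) s).re / c ^ 2 := by
    rw [crv, kap, hcn]
  have b0 : (conj N * N').re = 0 := by
    have : (conj N' * N).re = (conj N * N').re := by simp; ring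
    rw [Complex.add_re, this] at a2; linarith
  have b1 : (conj N * N').im * c = crv g η s * c ^ 2 := by
    rw [hk, div_mul_cancel₀ _ (pow_ne_zero 2 hc0)]
    rw [Complex.add_re, ht] at a1
    have : (conj N' * (-Complex.I * N * c)).re = - (conj N * N').im * c := by
      simp; ring
    linarith
  have b2 : (conj N * N').im = crv g η s * c := by
    have : c * ((conj N * N').im - crv g η s * c) = 0 := by linear_combination b1
    rcases mul_eq_zero.1 this with h | h
    · exact absurd h hc0
    · linarith
  have b3 : conj N * N' = ((crv g η s * c : ℝ) : ℂ) * Complex.I :=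
    Complex.ext (by simp [b0]) (by rw [b2]; simp)
  have b4 : N' = -(crv g η s : ℂ) * deriv g s := by
    rw [ht]
    push_cast at b3
    linear_combination (-N') * hn + N * b3
  rw [← b4]; exact h1
end

section
variable {Ω : Set ℂ} {J : ℕ} {γ : Fin J → ℝ → ℂ} {j1 j2 : Fin J} {s0 σ0 t0 L : ℝ} {η : ℝ}

lemma on_ray {N z T : ℂ} (hN : ‖N‖ = 1) {c : ℝ} (hc : c ≠ 0) (hT : T = -Complex.I * N * c) (h : (conj T * z).re = 0) :
    z = ((conj N * z).re : ℂ) * N := by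
  have h1 : (conj N * z).im = 0 := by
    have : (conj T * z).re = - c * (conj N * z).im := by rw [hT]; simp; ring
    rw [this] at h
    rcases mul_eq_zero.1 h with h | h
    · exact absurd (neg_eq_zero.1 h) hc
    · exact h
  have h2 : conj N * z = ((conj N * z).re : ℂ) := Complex.ext rfl (by simpa using h1)
  have h3 := unit_conj_mul hN
  linear_combination (-z) * h3 + N * h2

lemma Dom.hit_local (hd : Dom Ω J γ) (hη : η ^ 2 = 1)
    (hit : γ j2 σ0 = γ j1 s0 + t0 * nrm (γ j1) η s0)
    (tr : (conj (nrm (γ j1) η s0) * deriv (γ j2) σ0).im ≠ 0) :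
    ∃ φ : ℝ → ℝ, φ s0 = σ0 ∧ ContDiffAt ℝ 2 φ s0 ∧
      (∀ᶠ s in 𝓝 s0, γ j2 (φ s) = γ j1 s + ((conj (nrm (γ j1) η s) * (γ j2 (φ s) - γ j1 s)).re : ℝ) * nrm (γ j1) η s) ∧
      (∀ᶠ v : ℝ × ℝ in 𝓝 (s0, σ0), (conj (deriv (γ j1) v.1) * (γ j2 v.2 - γ j1 v.1)).re = 0 → v.2 = φ v.1) ∧
      ∀ᶠ v : ℝ × ℝ in 𝓝 (s0, t0), γ j1 v.1 + v.2 * nrm (γ j1) η v.1 ∈ frontier Ω →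
        γ j2 (φ v.1) = γ j1 v.1 + v.2 * nrm (γ j1) η v.1 := by
  set g := γ j1 with hg
  have sg : ContDiff ℝ (⊤ : ℕ∞) g := hd.smooth j1
  have rg : ∀ t, deriv g t ≠ 0 := hd.reg j1
  set N := nrm g η with hN
  have sN : ContDiff ℝ (⊤ : ℕ∞) N := nrm_smooth sg rg
  set F : ℝ × ℝ → ℝ := fun v => (conj (deriv g v.1) * (γ j2 v.2 - g v.1)).re with hF
  have sF : ContDiff ℝ (⊤ : ℕ∞) F := by
    refine Complex.reCLM.contDiff.comp (ContDiff.mul ?_ (ContDiff.sub ?_ ?_))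
    · exact (Complex.conjCLE : ℂ →L[ℝ] ℂ).contDiff.comp ((smooth_deriv sg).comp contDiff_fst)
    · exact (hd.smooth j2).comp contDiff_snd
    · exact sg.comp contDiff_fst
  have orth0 : ∀ s (a : ℝ), (conj (deriv g s) * (a * N s)).re = 0 := by
    intro s a
    have := nrm_orth (g := g) (η := η) s
    rw [← hN] at this
    have h2 : (conj (deriv g s) * (a * N s)).re = a * (conj (N s) * deriv g s).re := by simp; ring
    rw [h2, this, mul_zero]
  have F0 : F (s0, σ0) = 0 := by
    simp only [hF]; rw [hit, add_sub_cancel_left]; exact orth0 _ _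
  have hc0 : ∀ s, η * ‖deriv g s‖ ≠ 0 := by
    intro s
    refine mul_ne_zero ?_ (norm_ne_zero_iff.2 (rg s))
    rintro rfl; norm_num at hη
  have dF : HasDerivAt (fun τ => F (s0, τ)) (conj (deriv g s0) * deriv (γ j2) σ0).re σ0 :=
    hasDerivAt_re (((smooth_d1 (hd.smooth j2) σ0).sub_const (g s0)).const_mul (conj (deriv g s0)))
  have dF0 : (conj (deriv g s0) * deriv (γ j2) σ0).re ≠ 0 := by
    have : (conj (deriv g s0) * deriv (γ j2) σ0).re = - (η * ‖deriv g s0‖) * (conj (N s0) * deriv (γ j2) σ0).im := by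
      have ht := nrm_tan rg hη s0
      rw [← hN] at ht
      set cc := η * ‖deriv g s0‖ with hcc
      rw [ht]
      simp; ring
    rw [this]
    exact mul_ne_zero (neg_ne_zero.2 (hc0 s0)) tr
  obtain ⟨φ, h1, h2, h3, h4⟩ := ift (p := (s0, σ0)) (contDiff_infty.1 sF 2).contDiffAt F0 dF0 dF
  refine ⟨φ, h1, h2, ?_, h4, ?_⟩
  · filter_upwards [h3] with s hs
    have := on_ray (nrm_norm rg hη s) (hc0 s) (nrm_tan rg hη s) hs
    rw [← this]; ring
  · -- frontier points near the hit
    obtain ⟨ε, hε, h4⟩ := Metric.eventually_nhds_iff.1 h4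
    obtain ⟨r, hr, hfar⟩ := hd.far j2 σ0 hε
    have cont : Continuous (fun v : ℝ × ℝ => g v.1 + v.2 * N v.1) := by
      have := sg.continuous
      have := sN.continuous
      fun_prop
    have e1 : ∀ᶠ v : ℝ × ℝ in 𝓝 (s0, t0), dist (g v.1 + v.2 * N v.1) (γ j2 σ0) < r := by
      have : Tendsto (fun v : ℝ × ℝ => g v.1 + v.2 * N v.1) (𝓝 (s0, t0)) (𝓝 (γ j2 σ0)) := by
        rw [hit]; exact cont.tendsto (s0, t0)
      exact this (Metric.ball_mem_nhds _ hr)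
    have e2 : ∀ᶠ v : ℝ × ℝ in 𝓝 (s0, t0), dist v.1 s0 < ε :=
      (continuous_fst.tendsto (s0, t0)) (Metric.ball_mem_nhds _ hε)
    filter_upwards [e1, e2] with v hv1 hv2 hfr
    obtain ⟨τ, hτ, hτ2⟩ := hfar _ hfr hv1
    have hF1 : F (v.1, τ) = 0 := by
      simp only [hF]; rw [hτ2, add_sub_cancel_left]; exact orth0 _ _
    have := h4 (y := (v.1, τ)) (by rw [Prod.dist_eq]; exact max_lt hv2 (by simpa [Real.dist_eq] using hτ)) hF1
    rw [← this, hτ2]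

lemma Dom.near_start (hd : Dom Ω J γ) (hη : η ^ 2 = 1) (j1 : Fin J) (s0 : ℝ) :
    ∀ᶠ v : ℝ × ℝ in 𝓝 (s0, 0), v.2 ≠ 0 → γ j1 v.1 + v.2 * nrm (γ j1) η v.1 ∉ frontier Ω := by
  obtain ⟨φ, h1, h2, h3, h4, h5⟩ := hd.hit_local (j1 := j1) (j2 := j1) (s0 := s0) (σ0 := s0) (t0 := 0) hη (by simp)
    (nrm_im_ne (hd.reg j1) hη s0)
  have e1 : ∀ᶠ s in 𝓝 s0, s = φ s := by
    have : Tendsto (fun s : ℝ => (s, s)) (𝓝 s0) (𝓝 (s0, s0)) := (Continuous.prodMk continuous_id continuous_id).tendsto s0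
    filter_upwards [this.eventually h4] with s hs
    exact hs (by simp)
  have e2 : ∀ᶠ v : ℝ × ℝ in 𝓝 (s0, 0), v.1 = φ v.1 := (continuous_fst.tendsto (s0, (0:ℝ))).eventually e1
  filter_upwards [h5, e2] with v hv hv2 hne hfr
  have := hv hfr
  rw [← hv2] at this
  have h6 : (v.2 : ℂ) * nrm (γ j1) η v.1 = 0 := by linear_combination -this
  rcases mul_eq_zero.1 h6 with h | h
  · exact hne (by exact_mod_cast h)
  · have h7 := nrm_norm (hd.reg j1) hη v.1
    rw [h] at h7; simp at h7

lemma Chord.stable (hd : Dom Ω J γ) (hη : η ^ 2 = 1)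
    (c : Chord Ω γ j1 j2 s0 σ0 L (nrm (γ j1) η s0)) :
    ∃ φ : ℝ → ℝ, φ s0 = σ0 ∧ ContDiffAt ℝ 2 φ s0 ∧ ∀ᶠ s in 𝓝 s0,
      Chord Ω γ j1 j2 s (φ s) (conj (nrm (γ j1) η s) * (γ j2 (φ s) - γ j1 s)).re (nrm (γ j1) η s) := by
  obtain ⟨φ, h1, h2, h3, h4, h5⟩ := hd.hit_local hη c.hit c.trans
  refine ⟨φ, h1, h2, ?_⟩
  set g := γ j1 with hg
  have sg : ContDiff ℝ (⊤ : ℕ∞) g := hd.smooth j1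
  have rg : ∀ t, deriv g t ≠ 0 := hd.reg j1
  set N := nrm g η with hN
  have sN : ContDiff ℝ (⊤ : ℕ∞) N := nrm_smooth sg rg
  have cg := sg.continuous
  have cN := sN.continuous
  have cφ : ContinuousAt φ s0 := h2.continuousAt
  have c2 := (hd.smooth j2).continuous
  set Ls : ℝ → ℝ := fun s => (conj (N s) * (γ j2 (φ s) - g s)).re with hLs
  have cLs : ContinuousAt Ls s0 := by
    refine Complex.continuous_re.continuousAt.comp (ContinuousAt.mul ?_ (ContinuousAt.sub ?_ cg.continuousAt))
    · exact (Complex.continuous_conj.comp cN).continuousAt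
    · exact c2.continuousAt.comp cφ
  have L0 : Ls s0 = L := by
    simp only [hLs]
    rw [h1, c.hit, add_sub_cancel_left, mul_left_comm, unit_conj_mul c.hν]; simp
  have cont : Continuous (fun v : ℝ × ℝ => g v.1 + v.2 * N v.1) := by fun_prop
  have hL := c.hL
  -- avoid the frontier
  have cLs2 : ∀ t, Tendsto (fun v : ℝ × ℝ => v.2 - Ls v.1) (𝓝 (s0, t)) (𝓝 (t - L)) := by
    intro t
    have a1 : Tendsto (fun v : ℝ × ℝ => Ls v.1) (𝓝 (s0, t)) (𝓝 L) := by
      have : Tendsto Ls (𝓝 s0) (𝓝 L) := by rw [← L0]; exact cLs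
      exact this.comp (continuous_fst.tendsto (s0, t))
    exact (continuous_snd.tendsto (s0, t)).sub a1
  have av : ∀ᶠ s in 𝓝 s0, ∀ t ∈ Icc 0 (L + 1), 0 < t → t < Ls s → g s + t * N s ∉ frontier Ω := by
    refine isCompact_Icc.eventually_forall_of_forall_eventually (fun t ht => ?_)
    rcases ht.1.eq_or_lt with h | h
    · subst h
      filter_upwards [hd.near_start hη j1 s0] with v hv a b
      exact hv a.ne'
    rcases lt_trichotomy t L with h' | h' | h'
    · have : ∀ᶠ v : ℝ × ℝ in 𝓝 (s0, t), g v.1 + v.2 * N v.1 ∈ Ω :=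
        (cont.tendsto (s0, t)) (hd.op.mem_nhds (c.ins t ⟨h, h'⟩))
      filter_upwards [this] with v hv _ _ hf
      rw [hd.op.frontier_eq] at hf
      exact hf.2 hv
    · subst h'
      filter_upwards [h5] with v hv _ hlt hf
      have := hv hf
      have h6 : Ls v.1 = v.2 := by
        simp only [hLs]
        rw [this, add_sub_cancel_left, mul_left_comm, unit_conj_mul (nrm_norm rg hη v.1)]; simp
      linarith
    · have := (cLs2 t).eventually (lt_mem_nhds (show (0:ℝ) < t - L by linarith))
      filter_upwards [this] with v hv _ hlt
      linarith
  have e1 : ∀ᶠ s in 𝓝 s0, Ls s < L + 1 := cLs.eventually (gt_mem_nhds (by rw [L0]; linarith))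
  have e2 : ∀ᶠ s in 𝓝 s0, L / 2 < Ls s := cLs.eventually (lt_mem_nhds (by rw [L0]; linarith))
  have e3 : ∀ᶠ s in 𝓝 s0, g s + (L / 2 : ℝ) * N s ∈ Ω := by
    have : Continuous (fun s => g s + (L / 2 : ℝ) * N s) := by fun_prop
    exact (this.tendsto s0) (hd.op.mem_nhds (c.ins (L/2) ⟨by linarith, by linarith⟩))
  have e4 : ∀ᶠ s in 𝓝 s0, (conj (N s) * deriv (γ j2) (φ s)).im ≠ 0 := by
    have : ContinuousAt (fun s => (conj (N s) * deriv (γ j2) (φ s)).im) s0 := by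
      refine Complex.continuous_im.continuousAt.comp (ContinuousAt.mul ?_ ?_)
      · exact (Complex.continuous_conj.comp cN).continuousAt
      · exact (smooth_deriv (hd.smooth j2)).continuous.continuousAt.comp cφ
    exact this.eventually_ne (by rw [h1]; exact c.trans)
  filter_upwards [av, e1, e2, e3, e4, h3] with s hav a1 a2 a3 a4 a5
  refine ⟨by linarith, nrm_norm rg hη s, a5, nrm_orth s, ?_, a4⟩
  have hpc : IsPreconnected ((fun t : ℝ => g s + t * N s) '' Ioo 0 (Ls s)) :=
    isPreconnected_Ioo.image _ (by fun_prop)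
  have hdis : Disjoint ((fun t : ℝ => g s + t * N s) '' Ioo 0 (Ls s)) (frontier Ω) := by
    rw [Set.disjoint_left]
    rintro _ ⟨t, ht, rfl⟩
    exact hav t ⟨ht.1.le, by linarith [ht.2]⟩ ht.1 ht.2
  have hmid : g s + (L / 2 : ℝ) * N s ∈ (fun t : ℝ => g s + t * N s) '' Ioo 0 (Ls s) :=
    ⟨L/2, ⟨by linarith, a2⟩, rfl⟩
  rcases side_of_preconnected hd.op hpc hdis with h | h
  · exact fun t ht => h ⟨t, ht, rfl⟩
  · exact absurd (subset_closure a3) (Set.disjoint_left.1 h hmid)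
end
end Rig

namespace Rig
open Filter Topology ComplexConjugate

section
variable {Ω : Set ℂ} {J : ℕ} {γ : Fin J → ℝ → ℂ} {j1 j2 : Fin J} {s0 σ0 t0 L : ℝ} {η : ℝ}

lemma Chord.arc {u : ℕ → ℂ → ℝ} {D : ℕ → ℂ → ℂ →L[ℝ] ℝ}
    {H : ℕ → ℂ → ℂ →L[ℝ] ℂ →L[ℝ] ℝ} {μ : ℕ → ℝ} (hd : Dom Ω J γ) (hη : η ^ 2 = 1)
    (c : Chord Ω γ j1 j2 s0 σ0 L (nrm (γ j1) η s0)) (sq : Sq Ω γ j1 u D H μ)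
    (hκ : crv (γ j1) η s0 ≠ 0) :
    ∃ (x0 : ℂ) (R : ℝ), 0 < R ∧ ∀ᶠ s in 𝓝 s0, ‖γ j1 s - x0‖ = R := by
  obtain ⟨φ, h1, h2, h3⟩ := c.stable hd hη
  set g := γ j1 with hg
  have sg : ContDiff ℝ (⊤ : ℕ∞) g := hd.smooth j1
  have rg : ∀ t, deriv g t ≠ 0 := hd.reg j1
  set N := nrm g η with hN
  set κ := crv g η with hκd
  have dN : ∀ s, HasDerivAt N (-(κ s : ℂ) * deriv g s) s := nrm_deriv sg rg hη
  have dg : ∀ s, HasDerivAt g (deriv g s) s := smooth_d1 sg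
  set Ls : ℝ → ℝ := fun s => (conj (N s) * (γ j2 (φ s) - g s)).re with hLs
  have ev2 := h2.eventually (by simp)
  obtain ⟨r, hr, hall⟩ := Metric.eventually_nhds_iff_ball.1 (h3.and ev2)
  have hch : ∀ s ∈ Metric.ball s0 r, Chord Ω γ j1 j2 s (φ s) (Ls s) (N s) := fun s hs => (hall s hs).1
  have hpc : IsPreconnected (Metric.ball s0 r) := (convex_ball s0 r).isPreconnected
  have hs0 : s0 ∈ Metric.ball s0 r := Metric.mem_ball_self hr
  have dL : ∀ s ∈ Metric.ball s0 r, HasDerivAt Ls 0 s := by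
    intro s hs
    have ch := hch s hs
    obtain ⟨ho, -⟩ := ch.lim hd sq
    have dφ : HasDerivAt φ (deriv φ s) s := ((hall s hs).2.differentiableAt (by norm_num)).hasDerivAt
    have d2 : HasDerivAt (fun s => γ j2 (φ s)) (deriv φ s • deriv (γ j2) (φ s)) s :=
      (smooth_d1 (hd.smooth j2) (φ s)).scomp s dφ
    have := hasDerivAt_re ((hasDerivAt_conj (dN s)).mul (d2.sub (dg s)))
    refine this.congr_deriv ?_
    have hit := ch.hit
    have e1 : γ j2 (φ s) - g s = Ls s * N s := by rw [hit]; ring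
    have o1 : (conj (N s) * deriv g s).re = 0 := ch.orth
    rw [Pi.sub_apply, e1, Complex.real_smul]
    have e2 : (conj (-(κ s : ℂ) * deriv g s) * (Ls s * N s)).re = - κ s * Ls s * (conj (N s) * deriv g s).re := by
      simp; ring
    have e3 : (conj (N s) * ((deriv φ s : ℝ) * deriv (γ j2) (φ s) - deriv g s)).re =
      deriv φ s * (conj (N s) * deriv (γ j2) (φ s)).re - (conj (N s) * deriv g s).re := by
      simp; ring
    rw [Complex.add_re, e2, e3, o1, ho]; ring
  have Lc : ∀ s ∈ Metric.ball s0 r, Ls s = Ls s0 := fun s hs =>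
    Metric.isOpen_ball.is_const_of_deriv_eq_zero hpc (fun x hx => (dL x hx).differentiableAt.differentiableWithinAt)
      (fun x hx => (dL x hx).deriv) hs hs0
  obtain ⟨-, C, hC, hC1, hC2⟩ := (hch s0 hs0).lim hd sq
  have hLpos : 0 < Ls s0 := (hch s0 hs0).hL
  set ℓ := Ls s0 with hℓ
  have hC0 : 0 ≤ C := by rw [← hC1]; positivity
  have hCne : C ≠ 0 := by
    intro h
    rw [h] at hC1 hC2
    have : kap (γ j2) (N s0) (φ s0) = 0 := by simpa using hC2
    rw [this] at hC1; norm_num at hC1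
  have hk : ∀ s ∈ Metric.ball s0 r, ∃ k2 : ℝ, (1 + k2 * ℓ) ^ 2 = C ∧ k2 ^ 2 = C * κ s ^ 2 := by
    intro s hs
    obtain ⟨-, C', hC', a1, a2⟩ := (hch s hs).lim hd sq
    have : C' = C := tendsto_nhds_unique hC' hC
    subst this
    rw [Lc s hs] at a1
    exact ⟨_, a1, a2⟩
  set T : Set ℝ := {x | ∃ k2 : ℝ, (1 + k2 * ℓ) ^ 2 = C ∧ k2 ^ 2 = C * x ^ 2} with hT
  have hTf : T.Finite := by
    set a : ℝ := (√C - 1) / ℓ / √C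
    set b : ℝ := (-√C - 1) / ℓ / √C
    refine Set.Finite.subset (s := {a, -a, b, -b}) (by simp) ?_
    rintro x ⟨k2, hk1, hk2⟩
    have hsq : √C ^ 2 = C := Real.sq_sqrt hC0
    have hsp : √C ≠ 0 := (Real.sqrt_pos.2 (lt_of_le_of_ne hC0 (Ne.symm hCne))).ne'
    have p1 : 1 + k2 * ℓ = √C ∨ 1 + k2 * ℓ = -√C := sq_eq_sq_iff_eq_or_eq_neg.1 (by rw [hk1, hsq])
    have p2 : k2 = √C * x ∨ k2 = -(√C * x) := sq_eq_sq_iff_eq_or_eq_neg.1 (by rw [hk2, mul_pow, hsq])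
    have hl : ℓ ≠ 0 := hLpos.ne'
    simp only [mem_insert_iff, mem_singleton_iff]
    rcases p1 with p1 | p1 <;> rcases p2 with p2 | p2
    · left; simp only [a]; rw [p2] at p1; field_simp; first | linear_combination p1 | linear_combination -p1
    · right; left; simp only [a]; rw [p2] at p1; field_simp; first | linear_combination p1 | linear_combination -p1
    · right; right; left; simp only [b]; rw [p2] at p1; field_simp; first | linear_combination p1 | linear_combination -p1
    · right; right; right; simp only [b]; rw [p2] at p1; field_simp; first | linear_combination p1 | linear_combination -p1
  have sκ : ContDiff ℝ (⊤ : ℕ∞) κ := crv_smooth sg rg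
  obtain ⟨k, -, hkc⟩ := hpc.eqOn_const_of_mapsTo hTf.isDiscrete sκ.continuous.continuousOn (fun s hs => hk s hs) ⟨_, hk s0 hs0⟩
  have hκc : ∀ s ∈ Metric.ball s0 r, κ s = κ s0 := fun s hs => by rw [hkc hs, hkc hs0]; rfl
  set K := κ s0 with hK
  have hKc : (K : ℂ) ≠ 0 := by exact_mod_cast hκ
  set P : ℝ → ℂ := fun s => g s + N s / K with hP
  have dP : ∀ s ∈ Metric.ball s0 r, HasDerivAt P 0 s := by
    intro s hs
    refine ((dg s).add ((dN s).div_const (K : ℂ))).congr_deriv ?_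
    rw [hκc s hs]; field_simp; ring
  have Pc : ∀ s ∈ Metric.ball s0 r, P s = P s0 := fun s hs =>
    Metric.isOpen_ball.is_const_of_deriv_eq_zero hpc (fun x hx => (dP x hx).differentiableAt.differentiableWithinAt)
      (fun x hx => (dP x hx).deriv) hs hs0
  refine ⟨P s0, 1 / |K|, by positivity, ?_⟩
  filter_upwards [Metric.ball_mem_nhds s0 hr] with s hs
  rw [← Pc s hs]
  have : g s - P s = - (N s / K) := by simp only [hP]; ring
  rw [this, norm_neg, norm_div, nrm_norm rg hη]
  simp
end
end Rig

namespace Rig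
open Filter Topology ComplexConjugate

lemma nrm_eta (g : ℝ → ℂ) (η s : ℝ) : nrm g η s = η * nrm g 1 s := by
  simp only [nrm]; push_cast; ring

lemma crv_eta (g : ℝ → ℂ) (η s : ℝ) : crv g η s = η * crv g 1 s := by
  simp only [crv, kap]
  rw [nrm_eta g η]
  have : (conj ((η : ℂ) * nrm g 1 s) * deriv (deriv g) s).re = η * (conj (nrm g 1 s) * deriv (deriv g) s).re := by
    simp; ring
  rw [this]; ring

lemma periodic_deriv {g : ℝ → ℂ} {c : ℝ} (h : Function.Periodic g c) : Function.Periodic (deriv g) c := by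
  intro x
  have : (fun y => g (y + c)) = g := funext h
  rw [← deriv_comp_add_const, this]

lemma max_crv {g : ℝ → ℂ} (hg : ContDiff ℝ (⊤ : ℕ∞) g) (hr : ∀ t, deriv g t ≠ 0)
    (hp : Function.Periodic g (2 * π)) :
    ∃ s, crv g 1 s ≠ 0 ∧ HasDerivAt (crv g 1) 0 s := by
  have p1 := periodic_deriv hp
  have p2 := periodic_deriv p1
  have pN : Function.Periodic (nrm g 1) (2 * π) := fun s => by simp only [nrm, p1 s]
  have pc : Function.Periodic (crv g 1) (2 * π) := fun s => by simp only [crv, kap, p1 s, p2 s, pN s]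
  have sc : ContDiff ℝ (⊤ : ℕ∞) (crv g 1) := crv_smooth hg hr
  have hpi : (0:ℝ) < 2 * π := by positivity
  obtain ⟨s, hs, hmax⟩ := isCompact_Icc.exists_isMaxOn (nonempty_Icc.2 hpi.le)
    ((sc.continuous.pow 2).continuousOn (s := Icc 0 (2 * π)))
  have hglob : ∀ t, crv g 1 t ^ 2 ≤ crv g 1 s ^ 2 := by
    intro t
    obtain ⟨y, hy, hyt⟩ := pc.exists_mem_Ico₀ hpi t
    rw [hyt]; exact hmax ⟨hy.1, hy.2.le⟩
  have hd := (sc.differentiable (by simp) s).hasDerivAt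
  have hne : crv g 1 s ≠ 0 := by
    intro h0
    have hz : ∀ t, crv g 1 t = 0 := by
      intro t
      have := hglob t
      rw [h0] at this
      exact pow_eq_zero_iff (two_ne_zero) |>.1 (le_antisymm (by simpa using this) (sq_nonneg _))
    have hN : ∀ t, HasDerivAt (nrm g 1) 0 t := fun t => by
      have := nrm_deriv hg hr (η := 1) (by norm_num) t
      rw [hz t] at this; simpa using this
    have hNc : ∀ t, nrm g 1 t = nrm g 1 0 := fun t =>
      is_const_of_deriv_eq_zero (fun x => (hN x).differentiableAt) (fun x => (hN x).deriv) t 0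
    have d2 : ∀ t, HasDerivAt (fun t => (conj (nrm g 1 0) * g t).im) (conj (nrm g 1 0) * deriv g t).im t :=
      fun t => hasDerivAt_im ((smooth_d1 hg t).const_mul _)
    obtain ⟨t, -, ht⟩ := exists_hasDerivAt_eq_zero hpi
      (fun x _ => (d2 x).continuousAt.continuousWithinAt) (by have := hp 0; rw [zero_add] at this; simp only [this]) (fun x _ => d2 x)
    rw [← hNc t] at ht
    exact nrm_im_ne hr (η := 1) (by norm_num) t ht
  refine ⟨s, hne, ?_⟩
  have h1 : HasDerivAt (fun t => crv g 1 t ^ 2) (2 * crv g 1 s * deriv (crv g 1) s) s := by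
    exact (hd.pow 2).congr_deriv (by simp)
  have h2 : IsLocalMax (fun t => crv g 1 t ^ 2) s := Filter.Eventually.of_forall hglob
  have h3 := h2.hasDerivAt_eq_zero h1
  have h4 : deriv (crv g 1) s = 0 := by
    rcases mul_eq_zero.1 h3 with h | h
    · exact absurd h (mul_ne_zero two_ne_zero hne)
    · exact h
  rwa [h4] at hd

section
variable {Ω : Set ℂ} {J : ℕ} {γ : Fin J → ℝ → ℂ}

lemma Dom.start (hd : Dom Ω J γ) (j : Fin J) (s0 : ℝ) : ∃ η : ℝ, η ^ 2 = 1 ∧ ∃ ε > 0,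
    ∀ s ∈ Metric.ball s0 ε, ∀ t ∈ Ioo 0 ε, γ j s + t * nrm (γ j) η s ∈ Ω := by
  obtain ⟨h1, h2⟩ := unit_tangent (hd.reg j s0)
  set e := deriv (γ j) s0 / ‖deriv (γ j) s0‖ with he
  have hN : nrm (γ j) 1 s0 = e * Complex.I := by rw [nrm, he]; push_cast; ring
  obtain ⟨δ, h, -, -, f, S, c, -⟩ := hd.ch j s0 h1 (by
    rw [h2, Complex.ofReal_re]; exact norm_ne_zero_iff.2 (hd.reg j s0)) one_pos
  obtain ⟨η, hη, hin⟩ : ∃ η : ℝ, η ^ 2 = 1 ∧ ∀ t ∈ Ioo 0 h, γ j s0 + t * nrm (γ j) η s0 ∈ Ω := by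
    rcases c.one_side hd.op with h3 | h3
    · refine ⟨1, by norm_num, fun t ht => h3 ⟨0, t, by simpa using c.hδ, by rw [c.f0]; exact ht.1, ht.2, ?_⟩⟩
      rw [hN]; push_cast; ring
    · refine ⟨-1, by norm_num, fun t ht => h3 ⟨0, t, by simpa using c.hδ, by simp [c.f0]; exact ht.1, ht.2, ?_⟩⟩
      rw [nrm_eta, hN]; push_cast; ring
  refine ⟨η, hη, ?_⟩
  obtain ⟨ε, hε, hav⟩ := Metric.eventually_nhds_iff.1 (hd.near_start hη j s0)
  refine ⟨ε, hε, ?_⟩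
  have cg := (hd.smooth j).continuous
  have cN := (nrm_smooth (η := η) (hd.smooth j) (hd.reg j)).continuous
  set A := (fun v : ℝ × ℝ => γ j v.1 + v.2 * nrm (γ j) η v.1) '' (Metric.ball s0 ε ×ˢ Ioo 0 ε) with hA
  have hpc : IsPreconnected A :=
    ((convex_ball s0 ε).isPreconnected.prod isPreconnected_Ioo).image _ (by fun_prop)
  have hdis : Disjoint A (frontier Ω) := by
    rw [Set.disjoint_left]
    rintro _ ⟨v, ⟨hv1, hv2⟩, rfl⟩
    refine hav (y := v) ?_ hv2.1.ne'
    rw [Prod.dist_eq]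
    exact max_lt hv1 (by rw [Real.dist_eq, sub_zero, abs_of_pos hv2.1]; exact hv2.2)
  have hh := c.hh
  set t := min ε h / 2 with ht
  have hm : 0 < min ε h := lt_min hε hh
  have t1 : t < ε := by have := min_le_left ε h; linarith
  have t2 : t < h := by have := min_le_right ε h; linarith
  have t3 : 0 < t := by linarith
  rcases side_of_preconnected hd.op hpc hdis with h3 | h3
  · intro s hs t ht
    exact h3 ⟨(s, t), ⟨hs, ht⟩, rfl⟩
  · exact absurd (subset_closure (hin t ⟨t3, t2⟩))
      (Set.disjoint_left.1 h3 ⟨(s0, t), ⟨Metric.mem_ball_self hε, t3, t1⟩, rfl⟩)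

lemma Dom.first_hit (hd : Dom Ω J γ) {q ν : ℂ} (hν : ‖ν‖ = 1) {ε : ℝ} (hε : 0 < ε)
    (h : ∀ t ∈ Ioo 0 ε, q + t * ν ∈ Ω) :
    ∃ T : ℝ, 0 < T ∧ (∀ t ∈ Ioo 0 T, q + t * ν ∈ Ω) ∧ q + T * ν ∈ frontier Ω := by
  set B : Set ℝ := {t | ε / 2 ≤ t ∧ q + t * ν ∉ Ω} with hB
  have hc : Continuous (fun t : ℝ => q + t * ν) := by fun_prop
  have hBc : IsClosed B := isClosed_Ici.inter (hd.op.isClosed_compl.preimage hc)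
  have hBn : B.Nonempty := by
    obtain ⟨R, hR⟩ := hd.bdd.subset_ball 0
    refine ⟨max ε (|R| + ‖q‖), le_trans (by linarith) (le_max_left _ _), fun hin => ?_⟩
    have h1 := hR hin
    rw [mem_ball_zero_iff] at h1
    set t := max ε (|R| + ‖q‖)
    have h2 : ‖(t : ℂ) * ν‖ = t := by
      rw [norm_mul, hν, mul_one, Complex.norm_real, Real.norm_eq_abs, abs_of_pos (lt_of_lt_of_le hε (le_max_left _ _))]
    have h3 : ‖(t : ℂ) * ν‖ ≤ ‖q + t * ν‖ + ‖q‖ := by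
      have := norm_sub_le (q + t * ν) q
      simpa using this
    have h4 : |R| + ‖q‖ ≤ t := le_max_right _ _
    have := le_abs_self R
    linarith
  have hBb : BddBelow B := ⟨ε / 2, fun t ht => ht.1⟩
  have hT := hBc.csInf_mem hBn hBb
  set T := sInf B with hTd
  have hT0 : 0 < T := by linarith [hT.1]
  have hins : ∀ t ∈ Ioo 0 T, q + t * ν ∈ Ω := by
    intro t ht
    by_cases h1 : t < ε
    · exact h t ⟨ht.1, h1⟩
    · by_contra h2
      have : T ≤ t := csInf_le hBb ⟨by linarith, h2⟩
      linarith [ht.2]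
  refine ⟨T, hT0, hins, ?_⟩
  rw [hd.op.frontier_eq]
  refine ⟨?_, hT.2⟩
  have : T ∈ closure (Ioo 0 T) := by rw [closure_Ioo hT0.ne]; exact ⟨hT0.le, le_rfl⟩
  exact map_mem_closure (f := fun t : ℝ => q + t * ν) hc this hins
end

lemma sard_proj {G : ℝ × ℝ → ℝ} (hG : ContDiff ℝ 2 G) :
    volume (Prod.fst '' {v : ℝ × ℝ | G v = 0 ∧ fderiv ℝ G v (0, 1) = 0 ∧ fderiv ℝ G v (1, 0) ≠ 0}) = 0 := by
  set A := {v : ℝ × ℝ | G v = 0 ∧ fderiv ℝ G v (0, 1) = 0 ∧ fderiv ℝ G v (1, 0) ≠ 0} with hA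
  have key : (OuterMeasure.comap (Prod.fst : ℝ × ℝ → ℝ) (volume : Measure ℝ).toOuterMeasure) A = 0 := by
    apply measure_null_of_locally_null
    rintro ⟨s1, σ1⟩ ⟨h0, -, hs⟩
    have hswap : ContDiff ℝ 2 (fun v : ℝ × ℝ => G (v.2, v.1)) := hG.comp (contDiff_snd.prodMk contDiff_fst)
    have dG : ∀ v, HasFDerivAt G (fderiv ℝ G v) v := fun v => (hG.differentiable (by norm_num) v).hasFDerivAt
    have d1 : HasDerivAt (fun s => G (s, σ1)) (fderiv ℝ G (s1, σ1) (1, 0)) s1 :=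
      (dG (s1, σ1)).comp_hasDerivAt (f := fun s : ℝ => (s, σ1)) s1 ((hasDerivAt_id _).prodMk (hasDerivAt_const _ _))
    obtain ⟨φ, a1, a2, a3, a4⟩ := ift (F := fun v : ℝ × ℝ => G (v.2, v.1)) (p := (σ1, s1)) hswap.contDiffAt h0 hs d1
    simp only at a1 a2 a3 a4
    have a5 := a2.eventually (by simp)
    obtain ⟨r, hr, hV⟩ := Metric.eventually_nhds_iff_ball.1 (a3.and a5)
    have a4' : ∀ᶠ v : ℝ × ℝ in 𝓝 (s1, σ1), G v = 0 → v.1 = φ v.2 := by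
      have : Tendsto (fun v : ℝ × ℝ => (v.2, v.1)) (𝓝 (s1, σ1)) (𝓝 (σ1, s1)) :=
        (continuous_snd.prodMk continuous_fst).tendsto (s1, σ1)
      exact this.eventually a4
    have a6 : ∀ᶠ v : ℝ × ℝ in 𝓝 (s1, σ1), v.2 ∈ Metric.ball σ1 r :=
      (continuous_snd.tendsto (s1, σ1)) (Metric.ball_mem_nhds _ hr)
    refine ⟨A ∩ {v | (G v = 0 → v.1 = φ v.2) ∧ v.2 ∈ Metric.ball σ1 r},
      inter_mem self_mem_nhdsWithin (mem_nhdsWithin_of_mem_nhds (a4'.and a6)), ?_⟩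
    rw [OuterMeasure.comap_apply]
    have hsub : Prod.fst '' (A ∩ {v | (G v = 0 → v.1 = φ v.2) ∧ v.2 ∈ Metric.ball σ1 r}) ⊆
        φ '' {σ | σ ∈ Metric.ball σ1 r ∧ HasDerivAt φ 0 σ} := by
      rintro _ ⟨v, ⟨⟨b1, b2, b3⟩, b4, b5⟩, rfl⟩
      have b6 := b4 b1
      refine ⟨v.2, ⟨b5, ?_⟩, b6.symm⟩
      have dφ : HasDerivAt φ (deriv φ v.2) v.2 := (((hV v.2 b5).2).differentiableAt (by norm_num)).hasDerivAt
      have e1 : HasDerivAt (fun σ => G (φ σ, σ)) (fderiv ℝ G (φ v.2, v.2) (deriv φ v.2, 1)) v.2 :=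
        (dG (φ v.2, v.2)).comp_hasDerivAt (f := fun σ : ℝ => (φ σ, σ)) v.2 (dφ.prodMk (hasDerivAt_id _))
      have e2 : HasDerivAt (fun σ => G (φ σ, σ)) 0 v.2 := by
        refine (hasDerivAt_const v.2 (0:ℝ)).congr_of_eventuallyEq ?_
        filter_upwards [Metric.isOpen_ball.mem_nhds b5] with σ hσ using (hV σ hσ).1
      have e3 := e1.unique e2
      rw [← b6] at e3
      have e4 : ((deriv φ v.2, 1) : ℝ × ℝ) = deriv φ v.2 • (1, 0) + (0, 1) := by simp
      rw [e4, map_add, map_smul, b2, add_zero, smul_eq_mul] at e3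
      rcases mul_eq_zero.1 e3 with h | h
      · rwa [h] at dφ
      · exact absurd h b3
    refine measure_mono_null hsub ?_
    refine addHaar_image_eq_zero_of_det_fderivWithin_eq_zero (f' := fun _ => 0) volume (fun σ hσ => ?_) (fun σ _ => by simp)
    have := hσ.2.hasFDerivAt.hasFDerivWithinAt (s := {σ | σ ∈ Metric.ball σ1 r ∧ HasDerivAt φ 0 σ})
    exact this.congr_fderiv (by ext; simp)
  rwa [OuterMeasure.comap_apply] at key
end Rig

namespace Rig
open Filter Topology ComplexConjugate

section
variable {Ω : Set ℂ} {J : ℕ} {γ : Fin J → ℝ → ℂ}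

lemma Dom.per_deriv (hd : Dom Ω J γ) {j : Fin J} {σ τ : ℝ} (h : γ j σ = γ j τ) :
    deriv (γ j) σ = deriv (γ j) τ := by
  obtain ⟨n, hn⟩ := hd.inj j σ τ h
  have := (periodic_deriv (hd.per j)).int_mul n τ
  rw [← this, ← hn]; congr 1; ring

/-- The evolute point at `s` lies on the boundary with tangent parallel to the normal at `s`. -/
def EvP (γ : Fin J → ℝ → ℂ) (j0 : Fin J) (η : ℝ) (s : ℝ) : Prop :=
  ∃ j, ∃ σ ∈ Icc (0:ℝ) (2 * π), γ j σ = γ j0 s + nrm (γ j0) η s / crv (γ j0) η s ∧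
    (conj (nrm (γ j0) η s) * deriv (γ j) σ).im = 0

lemma Dom.tangential_null (hd : Dom Ω J γ) (j0 : Fin J) {η : ℝ} (hη : η ^ 2 = 1) {U : Set ℝ}
    (h : ∀ s ∈ U, ∃ (T : ℝ) (j : Fin J) (σ : ℝ), γ j σ = γ j0 s + T * nrm (γ j0) η s ∧
      (conj (nrm (γ j0) η s) * deriv (γ j) σ).im = 0) :
    volume {s ∈ U | ¬ EvP γ j0 η s} = 0 := by
  set g := γ j0 with hg
  have sg : ContDiff ℝ (⊤ : ℕ∞) g := hd.smooth j0
  have rg : ∀ t, deriv g t ≠ 0 := hd.reg j0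
  set N := nrm g η with hN
  set G : Fin J → ℝ × ℝ → ℝ := fun j v => (conj (deriv g v.1) * (γ j v.2 - g v.1)).re with hG
  have sG : ∀ j, ContDiff ℝ (⊤ : ℕ∞) (G j) := by
    intro j
    refine Complex.reCLM.contDiff.comp (ContDiff.mul ?_ (ContDiff.sub ?_ ?_))
    · exact (Complex.conjCLE : ℂ →L[ℝ] ℂ).contDiff.comp ((smooth_deriv sg).comp contDiff_fst)
    · exact (hd.smooth j).comp contDiff_snd
    · exact sg.comp contDiff_fst
  have dG : ∀ j v, HasFDerivAt (G j) (fderiv ℝ (G j) v) v := fun j v =>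
    ((sG j).differentiable (by simp) v).hasFDerivAt
  have g1 : ∀ j s σ, fderiv ℝ (G j) (s, σ) (0, 1) = (conj (deriv g s) * deriv (γ j) σ).re := by
    intro j s σ
    have a1 : HasDerivAt (fun τ => G j (s, τ)) (fderiv ℝ (G j) (s, σ) (0, 1)) σ :=
      (dG j (s, σ)).comp_hasDerivAt (f := fun τ : ℝ => (s, τ)) σ ((hasDerivAt_const _ _).prodMk (hasDerivAt_id _))
    have a2 : HasDerivAt (fun τ => G j (s, τ)) (conj (deriv g s) * deriv (γ j) σ).re σ :=
      hasDerivAt_re (((smooth_d1 (hd.smooth j) σ).sub_const (g s)).const_mul (conj (deriv g s)))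
    exact a1.unique a2
  have g2 : ∀ j s σ, fderiv ℝ (G j) (s, σ) (1, 0) =
      (conj (deriv (deriv g) s) * (γ j σ - g s) + conj (deriv g s) * (-deriv g s)).re := by
    intro j s σ
    have a1 : HasDerivAt (fun τ => G j (τ, σ)) (fderiv ℝ (G j) (s, σ) (1, 0)) s :=
      (dG j (s, σ)).comp_hasDerivAt (f := fun τ : ℝ => (τ, σ)) s ((hasDerivAt_id _).prodMk (hasDerivAt_const _ _))
    have a2 : HasDerivAt (fun τ => G j (τ, σ)) (conj (deriv (deriv g) s) * (γ j σ - g s) + conj (deriv g s) * (-deriv g s)).re s :=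
      hasDerivAt_re ((hasDerivAt_conj (smooth_d1 (smooth_deriv sg) s)).mul ((smooth_d1 sg s).const_sub (γ j σ)))
    exact a1.unique a2
  have hsub : {s ∈ U | ¬ EvP γ j0 η s} ⊆ ⋃ j, Prod.fst '' {v : ℝ × ℝ | G j v = 0 ∧ fderiv ℝ (G j) v (0, 1) = 0 ∧ fderiv ℝ (G j) v (1, 0) ≠ 0} := by
    rintro s ⟨hs, hnP⟩
    obtain ⟨T, j, σ, h1, h2⟩ := h s hs
    refine mem_iUnion.2 ⟨j, (s, σ), ⟨?_, ?_, ?_⟩, rfl⟩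
    · simp only [hG]
      rw [h1, add_sub_cancel_left]
      have : (conj (deriv g s) * (T * N s)).re = T * (conj (N s) * deriv g s).re := by simp; ring
      rw [this, hN, nrm_orth, mul_zero]
    · rw [g1]
      have ht := nrm_tan rg hη s
      rw [← hN] at ht
      set cc := η * ‖deriv g s‖ with hcc
      rw [ht]
      have : (conj (-Complex.I * N s * cc) * deriv (γ j) σ).re = -cc * (conj (N s) * deriv (γ j) σ).im := by
        simp; ring
      rw [this, h2, mul_zero]
    · rw [g2, h1, add_sub_cancel_left]
      intro h0
      apply hnP
      have hn : ‖deriv g s‖ ^ 2 ≠ 0 := pow_ne_zero 2 (norm_ne_zero_iff.2 (rg s))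
      have hk : (conj (N s) * deriv (deriv g) s).re = crv g η s * ‖deriv g s‖ ^ 2 := by
        rw [crv, kap, div_mul_cancel₀ _ hn]
      have e1 : (conj (deriv (deriv g) s) * (T * N s) + conj (deriv g s) * (-deriv g s)).re =
          T * (conj (N s) * deriv (deriv g) s).re - ‖deriv g s‖ ^ 2 := by
        rw [← Complex.normSq_eq_norm_sq, Complex.normSq_apply]; simp; ring
      rw [e1, hk] at h0
      have e2 : T * crv g η s = 1 := by
        have : ‖deriv g s‖ ^ 2 * (T * crv g η s - 1) = 0 := by linear_combination h0
        rcases mul_eq_zero.1 this with h | h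
        · exact absurd h hn
        · linarith
      have hk0 : crv g η s ≠ 0 := by rintro h; rw [h] at e2; simp at e2
      have e3 : (T : ℂ) * N s = N s / crv g η s := by
        have hk1 : (crv g η s : ℂ) ≠ 0 := by exact_mod_cast hk0
        have e4 : (T : ℂ) * crv g η s = 1 := by exact_mod_cast e2
        rw [eq_div_iff hk1]; linear_combination (N s) * e4
      obtain ⟨y, hy, hyt⟩ := (hd.per j).exists_mem_Ico₀ (by positivity) σ
      refine ⟨j, y, ⟨hy.1, hy.2.le⟩, ?_, ?_⟩
      · rw [← hyt, h1, e3]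
      · rw [← hd.per_deriv hyt]; exact h2
  exact measure_mono_null hsub (measure_iUnion_null fun j => sard_proj (contDiff_infty.1 (sG j) 2))

lemma Dom.evP_closed (hd : Dom Ω J γ) (j0 : Fin J) {η : ℝ} {s0 : ℝ} (hκ : crv (γ j0) η s0 ≠ 0)
    (h : ¬ EvP γ j0 η s0) : ∀ᶠ s in 𝓝 s0, ¬ EvP γ j0 η s := by
  have cg := (hd.smooth j0).continuous
  have cN := (nrm_smooth (η := η) (hd.smooth j0) (hd.reg j0)).continuous
  have cκ := (crv_smooth (η := η) (hd.smooth j0) (hd.reg j0)).continuous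
  have key : ∀ j, ∀ᶠ s in 𝓝 s0, ∀ σ ∈ Icc (0:ℝ) (2 * π), ¬ (γ j σ = γ j0 s + nrm (γ j0) η s / crv (γ j0) η s ∧
      (conj (nrm (γ j0) η s) * deriv (γ j) σ).im = 0) := by
    intro j
    refine isCompact_Icc.eventually_forall_of_forall_eventually (fun σ hσ => ?_)
    have c1 : ContinuousAt (fun v : ℝ × ℝ => γ j v.2 - (γ j0 v.1 + nrm (γ j0) η v.1 / crv (γ j0) η v.1)) (s0, σ) := by
      have : Continuous (γ j) := (hd.smooth j).continuous
      refine ContinuousAt.sub (by fun_prop) (ContinuousAt.add (by fun_prop) (ContinuousAt.div (by fun_prop) (by fun_prop) ?_))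
      exact_mod_cast hκ
    have c2 : ContinuousAt (fun v : ℝ × ℝ => (conj (nrm (γ j0) η v.1) * deriv (γ j) v.2).im) (s0, σ) := by
      have : Continuous (deriv (γ j)) := (smooth_deriv (hd.smooth j)).continuous
      have : Continuous (fun v : ℝ × ℝ => conj (nrm (γ j0) η v.1) * deriv (γ j) v.2) := by fun_prop
      exact (Complex.continuous_im.comp this).continuousAt
    by_cases hh : γ j σ = γ j0 s0 + nrm (γ j0) η s0 / crv (γ j0) η s0
    · have h2 : (conj (nrm (γ j0) η s0) * deriv (γ j) σ).im ≠ 0 := fun h2 => h ⟨j, σ, hσ, hh, h2⟩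
      filter_upwards [c2.eventually_ne h2] with v hv hv2
      exact hv hv2.2
    · filter_upwards [c1.eventually_ne (sub_ne_zero.2 hh)] with v hv hv2
      exact hv (sub_eq_zero.2 hv2.1)
  filter_upwards [eventually_all.2 key] with s hs
  rintro ⟨j, σ, hσ, h1⟩
  exact hs j σ hσ h1

/-- the evolute cannot lie on the boundary near a critical point of the curvature -/
lemma Dom.no_evolute (hd : Dom Ω J γ) (j0 : Fin J) {η : ℝ} (hη : η ^ 2 = 1) {s0 : ℝ} (hκ : crv (γ j0) η s0 ≠ 0)
    (hκ' : HasDerivAt (crv (γ j0) η) 0 s0) (h : ∀ᶠ s in 𝓝 s0, EvP γ j0 η s) : False := by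
  set g := γ j0 with hg
  have sg : ContDiff ℝ (⊤ : ℕ∞) g := hd.smooth j0
  have rg : ∀ t, deriv g t ≠ 0 := hd.reg j0
  set N := nrm g η with hN
  set κ := crv g η with hκd
  have dN : HasDerivAt N (-(κ s0 : ℂ) * deriv g s0) s0 := nrm_deriv sg rg hη s0
  have hκc : (κ s0 : ℂ) ≠ 0 := by exact_mod_cast hκ
  set E : ℝ → ℂ := fun s => g s + N s / κ s with hE
  have dE : HasDerivAt E 0 s0 := by
    refine ((smooth_d1 sg s0).add (dN.div hκ'.ofReal_comp hκc)).congr_deriv ?_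
    push_cast; field_simp; ring
  obtain ⟨j, σ0, -, hσ0, ht0⟩ := h.self_of_nhds
  have hr0 := hd.reg j σ0
  have d2 := smooth_d1 (hd.smooth j) σ0
  obtain ⟨M, hM⟩ := ((HasDerivAtFilter.isTheta_sub d2 hr0).2).bound
  rw [Filter.prod_pure, Filter.eventually_map] at hM
  obtain ⟨ε, hε, hM⟩ := Metric.eventually_nhds_iff.1 hM
  obtain ⟨r, hr, hfar⟩ := hd.far j σ0 hε
  have hσ0' : γ j σ0 = E s0 := hσ0
  have ev : ∀ᶠ s in 𝓝 s0, ∃ σ, γ j σ = E s ∧ |σ - σ0| ≤ M * ‖E s - E s0‖ ∧ (conj (N s) * deriv (γ j) σ).im = 0 := by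
    have e1 : ∀ᶠ s in 𝓝 s0, dist (E s) (γ j σ0) < r := by
      rw [hσ0']; exact dE.continuousAt (Metric.ball_mem_nhds _ hr)
    filter_upwards [h, e1] with s ⟨i, τ, _, h1, h2⟩ hs
    have h1' : γ i τ = E s := h1
    obtain ⟨σ, a1, a2⟩ := hfar (E s) (by rw [← h1']; exact hd.mem_fr i τ) hs
    have : i = j := hd.disj i j τ σ (by rw [h1', a2])
    subst this
    refine ⟨σ, a2, ?_, ?_⟩
    · have := hM (y := σ) (by simpa [Real.dist_eq] using a1)
      rwa [a2, hσ0', Real.norm_eq_abs] at this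
    · rw [hd.per_deriv (a2.trans h1'.symm)]; exact h2
  obtain ⟨σ, hσ⟩ : ∃ σ : ℝ → ℝ, ∀ᶠ s in 𝓝 s0, γ j (σ s) = E s ∧ |σ s - σ0| ≤ M * ‖E s - E s0‖ ∧
      (conj (N s) * deriv (γ j) (σ s)).im = 0 := ev.choice
  have hs0 : σ s0 = σ0 := by
    have := hσ.self_of_nhds.2.1
    simp only [sub_self, norm_zero, mul_zero, abs_nonpos_iff] at this
    linarith
  have dσ : HasDerivAt σ 0 s0 := by
    rw [hasDerivAt_iff_isLittleO]
    have e2 := hasDerivAt_iff_isLittleO.1 dE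
    simp only [smul_zero, sub_zero] at e2 ⊢
    refine Asymptotics.IsBigO.trans_isLittleO ?_ e2
    refine Asymptotics.IsBigO.of_bound M ?_
    filter_upwards [hσ] with s hs
    rw [hs0, Real.norm_eq_abs]; exact hs.2.1
  have d3 : HasDerivAt (fun s => deriv (γ j) (σ s)) 0 s0 := by
    have := (smooth_d1 (smooth_deriv (hd.smooth j)) (σ s0)).scomp s0 dσ
    rw [zero_smul] at this; exact this
  have d4 := hasDerivAt_im ((hasDerivAt_conj dN).mul d3)
  have d5 : HasDerivAt (fun s => (conj (N s) * deriv (γ j) (σ s)).im) 0 s0 := by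
    refine (hasDerivAt_const s0 (0:ℝ)).congr_of_eventuallyEq ?_
    filter_upwards [hσ] with s hs using hs.2.2
  have d6 := d4.unique d5
  rw [hs0, mul_zero, add_zero] at d6
  have hn := unit_conj_mul (nrm_norm rg hη s0)
  rw [← hN] at hn
  have t1 : conj (N s0) * deriv (γ j) σ0 = ((conj (N s0) * deriv (γ j) σ0).re : ℂ) :=
    Complex.ext rfl (by rw [Complex.ofReal_im]; exact ht0)
  set c : ℝ := (conj (N s0) * deriv (γ j) σ0).re with hc
  have t2 : deriv (γ j) σ0 = c * N s0 := by
    linear_combination (-deriv (γ j) σ0) * hn + (N s0) * t1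
  have hc0 : c ≠ 0 := by rintro h; rw [h] at t2; simp at t2; exact hr0 t2
  have t3 : (conj (-(κ s0 : ℂ) * deriv g s0) * deriv (γ j) σ0).im = κ s0 * c * (conj (N s0) * deriv g s0).im := by
    rw [t2]; simp; ring
  rw [t3] at d6
  exact mul_ne_zero (mul_ne_zero hκ hc0) (nrm_im_ne rg hη s0) d6

/-- **A boundary arc is circular.** -/
theorem Dom.arc {u : ℕ → ℂ → ℝ} {D : ℕ → ℂ → ℂ →L[ℝ] ℝ} {j0 : Fin J}
    {H : ℕ → ℂ → ℂ →L[ℝ] ℂ →L[ℝ] ℝ} {μ : ℕ → ℝ} (hd : Dom Ω J γ) (sq : Sq Ω γ j0 u D H μ) :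
    ∃ (s0 : ℝ) (x0 : ℂ) (R : ℝ), 0 < R ∧ ∀ᶠ s in 𝓝 s0, ‖γ j0 s - x0‖ = R := by
  by_contra hno
  obtain ⟨s0, hc, hc'⟩ := max_crv (hd.smooth j0) (hd.reg j0) (hd.per j0)
  obtain ⟨η, hη, ε, hε, hst⟩ := hd.start j0 s0
  have hη0 : η ≠ 0 := by rintro rfl; norm_num at hη
  have hκ : crv (γ j0) η s0 ≠ 0 := by rw [crv_eta]; exact mul_ne_zero hη0 hc
  have hκ' : HasDerivAt (crv (γ j0) η) 0 s0 := by
    have : crv (γ j0) η = fun s => η * crv (γ j0) 1 s := funext (crv_eta _ _)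
    rw [this]
    simpa using hc'.const_mul η
  have sκ := crv_smooth (η := η) (hd.smooth j0) (hd.reg j0)
  have ev1 : ∀ᶠ s in 𝓝 s0, crv (γ j0) η s ≠ 0 := sκ.continuous.continuousAt.eventually_ne hκ
  obtain ⟨U, hU, hUo, hUs⟩ := eventually_nhds_iff.1 (ev1.and (Metric.ball_mem_nhds s0 hε))
  have tang : ∀ s ∈ U, ∃ (T : ℝ) (j : Fin J) (σ : ℝ), γ j σ = γ j0 s + T * nrm (γ j0) η s ∧
      (conj (nrm (γ j0) η s) * deriv (γ j) σ).im = 0 := by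
    intro s hs
    obtain ⟨T, hT, hTi, hTf⟩ := hd.first_hit (nrm_norm (hd.reg j0) hη s) hε (hst s (hU s hs).2)
    obtain ⟨j, σ, hσ⟩ := hd.exists_fr hTf
    refine ⟨T, j, σ, hσ, ?_⟩
    by_contra htr
    have ch : Chord Ω γ j0 j s σ T (nrm (γ j0) η s) :=
      ⟨hT, nrm_norm (hd.reg j0) hη s, hσ, nrm_orth s, hTi, htr⟩
    exact hno ⟨s, ch.arc hd hη sq (hU s hs).1⟩
  have hnull := hd.tangential_null j0 hη tang
  refine hd.no_evolute j0 hη hκ hκ' ?_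
  filter_upwards [hUo.mem_nhds hUs] with s hs
  by_contra hP
  have e1 := hd.evP_closed j0 (hU s hs).1 hP
  obtain ⟨V, hV, hVo, hVs⟩ := eventually_nhds_iff.1 (e1.and (hUo.mem_nhds hs))
  have hsub : V ⊆ {s ∈ U | ¬ EvP γ j0 η s} := fun x hx => ⟨(hV x hx).2, (hV x hx).1⟩
  have : volume V = 0 := measure_mono_null hsub hnull
  exact (hVo.measure_pos volume ⟨s, hVs⟩).ne' this
end
end Rig

namespace Rig
open Filter Topology ComplexConjugate

/-- Parametric integrals over a period. -/
lemma par_int {F F' : ℝ → ℝ → ℂ} {L : ℝ}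
    (h : ∀ t < L, ∀ θ, HasDerivAt (fun t => F t θ) (F' t θ) t)
    (cF : ContinuousOn (fun p : ℝ × ℝ => F p.1 p.2) (Iio L ×ˢ univ))
    (cF' : ContinuousOn (fun p : ℝ × ℝ => F' p.1 p.2) (Iio L ×ˢ univ)) {t : ℝ} (ht : t < L) :
    HasDerivAt (fun t => ∫ θ in (0:ℝ)..(2*π), F t θ) (∫ θ in (0:ℝ)..(2*π), F' t θ) t := by
  have sec : ∀ {G : ℝ → ℝ → ℂ}, ContinuousOn (fun p : ℝ × ℝ => G p.1 p.2) (Iio L ×ˢ univ) →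
      ∀ t < L, Continuous (G t) := by
    intro G hG t ht
    have : ContinuousOn (fun θ : ℝ => G t θ) univ :=
      hG.comp (f := fun θ : ℝ => ((t, θ) : ℝ × ℝ)) (by fun_prop) (fun θ _ => ⟨ht, mem_univ _⟩)
    exact continuousOn_univ.1 this
  obtain ⟨b, hb1, hb2⟩ := exists_between ht
  have hK : IsCompact (Icc (t-1) b ×ˢ Icc (0:ℝ) (2*π)) := isCompact_Icc.prod isCompact_Icc
  obtain ⟨M, hM⟩ := hK.exists_bound_of_continuousOn
    (cF'.mono (prod_mono (fun x hx => lt_of_le_of_lt hx.2 hb2) (subset_univ _)))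
  have hs : Icc (t-1) b ∈ 𝓝 t := Icc_mem_nhds (by linarith) hb1
  refine (intervalIntegral.hasDerivAt_integral_of_dominated_loc_of_deriv_le (bound := fun _ => M) hs ?_
    ((sec cF t ht).intervalIntegrable _ _) (sec cF' t ht).aestronglyMeasurable ?_
    intervalIntegrable_const ?_).2
  · filter_upwards [Iio_mem_nhds ht] with x hx
    exact (sec cF x hx).aestronglyMeasurable
  · refine Eventually.of_forall fun θ hθ x hx => hM (x, θ) ⟨hx, ?_⟩
    rw [uIoc_of_le (by positivity)] at hθ
    exact ⟨hθ.1.le, hθ.2⟩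
  · exact Eventually.of_forall fun θ hθ x hx => h x (lt_of_le_of_lt hx.2 hb2) θ

/-- A continuous periodic function with vanishing Fourier coefficients is zero. -/
lemma fourier_zero_of {g : ℝ → ℂ} (hc : Continuous g) (hp : Function.Periodic g (2*π))
    (h : ∀ m : ℤ, ∫ θ in (0:ℝ)..(2*π), g θ * Complex.exp (m * Complex.I * θ) = 0) (θ : ℝ) : g θ = 0 := by
  have hpos : (0:ℝ) < 2 * π := by positivity
  haveI : Fact ((0:ℝ) < 2 * π) := ⟨hpos⟩
  let G : C(AddCircle (2*π), ℂ) := ⟨hp.lift, continuous_coinduced_dom.2 hc⟩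
  have hco : ∀ n : ℤ, fourierCoeff (⇑G) n = 0 := by
    intro n
    rw [fourierCoeff_eq_intervalIntegral _ n 0, zero_add]
    have := h (-n)
    have e : ∀ x : ℝ, (fourier (-n) (x : AddCircle (2*π)) : ℂ) • G x =
        g x * Complex.exp ((-n : ℤ) * Complex.I * x) := by
      intro x
      rw [fourier_coe_apply, smul_eq_mul, mul_comm]
      congr 1
      congr 1
      have : (π : ℂ) ≠ 0 := by exact_mod_cast pi_ne_zero
      push_cast; field_simp
    simp_rw [e, this, smul_zero]
  have hs : Summable (fourierCoeff (⇑G)) := by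
    have : fourierCoeff (⇑G) = fun _ => 0 := funext hco
    rw [this]; exact summable_zero
  have h1 := has_pointwise_sum_fourier_series_of_summable hs (θ : AddCircle (2*π))
  simp only [hco, zero_smul] at h1
  exact h1.unique hasSum_zero

/-- linear second order ODE uniqueness -/
lemma ode_zero {y y1 : ℝ → ℂ} {a : ℝ → ℂ} {L t0 M t1 : ℝ} (h0 : t0 ≤ t1) (h1 : t1 < L)
    (d : ∀ t < L, HasDerivAt y (y1 t) t) (d1 : ∀ t < L, HasDerivAt y1 (a t * y t) t)
    (hM : ∀ t ≤ t1, ‖a t‖ ≤ M) (i0 : y t0 = 0) (i1 : y1 t0 = 0) : y t1 = 0 := by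
  have hM0 : 0 ≤ M := (norm_nonneg _).trans (hM t1 le_rfl)
  have dd : ∀ t < L, HasDerivAt (fun t => (y t, y1 t)) (y1 t, a t * y t) t :=
    fun t ht => (d t ht).prodMk (d1 t ht)
  have := norm_le_gronwallBound_of_norm_deriv_right_le (f := fun t => (y t, y1 t))
    (f' := fun t => (y1 t, a t * y t)) (δ := 0) (K := M + 1) (ε := 0) (a := t0) (b := t1)
    (fun t ht => (dd t (lt_of_le_of_lt ht.2 h1)).continuousAt.continuousWithinAt)
    (fun t ht => (dd t (ht.2.trans h1)).hasDerivWithinAt) (by simp [i0, i1])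
    (fun t ht => by
      have b0 : ‖y t‖ ≤ ‖(y t, y1 t)‖ := norm_fst_le (y t, y1 t)
      have b1 : ‖y1 t‖ ≤ ‖(y t, y1 t)‖ := norm_snd_le (y t, y1 t)
      have b2 : ‖a t * y t‖ ≤ M * ‖(y t, y1 t)‖ := by
        rw [norm_mul]
        exact mul_le_mul (hM t ht.2.le) b0 (norm_nonneg _) hM0
      rw [Prod.norm_mk, add_zero]
      apply max_le
      · nlinarith [norm_nonneg (y t, y1 t)]
      · nlinarith [norm_nonneg (y t, y1 t)]) t1 ⟨h0, le_rfl⟩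
  rw [gronwallBound_ε0_δ0] at this
  have := norm_le_zero_iff.1 this
  exact (Prod.mk.inj this).1

/-- twice continuously differentiable on an open set -/
structure C2O (W : Set ℂ) (u : ℂ → ℝ) (D : ℂ → ℂ →L[ℝ] ℝ) (H : ℂ → ℂ →L[ℝ] ℂ →L[ℝ] ℝ) : Prop where
  du : ∀ x ∈ W, HasFDerivAt u (D x) x
  dD : ∀ x ∈ W, HasFDerivAt D (H x) x
  cH : ContinuousOn H W

lemma trace_rot' (B : ℂ →L[ℝ] ℂ →L[ℝ] ℝ) (e : ℂ) :
    B e e + B (e * Complex.I) (e * Complex.I) = ‖e‖ ^ 2 * (B 1 1 + B Complex.I Complex.I) := by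
  have e1 : e = e.re • (1:ℂ) + e.im • Complex.I := by apply Complex.ext <;> simp
  have e2 : e * Complex.I = (-e.im) • (1:ℂ) + e.re • Complex.I := by apply Complex.ext <;> simp
  have e3 : ‖e‖ ^ 2 = e.re ^ 2 + e.im ^ 2 := by
    rw [← Complex.normSq_eq_norm_sq e, Complex.normSq_apply]; ring
  have r : ∀ a b : ℝ, B (a • (1:ℂ) + b • Complex.I) (a • (1:ℂ) + b • Complex.I) =
     a * (a * B 1 1 + b * B 1 Complex.I) + b * (a * B Complex.I 1 + b * B Complex.I Complex.I) := by
    intro a b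
    simp only [map_add, map_smul, add_apply, smul_apply, smul_eq_mul]; ring
  rw [e2, r, e3]
  have := r e.re e.im
  rw [← e1] at this
  rw [this]; ring

section
variable {p : ℂ} {R μ : ℝ} {u : ℂ → ℝ} {D : ℂ → ℂ →L[ℝ] ℝ} {H : ℂ → ℂ →L[ℝ] ℂ →L[ℝ] ℝ}

/-- unique continuation from the centre of a disk -/
lemma uc_ball (hR : 0 < R) (h : C2O (Metric.ball p R) u D H)
    (pde : ∀ x ∈ Metric.ball p R, H x 1 1 + H x Complex.I Complex.I = - (μ * u x))
    {r : ℝ} (hr : 0 < r) (hz : ∀ x ∈ Metric.ball p r, u x = 0) : ∀ x ∈ Metric.ball p R, u x = 0 := by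
  set L := Real.log R with hL
  let E : ℝ → ℝ → ℂ := fun t θ => Complex.exp (t + θ * Complex.I)
  have nE : ∀ t θ, ‖E t θ‖ = Real.exp t := by
    intro t θ; simp [E, Complex.norm_exp]
  have mE : ∀ t < L, ∀ θ, p + E t θ ∈ Metric.ball p R := by
    intro t ht θ
    rw [Metric.mem_ball, dist_eq_norm, add_sub_cancel_left, nE]
    calc Real.exp t < Real.exp L := Real.exp_lt_exp.2 ht
      _ = R := Real.exp_log hR
  have cE : Continuous (fun q : ℝ × ℝ => E q.1 q.2) := by fun_prop
  have dEt : ∀ t θ, HasDerivAt (fun t => p + E t θ) (E t θ) t := by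
    intro t θ
    have h1 : HasDerivAt (fun t : ℝ => (t : ℂ) + θ * Complex.I) 1 t :=
      (Complex.ofRealCLM.hasDerivAt (x := t)).add_const _
    exact (h1.cexp.const_add p).congr_deriv (by simp [E])
  have dEt' : ∀ t θ, HasDerivAt (fun t => E t θ) (E t θ) t := by
    intro t θ
    have h1 : HasDerivAt (fun t : ℝ => (t : ℂ) + θ * Complex.I) 1 t :=
      (Complex.ofRealCLM.hasDerivAt (x := t)).add_const _
    exact h1.cexp.congr_deriv (by simp [E])
  have dEθ' : ∀ t θ, HasDerivAt (fun θ => E t θ) (E t θ * Complex.I) θ := by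
    intro t θ
    have h1 : HasDerivAt (fun θ : ℝ => (t : ℂ) + θ * Complex.I) (1 * Complex.I) θ :=
      ((Complex.ofRealCLM.hasDerivAt (x := θ)).mul_const _).const_add _
    exact h1.cexp.congr_deriv (by simp [E])
  have dEθ : ∀ t θ, HasDerivAt (fun θ => p + E t θ) (E t θ * Complex.I) θ :=
    fun t θ => (dEθ' t θ).const_add p
  have pE : ∀ t, Function.Periodic (E t) (2*π) := by
    intro t θ
    simp only [E]
    push_cast
    rw [show (t:ℂ) + (θ + 2 * π) * Complex.I = (t + θ * Complex.I) + 2 * π * Complex.I by ring,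
      Complex.exp_periodic]
  -- the functions
  have cuB : ContinuousOn u (Metric.ball p R) := fun x hx => (h.du x hx).continuousAt.continuousWithinAt
  have cDB : ContinuousOn D (Metric.ball p R) := fun x hx => (h.dD x hx).continuousAt.continuousWithinAt
  have mps : MapsTo (fun q : ℝ × ℝ => p + E q.1 q.2) (Iio L ×ˢ univ) (Metric.ball p R) :=
    fun q hq => mE q.1 hq.1 q.2
  have cpE : ContinuousOn (fun q : ℝ × ℝ => p + E q.1 q.2) (Iio L ×ˢ univ) :=
    (continuous_const.add cE).continuousOn
  have cG : ContinuousOn (fun q : ℝ × ℝ => u (p + E q.1 q.2)) (Iio L ×ˢ univ) := cuB.comp cpE mps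
  have cD : ContinuousOn (fun q : ℝ × ℝ => D (p + E q.1 q.2)) (Iio L ×ˢ univ) := cDB.comp cpE mps
  have cH : ContinuousOn (fun q : ℝ × ℝ => H (p + E q.1 q.2)) (Iio L ×ˢ univ) := h.cH.comp cpE mps
  have cE' := cE.continuousOn (s := Iio L ×ˢ univ)
  have dGt : ∀ t < L, ∀ θ, HasDerivAt (fun t => u (p + E t θ)) (D (p + E t θ) (E t θ)) t :=
    fun t ht θ => (h.du _ (mE t ht θ)).comp_hasDerivAt t (dEt t θ)
  have dGθ : ∀ t < L, ∀ θ, HasDerivAt (fun θ => u (p + E t θ)) (D (p + E t θ) (E t θ * Complex.I)) θ :=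
    fun t ht θ => (h.du _ (mE t ht θ)).comp_hasDerivAt θ (dEθ t θ)
  have dGtt : ∀ t < L, ∀ θ, HasDerivAt (fun t => D (p + E t θ) (E t θ))
      (H (p + E t θ) (E t θ) (E t θ) + D (p + E t θ) (E t θ)) t :=
    fun t ht θ => HasDerivAt.clm_apply ((h.dD _ (mE t ht θ)).comp_hasDerivAt t (dEt t θ)) (dEt' t θ)
  have dGθθ : ∀ t < L, ∀ θ, HasDerivAt (fun θ => D (p + E t θ) (E t θ * Complex.I))
      (H (p + E t θ) (E t θ * Complex.I) (E t θ * Complex.I) + D (p + E t θ) (E t θ * Complex.I * Complex.I)) θ :=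
    fun t ht θ => HasDerivAt.clm_apply ((h.dD _ (mE t ht θ)).comp_hasDerivAt θ (dEθ t θ)) ((dEθ' t θ).mul_const _)
  have lapG : ∀ t < L, ∀ θ, (H (p + E t θ) (E t θ * Complex.I) (E t θ * Complex.I) +
        D (p + E t θ) (E t θ * Complex.I * Complex.I)) +
      (H (p + E t θ) (E t θ) (E t θ) + D (p + E t θ) (E t θ)) = - (μ * Real.exp t ^ 2) * u (p + E t θ) := by
    intro t ht θ
    have h1 := trace_rot' (H (p + E t θ)) (E t θ)
    rw [pde _ (mE t ht θ), nE] at h1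
    have h2 : E t θ * Complex.I * Complex.I = - E t θ := by rw [mul_assoc, Complex.I_mul_I]; ring
    have h3 : D (p + E t θ) (E t θ * Complex.I * Complex.I) = - D (p + E t θ) (E t θ) := by rw [h2, map_neg]
    rw [h3]; linarith
  have sec : ∀ t < L, Continuous (fun θ => u (p + E t θ)) := by
    intro t ht
    exact continuous_iff_continuousAt.2 fun θ => (dGθ t ht θ).continuousAt
  -- Fourier modes
  have key : ∀ m : ℤ, ∀ t < L, ∫ θ in (0:ℝ)..(2*π), (u (p + E t θ) : ℂ) * Complex.exp (m * Complex.I * θ) = 0 := by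
    intro m
    set k : ℝ → ℂ := fun θ => Complex.exp (m * Complex.I * θ) with hk
    have ck : Continuous k := by fun_prop
    have dk : ∀ θ, HasDerivAt k (m * Complex.I * k θ) θ := by
      intro θ
      have h1 : HasDerivAt (fun θ : ℝ => (m * Complex.I * θ : ℂ)) (m * Complex.I * 1) θ :=
        (Complex.ofRealCLM.hasDerivAt (x := θ)).const_mul _
      exact h1.cexp.congr_deriv (by simp [hk]; ring)
    have kp : k (2*π) = k 0 := by
      simp only [hk]
      push_cast
      rw [show (m : ℂ) * Complex.I * (2 * π) = m * (2 * π * Complex.I) by ring, Complex.exp_int_mul_two_pi_mul_I]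
      simp
    set y : ℝ → ℂ := fun t => ∫ θ in (0:ℝ)..(2*π), (u (p + E t θ) : ℂ) * k θ with hy
    set y1 : ℝ → ℂ := fun t => ∫ θ in (0:ℝ)..(2*π), (D (p + E t θ) (E t θ) : ℂ) * k θ with hy1
    have ck2 : ContinuousOn (fun q : ℝ × ℝ => k q.2) (Iio L ×ˢ univ) := by fun_prop
    have c0 : ContinuousOn (fun q : ℝ × ℝ => (u (p + E q.1 q.2) : ℂ) * k q.2) (Iio L ×ˢ univ) :=
      (Complex.continuous_ofReal.comp_continuousOn cG).mul ck2
    have c1 : ContinuousOn (fun q : ℝ × ℝ => (D (p + E q.1 q.2) (E q.1 q.2) : ℂ) * k q.2) (Iio L ×ˢ univ) :=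
      (Complex.continuous_ofReal.comp_continuousOn (cD.clm_apply cE')).mul ck2
    have c2 : ContinuousOn (fun q : ℝ × ℝ => ((H (p + E q.1 q.2) (E q.1 q.2) (E q.1 q.2) +
        D (p + E q.1 q.2) (E q.1 q.2) : ℝ) : ℂ) * k q.2) (Iio L ×ˢ univ) :=
      (Complex.continuous_ofReal.comp_continuousOn
        (((cH.clm_apply cE').clm_apply cE').add (cD.clm_apply cE'))).mul ck2
    have d : ∀ t < L, HasDerivAt y (y1 t) t := fun t ht =>
      par_int (F := fun t θ => (u (p + E t θ) : ℂ) * k θ) (F' := fun t θ => (D (p + E t θ) (E t θ) : ℂ) * k θ)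
        (fun t ht θ => ((dGt t ht θ).ofReal_comp).mul_const _) c0 c1 ht
    have d1 : ∀ t < L, HasDerivAt y1 (((m:ℂ)^2 - μ * Real.exp t ^ 2) * y t) t := by
      intro t ht
      have := par_int (F := fun t θ => (D (p + E t θ) (E t θ) : ℂ) * k θ) (F' := fun t θ =>
         ((H (p + E t θ) (E t θ) (E t θ) + D (p + E t θ) (E t θ) : ℝ) : ℂ) * k θ)
        (fun t ht θ => ((dGtt t ht θ).ofReal_comp).mul_const _) c1 c2 ht
      refine this.congr_deriv ?_
      have ibp : ∀ θ, HasDerivAt (fun θ => (D (p + E t θ) (E t θ * Complex.I) : ℂ) * k θ -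
          (u (p + E t θ) : ℂ) * (m * Complex.I * k θ))
          (((m:ℂ)^2 - μ * Real.exp t ^ 2) * ((u (p + E t θ) : ℂ) * k θ) -
           ((H (p + E t θ) (E t θ) (E t θ) + D (p + E t θ) (E t θ) : ℝ) : ℂ) * k θ) θ := by
        intro θ
        refine (((dGθθ t ht θ).ofReal_comp.mul (dk θ)).sub
          ((dGθ t ht θ).ofReal_comp.mul ((dk θ).const_mul _))).congr_deriv ?_
        have h1 : ((H (p + E t θ) (E t θ * Complex.I) (E t θ * Complex.I) +
          D (p + E t θ) (E t θ * Complex.I * Complex.I) : ℝ) : ℂ) = (- (μ * Real.exp t ^ 2) * u (p + E t θ) : ℝ) -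
          ((H (p + E t θ) (E t θ) (E t θ) + D (p + E t θ) (E t θ) : ℝ) : ℂ) := by
          rw [← lapG t ht θ]; push_cast; ring
        rw [h1]
        have h2 : ((- (μ * Real.exp t ^ 2) * u (p + E t θ) : ℝ) : ℂ) =
          - (μ * (Real.exp t : ℂ) ^ 2) * u (p + E t θ) := by push_cast; ring
        rw [h2]
        linear_combination (- (m:ℂ)^2 * (u (p + E t θ)) * k θ) * Complex.I_mul_I
      have sk : ∀ θ : ℝ, ((t, θ) : ℝ × ℝ) ∈ Iio L ×ˢ (univ : Set ℝ) := fun θ => ⟨ht, mem_univ _⟩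
      have s0 : Continuous (fun θ : ℝ => (u (p + E t θ) : ℂ) * k θ) :=
        continuousOn_univ.1 (c0.comp (f := fun θ : ℝ => ((t, θ) : ℝ × ℝ)) (by fun_prop) (fun θ _ => sk θ))
      have s2 : Continuous (fun θ : ℝ => ((H (p + E t θ) (E t θ) (E t θ) +
        D (p + E t θ) (E t θ) : ℝ) : ℂ) * k θ) :=
        continuousOn_univ.1 (c2.comp (f := fun θ : ℝ => ((t, θ) : ℝ × ℝ)) (by fun_prop) (fun θ _ => sk θ))
      have s1 : Continuous (fun θ : ℝ => ((m:ℂ)^2 - μ * Real.exp t ^ 2) * ((u (p + E t θ) : ℂ) * k θ)) :=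
        continuous_const.mul s0
      have i := intervalIntegral.integral_eq_sub_of_hasDerivAt (a := 0) (b := 2*π) (fun θ _ => ibp θ)
        ((s1.sub s2).intervalIntegrable _ _)
      have pE0 : E t (2*π) = E t 0 := by simpa using pE t 0
      rw [kp, pE0, sub_self, intervalIntegral.integral_sub (s1.intervalIntegrable _ _)
        (s2.intervalIntegrable _ _), intervalIntegral.integral_const_mul] at i
      linear_combination -i
    intro t ht
    set t0 := min t (Real.log r - 1) with ht0
    have hlow : ∀ s ≤ t0, y s = 0 := by
      intro s hs
      have : ∀ θ, u (p + E s θ) = 0 := by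
        intro θ
        apply hz
        rw [Metric.mem_ball, dist_eq_norm, add_sub_cancel_left, nE]
        calc Real.exp s < Real.exp (Real.log r) := Real.exp_lt_exp.2 (by
              have := min_le_right t (Real.log r - 1); linarith)
          _ = r := Real.exp_log hr
      simp [hy, this]
    have ht0t : t0 ≤ t := min_le_left _ _
    refine ode_zero (y := y) (y1 := y1) (a := fun t => (m:ℂ)^2 - μ * Real.exp t ^ 2) (L := L) (t0 := t0) (t1 := t)
      (M := ‖(m:ℂ)^2‖ + |μ| * Real.exp t ^ 2) ht0t ht d d1 ?_ (hlow _ le_rfl) ?_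
    · intro s hs
      refine (norm_sub_le _ _).trans ?_
      rw [norm_mul, norm_pow (Real.exp s : ℂ), Complex.norm_real, Complex.norm_real, Real.norm_eq_abs, Real.norm_eq_abs,
        abs_of_pos (Real.exp_pos s)]
      gcongr
    · have h1 : HasDerivWithinAt y (y1 t0) (Iic t0) t0 := (d t0 (ht0t.trans_lt ht)).hasDerivWithinAt
      have h2 : HasDerivWithinAt y 0 (Iic t0) t0 :=
        (hasDerivWithinAt_const t0 (Iic t0) (0:ℂ)).congr (fun s hs => hlow s hs) (hlow _ le_rfl)
      exact (uniqueDiffWithinAt_Iic t0).eq_deriv _ h1 h2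
  intro x hx
  rcases eq_or_ne x p with rfl | hne
  · exact hz _ (Metric.mem_ball_self hr)
  have hxp : 0 < ‖x - p‖ := norm_pos_iff.2 (sub_ne_zero.2 hne)
  have hE : p + E (Real.log ‖x - p‖) (Complex.arg (x - p)) = x := by
    simp only [E]
    rw [Complex.exp_add, ← Complex.ofReal_exp, Real.exp_log hxp, Complex.norm_mul_exp_arg_mul_I]; ring
  have ht : Real.log ‖x - p‖ < L := Real.log_lt_log hxp (by simpa [dist_eq_norm] using hx)
  have := fourier_zero_of (g := fun θ => (u (p + E (Real.log ‖x - p‖) θ) : ℂ))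
    (Complex.continuous_ofReal.comp (sec _ ht)) (fun θ => by simp only [pE _ θ])
    (fun m => key m _ ht) (Complex.arg (x - p))
  simp only [hE] at this
  exact_mod_cast this

/-- unique continuation on a connected open set -/
lemma uc {W : Set ℂ} (hW : IsOpen W) (hc : IsPreconnected W) (h : C2O W u D H)
    (pde : ∀ x ∈ W, H x 1 1 + H x Complex.I Complex.I = - (μ * u x)) {q : ℂ} (hq : q ∈ W)
    (hz : ∀ᶠ x in 𝓝 q, u x = 0) : ∀ x ∈ W, u x = 0 := by
  have hsub : W ⊆ {x | ∀ᶠ y in 𝓝 x, u y = 0} := by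
    refine hc.subset_of_closure_inter_subset (isOpen_setOfPred_eventually_nhds) ⟨q, hq, hz⟩ ?_
    rintro x ⟨hx, hxW⟩
    obtain ⟨ρ, hρ, hB⟩ := Metric.isOpen_iff.1 hW x hxW
    obtain ⟨z, hz, hzx⟩ := Metric.mem_closure_iff.1 hx (ρ/2) (by positivity)
    obtain ⟨r, hr, hzr⟩ := Metric.eventually_nhds_iff_ball.1 hz
    have hBz : Metric.ball z (ρ/2) ⊆ W := fun y hy => hB (by
      rw [Metric.mem_ball] at *
      linarith [dist_triangle y z x, dist_comm x z])
    have := uc_ball (p := z) (R := ρ/2) (by positivity)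
      ⟨fun x hx => h.du x (hBz hx), fun x hx => h.dD x (hBz hx), h.cH.mono hBz⟩ (fun x hx => pde x (hBz hx)) hr hzr
    exact mem_of_superset (Metric.isOpen_ball.mem_nhds (Metric.mem_ball.2 hzx)) this
  exact fun x hx => (hsub hx).self_of_nhds
end
end Rig

namespace Rig
open Filter Topology ComplexConjugate

lemma glue_deriv {F : Type*} [NormedAddCommGroup F] [NormedSpace ℝ F] {W : Set ℂ} (hW : IsOpen W)
    {g : ℂ → ℝ} (hg : ContinuousOn g W) {φ : ℂ → F} {φ' : ℂ → ℂ →L[ℝ] F}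
    (h : ∀ x ∈ W, 0 ≤ g x → HasFDerivWithinAt φ (φ' x) (W ∩ {x | 0 ≤ g x}) x)
    (z : ∀ x ∈ W, g x = 0 → φ x = 0 ∧ φ' x = 0) {x : ℂ} (hx : x ∈ W) :
    HasFDerivAt (indicator {x | 0 ≤ g x} φ) (indicator {x | 0 ≤ g x} φ' x) x := by
  have hgx := hg.continuousAt (hW.mem_nhds hx)
  rcases lt_trichotomy (g x) 0 with hx0 | hx0 | hx0
  · have e : ∀ᶠ y in 𝓝 x, g y < 0 := hgx (Iio_mem_nhds hx0)
    have e' : indicator {x | 0 ≤ g x} φ =ᶠ[𝓝 x] fun _ => 0 := by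
      filter_upwards [e] with y hy
      exact indicator_of_notMem (by simpa using hy) _
    rw [indicator_of_notMem (by simpa using hx0)]
    exact (hasFDerivAt_const (0:F) x).congr_of_eventuallyEq e'
  · have hm : x ∈ {x | 0 ≤ g x} := hx0.ge
    have h1 := h x hx hx0.ge
    rw [indicator_of_mem hm]
    have h2 : HasFDerivWithinAt (indicator {x | 0 ≤ g x} φ) (φ' x) (W ∩ {x | 0 ≤ g x}) x :=
      h1.congr (fun y hy => indicator_of_mem hy.2 _) (indicator_of_mem hm _)
    have hz : ∀ y ∈ W ∩ {x | g x ≤ 0}, indicator {x | 0 ≤ g x} φ y = 0 := by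
      intro y hy
      by_cases hy0 : 0 ≤ g y
      · rw [indicator_of_mem (show y ∈ {x | 0 ≤ g x} from hy0)]
        exact (z y hy.1 (le_antisymm hy.2 hy0)).1
      · exact indicator_of_notMem (s := {x | 0 ≤ g x}) hy0 φ
    have h3 : HasFDerivWithinAt (indicator {x | 0 ≤ g x} φ) (φ' x) (W ∩ {x | g x ≤ 0}) x := by
      rw [(z x hx hx0).2]
      exact (hasFDerivWithinAt_const (0:F) x _).congr hz (hz x ⟨hx, hx0.le⟩)
    refine (h2.union h3).hasFDerivAt (mem_of_superset (hW.mem_nhds hx) ?_)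
    intro y hy
    rcases le_total 0 (g y) with h | h
    · exact Or.inl ⟨hy, h⟩
    · exact Or.inr ⟨hy, h⟩
  · have hm : x ∈ {x | 0 ≤ g x} := hx0.le
    have e : ∀ᶠ y in 𝓝 x, 0 < g y := hgx (Ioi_mem_nhds hx0)
    rw [indicator_of_mem hm]
    have h1 := (h x hx hx0.le).hasFDerivAt (by
      filter_upwards [e, hW.mem_nhds hx] with y hy hyW using ⟨hyW, hy.le⟩)
    refine h1.congr_of_eventuallyEq ?_
    filter_upwards [e] with y hy using indicator_of_mem (show y ∈ {x | 0 ≤ g x} from hy.le) _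

lemma glue_cont {F : Type*} [NormedAddCommGroup F] {W : Set ℂ} (hW : IsOpen W)
    {g : ℂ → ℝ} (hg : ContinuousOn g W) {φ : ℂ → F}
    (h : ContinuousOn φ (W ∩ {x | 0 ≤ g x}))
    (z : ∀ x ∈ W, g x = 0 → φ x = 0) : ContinuousOn (indicator {x | 0 ≤ g x} φ) W := by
  intro x hx
  apply ContinuousAt.continuousWithinAt
  have hgx := hg.continuousAt (hW.mem_nhds hx)
  rcases lt_trichotomy (g x) 0 with hx0 | hx0 | hx0
  · have e : ∀ᶠ y in 𝓝 x, g y < 0 := hgx (Iio_mem_nhds hx0)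
    have e' : indicator {x | 0 ≤ g x} φ =ᶠ[𝓝 x] fun _ => 0 := by
      filter_upwards [e] with y hy
      exact indicator_of_notMem (by simpa using hy) _
    exact (continuousAt_const (y := (0:F))).congr e'.symm
  · have hm : x ∈ {x | 0 ≤ g x} := hx0.ge
    have h1 := h x ⟨hx, hx0.ge⟩
    have h2 : ContinuousWithinAt (indicator {x | 0 ≤ g x} φ) (W ∩ {x | 0 ≤ g x}) x :=
      h1.congr (fun y hy => indicator_of_mem hy.2 _) (indicator_of_mem hm _)
    have hz : ∀ y ∈ W ∩ {x | g x ≤ 0}, indicator {x | 0 ≤ g x} φ y = 0 := by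
      intro y hy
      by_cases hy0 : 0 ≤ g y
      · rw [indicator_of_mem (show y ∈ {x | 0 ≤ g x} from hy0)]
        exact z y hy.1 (le_antisymm hy.2 hy0)
      · exact indicator_of_notMem (s := {x | 0 ≤ g x}) hy0 φ
    have h3 : ContinuousWithinAt (indicator {x | 0 ≤ g x} φ) (W ∩ {x | g x ≤ 0}) x :=
      (continuousWithinAt_const (b := (0:F))).congr hz (hz x ⟨hx, hx0.le⟩)
    refine (h2.union h3).continuousAt (mem_of_superset (hW.mem_nhds hx) ?_)
    intro y hy
    rcases le_total 0 (g y) with h | h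
    · exact Or.inl ⟨hy, h⟩
    · exact Or.inr ⟨hy, h⟩
  · have e : ∀ᶠ y in 𝓝 x, 0 < g y := hgx (Ioi_mem_nhds hx0)
    have h1 := (h x ⟨hx, hx0.le⟩).continuousAt (by
      filter_upwards [e, hW.mem_nhds hx] with y hy hyW using ⟨hyW, hy.le⟩)
    refine h1.congr ?_
    filter_upwards [e] with y hy using (indicator_of_mem (show y ∈ {x | 0 ≤ g x} from hy.le) _).symm

/-- Cauchy data uniqueness by zero extension -/
lemma zero_ext {W : Set ℂ} (hW : IsOpen W) (hc : IsPreconnected W)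
    {g : ℂ → ℝ} (hg : ContinuousOn g W) {μ : ℝ} {u : ℂ → ℝ} {D : ℂ → ℂ →L[ℝ] ℝ}
    {H : ℂ → ℂ →L[ℝ] ℂ →L[ℝ] ℝ}
    (du : ∀ x ∈ W, 0 ≤ g x → HasFDerivWithinAt u (D x) (W ∩ {x | 0 ≤ g x}) x)
    (dD : ∀ x ∈ W, 0 ≤ g x → HasFDerivWithinAt D (H x) (W ∩ {x | 0 ≤ g x}) x)
    (cH : ContinuousOn H (W ∩ {x | 0 ≤ g x}))
    (z : ∀ x ∈ W, g x = 0 → u x = 0 ∧ D x = 0 ∧ H x = 0)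
    (pde : ∀ x ∈ W, 0 < g x → H x 1 1 + H x Complex.I Complex.I = - (μ * u x))
    (hne : ∃ x ∈ W, g x < 0) : ∀ x ∈ W, 0 ≤ g x → u x = 0 := by
  obtain ⟨S, hS⟩ : ∃ S, S = {x | 0 ≤ g x} := ⟨_, rfl⟩
  have g1 := fun x hx => glue_deriv (φ := u) (φ' := D) hW hg du (fun x hx h => ⟨(z x hx h).1, (z x hx h).2.1⟩) (x := x) hx
  have g2 := fun x hx => glue_deriv (φ := D) (φ' := H) hW hg dD (fun x hx h => (z x hx h).2) (x := x) hx
  have g3 := glue_cont (φ := H) hW hg cH (fun x hx h => (z x hx h).2.2)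
  rw [← hS] at g3
  simp only [← hS] at g1 g2
  have hC : C2O W (indicator S u) (indicator S D) (indicator S H) := ⟨g1, g2, g3⟩
  have hp : ∀ x ∈ W, indicator S H x 1 1 + indicator S H x Complex.I Complex.I = - (μ * indicator S u x) := by
    intro x hx
    rcases lt_trichotomy (g x) 0 with h | h | h
    · have : x ∉ S := by simpa [hS] using h
      rw [indicator_of_notMem this, indicator_of_notMem this]; simp
    · have : x ∈ S := by rw [hS]; exact h.ge
      rw [indicator_of_mem this, indicator_of_mem this, (z x hx h).1, (z x hx h).2.2]; simp
    · have : x ∈ S := by rw [hS]; exact h.le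
      rw [indicator_of_mem this, indicator_of_mem this]
      exact pde x hx h
  obtain ⟨q, hq, hq0⟩ := hne
  have hev : ∀ᶠ x in 𝓝 q, indicator S u x = 0 := by
    filter_upwards [(hg.continuousAt (hW.mem_nhds hq)) (Iio_mem_nhds hq0)] with y hy
    exact indicator_of_notMem (show y ∉ S by simpa [hS] using hy) _
  have hzero := uc (μ := μ) hW hc hC hp hq hev
  intro x hx h
  have := hzero x hx
  rwa [indicator_of_mem (show x ∈ S by rw [hS]; exact h)] at this
end Rig

namespace Rig
open Filter Topology ComplexConjugate

lemma sub_cont {F X : Type*} [NormedAddCommGroup F] [TopologicalSpace X] {f g : X → F} {A : Set X}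
    (hf : ContinuousOn f A) (hg : ContinuousOn g A) : ContinuousOn (fun x => f x - g x) A := hf.sub hg

section
variable {Ω : Set ℂ} {J : ℕ} {γ : Fin J → ℝ → ℂ} {u : ℂ → ℝ} {μ : ℝ}
    {D : ℂ → ℂ →L[ℝ] ℝ} {H : ℂ → ℂ →L[ℝ] ℂ →L[ℝ] ℝ}

lemma C2B.symm' (h : C2B Ω u D H) (ho : IsOpen Ω) {x : ℂ} (hx : x ∈ closure Ω) (v w : ℂ) :
    H x v w = H x w v := by
  have c : ∀ v w : ℂ, ContinuousOn (fun x => H x v w) (closure Ω) := fun v w =>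
    (h.cH.clm_apply continuousOn_const).clm_apply continuousOn_const
  exact EqOn.of_subset_closure (fun x hx => h.symm ho hx v w) (c v w) (c w v) subset_closure subset_rfl hx

lemma hess_form {B : ℂ →L[ℝ] ℂ →L[ℝ] ℝ} {τ : ℂ} (hτ : τ ≠ 0) (h1 : ∀ v, B τ v = 0) (h2 : ∀ v, B v τ = 0)
    (v w : ℂ) : B v w * ‖τ‖ ^ 2 = (conj τ * v).im * (conj τ * w).im * (B 1 1 + B Complex.I Complex.I) := by
  have hn : ‖τ‖ ^ 2 ≠ 0 := pow_ne_zero 2 (norm_ne_zero_iff.2 hτ)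
  have e : ∀ v : ℂ, ‖τ‖ ^ 2 • v = (conj τ * v).re • τ + (conj τ * v).im • (τ * Complex.I) := by
    intro v
    rw [← Complex.normSq_eq_norm_sq, Complex.normSq_apply]
    apply Complex.ext <;> simp <;> ring
  have hB : B (‖τ‖ ^ 2 • v) (‖τ‖ ^ 2 • w) = (conj τ * v).im * ((conj τ * w).im * B (τ * Complex.I) (τ * Complex.I)) := by
    rw [e v, e w]
    simp only [map_add, map_smul, add_apply, smul_apply, smul_eq_mul, h1, h2]; ring
  have ht := trace_rot' B τ
  rw [h1, zero_add] at ht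
  rw [ht] at hB
  simp only [map_smul, smul_apply, smul_eq_mul] at hB
  apply mul_left_cancel₀ hn
  linear_combination hB

lemma Eig.hess (hd : Dom Ω J γ) (E : Eig Ω u D H μ) (j : Fin J) (s : ℝ) (v w : ℂ) :
    H (γ j s) v w * ‖deriv (γ j) s‖ ^ 2 =
      (conj (deriv (γ j) s) * v).im * (conj (deriv (γ j) s) * w).im * (-(μ * u (γ j 0))) := by
  have hq : γ j s ∈ closure Ω := frontier_subset_closure (hd.mem_fr j s)
  have h1 : HasDerivAt (fun s => D (γ j s)) (H (γ j s) (deriv (γ j) s)) s :=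
    (E.dD _ hq).comp_hasDerivAt s (smooth_d1 (hd.smooth j) s)
      (Eventually.of_forall fun t => frontier_subset_closure (hd.mem_fr j t))
  have h2 : (fun s => D (γ j s)) = fun _ => 0 := funext fun t => E.zero _ (hd.mem_fr j t)
  rw [h2] at h1
  have h3 : H (γ j s) (deriv (γ j) s) = 0 := h1.unique (hasDerivAt_const s 0)
  have h4 : ∀ v, H (γ j s) (deriv (γ j) s) v = 0 := fun v => by rw [h3]; rfl
  rw [hess_form (hd.reg j s) h4 (fun v => by rw [E.toC2B.symm' hd.op hq]; exact h4 v), E.pde' hq, E.const hd j s 0]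

lemma Eig.c2o (hd : Dom Ω J γ) (E : Eig Ω u D H μ) : C2O Ω u D H :=
  ⟨fun x hx => (E.du x (subset_closure hx)).hasFDerivAt (closure_nhds hd.op hx),
   fun x hx => (E.dD x (subset_closure hx)).hasFDerivAt (closure_nhds hd.op hx), E.cH.mono subset_closure⟩

lemma Eig.zero_side (hd : Dom Ω J γ) (E : Eig Ω u D H μ) {j : Fin J} (h0 : u (γ j 0) = 0)
    {q e : ℂ} {δ h : ℝ} {f : ℝ → ℝ} (c : Ch Ω q e δ h f) (hu : upper q e δ h f ⊆ Ω)
    (hγ : ∀ x ∈ Ioo (-δ) δ, ∃ s, γ j s = q + e * (x + f x * Complex.I)) : ∀ x ∈ Ω, u x = 0 := by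
  set X : ℂ → ℝ := fun z => (conj e * (z - q)).re with hX
  set Y : ℂ → ℝ := fun z => (conj e * (z - q)).im with hY
  have cX : Continuous X := by fun_prop
  have cY : Continuous Y := by fun_prop
  have hz : ∀ z, z = q + e * (X z + Y z * Complex.I) := by
    intro z; rw [← frame_eq c.he]; ring
  set W : Set ℂ := X ⁻¹' Ioo (-δ) δ ∩ Y ⁻¹' Ioo (-h) h with hW
  have oW : IsOpen W := (isOpen_Ioo.preimage cX).inter (isOpen_Ioo.preimage cY)
  set T : ℂ →ᵃ[ℝ] ℂ := (((ContinuousLinearMap.mul ℝ ℂ (conj e)).toLinearMap).toAffineMap).comp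
    (AffineMap.id ℝ ℂ - AffineMap.const ℝ ℂ q) with hT
  have cvW : Convex ℝ W := by
    have h1 : Convex ℝ (X ⁻¹' Ioo (-δ) δ) :=
      ((convex_Ioo (-δ) δ).affine_preimage (Complex.reLm.toAffineMap.comp T))
    have h2 : Convex ℝ (Y ⁻¹' Ioo (-h) h) :=
      ((convex_Ioo (-h) h).affine_preimage (Complex.imLm.toAffineMap.comp T))
    exact h1.inter h2
  set g : ℂ → ℝ := fun z => Y z - f (X z) with hg
  have cg : ContinuousOn g W := cY.continuousOn.sub
    (c.sm.continuousOn.comp cX.continuousOn (fun z hz => hz.1))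
  have hup : ∀ z ∈ W, 0 < g z → z ∈ upper q e δ h f := fun z hzW hg0 =>
    ⟨X z, Y z, abs_lt.2 hzW.1, by simp only [hg] at hg0; linarith, hzW.2.2, hz z⟩
  have hgr : ∀ z ∈ W, g z = 0 → ∃ s, γ j s = z := by
    intro z hzW hg0
    obtain ⟨s, hs⟩ := hγ (X z) hzW.1
    refine ⟨s, ?_⟩
    have : f (X z) = Y z := by simp only [hg] at hg0; linarith
    rw [hs, this]; exact (hz z).symm
  have hcl : W ∩ {x | 0 ≤ g x} ⊆ closure Ω := by
    rintro z ⟨hzW, hg0⟩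
    rcases (show 0 ≤ g z from hg0).eq_or_lt with h1 | h1
    · obtain ⟨s, rfl⟩ := hgr z hzW h1.symm
      exact frontier_subset_closure (hd.mem_fr j s)
    · exact subset_closure (hu (hup z hzW h1))
  have XY : ∀ x y : ℝ, X (q + e * (x + y * Complex.I)) = x ∧ Y (q + e * (x + y * Complex.I)) = y := by
    intro x y
    have : conj e * (q + e * (x + y * Complex.I) - q) = x + y * Complex.I := by
      linear_combination (x + y * Complex.I) * unit_conj_mul c.he
    simp only [hX, hY, this]; simp
  have mW : ∀ y : ℝ, |y| < h → q + e * ((0:ℝ) + y * Complex.I) ∈ W := by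
    intro y hy
    constructor
    · rw [mem_preimage, (XY 0 y).1]; exact ⟨by linarith [c.hδ], c.hδ⟩
    · rw [mem_preimage, (XY 0 y).2]; exact abs_lt.1 hy
  have gW : ∀ y : ℝ, g (q + e * ((0:ℝ) + y * Complex.I)) = y := by
    intro y; simp only [hg]; rw [(XY 0 y).1, (XY 0 y).2, c.f0, sub_zero]
  have hh := c.hh
  have z0 := zero_ext (μ := μ) (u := u) (D := D) (H := H) oW cvW.isPreconnected cg
    (fun x hx h => (E.du x (hcl ⟨hx, h⟩)).mono hcl) (fun x hx h => (E.dD x (hcl ⟨hx, h⟩)).mono hcl)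
    (E.cH.mono hcl) (by
      intro x hx h
      obtain ⟨s, rfl⟩ := hgr x hx h
      refine ⟨by rw [E.const hd j s 0, h0], E.zero _ (hd.mem_fr j s), ?_⟩
      ext v w
      have := E.hess hd j s v w
      rw [h0, mul_zero, neg_zero, mul_zero] at this
      simpa [hd.reg j s] using this)
    (fun x hx h => E.pde x (hu (hup x hx h)))
    ⟨_, mW (-(h/2)) (by rw [abs_neg, abs_of_pos] <;> linarith), by rw [gW]; linarith⟩
  have hm := mW (h/2) (by rw [abs_of_pos] <;> linarith)
  have hp : 0 < g (q + e * ((0:ℝ) + (h/2 : ℝ) * Complex.I)) := by rw [gW]; linarith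
  refine uc hd.op hd.conn.isPreconnected (E.c2o hd) E.pde (hu (hup _ hm hp)) ?_
  filter_upwards [oW.mem_nhds hm, (cg.continuousAt (oW.mem_nhds hm)) (Ioi_mem_nhds hp)] with y h1 h2
  exact z0 y h1 (le_of_lt h2)

lemma Eig.dirichlet_zero (hd : Dom Ω J γ) (E : Eig Ω u D H μ) {j : Fin J} (h0 : u (γ j 0) = 0) :
    ∀ x ∈ Ω, u x = 0 := by
  obtain ⟨h1, h2⟩ := unit_tangent (hd.reg j 0)
  obtain ⟨δ, h, -, -, f, S, c, -, -, hS⟩ := hd.ch j 0 h1 (by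
    rw [h2, Complex.ofReal_re]; exact norm_ne_zero_iff.2 (hd.reg j 0)) one_pos
  rcases c.one_side hd.op with hu | hu
  · exact E.zero_side hd h0 c hu fun x hx => ⟨S x, hS x hx⟩
  · refine E.zero_side hd h0 c.flip hu fun x hx => ⟨S (-x), ?_⟩
    rw [hS (-x) ⟨by linarith [hx.2], by linarith [hx.1]⟩]
    push_cast; ring

/-- difference of an eigenfunction and its rotation -/
lemma Eig.rot_diff (E : Eig Ω u D H μ) {a x0 : ℂ} (ha : ‖a‖ = 1) {A : Set ℂ}
    (hA : A ⊆ closure Ω) (hA' : ∀ z ∈ A, x0 + a * (z - x0) ∈ closure Ω) :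
    ∃ (D' : ℂ → ℂ →L[ℝ] ℝ) (H' : ℂ → ℂ →L[ℝ] ℂ →L[ℝ] ℝ),
      (∀ x ∈ A, HasFDerivWithinAt (fun z => u z - u (x0 + a * (z - x0))) (D' x) A x) ∧
      (∀ x ∈ A, HasFDerivWithinAt D' (H' x) A x) ∧ ContinuousOn H' A ∧
      (∀ x ∈ A, H' x 1 1 + H' x Complex.I Complex.I = -(μ * (u x - u (x0 + a * (x - x0))))) ∧
      (∀ x v, D' x v = D x v - D (x0 + a * (x - x0)) (a * v)) ∧
      (∀ x v w, H' x v w = H x v w - H (x0 + a * (x - x0)) (a * v) (a * w)) := by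
  set φ : ℂ → ℂ := fun z => x0 + a * (z - x0) with hφ
  have cφ : Continuous φ := by fun_prop
  set M : ℂ →L[ℝ] ℂ := (ContinuousLinearMap.mul ℝ ℂ a) with hM
  have dφ : ∀ z, HasFDerivAt φ M z := fun z => by
    have := ((M.hasFDerivAt (x := z)).const_add (x0 - a * x0))
    have e : φ = fun z => (x0 - a * x0) + M z := by
      funext z; simp only [hφ, hM, ContinuousLinearMap.mul_apply']; ring
    rw [e]; exact this
  let Φ : (ℂ →L[ℝ] ℝ) →L[ℝ] (ℂ →L[ℝ] ℝ) := (ContinuousLinearMap.compL ℝ ℂ ℂ ℝ).flip M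
  have mps : MapsTo φ A (closure Ω) := hA'
  have tr : ∀ x v w, (H x - Φ.comp ((H (φ x)).comp M)) v w = H x v w - H (φ x) (a * v) (a * w) := by
    intro x v w; simp [Φ, hM]
  refine ⟨fun z => D z - Φ (D (φ z)), fun z => H z - Φ.comp ((H (φ z)).comp M), ?_, ?_, ?_, ?_, ?_, tr⟩
  · intro x hx
    exact ((E.du x (hA hx)).mono hA).sub ((E.du (φ x) (mps hx)).comp x (dφ x).hasFDerivWithinAt mps)
  · intro x hx
    exact ((E.dD x (hA hx)).mono hA).sub
      (Φ.hasFDerivAt.comp_hasFDerivWithinAt x ((E.dD (φ x) (mps hx)).comp x (dφ x).hasFDerivWithinAt mps))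
  · have c1 : ContinuousOn (fun z => H (φ z)) A := E.cH.comp cφ.continuousOn mps
    have c2 : ContinuousOn (fun z => (H (φ z)).comp M) A := c1.clm_comp continuousOn_const
    have c3 : ContinuousOn (fun z => Φ.comp ((H (φ z)).comp M)) A := continuousOn_const.clm_comp c2
    exact sub_cont (F := ℂ →L[ℝ] ℂ →L[ℝ] ℝ) (X := ℂ) (E.cH.mono hA) c3
  · intro x hx
    rw [tr, tr]
    have h1 := E.pde' (hA hx)
    have h2 := E.pde' (mps hx)
    rw [← trace_rot _ ha] at h2
    rw [mul_one]
    linarith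
  · intro x v; simp [Φ, hM, hφ]
end
end Rig

namespace Rig
open Filter Topology ComplexConjugate

section
variable {Ω : Set ℂ} {J : ℕ} {γ : Fin J → ℝ → ℂ} {u : ℂ → ℝ} {μ : ℝ}
    {D : ℂ → ℂ →L[ℝ] ℝ} {H : ℂ → ℂ →L[ℝ] ℂ →L[ℝ] ℝ}

lemma orth_of_norm {g : ℝ → ℂ} (hg : ContDiff ℝ (⊤ : ℕ∞) g) {s : ℝ} {x0 : ℂ} {R : ℝ}
    (h : ∀ᶠ t in 𝓝 s, ‖g t - x0‖ = R) : (conj (g s - x0) * deriv g s).re = 0 := by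
  have d := smooth_d1 hg s
  have d1 : HasDerivAt (fun t => (g t - x0).re ^ 2 + (g t - x0).im ^ 2)
      (2 * ((g s - x0).re * (deriv g s).re + (g s - x0).im * (deriv g s).im)) s := by
    have a := hasDerivAt_re (d.sub_const x0)
    have b := hasDerivAt_im (d.sub_const x0)
    refine ((a.pow 2).add (b.pow 2)).congr_deriv ?_
    push_cast; ring
  have e : (fun t => (g t - x0).re ^ 2 + (g t - x0).im ^ 2) =ᶠ[𝓝 s] fun _ => R ^ 2 := by
    filter_upwards [h] with t ht
    rw [← ht, ← Complex.normSq_eq_norm_sq, Complex.normSq_apply]; ring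
  have := d1.unique ((hasDerivAt_const s (R^2)).congr_of_eventuallyEq e)
  simp only [Complex.mul_re, Complex.conj_re, Complex.conj_im]
  linarith

lemma arc_side_aux {q e x0 : ℂ} {δ h R r1 s : ℝ} {f : ℝ → ℝ} (c : Ch Ω q e δ h f)
    (hu : upper q e δ h f ⊆ Ω) (hhR : h < R) (hs : s = 1 ∨ s = -1) (hr1 : 0 < r1)
    (hq : q - x0 = (s * R : ℝ) * (e * Complex.I))
    (hfr : ∀ z ∈ frontier Ω, dist z q < r1 → ‖z - x0‖ ^ 2 = R ^ 2) :
    ∃ r > 0, r ≤ r1 ∧ (∀ z ∈ Metric.ball q r, 0 < s * (‖z - x0‖ ^ 2 - R ^ 2) → z ∈ Ω) ∧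
      (∀ z ∈ Metric.ball q r, ‖z - x0‖ ^ 2 = R ^ 2 → z ∈ frontier Ω) := by
  have nz : ∀ x y : ℝ, ‖q + e * (x + y * Complex.I) - x0‖ ^ 2 = x ^ 2 + (y + s * R) ^ 2 := by
    intro x y
    have : q + e * (x + y * Complex.I) - x0 = e * (x + ((y + s * R : ℝ) : ℂ) * Complex.I) := by
      push_cast at hq ⊢
      linear_combination hq
    rw [this, norm_mul, c.he, one_mul, ← Complex.normSq_eq_norm_sq, Complex.normSq_add_mul_I]
  have cf : ContinuousAt f 0 := (c.sm.continuousOn).continuousAt (Ioo_mem_nhds (by linarith [c.hδ]) c.hδ)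
  have ev : ∀ᶠ x in 𝓝 (0:ℝ), |x| + |f x| < r1 := by
    have : ContinuousAt (fun x : ℝ => |x| + |f x|) 0 := continuous_abs.continuousAt.add cf.abs
    exact this.eventually_lt_const (by simp [c.f0, hr1])
  obtain ⟨ε, hε, hev⟩ := Metric.eventually_nhds_iff.1 ev
  have main : ∀ z ∈ Metric.ball q (min (min ε r1) (min δ h)), ∃ x y : ℝ, |x| < δ ∧ |y| < h ∧ |f x| < h ∧
      z = q + e * (x + y * Complex.I) ∧ ‖z - x0‖ ^ 2 - R ^ 2 = (y - f x) * (y + f x + 2 * s * R) ∧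
      q + e * (x + f x * Complex.I) ∈ frontier Ω := by
    intro z hz
    rw [Metric.mem_ball] at hz
    obtain ⟨x, y, hx, hy, rfl⟩ := c.near (hz.trans_le (min_le_right _ _))
    have hxe : |x| < ε := by
      have h1 : |x| ≤ dist (q + e * (x + y * Complex.I)) q := by
        rw [dist_eq_norm, add_sub_cancel_left, norm_mul, c.he, one_mul]
        simpa using Complex.abs_re_le_norm (x + y * Complex.I)
      exact h1.trans_lt (hz.trans_le ((min_le_left _ _).trans (min_le_left _ _)))
    have hx' := abs_lt.1 hx
    have hm := c.mem x hx'
    have h2 := hfr _ hm (by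
      rw [dist_eq_norm, add_sub_cancel_left, norm_mul, c.he, one_mul]
      refine lt_of_le_of_lt (norm_add_le _ _) ?_
      rw [norm_mul, Complex.norm_I, mul_one, Complex.norm_real, Complex.norm_real]
      exact hev (by simpa using hxe))
    refine ⟨x, y, hx, hy, c.bd x hx', rfl, ?_, hm⟩
    rw [nz] at h2 ⊢
    linear_combination h2
  refine ⟨min (min ε r1) (min δ h), lt_min (lt_min hε hr1) (lt_min c.hδ c.hh),
    (min_le_left _ _).trans (min_le_right _ _), ?_, ?_⟩
  · intro z hz h0
    obtain ⟨x, y, hx, hy, hf, rfl, h1, hm⟩ := main z hz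
    rw [h1] at h0
    have hy := abs_lt.1 hy
    have hf := abs_lt.1 hf
    apply hu
    refine ⟨x, y, hx, ?_, hy.2, rfl⟩
    by_contra hle
    push Not at hle
    rcases hs with rfl | rfl
    · nlinarith
    · nlinarith
  · intro z hz h0
    obtain ⟨x, y, hx, hy, hf, rfl, h1, hm⟩ := main z hz
    rw [h0, sub_self] at h1
    have hy := abs_lt.1 hy
    have hf := abs_lt.1 hf
    rcases mul_eq_zero.1 h1.symm with h2 | h2
    · have : y = f x := by linarith
      rwa [this]
    · exfalso
      rcases hs with rfl | rfl <;> linarith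

lemma Dom.arc_side (hd : Dom Ω J γ) {j : Fin J} {s0 : ℝ} {x0 : ℂ} {R : ℝ} (hR : 0 < R)
    (h : ∀ᶠ s in 𝓝 s0, ‖γ j s - x0‖ = R) :
    ∃ r > 0, ∃ s : ℝ, (s = 1 ∨ s = -1) ∧
      (∀ z ∈ Metric.ball (γ j s0) r, 0 < s * (‖z - x0‖ ^ 2 - R ^ 2) → z ∈ Ω) ∧
      (∀ z ∈ Metric.ball (γ j s0) r, ‖z - x0‖ ^ 2 = R ^ 2 →
        ∃ t, γ j t = z ∧ (conj (z - x0) * deriv (γ j) t).re = 0) := by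
  obtain ⟨ε, hε, hev⟩ := Metric.eventually_nhds_iff.1 h.eventually_nhds
  obtain ⟨r1, hr1, hfar⟩ := hd.far j s0 hε
  have hfr : ∀ z ∈ frontier Ω, dist z (γ j s0) < r1 → ‖z - x0‖ ^ 2 = R ^ 2 := by
    intro z hz hz1
    obtain ⟨σ, h1, rfl⟩ := hfar z hz hz1
    rw [(hev (y := σ) h1).self_of_nhds]
  have hfr' : ∀ z ∈ frontier Ω, dist z (γ j s0) < r1 → ∃ t, γ j t = z ∧ (conj (z - x0) * deriv (γ j) t).re = 0 := by
    intro z hz hz1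
    obtain ⟨σ, h1, rfl⟩ := hfar z hz hz1
    exact ⟨σ, rfl, orth_of_norm (hd.smooth j) (hev (y := σ) h1)⟩
  have ho := orth_of_norm (hd.smooth j) h
  have hqR := h.self_of_nhds
  set q := γ j s0 with hq
  have hRc : (R : ℂ) ≠ 0 := by exact_mod_cast hR.ne'
  set e : ℂ := Complex.I * ((q - x0) / R) with he
  have ne : ‖e‖ = 1 := by
    rw [he, norm_mul, norm_div, Complex.norm_I, Complex.norm_real, Real.norm_eq_abs, abs_of_pos hR, hqR, div_self hR.ne', mul_one]
  have heq : q - x0 = -(R * (e * Complex.I)) := by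
    rw [he]; field_simp
    linear_combination (q - x0) * Complex.I_sq
  obtain ⟨δ, hh, -, hhR, f, S, c, -⟩ := hd.ch j s0 ne (by
    intro h0
    apply hd.reg j s0
    have h1 : (conj (q - x0) * deriv (γ j) s0) = 0 := by
      apply Complex.ext
      · exact ho
      · have : conj e = -Complex.I * (conj (q - x0) / R) := by rw [he]; simp
        rw [this] at h0
        have e2 : -Complex.I * (conj (q - x0) / R) * deriv (γ j) s0 =
          ((1 / R : ℝ) : ℂ) * (-Complex.I * (conj (q - x0) * deriv (γ j) s0)) := by
          push_cast; ring
        rw [e2, Complex.re_ofReal_mul] at h0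
        have h3 := (mul_eq_zero.1 h0).resolve_left (by positivity)
        simpa using h3
    rcases mul_eq_zero.1 h1 with h2 | h2
    · exfalso
      have : q - x0 = 0 := (map_eq_zero _).1 h2
      rw [this, norm_zero] at hqR
      exact hR.ne hqR
    · exact h2) hR
  rcases c.one_side hd.op with hu | hu
  · obtain ⟨r, hr, hrr, a1, a2⟩ := arc_side_aux c hu hhR (Or.inr rfl) hr1 (by rw [heq]; push_cast; ring) hfr
    exact ⟨r, hr, -1, Or.inr rfl, a1, fun z hz h0 => hfr' z (a2 z hz h0) (lt_of_lt_of_le hz hrr)⟩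
  · obtain ⟨r, hr, hrr, a1, a2⟩ := arc_side_aux c.flip hu hhR (Or.inl rfl) hr1 (by rw [heq]; push_cast; ring) hfr
    exact ⟨r, hr, 1, Or.inl rfl, a1, fun z hz h0 => hfr' z (a2 z hz h0) (lt_of_lt_of_le hz hrr)⟩
end
end Rig

namespace Rig
open Filter Topology ComplexConjugate

section
variable {Ω : Set ℂ} {J : ℕ} {γ : Fin J → ℝ → ℂ} {u : ℂ → ℝ} {μ : ℝ}
    {D : ℂ → ℂ →L[ℝ] ℝ} {H : ℂ → ℂ →L[ℝ] ℂ →L[ℝ] ℝ}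

lemma hess_circ (hd : Dom Ω J γ) (E : Eig Ω u D H μ) {j : Fin J} {t : ℝ} {n : ℂ} {R : ℝ} (hR : 0 < R)
    (hn : ‖n‖ ^ 2 = R ^ 2) (ho : (conj n * deriv (γ j) t).re = 0) (v w : ℂ) :
    H (γ j t) v w * R ^ 2 = (conj n * v).re * (conj n * w).re * (-(μ * u (γ j 0))) := by
  have h := E.hess hd j t v w
  set τ := deriv (γ j) t with hτ
  have hτ0 : ‖τ‖ ^ 2 ≠ 0 := pow_ne_zero 2 (norm_ne_zero_iff.2 (hd.reg j t))
  have hR2 : R ^ 2 ≠ 0 := pow_ne_zero 2 hR.ne'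
  rw [← Complex.normSq_eq_norm_sq, Complex.normSq_apply] at hn h hτ0
  simp only [Complex.mul_re, Complex.mul_im, Complex.conj_re, Complex.conj_im] at ho h ⊢
  set k := n.re * τ.im - n.im * τ.re with hk
  have a : ∀ v : ℂ, R ^ 2 * (τ.re * v.im + -τ.im * v.re) = - k * (n.re * v.re - -n.im * v.im) := by
    intro v
    rw [← hn, hk]
    linear_combination (n.re * v.im - n.im * v.re) * ho
  have b : (τ.re * τ.re + τ.im * τ.im) * R ^ 2 = k ^ 2 := by
    rw [← hn, hk]
    linear_combination (n.re * τ.re + n.im * τ.im) * ho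
  apply mul_left_cancel₀ hτ0
  apply mul_left_cancel₀ hR2
  linear_combination R ^ 4 * h + (-(μ * u (γ j 0))) * R ^ 2 * (τ.re * w.im + -τ.im * w.re) * a v
     + (-(μ * u (γ j 0))) * (- k * (n.re * v.re - -n.im * v.im)) * a w
     - (-(μ * u (γ j 0))) * (n.re * v.re - -n.im * v.im) * (n.re * w.re - -n.im * w.im) * b

lemma rot_path (x0 z : ℂ) (θ : ℝ) : HasDerivAt (fun θ : ℝ => x0 + Complex.exp (θ * Complex.I) * (z - x0))
    (Complex.I * (x0 + Complex.exp (θ * Complex.I) * (z - x0) - x0)) θ := by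
  have h1 : HasDerivAt (fun θ : ℝ => (θ * Complex.I : ℂ)) (1 * Complex.I) θ :=
    (Complex.ofRealCLM.hasDerivAt (x := θ)).mul_const _
  refine ((h1.cexp.mul_const (z - x0)).const_add x0).congr_deriv ?_
  ring

lemma rot_deriv_zero {x0 z : ℂ} (h : HasFDerivAt u (D z) z)
    (he : ∀ᶠ θ : ℝ in 𝓝 0, u (x0 + Complex.exp (θ * Complex.I) * (z - x0)) = u z) :
    D z (Complex.I * (z - x0)) = 0 := by
  have h0 : x0 + Complex.exp ((0:ℝ) * Complex.I) * (z - x0) = z := by simp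
  have p := rot_path x0 z 0
  rw [h0] at p
  have h1 : HasDerivAt (fun θ : ℝ => u (x0 + Complex.exp (θ * Complex.I) * (z - x0))) (D z (Complex.I * (z - x0))) 0 := by
    have h' : HasFDerivAt u (D z) (x0 + Complex.exp ((0:ℝ) * Complex.I) * (z - x0)) := by rw [h0]; exact h
    exact h'.comp_hasDerivAt 0 p
  exact h1.unique ((hasDerivAt_const 0 (u z)).congr_of_eventuallyEq he)

lemma rot_small {K η : ℝ} (hη : 0 < η) : ∃ θ0 > 0, ∀ θ : ℝ, |θ| < θ0 →
    ‖Complex.exp (θ * Complex.I) - 1‖ * K < η := by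
  have c : Continuous (fun θ : ℝ => ‖Complex.exp (θ * Complex.I) - 1‖ * K) := by fun_prop
  have e : ∀ᶠ θ : ℝ in 𝓝 0, ‖Complex.exp (θ * Complex.I) - 1‖ * K < η :=
    (c.tendsto 0).eventually_lt_const (by simpa using hη)
  obtain ⟨θ0, h0, h1⟩ := Metric.eventually_nhds_iff.1 e
  exact ⟨θ0, h0, fun θ hθ => h1 (by simpa using hθ)⟩

lemma rot_dist (x0 z a : ℂ) : dist (x0 + a * (z - x0)) z = ‖a - 1‖ * ‖z - x0‖ := by
  rw [dist_eq_norm, ← norm_mul]; congr 1; ring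

lemma Eig.rot_prop (hd : Dom Ω J γ) (E : Eig Ω u D H μ) {x0 p : ℂ} (hp : p ∈ Ω)
    (h : ∀ᶠ z in 𝓝 p, D z (Complex.I * (z - x0)) = 0) : ∀ z ∈ Ω, D z (Complex.I * (z - x0)) = 0 := by
  have hsub : Ω ⊆ {z | ∀ᶠ y in 𝓝 z, D y (Complex.I * (y - x0)) = 0} := by
    refine hd.conn.isPreconnected.subset_of_closure_inter_subset (isOpen_setOfPred_eventually_nhds) ⟨p, hp, h⟩ ?_
    rintro x ⟨hx, hxΩ⟩
    obtain ⟨ρ, hρ, hB⟩ := Metric.isOpen_iff.1 hd.op x hxΩ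
    obtain ⟨z, hz, hzx⟩ := Metric.mem_closure_iff.1 hx (ρ/2) (by positivity)
    set W := Metric.ball x (ρ/2) with hW
    have hzW : z ∈ W := by rw [hW, Metric.mem_ball, dist_comm]; exact hzx
    obtain ⟨η, hη, hzη⟩ := Metric.eventually_nhds_iff_ball.1 (hz.and (Metric.isOpen_ball.mem_nhds hzW))
    set K := ‖x - x0‖ + ρ with hK
    have hWK : ∀ y ∈ W, ‖y - x0‖ ≤ K := by
      intro y hy
      rw [hW, Metric.mem_ball, dist_eq_norm] at hy
      calc ‖y - x0‖ = ‖(y - x) + (x - x0)‖ := by congr 1; ring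
        _ ≤ ‖y - x‖ + ‖x - x0‖ := norm_add_le _ _
        _ ≤ K := by linarith
    have hWΩ : W ⊆ Ω := fun y hy => hB (Metric.ball_subset_ball (by linarith) hy)
    obtain ⟨θ0, hθ0, hsm⟩ := rot_small (K := K) (η := min (ρ/2) (η/2)) (lt_min (by positivity) (by positivity))
    have mv : ∀ y ∈ W, ∀ θ : ℝ, |θ| < θ0 → dist (x0 + Complex.exp (θ * Complex.I) * (y - x0)) y < min (ρ/2) (η/2) := by
      intro y hy θ hθ
      rw [rot_dist]
      exact (mul_le_mul_of_nonneg_left (hWK y hy) (norm_nonneg _)).trans_lt (hsm θ hθ)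
    have mvΩ : ∀ y ∈ W, ∀ θ : ℝ, |θ| < θ0 → x0 + Complex.exp (θ * Complex.I) * (y - x0) ∈ Ω := by
      intro y hy θ hθ
      apply hB
      have h1 := (mv y hy θ hθ).trans_le (min_le_left _ _)
      have h2 := dist_triangle (x0 + Complex.exp (θ * Complex.I) * (y - x0)) y x
      rw [hW, Metric.mem_ball] at hy
      rw [Metric.mem_ball]; linarith
    have near : ∀ θ : ℝ, |θ| < θ0 → ∀ y ∈ Metric.ball z (η/2), u y - u (x0 + Complex.exp (θ * Complex.I) * (y - x0)) = 0 := by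
      intro θ hθ y hy
      have hyW : y ∈ W := (hzη y (Metric.ball_subset_ball (by linarith) hy)).2
      have dφ : ∀ t ∈ Metric.ball (0:ℝ) θ0, HasDerivAt (fun t : ℝ => u (x0 + Complex.exp (t * Complex.I) * (y - x0))) 0 t := by
        intro t ht
        rw [Metric.mem_ball, dist_zero_right, Real.norm_eq_abs] at ht
        have h1 := ((E.c2o hd).du _ (mvΩ y hyW t ht)).comp_hasDerivAt t (rot_path x0 y t)
        refine h1.congr_deriv ?_
        refine (hzη _ ?_).1
        have h2 := (mv y hyW t ht).trans_le (min_le_right _ _)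
        have h3 := dist_triangle (x0 + Complex.exp (t * Complex.I) * (y - x0)) y z
        rw [Metric.mem_ball] at hy ⊢
        linarith
      have := Metric.isOpen_ball.is_const_of_deriv_eq_zero (convex_ball (0:ℝ) θ0).isPreconnected
        (fun t ht => (dφ t ht).differentiableAt.differentiableWithinAt) (fun t ht => (dφ t ht).deriv)
        (Metric.mem_ball_self hθ0) (show θ ∈ Metric.ball (0:ℝ) θ0 by simpa using hθ)
      simp only [Complex.ofReal_zero, zero_mul, Complex.exp_zero, one_mul] at this
      rw [← this]; simp
    have all : ∀ θ : ℝ, |θ| < θ0 → ∀ y ∈ W, u y - u (x0 + Complex.exp (θ * Complex.I) * (y - x0)) = 0 := by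
      intro θ hθ
      obtain ⟨D', H', d1, d2, d3, d4, -, -⟩ := E.rot_diff (x0 := x0) (Complex.norm_exp_ofReal_mul_I θ)
        (hWΩ.trans subset_closure) (fun y hy => subset_closure (mvΩ y hy θ hθ))
      have oW : IsOpen W := Metric.isOpen_ball
      refine uc oW (convex_ball x (ρ/2)).isPreconnected
        ⟨fun y hy => (d1 y hy).hasFDerivAt (oW.mem_nhds hy), fun y hy => (d2 y hy).hasFDerivAt (oW.mem_nhds hy), d3⟩
        d4 hzW ?_
      filter_upwards [Metric.ball_mem_nhds z (half_pos hη)] with y hy using near θ hθ y hy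
    filter_upwards [Metric.isOpen_ball.mem_nhds (Metric.mem_ball_self (half_pos hρ) : x ∈ W)] with y hy
    refine rot_deriv_zero ((E.c2o hd).du y (hWΩ hy)) ?_
    filter_upwards [Metric.ball_mem_nhds (0:ℝ) hθ0] with θ hθ
    have := all θ (by simpa using hθ) y hy
    linarith
  exact fun z hz => (hsub hz).self_of_nhds

lemma Eig.rot_near (hd : Dom Ω J γ) (E : Eig Ω u D H μ) {j : Fin J} {s0 : ℝ} {x0 : ℂ} {R : ℝ} (hR : 0 < R)
    (h : ∀ᶠ s in 𝓝 s0, ‖γ j s - x0‖ = R) :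
    ∃ p ∈ Ω, ∀ᶠ z in 𝓝 p, D z (Complex.I * (z - x0)) = 0 := by
  obtain ⟨r, hr, s, hs, hi, hf⟩ := hd.arc_side hR h
  have hqR := h.self_of_nhds
  set q := γ j s0 with hq
  have hss : s * s = 1 := by rcases hs with rfl | rfl <;> norm_num
  obtain ⟨g, hg⟩ : ∃ g : ℂ → ℝ, g = fun z => s * (‖z - x0‖ ^ 2 - R ^ 2) := ⟨_, rfl⟩
  have cg : Continuous g := by rw [hg]; fun_prop
  have g0 : ∀ z, g z = 0 → ‖z - x0‖ ^ 2 = R ^ 2 := by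
    intro z hz
    rw [hg] at hz
    have : s ≠ 0 := by rintro rfl; simp at hss
    linarith [(mul_eq_zero.1 hz).resolve_left this]
  have hi' : ∀ z ∈ Metric.ball q r, 0 < g z → z ∈ Ω := by rw [hg]; exact hi
  have hcl : ∀ z ∈ Metric.ball q r, 0 ≤ g z → z ∈ closure Ω := by
    intro z hz h0
    rcases h0.eq_or_lt with h1 | h1
    · obtain ⟨t, rfl, -⟩ := hf z hz (g0 z h1.symm)
      exact frontier_subset_closure (hd.mem_fr j t)
    · exact subset_closure (hi' z hz h1)
  set W := Metric.ball q (r/2) with hW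
  have hWb : W ⊆ Metric.ball q r := Metric.ball_subset_ball (by linarith)
  have hWK : ∀ y ∈ W, ‖y - x0‖ ≤ R + r := by
    intro y hy
    rw [hW, Metric.mem_ball, dist_eq_norm] at hy
    calc ‖y - x0‖ = ‖(y - q) + (q - x0)‖ := by congr 1; ring
      _ ≤ ‖y - q‖ + ‖q - x0‖ := norm_add_le _ _
      _ ≤ R + r := by rw [hqR]; linarith
  -- test points
  set t := min (r / (4 * R)) (1/2) with ht
  have t0 : 0 < t := lt_min (by positivity) (by norm_num)
  have t1 : t ≤ 1/2 := min_le_right _ _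
  have t2 : t * R ≤ r / 4 := by
    calc t * R ≤ r / (4 * R) * R := mul_le_mul_of_nonneg_right (min_le_left _ _) hR.le
      _ = r / 4 := by field_simp
  have pt : ∀ c : ℝ, |c| = t → q + c * (q - x0) ∈ W ∧ g (q + c * (q - x0)) = s * (2 * c + c ^ 2) * R ^ 2 := by
    intro c hc
    constructor
    · rw [hW, Metric.mem_ball, dist_eq_norm, add_sub_cancel_left, norm_mul, Complex.norm_real, Real.norm_eq_abs, hc, hqR]
      linarith
    · have e : q + c * (q - x0) - x0 = ((1 + c : ℝ) : ℂ) * (q - x0) := by push_cast; ring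
      rw [hg]
      simp only [e]
      rw [norm_mul, Complex.norm_real, hqR, mul_pow, Real.norm_eq_abs, sq_abs]; ring
  have hst : |s * t| = t := by
    rcases hs with rfl | rfl <;> simp [abs_of_pos t0]
  obtain ⟨p1, p2⟩ := pt (s * t) hst
  obtain ⟨n1, n2⟩ := pt (-(s * t)) (by rw [abs_neg, hst])
  have hR2 : 0 < R ^ 2 := by positivity
  have p3 : 0 < g (q + (s * t : ℝ) * (q - x0)) := by
    rw [p2]
    apply mul_pos _ hR2
    have : s * (2 * (s * t) + (s * t) ^ 2) = 2 * t + s * t ^ 2 := by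
      linear_combination (2 * t + s * t ^ 2) * hss
    rw [this]
    rcases hs with h | h <;> rw [h] <;> nlinarith
  have n3 : g (q + (-(s * t) : ℝ) * (q - x0)) < 0 := by
    rw [n2]
    apply mul_neg_of_neg_of_pos _ hR2
    have : s * (2 * -(s * t) + (-(s * t)) ^ 2) = -(2 * t) + s * t ^ 2 := by
      linear_combination (-(2 * t) + s * t ^ 2) * hss
    rw [this]
    rcases hs with h | h <;> rw [h] <;> nlinarith
  obtain ⟨θ0, hθ0, hsm⟩ := rot_small (K := R + r) (half_pos hr)
  have all : ∀ θ : ℝ, |θ| < θ0 → ∀ y ∈ W, 0 ≤ g y → u y - u (x0 + Complex.exp (θ * Complex.I) * (y - x0)) = 0 := by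
    intro θ hθ
    have ha := Complex.norm_exp_ofReal_mul_I θ
    have hsmθ := hsm θ hθ
    set a := Complex.exp (θ * Complex.I) with hadef
    have mv : ∀ y ∈ W, x0 + a * (y - x0) ∈ Metric.ball q r := by
      intro y hy
      have h1 : dist (x0 + a * (y - x0)) y < r / 2 := by
        rw [rot_dist]
        exact (mul_le_mul_of_nonneg_left (hWK y hy) (norm_nonneg _)).trans_lt hsmθ
      have h2 := dist_triangle (x0 + a * (y - x0)) y q
      rw [hW, Metric.mem_ball] at hy
      rw [Metric.mem_ball]; linarith
    have nr : ∀ y, ‖x0 + a * (y - x0) - x0‖ = ‖y - x0‖ := by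
      intro y; rw [add_sub_cancel_left, norm_mul, ha, one_mul]
    have gr : ∀ y, g (x0 + a * (y - x0)) = g y := by
      intro y; rw [hg]; simp only [nr]
    obtain ⟨D', H', d1, d2, d3, d4, d5, d6⟩ := E.rot_diff (x0 := x0) (A := W ∩ {x | 0 ≤ g x}) ha
      (fun y hy => hcl y (hWb hy.1) hy.2) (fun y hy => hcl _ (mv y hy.1) (by rw [gr]; exact hy.2))
    refine zero_ext (μ := μ) Metric.isOpen_ball (convex_ball q (r/2)).isPreconnected cg.continuousOn
      (fun x hx h => d1 x ⟨hx, h⟩) (fun x hx h => d2 x ⟨hx, h⟩) d3 ?_ (fun x hx h => d4 x ⟨hx, h.le⟩)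
      ⟨_, n1, n3⟩
    intro x hx h0
    have e0 := g0 x h0
    have e1 : ‖x0 + a * (x - x0) - x0‖ ^ 2 = R ^ 2 := by rw [nr, e0]
    obtain ⟨t, ht, ht'⟩ := hf x (hWb hx) e0
    obtain ⟨t', hta, hta'⟩ := hf _ (mv x hx) e1
    refine ⟨?_, ?_, ?_⟩
    · change u x - u (x0 + a * (x - x0)) = 0
      rw [← ht, ht, ← hta, ← ht, E.const hd j t 0, E.const hd j t' 0, sub_self]
    · ext v
      rw [d5, E.zero x (by rw [← ht]; exact hd.mem_fr j t), E.zero (x0 + a * (x - x0)) (by rw [← hta]; exact hd.mem_fr j t')]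
      simp
    · ext v w
      rw [d6]
      have k1 := hess_circ hd E hR e0 ht' v w
      have k2 := hess_circ hd E hR e1 hta' (a * v) (a * w)
      rw [ht] at k1
      rw [hta] at k2
      have cc : ∀ v, conj (x0 + a * (x - x0) - x0) * (a * v) = conj (x - x0) * v := by
        intro v
        rw [add_sub_cancel_left, map_mul]
        linear_combination (conj (x - x0) * v) * unit_conj_mul ha
      rw [cc, cc, ← k1] at k2
      have := mul_right_cancel₀ hR2.ne' k2
      rw [this]; simp
  refine ⟨_, hi' _ (hWb p1) p3, ?_⟩
  filter_upwards [Metric.isOpen_ball.mem_nhds p1, cg.continuousAt (Ioi_mem_nhds p3)] with z hz hz0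
  refine rot_deriv_zero ((E.c2o hd).du z (hi' z (hWb hz) hz0)) ?_
  filter_upwards [Metric.ball_mem_nhds (0:ℝ) hθ0] with θ hθ
  have := all θ (by simpa using hθ) z hz (le_of_lt hz0)
  linarith
end
end Rig

namespace Rig
open Filter Topology ComplexConjugate

section
variable {Ω : Set ℂ} {J : ℕ} {γ : Fin J → ℝ → ℂ} {u : ℂ → ℝ} {D : ℂ → ℂ →L[ℝ] ℝ}
  {H : ℂ → ℂ →L[ℝ] ℂ →L[ℝ] ℝ} {μ : ℝ} {x0 : ℂ}

/-- Rotation invariance of `u` forces the boundary to be orthogonal to the radii. -/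
lemma Eig.rot_boundary (hd : Dom Ω J γ) (E : Eig Ω u D H μ) (hμ : 0 < μ) {j0 : Fin J}
    (hj0 : |u (γ j0 0)| = 1) (hw : ∀ z ∈ Ω, D z (Complex.I * (z - x0)) = 0) (j : Fin J) (s : ℝ) :
    (conj (γ j s - x0) * deriv (γ j) s).re = 0 := by
  have hq : γ j s ∈ closure Ω := frontier_subset_closure (hd.mem_fr j s)
  have hl : HasFDerivAt (fun z : ℂ => Complex.I * (z - x0))
      ((ContinuousLinearMap.mul ℝ ℂ) Complex.I) (γ j s) :=
    (((ContinuousLinearMap.mul ℝ ℂ) Complex.I).hasFDerivAt.comp (γ j s)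
      ((hasFDerivAt_id _).sub_const x0))
  have hc : ∀ z ∈ closure Ω, D z (Complex.I * (z - x0)) = 0 := by
    have c1 : ContinuousOn D (closure Ω) := fun z hz => (E.dD z hz).continuousWithinAt
    have : EqOn (fun z => D z (Complex.I * (z - x0))) (fun _ => (0:ℝ)) (closure Ω) :=
      EqOn.of_subset_closure (s := Ω) hw (c1.clm_apply (by fun_prop)) continuousOn_const
        subset_closure subset_rfl
    exact this
  have d1 := (E.dD _ hq).clm_apply (hl.hasFDerivWithinAt)
  have d2 : HasFDerivWithinAt (fun z => D z (Complex.I * (z - x0))) (0 : ℂ →L[ℝ] ℝ) (closure Ω) (γ j s) :=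
    (hasFDerivWithinAt_const (0:ℝ) _ _).congr hc (hc _ hq)
  have d3 := (hd.uniqueDiff _ hq).eq d1 d2
  have d4 := congrArg (fun L : ℂ →L[ℝ] ℝ => L (Complex.I * (γ j s - x0))) d3
  rw [E.zero _ (hd.mem_fr j s)] at d4
  have d5 : H (γ j s) (Complex.I * (γ j s - x0)) (Complex.I * (γ j s - x0)) = 0 := by
    simpa using d4
  have h := E.hess hd j s (Complex.I * (γ j s - x0)) (Complex.I * (γ j s - x0))
  rw [d5, zero_mul] at h
  have hu : u (γ j 0) ≠ 0 := by
    intro h0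
    have z1 := E.dirichlet_zero hd h0
    have : EqOn u (fun _ => (0:ℝ)) (closure Ω) :=
      EqOn.of_subset_closure (s := Ω) z1 E.toC2B.cu continuousOn_const subset_closure subset_rfl
    rw [this (frontier_subset_closure (hd.mem_fr j0 0))] at hj0
    norm_num at hj0
  have h2 : (conj (deriv (γ j) s) * (Complex.I * (γ j s - x0))).im = 0 := by
    have h3 : -(μ * u (γ j 0)) ≠ 0 := neg_ne_zero.2 (mul_ne_zero hμ.ne' hu)
    have := (mul_eq_zero.1 h.symm).resolve_right h3
    exact mul_self_eq_zero.1 this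
  rw [← h2]
  simp [Complex.mul_re, Complex.mul_im]
  ring

lemma norm_const_of_orth {g : ℝ → ℂ} (hg : ContDiff ℝ (⊤ : ℕ∞) g)
    (h : ∀ s, (conj (g s - x0) * deriv g s).re = 0) (s t : ℝ) : ‖g s - x0‖ = ‖g t - x0‖ := by
  have hd : ∀ s, HasDerivAt (fun s => ‖g s - x0‖ ^ 2) 0 s := by
    intro s
    have h1 : HasDerivAt (fun s => g s - x0) (deriv g s) s := (smooth_d1 hg s).sub_const x0
    have h2 := (hasDerivAt_re h1).pow 2
    have h3 := (hasDerivAt_im h1).pow 2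
    have h4 := h2.add h3
    have e : (fun s => ‖g s - x0‖ ^ 2) = (fun s => (g s - x0).re) ^ 2 + (fun s => (g s - x0).im) ^ 2 := by
      funext s
      simp only [Pi.add_apply, Pi.pow_apply]
      rw [← Complex.normSq_eq_norm_sq, Complex.normSq_apply]; ring
    rw [e]
    refine h4.congr_deriv ?_
    have := h s
    simp [Complex.mul_re] at this
    simp
    linear_combination 2 * this
  have := is_const_of_deriv_eq_zero (f := fun s => ‖g s - x0‖ ^ 2)
    (fun s => (hd s).differentiableAt) (fun s => (hd s).deriv) s t
  exact (pow_left_inj₀ (norm_nonneg _) (norm_nonneg _) two_ne_zero).1 this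

/-- A closed regular curve on a circle covers the circle. -/
lemma circle_cover {g : ℝ → ℂ} {R : ℝ} (hR : 0 < R) (hg : ContDiff ℝ (⊤ : ℕ∞) g)
    (hp : Function.Periodic g (2 * π)) (hr : ∀ s, deriv g s ≠ 0)
    (h : ∀ s, (conj (g s - x0) * deriv g s).re = 0) (hn : ∀ s, ‖g s - x0‖ = R)
    {z : ℂ} (hz : ‖z - x0‖ = R) : ∃ s, g s = z := by
  by_contra hno
  push Not at hno
  have hz0 : z - x0 ≠ 0 := by rw [← norm_ne_zero_iff, hz]; exact hR.ne'
  have hg0 : ∀ s, g s - x0 ≠ 0 := fun s => by rw [← norm_ne_zero_iff, hn]; exact hR.ne'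
  have hs : ∀ s, (g s - x0) / (-(z - x0)) ∈ Complex.slitPlane := by
    intro s
    rw [Complex.mem_slitPlane_iff_not_le_zero]
    intro hle
    rw [Complex.le_def] at hle
    obtain ⟨h1, h2⟩ := hle
    simp only [Complex.zero_re, Complex.zero_im] at h1 h2
    have hnn : ‖(g s - x0) / (-(z - x0))‖ = 1 := by
      rw [norm_div, norm_neg, hn, hz, div_self hR.ne']
    have e : (g s - x0) / (-(z - x0)) = -1 := by
      have h3 : ‖(g s - x0) / (-(z - x0))‖ ^ 2 = 1 := by rw [hnn]; norm_num
      rw [← Complex.normSq_eq_norm_sq, Complex.normSq_apply, h2] at h3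
      apply Complex.ext
      · simp only [Complex.neg_re, Complex.one_re]; nlinarith
      · rw [h2]; simp
    rw [div_eq_iff (neg_ne_zero.2 hz0)] at e
    apply hno s
    linear_combination e
  have hf : ∀ s, HasDerivAt (fun s => Complex.log ((g s - x0) / (-(z - x0))))
      (deriv g s / (g s - x0)) s := by
    intro s
    have h1 : HasDerivAt (fun s => (g s - x0) / (-(z - x0))) (deriv g s / (-(z - x0))) s :=
      ((smooth_d1 hg s).sub_const x0).div_const _
    refine (h1.clog_real (hs s)).congr_deriv ?_
    have := hg0 s
    field_simp
  have hF : ∀ s, HasDerivAt (fun s => (Complex.log ((g s - x0) / (-(z - x0)))).im)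
      (deriv g s / (g s - x0)).im s := fun s => hasDerivAt_im (hf s)
  have hcont : Continuous (fun s => (Complex.log ((g s - x0) / (-(z - x0)))).im) :=
    continuous_iff_continuousAt.2 fun s => (hF s).continuousAt
  obtain ⟨s, -, hmax⟩ := isCompact_Icc.exists_isMaxOn (s := Icc 0 (2*π))
    (nonempty_Icc.2 (by positivity)) hcont.continuousOn
  have hmax' : ∀ t, (Complex.log ((g t - x0) / (-(z - x0)))).im ≤
      (Complex.log ((g s - x0) / (-(z - x0)))).im := by
    intro t
    obtain ⟨t', ht', e⟩ := hp.exists_mem_Ico₀ two_pi_pos t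
    rw [e]
    exact hmax (Ico_subset_Icc_self ht')
  have him := IsLocalMax.hasDerivAt_eq_zero (Eventually.of_forall hmax') (hF s)
  have hre : (deriv g s / (g s - x0)).re = 0 := by
    have h5 : deriv g s / (g s - x0) = conj (g s - x0) * deriv g s * (((R^2)⁻¹ : ℝ) : ℂ) := by
      have h6 : (g s - x0) * conj (g s - x0) = ((R^2 : ℝ) : ℂ) := by
        rw [Complex.mul_conj, Complex.normSq_eq_norm_sq, hn]
      have h7 : ((R^2 : ℝ) : ℂ) * (((R^2)⁻¹ : ℝ) : ℂ) = 1 := by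
        rw [← Complex.ofReal_mul, mul_inv_cancel₀ (by positivity), Complex.ofReal_one]
      rw [div_eq_iff (hg0 s)]
      linear_combination (-deriv g s * (((R^2)⁻¹ : ℝ) : ℂ)) * h6 - deriv g s * h7
    rw [h5, Complex.re_mul_ofReal, h s, zero_mul]
  have : deriv g s / (g s - x0) = 0 := Complex.ext hre him
  rcases div_eq_zero_iff.1 this with h | h
  · exact hr s h
  · exact hg0 s h

lemma Dom.frontier_rot (hd : Dom Ω J γ)
    (h : ∀ j s, (conj (γ j s - x0) * deriv (γ j) s).re = 0) :
    x0 ∉ frontier Ω ∧ ∀ p ∈ frontier Ω, ∀ z, ‖z - x0‖ = ‖p - x0‖ → z ∈ frontier Ω := by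
  have hR : ∀ j s, 0 < ‖γ j s - x0‖ := by
    intro j s
    rw [norm_pos_iff]
    intro h0
    have hall : ∀ t, γ j t = x0 := by
      intro t
      have := norm_const_of_orth (hd.smooth j) (h j) t s
      rw [h0, norm_zero, norm_eq_zero] at this
      exact sub_eq_zero.1 this
    apply hd.reg j 0
    rw [show γ j = fun _ => x0 from funext hall]
    simp
  constructor
  · intro hx
    obtain ⟨j, s, e⟩ := hd.exists_fr hx
    have := hR j s
    rw [e] at this; simp at this
  · intro p hp z hz
    obtain ⟨j, s, rfl⟩ := hd.exists_fr hp
    obtain ⟨t, rfl⟩ := circle_cover (hR j s) (hd.smooth j) (hd.per j) (hd.reg j) (h j)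
      (fun t => norm_const_of_orth (hd.smooth j) (h j) t s) hz
    exact hd.mem_fr j t

lemma Dom.circle_sub (hd : Dom Ω J γ)
    (hf : ∀ p ∈ frontier Ω, ∀ z, ‖z - x0‖ = ‖p - x0‖ → z ∈ frontier Ω) {z w : ℂ} (hz : z ∈ Ω)
    (hw : ‖w - x0‖ = ‖z - x0‖) : w ∈ Ω := by
  have hc : IsPreconnected (Metric.sphere x0 ‖z - x0‖) :=
    isPreconnected_sphere (by rw [Complex.rank_real_complex]; norm_num) _ _
  have hdj : Disjoint (Metric.sphere x0 ‖z - x0‖) (frontier Ω) := by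
    rw [Set.disjoint_left]
    intro y hy hyf
    rw [mem_sphere_iff_norm] at hy
    have := hf y hyf z hy.symm
    rw [hd.op.frontier_eq] at this
    exact this.2 hz
  rcases side_of_preconnected hd.op hc hdj with h | h
  · exact h (mem_sphere_iff_norm.2 hw)
  · exact absurd (subset_closure hz) (Set.disjoint_left.1 h (mem_sphere_iff_norm.2 rfl))

lemma exists_ray (x0 z : ℂ) : ∃ e : ℂ, ‖e‖ = 1 ∧ z = x0 + ‖z - x0‖ * e := by
  by_cases h : z - x0 = 0
  · exact ⟨1, by simp, by rw [h]; simp; linear_combination h⟩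
  · have h' : (‖z - x0‖ : ℂ) ≠ 0 := by exact_mod_cast norm_ne_zero_iff.2 h
    refine ⟨(z - x0) / ‖z - x0‖, ?_, ?_⟩
    · rw [norm_div, Complex.norm_real, norm_norm, div_self (norm_ne_zero_iff.2 h)]
    · rw [mul_div_cancel₀ _ h']; ring

lemma Dom.disk_or_annulus (hd : Dom Ω J γ) (hx : x0 ∉ frontier Ω)
    (hf : ∀ p ∈ frontier Ω, ∀ z, ‖z - x0‖ = ‖p - x0‖ → z ∈ frontier Ω) :
    ∃ r₁ r₂ : ℝ, 0 ≤ r₁ ∧ r₁ < r₂ ∧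
      ((0 < r₁ ∧ Ω = {x : ℂ | r₁ < dist x x0 ∧ dist x x0 < r₂}) ∨
       (r₁ = 0 ∧ Ω = Metric.ball x0 r₂)) := by
  set S : Set ℝ := (fun z => ‖z - x0‖) '' Ω with hS
  have hSc : IsPreconnected S := hd.conn.isPreconnected.image _ (by fun_prop)
  have hSn : S.Nonempty := hd.conn.nonempty.image _
  have hSo : S.OrdConnected := hSc.ordConnected
  have hb0 : BddBelow S := ⟨0, by rintro _ ⟨z, -, rfl⟩; exact norm_nonneg _⟩
  have hb1 : BddAbove S := by
    obtain ⟨C, hC⟩ := hd.bdd.subset_ball x0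
    exact ⟨C, by rintro _ ⟨z, hz, rfl⟩; exact (mem_ball_iff_norm.1 (hC hz)).le⟩
  have mem : ∀ z, z ∈ Ω ↔ ‖z - x0‖ ∈ S := by
    intro z
    refine ⟨fun h => ⟨z, h, rfl⟩, ?_⟩
    rintro ⟨w, hw, e⟩
    exact hd.circle_sub hf hw e.symm
  -- a positive radius can be perturbed in both directions
  have pert : ∀ r ∈ S, ∃ ε > 0, ∀ t : ℝ, |t| < ε → 0 ≤ r + t → r + t ∈ S := by
    rintro _ ⟨z, hz, rfl⟩
    obtain ⟨e, he, ez⟩ := exists_ray x0 z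
    obtain ⟨ε, hε, hb⟩ := Metric.isOpen_iff.1 hd.op z hz
    refine ⟨ε, hε, fun t ht h0 => ?_⟩
    have h0' : 0 ≤ ‖z - x0‖ + t := h0
    have h1 : z + t * e ∈ Ω := hb (by simp [he, ht])
    have h2 : ‖z + t * e - x0‖ = ‖z - x0‖ + t := by
      have : z + t * e - x0 = ((‖z - x0‖ + t : ℝ) : ℂ) * e := by
        push_cast; linear_combination ez
      rw [this, norm_mul, he, Complex.norm_real, Real.norm_of_nonneg h0', mul_one]
    exact ⟨_, h1, h2⟩
  have hpos : ∀ r ∈ S, 0 ≤ r := by rintro _ ⟨z, -, rfl⟩; exact norm_nonneg _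
  have hlt : ∀ r ∈ S, r < sSup S := by
    intro r hr
    obtain ⟨ε, hε, hp⟩ := pert r hr
    have := le_csSup hb1 (hp (ε/2) (by rw [abs_of_pos (half_pos hε)]; linarith) (by linarith [hpos r hr]))
    linarith
  have hgt : ∀ r ∈ S, 0 < r → sInf S < r := by
    intro r hr h0
    obtain ⟨ε, hε, hp⟩ := pert r hr
    have hm : 0 < min (ε/2) r := lt_min (half_pos hε) h0
    have := csInf_le hb0 (hp (-(min (ε/2) r)) (by
      rw [abs_neg, abs_of_pos hm]; linarith [min_le_left (ε/2) r]) (by linarith [min_le_right (ε/2) r]))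
    linarith
  have hI0 : 0 ≤ sInf S := le_csInf hSn hpos
  have btw : ∀ r, sInf S < r → r < sSup S → r ∈ S := by
    intro r h1 h2
    obtain ⟨a, ha, har⟩ := exists_lt_of_csInf_lt hSn h1
    obtain ⟨b, hb, hbr⟩ := exists_lt_of_lt_csSup hSn h2
    exact hSo.out ha hb ⟨har.le, hbr.le⟩
  obtain ⟨r0, hr0⟩ := hSn
  have hIS : sInf S < sSup S := (csInf_le hb0 hr0).trans_lt (hlt r0 hr0)
  refine ⟨sInf S, sSup S, hI0, hIS, ?_⟩
  rcases hI0.eq_or_lt with h0 | h0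
  · right
    refine ⟨h0.symm, ?_⟩
    have hx0 : x0 ∈ Ω := by
      by_contra hn
      apply hx
      rw [hd.op.frontier_eq]
      refine ⟨?_, hn⟩
      rw [Metric.mem_closure_iff]
      intro ε hε
      obtain ⟨_, ⟨z, hz, rfl⟩, har⟩ := exists_lt_of_csInf_lt (s := S) ⟨r0, hr0⟩ (b := ε) (by rw [← h0]; exact hε)
      exact ⟨z, hz, by rw [dist_comm, dist_eq_norm]; exact har⟩
    ext z
    rw [mem_ball_iff_norm, mem]
    refine ⟨hlt _, fun h => ?_⟩
    rcases (norm_nonneg (z - x0)).eq_or_lt with e | e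
    · rw [← e]; exact ⟨x0, hx0, by simp⟩
    · exact btw _ (by rw [← h0]; exact e) h
  · left
    refine ⟨h0, ?_⟩
    ext z
    rw [mem_ofPred_eq, mem, dist_eq_norm]
    refine ⟨fun h => ⟨hgt _ h (h0.trans_le (csInf_le hb0 h)), hlt _ h⟩, fun h => btw _ h.1 h.2⟩
end

/-- The main theorem, in complex coordinates. -/
theorem main_complex {Ω : Set ℂ} {J : ℕ} {γ : Fin J → ℝ → ℂ} (hd : Dom Ω J γ)
    {u : ℕ → ℂ → ℝ} {D : ℕ → ℂ → ℂ →L[ℝ] ℝ} {H : ℕ → ℂ → ℂ →L[ℝ] ℂ →L[ℝ] ℝ} {μ : ℕ → ℝ}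
    (hE : ∀ n, Eig Ω (u n) (D n) (H n) (μ n)) (hμ : Function.Injective μ)
    (hnc : ∀ n, ∃ x ∈ closure Ω, ∃ y ∈ closure Ω, u n x ≠ u n y) :
    ∃ (x0 : ℂ) (r₁ r₂ : ℝ), 0 ≤ r₁ ∧ r₁ < r₂ ∧
      ((0 < r₁ ∧ Ω = {x : ℂ | r₁ < dist x x0 ∧ dist x x0 < r₂}) ∨
       (r₁ = 0 ∧ Ω = Metric.ball x0 r₂)) := by
  obtain ⟨j0, u', D', H', μ', sq⟩ := hd.normalise hE hμ hnc
  obtain ⟨s0, x0, R, hR, h⟩ := hd.arc sq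
  obtain ⟨p, hp, hw⟩ := (sq.eig 0).rot_near hd hR h
  have hw' := (sq.eig 0).rot_prop hd hp hw
  obtain ⟨h1, h2⟩ := hd.frontier_rot
    (fun j s => (sq.eig 0).rot_boundary hd (sq.pos 0) (sq.c0 0) hw' j s)
  exact ⟨x0, hd.disk_or_annulus h1 h2⟩
end Rig

namespace Rig
open Filter Topology ComplexConjugate

/-- The standard isometry between the complex plane and the Euclidean plane. -/
def toPt : ℂ ≃ₗᵢ[ℝ] Pt := Complex.orthonormalBasisOneI.repr

lemma toPt_symm0 : toPt.symm (EuclideanSpace.single 0 1) = 1 := by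
  unfold toPt
  rw [OrthonormalBasis.repr_symm_single]; simp

lemma toPt_symm1 : toPt.symm (EuclideanSpace.single 1 1) = Complex.I := by
  unfold toPt
  rw [OrthonormalBasis.repr_symm_single]; simp

lemma pre_closure (Ω : Set Pt) : toPt ⁻¹' (closure Ω) = closure (toPt ⁻¹' Ω) :=
  toPt.toHomeomorph.preimage_closure Ω

lemma pre_frontier (Ω : Set Pt) : toPt ⁻¹' (frontier Ω) = frontier (toPt ⁻¹' Ω) :=
  toPt.toHomeomorph.preimage_frontier Ω

lemma dom_of {Ω : Set Pt} (hopen : IsOpen Ω) (hconn : IsConnected Ω) (hbd : Bornology.IsBounded Ω)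
    {J : ℕ} {Γ : Fin J → Set Pt} (hΓ : ∀ j, IsSmoothJordanCurve (Γ j))
    (hdj : Pairwise (Function.onFun Disjoint Γ)) (hfr : frontier Ω = ⋃ j, Γ j) :
    ∃ γ : Fin J → ℝ → ℂ, Dom (toPt ⁻¹' Ω) J γ := by
  choose γ h1 h2 h3 h4 h5 using hΓ
  refine ⟨fun j s => toPt.symm (γ j s), ?_⟩
  constructor
  · exact hopen.preimage toPt.continuous
  · exact (toPt.toHomeomorph.isConnected_preimage).2 hconn
  · exact toPt.symm.lipschitz.isBounded_image hbd |>.subset (by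
      intro z hz; exact ⟨toPt z, hz, by simp⟩)
  · intro j
    exact toPt.symm.toContinuousLinearEquiv.contDiff.comp (h1 j)
  · intro j s
    simp only
    rw [h2 j s]
  · intro j s t h
    exact h3 j s t (toPt.symm.injective h)
  · intro j t h
    have hd : HasDerivAt (γ j) (deriv (γ j) t) t :=
      ((h1 j).differentiable (by simp) t).hasDerivAt
    have hd2 : HasDerivAt (fun s => toPt.symm (γ j s)) (toPt.symm (deriv (γ j) t)) t :=
      (toPt.symm.toContinuousLinearEquiv.hasFDerivAt (x := γ j t)).comp_hasDerivAt t hd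
    rw [hd2.deriv] at h
    exact h4 j t ((map_eq_zero_iff _ toPt.symm.injective).1 h)
  · intro i j s t h
    by_contra hij
    have e := toPt.symm.injective h
    have := hdj hij
    refine (Set.disjoint_left.1 this : ∀ ⦃a⦄, a ∈ Γ i → a ∉ Γ j) (a := γ i s) ?_ ?_
    · rw [h5 i]; exact mem_range_self s
    · rw [h5 j, e]; exact mem_range_self t
  · rw [← pre_frontier, hfr, preimage_iUnion]
    congr 1
    funext j
    rw [h5 j]
    ext z
    constructor
    · rintro ⟨s, hs⟩; exact ⟨s, by simp only; rw [hs]; simp⟩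
    · rintro ⟨s, rfl⟩; exact ⟨s, by simp⟩

lemma eig_of {Ω : Set Pt} {J : ℕ} {γ : Fin J → ℝ → ℂ} (hd : Dom (toPt ⁻¹' Ω) J γ) (hopen : IsOpen Ω)
    {u : Pt → ℝ} {μ : ℝ} (hC2 : ContDiffOn ℝ 2 u (closure Ω))
    (heq : ∀ x ∈ Ω, lap u x + μ * u x = 0)
    (hgrad : ∀ x ∈ frontier Ω, fderivWithin ℝ u (closure Ω) x = 0) :
    ∃ D H, Eig (toPt ⁻¹' Ω) (fun z => u (toPt z)) D H μ := by
  set C := closure (toPt ⁻¹' Ω) with hC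
  have hud : UniqueDiffOn ℝ C := hd.uniqueDiff
  have c2 : ContDiffOn ℝ 2 (fun z => u (toPt z)) C := by
    refine hC2.comp toPt.toContinuousLinearEquiv.contDiff.contDiffOn ?_
    rw [hC, ← pre_closure]; exact fun z hz => hz
  set D : ℂ → ℂ →L[ℝ] ℝ := fderivWithin ℝ (fun z => u (toPt z)) C with hD
  have c1 : ContDiffOn ℝ 1 D C := c2.fderivWithin hud (by norm_num)
  set H : ℂ → ℂ →L[ℝ] ℂ →L[ℝ] ℝ := fderivWithin ℝ D C with hH
  have hdu : ∀ x ∈ C, HasFDerivWithinAt (fun z => u (toPt z)) (D x) C x := fun x hx =>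
    (c2.differentiableOn (by norm_num) x hx).hasFDerivWithinAt
  have hdD : ∀ x ∈ C, HasFDerivWithinAt D (H x) C x := fun x hx =>
    (c1.differentiableOn (by norm_num) x hx).hasFDerivWithinAt
  have hnh : ∀ z, toPt z ∈ Ω → C ∈ 𝓝 z := fun z hz =>
    mem_of_superset (hd.op.mem_nhds hz) subset_closure
  refine ⟨D, H, ⟨⟨hdu, hdD, c1.continuousOn_fderivWithin hud (by norm_num)⟩, ?_, ?_⟩⟩
  · intro x hx
    rw [← pre_frontier] at hx
    have hx' : toPt x ∈ closure Ω := frontier_subset_closure hx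
    have h0 : HasFDerivWithinAt u (0 : Pt →L[ℝ] ℝ) (closure Ω) (toPt x) := by
      rw [← hgrad _ hx]
      exact (hC2.differentiableOn (by norm_num) _ hx').hasFDerivWithinAt
    have hxC : x ∈ C := by rw [hC, ← pre_closure]; exact hx'
    have h1 : HasFDerivWithinAt (fun z => u (toPt z)) ((0 : Pt →L[ℝ] ℝ).comp
        (toPt.toContinuousLinearEquiv : ℂ →L[ℝ] Pt)) C x :=
      h0.comp x (toPt.toContinuousLinearEquiv.hasFDerivAt.hasFDerivWithinAt) (by
        rw [hC, ← pre_closure]; exact fun z hz => hz)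
    have := (hud x hxC).eq (hdu x hxC) h1
    rw [this]; simp
  · intro x hx
    have first : ∀ z, toPt z ∈ Ω → HasFDerivAt u ((D z).comp
        (toPt.symm.toContinuousLinearEquiv : Pt →L[ℝ] ℂ)) (toPt z) := by
      intro z hz
      have h1 : HasFDerivAt (fun z => u (toPt z)) (D z) (toPt.symm (toPt z)) := by
        rw [toPt.symm_apply_apply]
        exact (hdu z (mem_of_mem_nhds (hnh z hz))).hasFDerivAt (hnh z hz)
      have h2 := h1.comp (toPt z) (toPt.symm.toContinuousLinearEquiv.hasFDerivAt (x := toPt z))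
      refine h2.congr_of_eventuallyEq (Eventually.of_forall fun y => ?_)
      simp
    have second : ∀ i, pd i (pd i u) (toPt x) =
        H x (toPt.symm (EuclideanSpace.single i 1)) (toPt.symm (EuclideanSpace.single i 1)) := by
      intro i
      have h1 : HasFDerivAt D (H x) (toPt.symm (toPt x)) := by
        rw [toPt.symm_apply_apply]
        exact (hdD x (mem_of_mem_nhds (hnh x hx))).hasFDerivAt (hnh x hx)
      have h2 := h1.comp (toPt x) (toPt.symm.toContinuousLinearEquiv.hasFDerivAt (x := toPt x))
      have h3 := h2.clm_apply (hasFDerivAt_const (toPt.symm (EuclideanSpace.single i (1:ℝ))) (toPt x))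
      have h4 := h3.congr_of_eventuallyEq (f₁ := pd i u) (by
        filter_upwards [hopen.mem_nhds hx] with y hy
        have h5 := (first (toPt.symm y) (by simpa using hy)).fderiv
        rw [toPt.apply_symm_apply] at h5
        unfold pd
        rw [h5]; rfl)
      rw [pd, h4.fderiv]
      simp
    have h := heq _ hx
    rw [lap, second 0, second 1, toPt_symm0, toPt_symm1] at h
    linarith
end Rig

/-- (Rigidity.) If a smooth bounded planar domain has an infinite
sequence of Neumann eigenfunctions, with pairwise distinct eigenvalues, each locally
constant on the boundary, then the domain is a disk or an annulus. -/
theorem rigidity_infinitely_many_eigenfunctions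
    (Ω : Set Pt)
    (hopen : IsOpen Ω) (hconn : IsConnected Ω) (hbd : Bornology.IsBounded Ω)
    (hboundary : ∃ (J : ℕ) (Γ : Fin J → Set Pt),
      (∀ j, IsSmoothJordanCurve (Γ j)) ∧ Pairwise (Function.onFun Disjoint Γ) ∧
      frontier Ω = ⋃ j, Γ j)
    (u : ℕ → Pt → ℝ) (μ : ℕ → ℝ) (hμ : Function.Injective μ)
    (hC2 : ∀ n, ContDiffOn ℝ 2 (u n) (closure Ω))
    (hnc : ∀ n, ∃ x ∈ closure Ω, ∃ y ∈ closure Ω, u n x ≠ u n y)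
    (heq : ∀ n, ∀ x ∈ Ω, lap (u n) x + μ n * u n x = 0)
    (hgrad : ∀ n, ∀ x ∈ frontier Ω, fderivWithin ℝ (u n) (closure Ω) x = 0) :
    ∃ (x₀ : Pt) (r₁ r₂ : ℝ), 0 ≤ r₁ ∧ r₁ < r₂ ∧
      ((0 < r₁ ∧ Ω = {x : Pt | r₁ < dist x x₀ ∧ dist x x₀ < r₂}) ∨
       (r₁ = 0 ∧ Ω = Metric.ball x₀ r₂)) := by
  obtain ⟨J, Γ, hΓ, hdj, hfr⟩ := hboundary
  obtain ⟨γ, hd⟩ := Rig.dom_of hopen hconn hbd hΓ hdj hfr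
  choose D H hE using fun n => Rig.eig_of hd hopen (hC2 n) (heq n) (hgrad n)
  obtain ⟨x0, r₁, r₂, h0, h12, h⟩ := Rig.main_complex hd hE hμ (by
    intro n
    obtain ⟨x, hx, y, hy, hxy⟩ := hnc n
    rw [← Rig.pre_closure]
    exact ⟨Rig.toPt.symm x, by simpa using hx, Rig.toPt.symm y, by simpa using hy, by simpa using hxy⟩)
  have hmem : ∀ y, y ∈ Ω ↔ Rig.toPt.symm y ∈ Rig.toPt ⁻¹' Ω := by intro y; simp
  have hdist : ∀ y, dist (Rig.toPt.symm y) x0 = dist y (Rig.toPt x0) := by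
    intro y
    rw [← Rig.toPt.dist_map (Rig.toPt.symm y) x0, Rig.toPt.apply_symm_apply]
  refine ⟨Rig.toPt x0, r₁, r₂, h0, h12, ?_⟩
  rcases h with ⟨h1, h2⟩ | ⟨h1, h2⟩
  · left
    refine ⟨h1, ?_⟩
    ext y
    rw [hmem, h2, mem_ofPred_eq, mem_ofPred_eq, hdist]
  · right
    refine ⟨h1, ?_⟩
    ext y
    rw [hmem, h2, Metric.mem_ball, Metric.mem_ball, hdist]

end
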